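/- Every finite simple planar graph of girth at least five is 3-choosable: if G is a finite simple planar graph containing no cycle of length 3 or 4, and L is a list assignment with |L(v)| ≥ 3 for every vertex v, then G admits an L-colouring. -/

import Mathlib

/-- `H` is a minor of `G`: there is a family of nonempty, pairwise disjoint, connected
branch sets in `G` indexed by the vertices of `H`, with an edge of `G` between the
branch sets of any two adjacent vertices of `H`. -/
def SimpleGraph.IsMinorOf {W V : Type*} (H : SimpleGraph W) (G : SimpleGraph V) : Prop :=
  ∃ f : W → Set V,
    (∀ w, (G.induce (f w)).Connected) ∧
    (Pairwise fun w₁ w₂ => Disjoint (f w₁) (f w₂)) ∧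
    ∀ ⦃w₁ w₂⦄, H.Adj w₁ w₂ → ∃ v₁ ∈ f w₁, ∃ v₂ ∈ f w₂, G.Adj v₁ v₂

/-- A graph is planar iff (by Wagner's theorem) it has neither `K₅` nor `K₃,₃` as a minor. -/
def SimpleGraph.IsPlanar {V : Type*} (G : SimpleGraph V) : Prop :=
  ¬ (completeGraph (Fin 5)).IsMinorOf G ∧
  ¬ (completeBipartiteGraph (Fin 3) (Fin 3)).IsMinorOf G

namespace GirthFive

section

variable {V : Type*}

/-- The degree modulo two of a vertex in an edge set. -/
noncomputable def dg [Fintype V] (Z : Set (Sym2 V)) (v : V) : ZMod 2 :=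
  ∑ w, (by classical exact if s(v, w) ∈ Z then 1 else 0)

/-- The edges of the path with the given vertex list. -/
def pe : List V → Set (Sym2 V)
  | [] => ∅
  | [_] => ∅
  | a :: b :: t => insert s(a, b) (pe (b :: t))

/-- The edges of the cycle with the given vertex list. -/
def ce : List V → Set (Sym2 V)
  | [] => ∅
  | a :: t => pe (a :: t ++ [a])

@[simp] theorem pe_nil : pe ([] : List V) = ∅ := rfl
@[simp] theorem pe_single (a : V) : pe [a] = ∅ := rfl
@[simp] theorem pe_cons_cons (a b : V) (t : List V) :
    pe (a :: b :: t) = insert s(a, b) (pe (b :: t)) := rfl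

theorem mem_swap {E : Set (Sym2 V)} {a b : V} (h : s(a, b) ∈ E) : s(b, a) ∈ E :=
  Sym2.eq_swap ▸ h

theorem pe_append (l : List V) (a : V) (r : List V) :
    pe (l ++ a :: r) = pe (l ++ [a]) ∪ pe (a :: r) := by
  induction l with
  | nil => simp
  | cons b l ih =>
    cases l with
    | nil => ext; simp
    | cons c l =>
      simp only [List.cons_append, pe_cons_cons] at ih ⊢
      grind

theorem pe_reverse (l : List V) : pe l.reverse = pe l := by
  induction l with
  | nil => rfl
  | cons a l ih =>
    cases l with
    | nil => rfl
    | cons b l =>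
      rw [List.reverse_cons, List.reverse_cons, List.append_assoc, List.singleton_append, pe_append,
        ← List.reverse_cons, ih]
      ext e; simp [Sym2.eq_swap (a := a), or_comm]

theorem mem_of_mem_pe {l : List V} {e : Sym2 V} (he : e ∈ pe l) {v : V} (hv : v ∈ e) :
    v ∈ l := by
  induction l with
  | nil => simp at he
  | cons a l ih =>
    cases l with
    | nil => simp at he
    | cons b l =>
      rcases he with rfl | he
      · grind
      grind

theorem ce_cons (a : V) (t : List V) : ce (a :: t) = pe (a :: t ++ [a]) := rfl

theorem ce_rotate (l : List V) (a : V) (r : List V) : ce (l ++ a :: r) = ce (a :: r ++ l) := by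
  cases l with
  | nil => simp
  | cons b l =>
    simp only [List.cons_append, ce_cons]
    have h1 := pe_append (b :: l) a (r ++ [b])
    have h2 := pe_append (a :: r) b (l ++ [a])
    grind

theorem ce_reverse (l : List V) : ce l.reverse = ce l := by
  cases l with
  | nil => rfl
  | cons a t =>
    rw [List.reverse_cons, ce_rotate]
    simp only [List.cons_append, ce_cons, List.nil_append]
    rw [← pe_reverse]
    simp

theorem ce_cons_cons (a b : V) (t : List V) :
    ce (a :: b :: t) = insert s(a, b) (pe (b :: t ++ [a])) := rfl

theorem ce_eq_insert (a : V) (t : List V) (z : V) :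
    ce (a :: (t ++ [z])) = insert s(z, a) (pe (a :: (t ++ [z]))) := by
  rw [ce_cons]
  have := pe_append (a :: t) z [a]
  simp_all

theorem mem_of_mem_ce {l : List V} {e : Sym2 V} (he : e ∈ ce l) {v : V} (hv : v ∈ e) :
    v ∈ l := by
  cases l with
  | nil => simp [ce] at he
  | cons a t =>
    have := mem_of_mem_pe he hv
    grind

section Parity
variable [Fintype V]

open Classical in
theorem dg_def (Z : Set (Sym2 V)) (v : V) :
    dg Z v = ∑ w, (if s(v, w) ∈ Z then 1 else 0) := by
  unfold dg; congr!

theorem dg_symmDiff (Z Y : Set (Sym2 V)) (v : V) :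
    dg (symmDiff Z Y) v = dg Z v + dg Y v := by
  classical
  simp only [dg_def]
  rw [← Finset.sum_add_distrib]
  grind

theorem dg_congr {Z Y : Set (Sym2 V)} {v : V} (h : ∀ w, s(v, w) ∈ Z ↔ s(v, w) ∈ Y) :
    dg Z v = dg Y v := by
  classical
  simp only [dg_def, h]

@[simp] theorem dg_empty (v : V) : dg (∅ : Set (Sym2 V)) v = 0 := by
  classical
  simp [dg_def]

open Classical in
theorem dg_singleton {a b : V} (hab : a ≠ b) (v : V) :
    dg {s(a, b)} v = (if v = a then 1 else 0) + (if v = b then 1 else 0) := by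
  simp only [dg_def, Set.mem_singleton_iff]
  by_cases ha : v = a
  · simp_all
  · by_cases hb : v = b
    · simp_all
    · simp [ha, hb]

theorem dg_of_notMem {Z : Set (Sym2 V)} {v : V} (h : ∀ w, s(v, w) ∉ Z) : dg Z v = 0 := by
  classical
  simp [dg_def, h]

theorem dg_of_unique {Z : Set (Sym2 V)} {v a : V} (ha : s(v, a) ∈ Z)
    (h : ∀ w, s(v, w) ∈ Z → w = a) : dg Z v = 1 := by
  classical
  rw [dg_def, Finset.sum_eq_single a]
  · simp [ha]
  · grind
  · simp

open Classical in
theorem dg_insert {Z : Set (Sym2 V)} {a b : V} (hab : a ≠ b) (h : s(a, b) ∉ Z) (v : V) :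
    dg (insert s(a, b) Z) v =
      (if v = a then 1 else 0) + (if v = b then 1 else 0) + dg Z v := by
  rw [← dg_singleton hab, ← dg_symmDiff, Disjoint.symmDiff_eq_sup, Set.insert_eq]
  · rfl
  · simpa using h

open Classical in
theorem dg_pe {a : V} {t : List V} (h : (a :: t).Nodup) (v : V) :
    dg (pe (a :: t)) v =
      (if v = a then 1 else 0) + (if v = (a :: t).getLast (by simp) then 1 else 0) := by
  induction t generalizing a with
  | nil =>
    by_cases hv : v = a
    · simp [hv]; rfl
    · simp [hv]
  | cons b t ih =>
    have hab : a ≠ b := by rintro rfl; simp at h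
    rw [pe_cons_cons, dg_insert hab _ v, ih h.of_cons]
    · grind
    · intro h'
      exact (List.nodup_cons.1 h).1 (mem_of_mem_pe h' (by simp))

/-- Every vertex has even degree. -/
def IsEven (Z : Set (Sym2 V)) : Prop := ∀ v, dg Z v = 0

theorem IsEven.symmDiff {Z Y : Set (Sym2 V)} (hZ : IsEven Z) (hY : IsEven Y) :
    IsEven (symmDiff Z Y) := fun v => by rw [dg_symmDiff, hZ, hY, add_zero]

theorem isEven_empty : IsEven (∅ : Set (Sym2 V)) := fun v => dg_empty v

theorem isEven_ce {c : List V} (h : c.Nodup) (h3 : 3 ≤ c.length) : IsEven (ce c) := by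
  classical
  intro v
  match c, h3 with
  | a :: t, h3 =>
    obtain ⟨t, z, rfl⟩ : ∃ t' z, t = t' ++ [z] := by
      rcases List.eq_nil_or_concat t with rfl | ⟨t', z, rfl⟩
      · simp at h3
      simp
    have haz : z ≠ a := by grind
    rw [ce_eq_insert, dg_insert haz, dg_pe h]
    · grind
    · match t, h3 with
      | b :: t, _ =>
        intro h'
        rcases h' with h' | h'
        · grind
        · exact (List.nodup_cons.1 h).1 (mem_of_mem_pe h' (by simp))

theorem IsEven.eq_empty_of_subset_pe {Z : Set (Sym2 V)} (hZ : IsEven Z) {l : List V}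
    (hl : l.Nodup) (h : Z ⊆ pe l) : Z = ∅ := by
  induction l with
  | nil => simpa using h
  | cons a l ih =>
    cases l with
    | nil => simpa using h
    | cons b l =>
      refine ih hl.of_cons fun e he => ?_
      rcases h he with rfl | h'
      · exfalso
        have : dg Z a = 1 := dg_of_unique he fun w hw => by
          rcases h hw with h' | h'
          · grind
          · exact absurd (mem_of_mem_pe h' (by simp)) (List.nodup_cons.1 hl).1
        rw [hZ] at this
        grind
      · exact h'

end Parity

end

section

variable {V : Type*}

theorem pe_cons_append_singleton (a : V) (t : List V) (z : V) (y : V) :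
    pe (a :: (t ++ [z]) ++ [y]) = insert s(z, y) (pe (a :: (t ++ [z]))) := by
  have := pe_append (a :: t) z [y]
  simp_all

theorem pe_prefix_subset (l r : List V) : pe l ⊆ pe (l ++ r) := by
  induction l with
  | nil => simp
  | cons a l ih =>
    cases l with
    | nil => simp
    | cons b l => exact Set.insert_subset_insert ih

theorem pe_suffix_subset (l r : List V) : pe r ⊆ pe (l ++ r) := by
  cases r with
  | nil => simp
  | cons a r => rw [pe_append]; simp

theorem exists_cycle_of_isEven [Fintype V] {Z : Set (Sym2 V)} (hZ : IsEven Z)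
    (hne : Z.Nonempty) (hd : ∀ v, s(v, v) ∉ Z) :
    ∃ c : List V, c.Nodup ∧ 3 ≤ c.length ∧ ce c ⊆ Z := by
  have key : ∀ n (a b : V) (t : List V), (a :: b :: t).Nodup → pe (a :: b :: t) ⊆ Z →
      Fintype.card V ≤ n + t.length →
      ∃ c : List V, c.Nodup ∧ 3 ≤ c.length ∧ ce c ⊆ Z := by
    intro n
    induction n with
    | zero =>
      intro a b t hl _ hn
      have := hl.length_le_card
      grind
    | succ n ih =>
      intro a b t hl hp hn
      obtain ⟨w, hw, hwb⟩ : ∃ w, s(a, w) ∈ Z ∧ w ≠ b := by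
        by_contra! hcon
        have := dg_of_unique (hp (by simp : s(a, b) ∈ _)) hcon
        rw [hZ] at this
        grind
      have hwa : w ≠ a := by grind
      by_cases hwt : w ∈ t
      · obtain ⟨t1, t2, rfl⟩ := List.append_of_mem hwt
        refine ⟨a :: ((b :: t1) ++ [w]), ?_, by simp, ?_⟩
        · grind
        · rw [ce_eq_insert]
          refine Set.insert_subset (by rwa [Sym2.eq_swap]) (le_trans ?_ hp)
          have := pe_prefix_subset (a :: b :: (t1 ++ [w])) t2
          simpa using this
      · refine ih w a (b :: t) ?_ ?_ ?_
        · rw [List.nodup_cons]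
          exact ⟨by simp [hwa, hwb, hwt], hl⟩
        · rw [pe_cons_cons]
          exact Set.insert_subset (by rwa [Sym2.eq_swap]) hp
        · simp; omega
  obtain ⟨e, he⟩ := hne
  induction e with
  | _ a b =>
    refine key (Fintype.card V) a b [] ?_ ?_ (by simp)
    · have : a ≠ b := by rintro rfl; exact hd _ he
      simp [this]
    · simpa using he

/-- Connectivity of a vertex set, expressed through cuts. -/
def CutConn (E : Set (Sym2 V)) (A : Set V) : Prop :=
  ∀ B ⊆ A, B.Nonempty → B ≠ A → ∃ u ∈ B, ∃ w ∈ A \ B, s(u, w) ∈ E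

theorem CutConn.congr {E E' : Set (Sym2 V)} {A : Set V} (h : CutConn E A)
    (hE : ∀ u ∈ A, ∀ w ∈ A, s(u, w) ∈ E → s(u, w) ∈ E') : CutConn E' A :=
  fun B hB hn hne => by
    obtain ⟨u, hu, w, hw, he⟩ := h B hB hn hne
    grind

theorem cutConn_singleton (E : Set (Sym2 V)) (a : V) : CutConn E {a} := fun B hB hn hne => by
  exact absurd ((Set.subset_singleton_iff_eq.1 hB).resolve_left hn.ne_empty) hne

/-- To show that `A` is connected it is enough to propagate from one vertex. -/
theorem CutConn.of_closed {E : Set (Sym2 V)} {A : Set V} {a : V} (ha : a ∈ A)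
    (h : ∀ B ⊆ A, a ∈ B → (∀ u ∈ B, ∀ w ∈ A, s(u, w) ∈ E → w ∈ B) → B = A) : CutConn E A := by
  intro B hB hn hne
  by_contra! hcon
  by_cases haB : a ∈ B
  · grind
  · have := h (A \ B) Set.sdiff_subset ⟨ha, haB⟩ fun u hu w hw he => ⟨hw, fun hwB =>
      hcon w hwB u hu (by rwa [Sym2.eq_swap])⟩
    obtain ⟨b, hb⟩ := hn
    grind

theorem CutConn.eq_of_closed {E : Set (Sym2 V)} {A B : Set V} (hA : CutConn E A) {a : V}
    (hBA : B ⊆ A) (ha : a ∈ B)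
    (h : ∀ u ∈ B, ∀ w ∈ A, s(u, w) ∈ E → w ∈ B) : B = A := by
  by_contra hne
  obtain ⟨u, hu, w, hw, he⟩ := hA B hBA ⟨a, ha⟩ hne
  grind

theorem CutConn.union_of_edge {E : Set (Sym2 V)} {A B : Set V} (hA : CutConn E A)
    (hB : CutConn E B) {a b : V} (ha : a ∈ A) (hb : b ∈ B) (hab : a = b ∨ s(a, b) ∈ E) :
    CutConn E (A ∪ B) := by
  refine CutConn.of_closed (Or.inl ha) fun C hC haC hcl => ?_
  have h1 : C ∩ A = A := hA.eq_of_closed Set.inter_subset_right ⟨haC, ha⟩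
    fun u hu w hw he => ⟨hcl u hu.1 w (Or.inl hw) he, hw⟩
  have hbC : b ∈ C := by grind
  have h2 : C ∩ B = B := hB.eq_of_closed Set.inter_subset_right ⟨hbC, hb⟩
    fun u hu w hw he => ⟨hcl u hu.1 w (Or.inr hw) he, hw⟩
  grind

theorem cutConn_list {E : Set (Sym2 V)} (l : List V) (h : pe l ⊆ E) : CutConn E {x | x ∈ l} := by
  induction l with
  | nil =>
    intro B hB hn
    grind
  | cons a l ih =>
    cases l with
    | nil => simpa using cutConn_singleton E a
    | cons b l =>
      have h2 := (cutConn_singleton E a).union_of_edge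
        (ih ((Set.subset_insert _ _).trans h)) (a := a) (b := b) rfl (by simp)
        (Or.inr (h (by simp)))
      refine (congrArg (CutConn E) ?_).mp h2
      ext x; simp

theorem CutConn.exists_path {E : Set (Sym2 V)} {A : Set V} (hA : CutConn E A) {u w : V}
    (hu : u ∈ A) (hw : w ∈ A) (huw : u ≠ w) :
    ∃ m : List V, (u :: (m ++ [w])).Nodup ∧ pe (u :: (m ++ [w])) ⊆ E ∧ ∀ x ∈ m, x ∈ A := by
  let B : Set V := {x | x ∈ A ∧ (x = u ∨ ∃ m : List V, (u :: (m ++ [x])).Nodup ∧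
    pe (u :: (m ++ [x])) ⊆ E ∧ ∀ x ∈ m, x ∈ A)}
  have hB : B = A := by
    refine hA.eq_of_closed (fun x hx => hx.1) (show u ∈ B from ⟨hu, Or.inl rfl⟩) ?_
    rintro x ⟨hxA, hx⟩ y hy he
    refine ⟨hy, ?_⟩
    by_cases hyu : y = u
    · exact Or.inl hyu
    right
    rcases hx with rfl | ⟨m, hm, hpm, hmA⟩
    · exact ⟨[], by grind, by simpa using he, by simp⟩
    · by_cases hym : y ∈ m ++ [x]
      · obtain ⟨t1, t2, ht⟩ := List.append_of_mem hym
        rw [ht] at hm hpm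
        refine ⟨t1, hm.sublist (by simp), le_trans ?_ hpm, fun z hz => ?_⟩
        · have := pe_prefix_subset (u :: (t1 ++ [y])) t2
          simpa using this
        · have : z ∈ m ++ [x] := by rw [ht]; simp [hz]
          grind
      · refine ⟨m ++ [x], ?_, ?_, ?_⟩
        · grind
        · have := pe_cons_append_singleton u m x y
          grind
        grind
  grind

/-- Two-connectivity of a vertex set. -/
structure TwoConn (E : Set (Sym2 V)) (W : Set V) : Prop where
  three : ∃ a ∈ W, ∃ b ∈ W, ∃ c ∈ W, a ≠ b ∧ a ≠ c ∧ b ≠ c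
  conn : CutConn E W
  del : ∀ v ∈ W, CutConn E (W \ {v})

theorem TwoConn.congr {E E' : Set (Sym2 V)} {A : Set V} (h : TwoConn E A)
    (hE : ∀ u ∈ A, ∀ w ∈ A, s(u, w) ∈ E → s(u, w) ∈ E') : TwoConn E' A :=
  ⟨h.three, h.conn.congr hE, fun v hv => (h.del v hv).congr fun u hu w hw => hE u hu.1 w hw.1⟩

section Frames
variable [Fintype V] {ι : Type*}

/-- The edges that separate the faces in `S` from the other faces. -/
def bd (E : Set (Sym2 V)) (d : Sym2 V → Sym2 ι) (S : Set ι) : Set (Sym2 V) :=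
  {e ∈ E | ∃ i ∈ S, ∃ j ∉ S, d e = s(i, j)}

/-- An algebraic planar drawing: every edge borders two faces, and the even edge sets are
exactly the boundaries of the sets of faces. -/
structure IsFrame (E : Set (Sym2 V)) (d : Sym2 V → Sym2 ι) : Prop where
  even : ∀ S, IsEven (bd E d S)
  gen : ∀ Z ⊆ E, IsEven Z → ∃ S, Z = bd E d S
  conn : ∀ S, bd E d S = ∅ → S = ∅ ∨ S = Set.univ

omit [Fintype V] in
theorem mem_bd_iff {E : Set (Sym2 V)} {d : Sym2 V → Sym2 ι} {S : Set ι} {e : Sym2 V} {i j : ι}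
    (h : d e = s(i, j)) : e ∈ bd E d S ↔ e ∈ E ∧ (i ∈ S ↔ j ∉ S) := by
  simp only [bd, Set.mem_ofPred_eq, h]
  refine and_congr_right fun _ => ?_
  constructor
  · grind
  · intro h'
    by_cases hi : i ∈ S
    · grind
    · exact ⟨j, by tauto, i, hi, Sym2.eq_swap⟩

omit [Fintype V] in
theorem bd_symmDiff (E : Set (Sym2 V)) (d : Sym2 V → Sym2 ι) (S T : Set ι) :
    bd E d (symmDiff S T) = symmDiff (bd E d S) (bd E d T) := by
  ext e
  induction h : d e with
  | _ i j =>
    simp only [mem_bd_iff h, Set.mem_symmDiff]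
    tauto

omit [Fintype V] in
theorem bd_compl (E : Set (Sym2 V)) (d : Sym2 V → Sym2 ι) (S : Set ι) :
    bd E d Sᶜ = bd E d S := by
  ext e
  induction h : d e with
  | _ i j =>
    rw [mem_bd_iff h, mem_bd_iff h, Set.mem_compl_iff, Set.mem_compl_iff]
    tauto

omit [Fintype V] in
theorem bd_subset (E : Set (Sym2 V)) (d : Sym2 V → Sym2 ι) (S : Set ι) : bd E d S ⊆ E :=
  fun _ h => h.1

omit [Fintype V] in
theorem mem_bd_inter {E : Set (Sym2 V)} {d : Sym2 V → Sym2 ι} {S T : Set ι} {e : Sym2 V}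
    (h : ∀ i ∈ d e, i ∈ S) : e ∈ bd E d (T ∩ S) ↔ e ∈ bd E d T := by
  induction h' : d e with
  | _ i j =>
    rw [mem_bd_iff h', mem_bd_iff h']
    grind

omit [Fintype V] in
theorem notMem_bd_inter {E : Set (Sym2 V)} {d : Sym2 V → Sym2 ι} {S T : Set ι} {e : Sym2 V}
    (h : ∀ i ∈ d e, i ∉ S) : e ∉ bd E d (T ∩ S) := by
  induction h' : d e with
  | _ i j =>
    rw [mem_bd_iff h']
    grind

omit [Fintype V] in
theorem all_or_none {E : Set (Sym2 V)} {d : Sym2 V → Sym2 ι} {S : Set ι} {e : Sym2 V}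
    (he : e ∈ E) (h : e ∉ bd E d S) : (∀ i ∈ d e, i ∈ S) ∨ (∀ i ∈ d e, i ∉ S) := by
  induction h' : d e with
  | _ i j =>
    rw [mem_bd_iff h'] at h
    grind

/-- The faces around a vertex are cyclically connected. -/
theorem IsFrame.rot {E : Set (Sym2 V)} {d : Sym2 V → Sym2 ι} (hF : IsFrame E d)
    {W : Set V} (hW : TwoConn E W) (hE : ∀ a b, s(a, b) ∈ E → a ∈ W ∧ b ∈ W ∧ a ≠ b) {v : V}
    {S : Set ι} (h : ∀ w, s(v, w) ∉ bd E d S) :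
    (∀ w, s(v, w) ∈ E → ∀ i ∈ d s(v, w), i ∈ S) ∨
    (∀ w, s(v, w) ∈ E → ∀ i ∈ d s(v, w), i ∉ S) := by
  by_contra! hcon
  obtain ⟨⟨b, hb, i, hi, hiS⟩, ⟨a, ha, j, hj, hjS⟩⟩ := hcon
  have ha' := (all_or_none ha (h a)).resolve_right fun h' => h' j hj hjS
  have hb' := (all_or_none hb (h b)).resolve_left fun h' => hiS (h' i hi)
  have hab : a ≠ b := by grind
  obtain ⟨hv, haW, hva⟩ := hE _ _ ha
  obtain ⟨-, hbW, hvb⟩ := hE _ _ hb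
  obtain ⟨m, hm, hpm, hmW⟩ := (hW.del v hv).exists_path (u := a) (w := b)
    ⟨haW, hva.symm⟩ ⟨hbW, hvb.symm⟩ hab
  have hvm : v ∉ a :: (m ++ [b]) := by grind
  have hnd : (v :: (a :: (m ++ [b]))).Nodup := List.nodup_cons.2 ⟨hvm, hm⟩
  have hce : ce (v :: ((a :: m) ++ [b])) = insert s(b, v) (insert s(v, a) (pe (a :: (m ++ [b])))) := by
    rw [ce_eq_insert]; rfl
  have hsub : ce (v :: ((a :: m) ++ [b])) ⊆ E := by grind
  obtain ⟨T, hT⟩ := hF.gen _ hsub (isEven_ce (by simpa using hnd) (by simp))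
  have h1 : dg (bd E d (T ∩ S)) v = 1 := by
    refine dg_of_unique (a := a) ?_ fun w hw => ?_
    · rw [mem_bd_inter ha', ← hT, hce]; simp
    · have hwE := hw.1
      rcases all_or_none hwE (h w) with hw' | hw'
      · rw [mem_bd_inter hw', ← hT, hce] at hw
        rcases hw with hw | hw | hw
        · rw [Sym2.eq_swap, Sym2.congr_left] at hw
          subst hw
          exact absurd (hw' i hi) hiS
        · rwa [Sym2.congr_right] at hw
        · exact absurd (mem_of_mem_pe hw (by simp)) hvm
      · exact absurd hw (notMem_bd_inter hw')
  rw [hF.even] at h1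
  exact absurd h1 (by decide)

end Frames

end

section

variable {V : Type*}

theorem exists_mem_ce {c : List V} {v : V} (hv : v ∈ c) (h2 : 2 ≤ c.length) :
    ∃ w, s(v, w) ∈ ce c := by
  obtain ⟨l, r, rfl⟩ := List.append_of_mem hv
  rw [ce_rotate]
  rw [List.cons_append]
  match h : r ++ l with
  | [] =>
    simp_all
  | b :: t => exact ⟨b, by rw [ce_cons_cons]; simp⟩

theorem TwoConn.exists_cycle {E : Set (Sym2 V)} {U : Set V} (hU : TwoConn E U) {v a b : V}
    (hv : v ∈ U) (ha : a ∈ U) (hb : b ∈ U) (hva : v ≠ a) (hvb : v ≠ b) (hab : a ≠ b)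
    (hea : s(v, a) ∈ E) (heb : s(v, b) ∈ E) :
    ∃ c : List V, c.Nodup ∧ 3 ≤ c.length ∧ ce c ⊆ E ∧ (∀ x ∈ c, x ∈ U) ∧ s(v, a) ∈ ce c ∧
      s(v, b) ∈ ce c ∧ ∀ w, s(v, w) ∈ ce c → w = a ∨ w = b := by
  obtain ⟨m, hm, hpm, hmW⟩ := (hU.del v hv).exists_path (u := a) (w := b)
    ⟨ha, hva.symm⟩ ⟨hb, hvb.symm⟩ hab
  have hvm : v ∉ a :: (m ++ [b]) := by grind
  have hnd : (v :: (a :: (m ++ [b]))).Nodup := List.nodup_cons.2 ⟨hvm, hm⟩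
  have hce : ce (v :: ((a :: m) ++ [b])) =
      insert s(b, v) (insert s(v, a) (pe (a :: (m ++ [b])))) := by
    rw [ce_eq_insert]; rfl
  refine ⟨v :: ((a :: m) ++ [b]), by simpa using hnd, by simp, ?_, ?_, ?_, ?_, ?_⟩
  · grind
  · grind
  · rw [hce]; simp
  · grind
  · intro w hw
    rw [hce] at hw
    rcases hw with hw | hw | hw
    · grind
    · grind
    · exact absurd (mem_of_mem_pe hw (by simp)) hvm

theorem CutConn.exists_edge {E : Set (Sym2 V)} {A : Set V} (hA : CutConn E A) {a b : V}
    (ha : a ∈ A) (hb : b ∈ A) (hab : a ≠ b) : ∃ w ∈ A, w ≠ a ∧ s(a, w) ∈ E := by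
  obtain ⟨u, hu, w, hw, he⟩ := hA {a} (by simpa using ha) (by simp) (by
    grind)
  grind

theorem TwoConn.exists_edge {E : Set (Sym2 V)} {A : Set V} (hA : TwoConn E A) {a : V}
    (ha : a ∈ A) : ∃ w ∈ A, w ≠ a ∧ s(a, w) ∈ E := by
  obtain ⟨x, hx, y, hy, _, _, hxy, _, _⟩ := hA.three
  by_cases h : a = x
  · exact hA.conn.exists_edge ha hy (h ▸ hxy)
  · exact hA.conn.exists_edge ha hx h

theorem TwoConn.exists_edge_ne {E : Set (Sym2 V)} {A : Set V} (hA : TwoConn E A) {a b : V}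
    (ha : a ∈ A) (hb : b ∈ A) (hab : a ≠ b) : ∃ w ∈ A, w ≠ a ∧ w ≠ b ∧ s(a, w) ∈ E := by
  have key : ∃ x ∈ A \ {b}, a ≠ x := by
    obtain ⟨x, hx, y, hy, z, hz, hxy, hxz, hyz⟩ := hA.three
    by_contra! hcon
    by_cases h1 : x = b
    · by_cases h2 : y = b
      · grind
      · have h3 : z ≠ b := fun h => hxz (h1.trans h.symm)
        exact hyz ((hcon y ⟨hy, h2⟩).symm.trans (hcon z ⟨hz, h3⟩))
    · by_cases h2 : y = b
      · have h3 : z ≠ b := fun h => hyz (h2.trans h.symm)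
        exact hxz ((hcon x ⟨hx, h1⟩).symm.trans (hcon z ⟨hz, h3⟩))
      · exact hxy ((hcon x ⟨hx, h1⟩).symm.trans (hcon y ⟨hy, h2⟩))
  obtain ⟨x, hx, hax⟩ := key
  obtain ⟨w, hw, hwa, he⟩ := (hA.del b hb).exists_edge (a := a) (b := x) ⟨ha, hab⟩ hx hax
  grind

section Regions
variable {ι : Type*}

/-- The faces that can be reached from `f` without crossing an edge spanned by `U`. -/
def reg (E : Set (Sym2 V)) (d : Sym2 V → Sym2 ι) (f : ι) (U : Set V) : Set ι :=
  {i | ∀ S, f ∈ S → (∀ e ∈ bd E d S, ∀ v ∈ e, v ∈ U) → i ∈ S}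

/-- The vertices of `U` incident with a face of the outer region. -/
def outer (E : Set (Sym2 V)) (d : Sym2 V → Sym2 ι) (f : ι) (U : Set V) : Set V :=
  {v | v ∈ U ∧ ∃ w, s(v, w) ∈ E ∧ ∃ i ∈ d s(v, w), i ∈ reg E d f U}

variable {E : Set (Sym2 V)} {d : Sym2 V → Sym2 ι} {f : ι} {U U' W : Set V}

theorem mem_reg : f ∈ reg E d f U := fun _ h _ => h

theorem reg_closed {e : Sym2 V} (he : e ∈ bd E d (reg E d f U)) {v : V} (hv : v ∈ e) :
    v ∈ U := by
  obtain ⟨heE, i, hi, j, hj, hij⟩ := he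
  by_contra hvU
  refine hj fun S hf hS => ?_
  by_contra hjS
  exact hvU (hS e ⟨heE, i, hi S hf hS, j, hjS, hij⟩ v hv)

theorem reg_anti (h : U' ⊆ U) : reg E d f U ⊆ reg E d f U' :=
  fun _ hi S hf hS => hi S hf fun e he v hv => h (hS e he v hv)

theorem outer_subset : outer E d f U ⊆ U := fun _ h => h.1

theorem outer_anti (h : U' ⊆ U) {v : V} (hv : v ∈ outer E d f U) (hv' : v ∈ U') :
    v ∈ outer E d f U' := by
  obtain ⟨-, w, hw, i, hi, hr⟩ := hv
  exact ⟨hv', w, hw, i, hi, reg_anti h hr⟩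

/-- The set `U` spans a disc with boundary cycle `c`. -/
structure Disc (E : Set (Sym2 V)) (d : Sym2 V → Sym2 ι) (f : ι) (U : Set V) (c : List V) :
    Prop where
  nodup : c.Nodup
  three : 3 ≤ c.length
  bd_eq : bd E d (reg E d f U) = ce c
  face : ∀ e ∈ E, (∀ v ∈ e, v ∈ U) → ∃ i ∈ d e, i ∉ reg E d f U
  outer_iff : ∀ v, v ∈ outer E d f U ↔ v ∈ c

theorem Disc.mem {c : List V} (h : Disc E d f U c) {v : V} (hv : v ∈ c) : v ∈ U :=
  ((h.outer_iff v).2 hv).1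

theorem Disc.ce_subset {c : List V} (h : Disc E d f U c) : ce c ⊆ E :=
  h.bd_eq ▸ bd_subset _ _ _

theorem Disc.rotate {l r : List V} (h : Disc E d f U (l ++ r)) : Disc E d f U (r ++ l) where
  nodup := (List.perm_append_comm (l₁ := l) (l₂ := r)).nodup_iff.1 h.nodup
  three := by have := h.three; grind
  bd_eq := by
    rw [h.bd_eq]
    cases r with
    | nil => simp
    | cons a r => rw [ce_rotate]
  face := h.face
  outer_iff v := by rw [h.outer_iff]; simp [or_comm]

theorem Disc.reverse {c : List V} (h : Disc E d f U c) : Disc E d f U c.reverse where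
  nodup := List.nodup_reverse.2 h.nodup
  three := by simpa using h.three
  bd_eq := by rw [h.bd_eq, ce_reverse]
  face := h.face
  outer_iff v := by rw [h.outer_iff]; simp

/-- The standing assumptions on a drawing of a two-connected graph. -/
structure Drawn [Fintype V] (E : Set (Sym2 V)) (d : Sym2 V → Sym2 ι) (W : Set V) : Prop where
  frame : IsFrame E d
  two : TwoConn E W
  supp : ∀ a b, s(a, b) ∈ E → a ∈ W ∧ b ∈ W ∧ a ≠ b

variable [Fintype V]

theorem Drawn.rot (h : Drawn E d W) {v : V} {S : Set ι} (hv : ∀ w, s(v, w) ∉ bd E d S) :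
    (∀ w, s(v, w) ∈ E → ∀ i ∈ d s(v, w), i ∈ S) ∨
    (∀ w, s(v, w) ∈ E → ∀ i ∈ d s(v, w), i ∉ S) :=
  h.frame.rot h.two h.supp hv

theorem Drawn.outer_delete (h : Drawn E d W) {v w : V} (hv : v ∈ outer E d f U) (hw : w ∈ U)
    (he : s(v, w) ∈ E) : w ∈ outer E d f (U \ {v}) := by
  have hne := (h.supp _ _ he).2.2
  obtain ⟨hvU, x, hx, i, hi, hr⟩ := hv
  have hr' := reg_anti (E := E) (d := d) (f := f) (Set.sdiff_subset (s := U) (t := {v})) hr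
  have := (h.rot (v := v) (S := reg E d f (U \ {v})) fun w hw =>
    (reg_closed hw (Sym2.mem_mk_left v w)).2 rfl).resolve_right
    fun h' => h' x hx i hi hr'
  refine ⟨⟨hw, hne.symm⟩, v, by rwa [Sym2.eq_swap], ?_⟩
  rw [Sym2.eq_swap]
  obtain ⟨j, hj⟩ : ∃ j, j ∈ d s(v, w) := by
    induction h : d s(v, w) with
    | _ a b => simp
  grind

omit [Fintype V] in
theorem exists_face (e : Sym2 V) (d : Sym2 V → Sym2 ι) : ∃ j, j ∈ d e := by
  induction h : d e with
  | _ a b => simp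

theorem Drawn.outer_nonempty (h : Drawn E d W) (hU : U ⊆ W) (hne : U.Nonempty) :
    (outer E d f U).Nonempty := by
  by_cases hb : bd E d (reg E d f U) = ∅
  · obtain ⟨u, hu⟩ := hne
    have h1 := (h.frame.conn _ hb).resolve_left (Set.nonempty_of_mem mem_reg).ne_empty
    obtain ⟨w, _, _, he⟩ := h.two.exists_edge (hU hu)
    obtain ⟨j, hj⟩ := exists_face s(u, w) d
    exact ⟨u, hu, w, he, j, hj, h1 ▸ Set.mem_univ j⟩
  · obtain ⟨e, he⟩ := Set.nonempty_iff_ne_empty.2 hb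
    induction e with
    | _ a b =>
      have ha := reg_closed he (Sym2.mem_mk_left a b)
      obtain ⟨heE, i, hi, j, hj, hij⟩ := he
      exact ⟨a, ha, b, heE, i, by simp [hij], hi⟩

theorem Drawn.gen_disjoint (h : Drawn E d W) {Z : Set (Sym2 V)} (hZ : Z ⊆ E) (hev : IsEven Z)
    (hU : ∀ e ∈ Z, ∀ v ∈ e, v ∈ U) : ∃ S, bd E d S = Z ∧ ∀ i ∈ reg E d f U, i ∉ S := by
  obtain ⟨S, rfl⟩ := h.frame.gen Z hZ hev
  by_cases hf : f ∈ S
  · exact ⟨Sᶜ, bd_compl _ _ _, fun i hi h' => h' (hi S hf hU)⟩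
  · exact ⟨S, rfl, fun i hi => hi Sᶜ hf (by rwa [bd_compl])⟩

theorem Drawn.exists_disc (h : Drawn E d W) (hU : TwoConn E U) :
    ∃ c, Disc E d f U c := by
  have hface : ∀ e ∈ E, (∀ v ∈ e, v ∈ U) → ∃ i ∈ d e, i ∉ reg E d f U := by
    intro e heE heU
    induction e with
    | _ a b =>
      have ha := heU a (by simp)
      have hb := heU b (by simp)
      have hab := (h.supp _ _ heE).2.2
      obtain ⟨w, hw, hwa, hwb, hew⟩ := hU.exists_edge_ne ha hb hab
      obtain ⟨c, hc, hc3, hcE, hcU, hcb, -, -⟩ :=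
        hU.exists_cycle ha hb hw hab hwa.symm hwb.symm heE hew
      obtain ⟨S, hS, hSR⟩ := h.gen_disjoint (f := f) (U := U) hcE (isEven_ce hc hc3)
        fun e he v hv => hcU v (mem_of_mem_ce he hv)
      rw [← hS] at hcb
      obtain ⟨-, i, hi, j, hj, hij⟩ := hcb
      grind
  obtain ⟨x, hx, _, _, _, _, _, _, _⟩ := hU.three
  have hne : (bd E d (reg E d f U)).Nonempty := by
    by_contra hcon
    have h1 := (h.frame.conn _ (Set.not_nonempty_iff_eq_empty.1 hcon)).resolve_left
      (Set.nonempty_of_mem mem_reg).ne_empty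
    obtain ⟨w, hw, _, he⟩ := hU.exists_edge hx
    grind
  obtain ⟨c, hc, hc3, hcR⟩ := exists_cycle_of_isEven (h.frame.even (reg E d f U)) hne
    fun v hv => (h.supp _ _ hv.1).2.2 rfl
  have hcU : ∀ e ∈ ce c, ∀ v ∈ e, v ∈ U := fun e he v hv => reg_closed (hcR he) hv
  obtain ⟨S, hS, hSR⟩ := h.gen_disjoint (f := f) (U := U)
    (hcR.trans (bd_subset _ _ _)) (isEven_ce hc hc3) hcU
  -- around each vertex, all edges spanned by `U` touch `S` or none does
  have hloc : ∀ v ∈ U, ∀ a ∈ U, ∀ b ∈ U, s(v, a) ∈ E → s(v, b) ∈ E →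
      (∃ i ∈ d s(v, a), i ∈ S) → ∃ i ∈ d s(v, b), i ∈ S := by
    intro v hv a ha b hb hea heb ⟨i, hi, hiS⟩
    by_contra hbS
    push Not at hbS
    have hab : a ≠ b := by grind
    obtain ⟨c', hc', hc3', hcE', hcU', hca, hcb, hcv⟩ := hU.exists_cycle hv ha hb
      (h.supp _ _ hea).2.2 (h.supp _ _ heb).2.2 hab hea heb
    obtain ⟨T, hT, hTR⟩ := h.gen_disjoint (f := f) (U := U) hcE' (isEven_ce hc' hc3')
        fun e he v hv => hcU' v (mem_of_mem_ce he hv)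
    have key : ∀ e ∈ E, (∃ i ∈ d e, i ∈ S) → (e ∈ bd E d (T ∩ S) ↔ e ∈ bd E d T) := by
      rintro e he ⟨i, hi, hiS⟩
      by_cases heS : e ∈ bd E d S
      · have heR := hcR (hS ▸ heS)
        obtain ⟨-, j, hj, k, hk, hjk⟩ := heS
        rw [mem_bd_iff hjk] at heR
        rw [mem_bd_iff hjk, mem_bd_iff hjk]
        have hjR : j ∉ reg E d f U := fun h' => hSR j h' hj
        have hkR : k ∈ reg E d f U := by tauto
        have := hTR k hkR
        simp [*]
      · exact mem_bd_inter ((all_or_none he heS).resolve_right fun h' => h' i hi hiS)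
    have h1 : dg (bd E d (T ∩ S)) v = 1 := by
      refine dg_of_unique (a := a) ?_ fun w hw => ?_
      · rw [key _ hea ⟨i, hi, hiS⟩, hT]
        exact hca
      · have hwS : ∃ i ∈ d s(v, w), i ∈ S := by
          obtain ⟨-, j, hj, k, -, hjk⟩ := hw
          exact ⟨j, by simp [hjk], hj.2⟩
        rw [key _ hw.1 hwS, hT] at hw
        refine (hcv w hw).resolve_right ?_
        rintro rfl
        obtain ⟨j, hj, hjS⟩ := hwS
        exact hbS j hj hjS
    rw [h.frame.even] at h1
    exact absurd h1 (by decide)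
  obtain ⟨z, hz⟩ : ∃ z, z ∈ c := List.exists_mem_of_length_pos (by omega)
  obtain ⟨z', hz'⟩ := exists_mem_ce hz (by omega)
  have hzU := hcU _ hz' z (by simp)
  have hall : {v | v ∈ U ∧ ∀ w ∈ U, s(v, w) ∈ E → ∃ i ∈ d s(v, w), i ∈ S} = U := by
    refine hU.conn.eq_of_closed (a := z) (fun v hv => hv.1) ?_ ?_
    · refine ⟨hzU, fun w hw he => ?_⟩
      refine hloc z hzU z' (hcU _ hz' z' (by simp)) w hw (hcR hz').1 he ?_
      rw [← hS] at hz'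
      obtain ⟨-, j, hj, k, -, hjk⟩ := hz'
      exact ⟨j, by simp [hjk], hj⟩
    · rintro u ⟨hu, hu'⟩ w hw he
      refine ⟨hw, fun x hx hex => ?_⟩
      have := hu' w hw he
      rw [Sym2.eq_swap] at this he
      exact hloc w hw u hu x hx he hex this
  have hbd : bd E d (reg E d f U) = ce c := by
    refine Set.Subset.antisymm (fun e he => ?_) hcR
    have heU := fun v hv => reg_closed (v := v) he hv
    induction e with
    | _ a b =>
      have ha := heU a (by simp)
      rw [← hall] at ha
      obtain ⟨i, hi, hiS⟩ := ha.2 b (heU b (by simp)) he.1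
      obtain ⟨heE, j, hj, k, hk, hjk⟩ := he
      rw [← hS, mem_bd_iff hjk]
      have hjS := hSR j hj
      rw [hjk, Sym2.mem_iff] at hi
      rcases hi with rfl | rfl
      · exact absurd hiS hjS
      · exact ⟨heE, by tauto⟩
  refine ⟨c, hc, hc3, hbd, hface, fun v => ⟨fun hv => ?_, fun hv => ?_⟩⟩
  · by_contra hvc
    obtain ⟨hvU, w, hw, i, hi, hiR⟩ := hv
    obtain ⟨x, hxU, -, hex⟩ := hU.exists_edge hvU
    obtain ⟨j, hj, hjR⟩ := hface _ hex (by simp [hvU, hxU])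
    rcases h.rot (v := v) (S := reg E d f U) fun w hw =>
      hvc (mem_of_mem_ce (hbd ▸ hw) (by simp)) with h1 | h1
    · exact hjR (h1 x hex j hj)
    · exact h1 w hw i hi hiR
  · obtain ⟨w, hw⟩ := exists_mem_ce hv (by omega)
    refine ⟨hcU _ hw v (by simp), w, (hcR hw).1, ?_⟩
    rw [← hbd] at hw
    obtain ⟨-, j, hj, k, -, hjk⟩ := hw
    exact ⟨j, by simp [hjk], hj⟩

/-- The vertices on the cycle `k` together with those surrounded by faces in `S`. -/
def half (E : Set (Sym2 V)) (d : Sym2 V → Sym2 ι) (U : Set V) (k : List V) (S : Set ι) : Set V :=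
  {v | v ∈ U ∧ (v ∈ k ∨ ∀ w, s(v, w) ∈ E → ∀ i ∈ d s(v, w), i ∈ S)}

theorem Drawn.disc_half (h : Drawn E d W) {S₁ S₂ : Set ι} {k₁ k₂ q : List V}
    (hface : ∀ e ∈ E, (∀ v ∈ e, v ∈ U) → ∃ i ∈ d e, i ∉ reg E d f U)
    (h1 : ∀ i ∈ reg E d f U, i ∉ S₁)
    (h12 : ∀ i ∈ S₁, i ∉ S₂) (hall : ∀ i, i ∈ reg E d f U ∨ i ∈ S₁ ∨ i ∈ S₂)
    (hk₁ : k₁.Nodup) (hk₁3 : 3 ≤ k₁.length) (hb₁ : bd E d S₁ = ce k₁) (hkU₁ : ∀ x ∈ k₁, x ∈ U)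
    (hb₂ : bd E d S₂ = ce k₂)
    (hq : q.Nodup) (hqk : pe q ⊆ ce k₁) (hqc : ∀ a ∈ q, ∀ b ∈ q, s(a, b) ∈ E → s(a, b) ∈ pe q)
    (hk : ∀ v ∈ k₁, v ∈ k₂ → v ∈ q) : Disc E d f (half E d U k₁ S₁) k₁ := by
  have hF : ∀ v ∈ half E d U k₁ S₁, ∀ w, s(v, w) ∈ E → ∀ i ∈ d s(v, w), i ∈ S₂ → v ∈ q := by
    rintro v ⟨hv, hv'⟩ w he i hi hiS
    have hvk : v ∈ k₁ := hv'.resolve_right fun h' => h12 i (h' w he i hi) hiS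
    refine hk v hvk ?_
    by_contra hvk2
    have := (h.rot (v := v) (S := S₂) fun w hw =>
      hvk2 (mem_of_mem_ce (hb₂ ▸ hw) (by simp))).resolve_right fun h' => h' w he i hi hiS
    obtain ⟨y, hy⟩ := exists_mem_ce hvk (by omega)
    rw [← hb₁] at hy
    obtain ⟨hyE, a, ha, b, hb, hab⟩ := hy
    exact h12 a ha (this y hyE a (by simp [hab]))
  have hsub : half E d U k₁ S₁ ⊆ U := fun v hv => hv.1
  have hkh : ∀ x ∈ k₁, x ∈ half E d U k₁ S₁ := fun x hx => ⟨hkU₁ x hx, Or.inl hx⟩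
  have hr1 : ∀ i ∈ reg E d f (half E d U k₁ S₁), i ∉ S₁ := fun i hi =>
    hi S₁ᶜ (h1 f mem_reg) fun e he v hv => by
      rw [bd_compl, hb₁] at he
      exact hkh v (mem_of_mem_ce he hv)
  have hFe : ∀ e ∈ E, (∀ v ∈ e, v ∈ half E d U k₁ S₁) → (∃ i ∈ d e, i ∈ S₂) → e ∈ pe q := by
    rintro e heE he ⟨i, hi, hiS⟩
    induction e with
    | _ a b =>
      refine hqc a (hF a (he a (by simp)) b heE i hi hiS)
        b (hF b (he b (by simp)) a (by rwa [Sym2.eq_swap]) i (by rwa [Sym2.eq_swap]) hiS) heE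
  have hreg : reg E d f (half E d U k₁ S₁) = S₁ᶜ := by
    refine Set.Subset.antisymm hr1 ?_
    have hY : bd E d (S₁ᶜ \ reg E d f (half E d U k₁ S₁)) ⊆ pe q := by
      rintro e ⟨heE, i, ⟨hi1, hir⟩, j, hj, hij⟩
      have hi2 : i ∈ S₂ := by
        rcases hall i with h' | h' | h'
        · exact absurd (reg_anti hsub h') hir
        · exact absurd h' hi1
        · exact h'
      by_cases hj1 : j ∈ S₁
      · have he1 : e ∈ ce k₁ := by
          rw [← hb₁]; exact ⟨heE, j, hj1, i, hi1, by rw [hij, Sym2.eq_swap]⟩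
        exact hFe e heE (fun v hv => hkh v (mem_of_mem_ce he1 hv)) ⟨i, by simp [hij], hi2⟩
      · have hjr : j ∈ reg E d f (half E d U k₁ S₁) := by
          by_contra hjr
          exact hj ⟨hj1, hjr⟩
        exact hFe e heE (fun v hv => reg_closed (f := f)
          ⟨heE, j, hjr, i, hir, by rw [hij, Sym2.eq_swap]⟩ hv) ⟨i, by simp [hij], hi2⟩
    have := (h.frame.conn _ ((h.frame.even _).eq_empty_of_subset_pe hq hY)).resolve_right
      fun h' => by
        have : f ∈ S₁ᶜ \ reg E d f (half E d U k₁ S₁) := h' ▸ Set.mem_univ f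
        exact this.2 mem_reg
    exact Set.sdiff_eq_empty.1 this
  refine ⟨hk₁, hk₁3, by rw [hreg, bd_compl, hb₁], fun e heE he => ?_, fun v => ⟨?_, ?_⟩⟩
  · by_contra! hcon
    rw [hreg] at hcon
    obtain ⟨i, hi, hiR⟩ := hface e heE fun v hv => hsub (he v hv)
    have hi2 : i ∈ S₂ := by
      rcases hall i with h' | h' | h'
      · exact absurd h' hiR
      · exact absurd h' (hcon i hi)
      · exact h'
    have := hqk (hFe e heE he ⟨i, hi, hi2⟩)
    rw [← hb₁] at this
    obtain ⟨-, j, hj, k, -, hjk⟩ := this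
    exact hcon j (by simp [hjk]) hj
  · rintro ⟨hv, w, hw, i, hi, hir⟩
    rw [hreg] at hir
    exact hv.2.resolve_right fun h' => hir (h' w hw i hi)
  · intro hv
    obtain ⟨w, hw⟩ := exists_mem_ce hv (by omega)
    rw [← hb₁] at hw
    obtain ⟨hwE, j, hj, k, hk, hjk⟩ := hw
    exact ⟨hkh v hv, w, hwE, k, by simp [hjk], by rwa [hreg]⟩

end Regions

end

section

variable {V : Type*}

theorem ends_mem_pe {x y : V} {m : List V} (h : (x :: (m ++ [y])).Nodup)
    (he : s(x, y) ∈ pe (x :: (m ++ [y]))) : m = [] := by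
  cases m with
  | nil => rfl
  | cons b m =>
    rw [List.cons_append, pe_cons_cons] at he
    rcases he with he | he
    · grind
    · exact absurd (mem_of_mem_pe he (by simp)) (List.nodup_cons.1 h).1

theorem ce_split (x y : V) (a b : List V) :
    ce (x :: (a ++ y :: b)) = pe (x :: (a ++ [y])) ∪ pe (y :: (b ++ [x])) := by
  rw [ce_cons]
  have := pe_append (x :: a) y (b ++ [x])
  simpa using this

theorem pe_path_reverse (x y : V) (m : List V) :
    pe (y :: (m.reverse ++ [x])) = pe (x :: (m ++ [y])) := by
  rw [← pe_reverse]
  simp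

variable {ι : Type*} {E : Set (Sym2 V)} {d : Sym2 V → Sym2 ι} {f : ι} {U U' W : Set V}

set_option maxHeartbeats 2000000 in
theorem Drawn.split [Fintype V] (h : Drawn E d W) (hUW : U ⊆ W) {x y : V} {a₁ a₂ m : List V}
    (hD : Disc E d f U (x :: (a₁ ++ y :: a₂))) (hm : (x :: (m ++ [y])).Nodup)
    (hmE : pe (x :: (m ++ [y])) ⊆ E) (hmU : ∀ v ∈ m, v ∈ U)
    (hmc : ∀ v ∈ m, v ∉ a₁ ∧ v ∉ a₂)
    (hch : ∀ a ∈ x :: (m ++ [y]), ∀ b ∈ x :: (m ++ [y]), s(a, b) ∈ E →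
      s(a, b) ∈ pe (x :: (m ++ [y])))
    (h₁ : 1 ≤ a₁.length + m.length) (h₂ : 1 ≤ m.length + a₂.length) :
    ∃ U₁ U₂, Disc E d f U₁ (x :: (a₁ ++ y :: m.reverse)) ∧ Disc E d f U₂ (x :: (m ++ y :: a₂)) ∧
      U₁ ∪ U₂ = U ∧ (∀ v ∈ U₁, v ∈ U₂ → v ∈ x :: (m ++ [y])) ∧
      (∀ u ∈ U₁, u ∉ U₂ → ∀ w ∈ U₂, w ∉ U₁ → s(u, w) ∉ E) := by
  classical
  have hnd := hD.nodup
  have h3 := hD.three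
  simp only [List.nodup_cons, List.mem_append, List.mem_cons, List.nodup_append, not_or,
    List.not_mem_nil, not_false_eq_true, List.nodup_nil, List.length_cons,
    List.length_append] at hnd hm h3
  have hk₁ : (x :: (a₁ ++ y :: m.reverse)).Nodup := by grind
  have hk₂ : (x :: (m ++ y :: a₂)).Nodup := by grind
  set P₁ := pe (x :: (a₁ ++ [y])) with hP₁
  set P₂ := pe (y :: (a₂ ++ [x])) with hP₂
  set Q := pe (x :: (m ++ [y])) with hQ
  have hce : ce (x :: (a₁ ++ y :: a₂)) = P₁ ∪ P₂ := ce_split _ _ _ _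
  have hce₁ : ce (x :: (a₁ ++ y :: m.reverse)) = P₁ ∪ Q := by
    rw [ce_split, pe_path_reverse]
  have hce₂ : ce (x :: (m ++ y :: a₂)) = Q ∪ P₂ := ce_split _ _ _ _
  have hcE := hD.ce_subset
  rw [hce] at hcE
  have hmemP₁ : ∀ e ∈ P₁, ∀ v ∈ e, v = x ∨ v ∈ a₁ ∨ v = y := fun e he v hv => by
    simpa using mem_of_mem_pe he hv
  have hmemP₂ : ∀ e ∈ P₂, ∀ v ∈ e, v = y ∨ v ∈ a₂ ∨ v = x := fun e he v hv => by
    simpa using mem_of_mem_pe he hv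
  have hmemQ : ∀ e ∈ Q, ∀ v ∈ e, v = x ∨ v ∈ m ∨ v = y := fun e he v hv => by
    simpa using mem_of_mem_pe he hv
  have hxy : ∀ e ∈ E, (∀ v ∈ e, v = x ∨ v = y) → e = s(x, y) := by
    intro e he hv
    induction e with
    | _ a b =>
      have hab := (h.supp _ _ he).2.2
      have ha := hv a (by simp)
      have hb := hv b (by simp)
      grind
  have e1 : s(x, y) ∈ P₁ → a₁ = [] := ends_mem_pe (by grind)
  have e2 : s(x, y) ∈ P₂ → a₂ = [] := fun he => by
    rw [Sym2.eq_swap] at he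
    exact ends_mem_pe (by grind) he
  have e3 : s(x, y) ∈ Q → m = [] := ends_mem_pe (by grind)
  have d12 : ∀ e ∈ P₁, e ∉ P₂ := fun e he he' => by
    have := hxy e (hcE (Or.inl he)) fun v hv => by grind
    grind
  have d1q : ∀ e ∈ P₁, e ∉ Q := fun e he he' => by grind
  have d2q : ∀ e ∈ P₂, e ∉ Q := fun e he he' => by grind
  have hxU : x ∈ U := hD.mem (by simp)
  have hyU : y ∈ U := hD.mem (by simp)
  have haU : ∀ v ∈ a₁, v ∈ U := fun v hv => hD.mem (by simp [hv])
  have haU2 : ∀ v ∈ a₂, v ∈ U := fun v hv => hD.mem (by simp [hv])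
  have hkU₁ : ∀ v ∈ x :: (a₁ ++ y :: m.reverse), v ∈ U := fun v hv => by grind
  have hkU₂ : ∀ v ∈ x :: (m ++ y :: a₂), v ∈ U := fun v hv => by grind
  obtain ⟨S₁, hS₁, hR₁⟩ := h.gen_disjoint (f := f) (U := U) (Z := ce (x :: (a₁ ++ y :: m.reverse)))
    (by grind)
    (isEven_ce hk₁ (by simp; omega)) fun e he v hv => hkU₁ v (mem_of_mem_ce he hv)
  obtain ⟨S₂, hS₂, hR₂⟩ := h.gen_disjoint (f := f) (U := U) (Z := ce (x :: (m ++ y :: a₂)))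
    (by grind)
    (isEven_ce hk₂ (by simp; omega)) fun e he v hv => hkU₂ v (mem_of_mem_ce he hv)
  have huniv : symmDiff (reg E d f U) (symmDiff S₁ S₂) = Set.univ := by
    refine (h.frame.conn _ ?_).resolve_left ?_
    · rw [bd_symmDiff, bd_symmDiff, hD.bd_eq, hS₁, hS₂, hce, hce₁, hce₂]
      ext e
      have t1 := d12 e
      have t2 := d1q e
      have t3 := d2q e
      simp only [Set.mem_symmDiff, Set.mem_union, Set.mem_empty_iff_false]
      clear * - t1 t2 t3
      tauto
    · intro h'
      have h0 : f ∉ symmDiff (reg E d f U) (symmDiff S₁ S₂) := by rw [h']; simp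
      apply h0
      rw [Set.mem_symmDiff, Set.mem_symmDiff]
      have t1 := hR₁ f mem_reg
      have t2 := hR₂ f mem_reg
      have t3 : f ∈ reg E d f U := mem_reg
      clear * - t1 t2 t3
      tauto
  have hpart : ∀ i, (i ∈ reg E d f U ∨ i ∈ S₁ ∨ i ∈ S₂) ∧ (i ∈ S₁ → i ∉ S₂) := fun i => by
    have h0 : i ∈ symmDiff (reg E d f U) (symmDiff S₁ S₂) := by rw [huniv]; simp
    rw [Set.mem_symmDiff, Set.mem_symmDiff] at h0
    have t1 := hR₁ i
    have t2 := hR₂ i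
    clear * - t1 t2 h0
    tauto
  have hdist : ∀ v ∈ x :: (a₁ ++ y :: m.reverse), v ∈ x :: (m ++ y :: a₂) →
      v ∈ x :: (m ++ [y]) := by
    intro v hv hv'
    simp only [List.mem_cons, List.mem_append, List.mem_reverse, List.not_mem_nil] at hv hv' ⊢
    grind
  have hm' : (x :: (m ++ [y])).Nodup := by simp [List.nodup_append]; grind
  have D₁ := h.disc_half (q := x :: (m ++ [y])) hD.face hR₁ (fun i => (hpart i).2)
    (fun i => (hpart i).1) hk₁ (by simp; omega) hS₁ hkU₁ hS₂ hm'
    (by rw [hce₁]; exact Set.subset_union_right) hch hdist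
  have D₂ := h.disc_half (q := x :: (m ++ [y])) hD.face hR₂
    (fun i hi hi' => (hpart i).2 hi' hi) (fun i => (hpart i).1.imp_right Or.symm) hk₂
    (by simp; omega) hS₂ hkU₂ hS₁ hm' (by rw [hce₂]; exact Set.subset_union_left) hch
    fun v hv hv' => hdist v hv' hv
  have hroty : ∀ {k : List V} {S : Set ι}, bd E d S = ce k → ∀ v, v ∉ k →
      (∀ w, s(v, w) ∈ E → ∀ i ∈ d s(v, w), i ∈ S) ∨
      (∀ w, s(v, w) ∈ E → ∀ i ∈ d s(v, w), i ∉ S) := fun hk v hv =>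
    h.rot fun w hw => hv (mem_of_mem_ce (hk ▸ hw) (by simp))
  have hedge : ∀ v ∈ U, ∃ w, s(v, w) ∈ E := fun v hv => by
    obtain ⟨w, _, _, hw⟩ := h.two.exists_edge (hUW hv)
    exact ⟨w, hw⟩
  refine ⟨_, _, D₁, D₂, ?_, ?_, ?_⟩
  · ext v
    constructor
    · rintro (hv | hv) <;> exact hv.1
    · intro hv
      by_cases hv1 : v ∈ x :: (a₁ ++ y :: m.reverse)
      · exact Or.inl ⟨hv, Or.inl hv1⟩
      by_cases hv2 : v ∈ x :: (m ++ y :: a₂)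
      · exact Or.inr ⟨hv, Or.inl hv2⟩
      rcases hroty hS₁ v hv1 with h1 | h1
      · exact Or.inl ⟨hv, Or.inr h1⟩
      rcases hroty hS₂ v hv2 with h2 | h2
      · exact Or.inr ⟨hv, Or.inr h2⟩
      · exfalso
        obtain ⟨w, hw⟩ := hedge v hv
        obtain ⟨i, hi⟩ := exists_face s(v, w) d
        have hiR := ((hpart i).1.resolve_right fun h' => by
          rcases h' with h' | h'
          · exact h1 w hw i hi h'
          · exact h2 w hw i hi h')
        have := (hD.outer_iff v).1 ⟨hv, w, hw, i, hi, hiR⟩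
        simp only [List.mem_cons, List.mem_append, List.mem_reverse] at this hv1 hv2
        grind
  · rintro v ⟨hv, hv1⟩ ⟨_, hv2⟩
    rcases hv1 with hv1 | hv1
    · rcases hv2 with hv2 | hv2
      · exact hdist v hv1 hv2
      · exfalso
        obtain ⟨w, hw⟩ := exists_mem_ce hv1 (by simp; omega)
        rw [← hS₁] at hw
        obtain ⟨hwE, i, hi, j, -, hij⟩ := hw
        exact (hpart i).2 hi (hv2 w hwE i (by simp [hij]))
    · rcases hv2 with hv2 | hv2
      · exfalso
        obtain ⟨w, hw⟩ := exists_mem_ce hv2 (by simp; omega)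
        rw [← hS₂] at hw
        obtain ⟨hwE, i, hi, j, -, hij⟩ := hw
        exact (hpart i).2 (hv1 w hwE i (by simp [hij])) hi
      · exfalso
        obtain ⟨w, hw⟩ := hedge v hv
        obtain ⟨i, hi⟩ := exists_face s(v, w) d
        exact (hpart i).2 (hv1 w hw i hi) (hv2 w hw i hi)
  · rintro u ⟨hu, hu1⟩ hu2 w ⟨hw, hw2⟩ hw1 he
    have hu2' : u ∉ x :: (m ++ y :: a₂) := fun h' => hu2 ⟨hu, Or.inl h'⟩
    have hw1' : w ∉ x :: (a₁ ++ y :: m.reverse) := fun h' => hw1 ⟨hw, Or.inl h'⟩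
    have hu3 := (hroty hS₂ u hu2').resolve_left fun h' => hu2 ⟨hu, Or.inr h'⟩
    have hw3 := (hroty hS₁ w hw1').resolve_left fun h' => hw1 ⟨hw, Or.inr h'⟩
    obtain ⟨i, hi, hiR⟩ := hD.face _ he (by simp [hu, hw])
    rcases (hpart i).1.resolve_left hiR with h' | h'
    · rw [Sym2.eq_swap] at he hi
      exact hw3 u he i hi h'
    · exact hu3 w he i hi h'

end

section

variable {V : Type*} [Fintype V]

section Operations
variable {ι : Type*} {E E' : Set (Sym2 V)} {d : Sym2 V → Sym2 ι}

/-- Two faces are identified when no even subset of `E'` separates them. -/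
def mergeSetoid (E E' : Set (Sym2 V)) (d : Sym2 V → Sym2 ι) : Setoid ι where
  r i j := ∀ S, bd E d S ⊆ E' → (i ∈ S ↔ j ∈ S)
  iseqv := ⟨fun _ _ _ => Iff.rfl, fun h S hS => (h S hS).symm,
    fun h h' S hS => (h S hS).trans (h' S hS)⟩

theorem IsFrame.restrict (h : IsFrame E d) (hE : E' ⊆ E) :
    IsFrame E' (fun e => (d e).map (Quotient.mk (mergeSetoid E E' d))) := by
  have key : ∀ S : Set (Quotient (mergeSetoid E E' d)),
      bd E' (fun e => (d e).map (Quotient.mk (mergeSetoid E E' d))) S =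
        bd E d (Quotient.mk (mergeSetoid E E' d) ⁻¹' S) := by
    intro S
    ext e
    induction hij : d e with
    | _ i j =>
      rw [mem_bd_iff (i := Quotient.mk (mergeSetoid E E' d) i)
        (j := Quotient.mk (mergeSetoid E E' d) j) (by simp [hij]), mem_bd_iff hij]
      refine ⟨fun ⟨h1, h2⟩ => ⟨hE h1, h2⟩, fun ⟨h1, h2⟩ => ⟨?_, h2⟩⟩
      by_contra hcon
      have : Quotient.mk (mergeSetoid E E' d) i = Quotient.mk (mergeSetoid E E' d) j := by
        refine Quotient.sound fun T hT => ?_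
        by_contra h'
        refine hcon (hT ((mem_bd_iff hij).2 ⟨h1, by tauto⟩))
      grind
  refine ⟨fun S => key S ▸ h.even _, fun Z hZ hev => ?_, fun S hS => ?_⟩
  · obtain ⟨S, rfl⟩ := h.gen Z (hZ.trans hE) hev
    refine ⟨Set.image (Quotient.mk (mergeSetoid E E' d)) S, ?_⟩
    rw [key]
    congr 1
    ext i
    constructor
    · grind
    · rintro ⟨j, hj, hij⟩
      exact (Quotient.exact hij S hZ).1 hj
  · rw [key] at hS
    rcases h.conn _ hS with h' | h'
    · left
      ext i
      induction i using Quotient.inductionOn with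
      | _ i => simpa using fun hi => (h' ▸ hi : i ∈ (∅ : Set ι))
    simp_all

theorem IsFrame.pendant (h : IsFrame E d) {a b : V} (hb : ∀ w, s(b, w) ∉ E)
    (f : ι) : ∃ d' : Sym2 V → Sym2 ι, IsFrame (insert s(a, b) E) d' ∧ d' s(a, b) = s(f, f) ∧
      ∀ e ≠ s(a, b), d' e = d e := by
  classical
  have he0 : s(a, b) ∉ E := fun h' => hb a (by rwa [Sym2.eq_swap])
  refine ⟨Function.update d s(a, b) s(f, f), ?_, by simp, fun e he => by simp [he]⟩
  have key : ∀ S, bd (insert s(a, b) E) (Function.update d s(a, b) s(f, f)) S = bd E d S := by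
    intro S
    ext e
    by_cases he : e = s(a, b)
    · subst he
      rw [mem_bd_iff (Function.update_self ..)]
      refine iff_of_false (by tauto) fun h' => he0 h'.1
    · induction hij : d e with
      | _ i j =>
        rw [mem_bd_iff (i := i) (j := j) (by simp [he, hij]), mem_bd_iff hij]
        simp [he]
  refine ⟨fun S => key S ▸ h.even S, fun Z hZ hev => ?_, fun S hS => h.conn S (key S ▸ hS)⟩
  have : s(a, b) ∉ Z := fun hZ' => by
    have := dg_of_unique (Z := Z) (v := b) (a := a) (by rwa [Sym2.eq_swap]) fun w hw => by grind
    rw [hev] at this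
    grind
  obtain ⟨S, hS⟩ := h.gen Z (fun e he => (hZ he).resolve_left (by grind)) hev
  grind

theorem IsFrame.split (h : IsFrame E d) {e₀ : Sym2 V} (he₀ : e₀ ∉ E) {f : ι}
    {A : Set (Sym2 V)} (hAE : A ⊆ E) (hA : ∀ e ∈ A, f ∈ d e) (hev : IsEven (insert e₀ A)) :
    ∃ d' : Sym2 V → Sym2 (Option ι), IsFrame (insert e₀ E) d' ∧ d' e₀ = s(some f, none) ∧
      (∀ e ∈ A, ∃ j, d e = s(f, j) ∧ d' e = s(none, some j)) ∧
      ∀ e ∉ A, e ≠ e₀ → d' e = (d e).map some := by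
  classical
  have hA' : ∀ e ∈ A, ∃ j, d e = s(f, j) := fun e he => by
    obtain ⟨j, hj⟩ := hA e he
    exact ⟨j, hj⟩
  have : Nonempty ι := ⟨f⟩
  choose! g hg using hA'
  let d' : Sym2 V → Sym2 (Option ι) := fun e =>
    if e = e₀ then s(some f, none) else if e ∈ A then s(none, some (g e)) else (d e).map some
  have heA : ∀ e ∈ A, e ≠ e₀ := fun e he => by grind
  have d0 : d' e₀ = s(some f, none) := by simp [d']
  have dA : ∀ e ∈ A, d' e = s(none, some (g e)) := fun e he => by grind
  have dn : ∀ e ∉ A, e ≠ e₀ → d' e = (d e).map some := fun e he h0 => by simp [d', he, h0]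
  refine ⟨d', ?_, d0, fun e he => ⟨g e, hg e he, dA e he⟩, dn⟩
  have key1 : ∀ S : Set (Option ι), (some f ∈ S ↔ none ∈ S) →
      bd (insert e₀ E) d' S = bd E d (some ⁻¹' S) := by
    intro S hS
    ext e
    by_cases h0 : e = e₀
    · subst h0
      rw [mem_bd_iff d0]
      refine iff_of_false (by tauto) fun h' => he₀ h'.1
    · by_cases heA : e ∈ A
      · rw [mem_bd_iff (dA e heA), mem_bd_iff (hg e heA)]
        simp [h0, hS]
      · induction hij : d e with
        | _ i j =>
          rw [mem_bd_iff (i := some i) (j := some j) (by simp [dn e heA h0, hij]),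
            mem_bd_iff hij]
          simp [h0]
  have key2 : ∀ S : Set (Option ι), ¬ (some f ∈ S ↔ none ∈ S) →
      bd (insert e₀ E) d' S = symmDiff (bd E d (some ⁻¹' S)) (insert e₀ A) := by
    intro S hS
    ext e
    rw [Set.mem_symmDiff]
    by_cases h0 : e = e₀
    · subst h0
      rw [mem_bd_iff d0]
      refine iff_of_true ⟨by simp, by tauto⟩ (Or.inr ⟨by simp, fun h' => he₀ h'.1⟩)
    · by_cases heA : e ∈ A
      · rw [mem_bd_iff (dA e heA), mem_bd_iff (hg e heA)]
        have : e ∈ E := hAE heA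
        simp only [Set.mem_insert_iff, h0, heA, this, Set.mem_preimage, true_and, or_true,
          not_true_eq_false, and_false, false_or]
        tauto
      · induction hij : d e with
        | _ i j =>
          rw [mem_bd_iff (i := some i) (j := some j) (by simp [dn e heA h0, hij]),
            mem_bd_iff hij]
          simp [h0, heA]
  refine ⟨fun S => ?_, fun Z hZ hZev => ?_, fun S hS => ?_⟩
  · by_cases hS : some f ∈ S ↔ none ∈ S
    · rw [key1 S hS]; exact h.even _
    · rw [key2 S hS]; exact (h.even _).symmDiff hev
  · by_cases h0 : e₀ ∈ Z
    · obtain ⟨S, hS⟩ := h.gen (symmDiff Z (insert e₀ A)) (fun e he => by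
        rcases Set.mem_symmDiff.1 he with ⟨h1, h2⟩ | ⟨h1, h2⟩
        · exact (hZ h1).resolve_left fun h' => h2 (by simp [h'])
        · exact hAE (h1.resolve_left fun h' => h2 (by simpa [h'] using h0))) (hZev.symmDiff hev)
      let S' : Set (Option ι) := {o | ∀ i, o = some i → i ∈ S} ∩ {o | o = none → f ∉ S}
      have hp : some ⁻¹' S' = S := by ext i; simp [S']
      have hn : none ∈ S' ↔ f ∉ S := by simp [S']
      have hf : some f ∈ S' ↔ f ∈ S := by simp [S']
      refine ⟨S', ?_⟩
      rw [key2 S' (by rw [hn, hf]; tauto), hp, ← hS, symmDiff_symmDiff_cancel_right]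
    · obtain ⟨S, hS⟩ := h.gen Z (fun e he => (hZ he).resolve_left
        (by rintro rfl; exact h0 he)) hZev
      let S' : Set (Option ι) := {o | ∀ i, o = some i → i ∈ S} ∩ {o | o = none → f ∈ S}
      have hp : some ⁻¹' S' = S := by ext i; simp [S']
      have hn : none ∈ S' ↔ f ∈ S := by simp [S']
      have hf : some f ∈ S' ↔ f ∈ S := by simp [S']
      exact ⟨S', by rw [key1 S' (by rw [hn, hf]), hp, ← hS]⟩
  · have hfn : some f ∈ S ↔ none ∈ S := by
      by_contra hcon
      have : e₀ ∈ bd (insert e₀ E) d' S := (mem_bd_iff d0).2 ⟨by simp, by tauto⟩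
      rw [hS] at this
      exact this
    rw [key1 S hfn] at hS
    rcases h.conn _ hS with h' | h'
    · left
      have : ∀ i, some i ∉ S := fun i hi => (h' ▸ hi : i ∈ (∅ : Set ι))
      ext o
      cases o with
      | none => simpa [← hfn] using this f
      | some i => simpa using this i
    · right
      have : ∀ i, some i ∈ S := fun i => (h' ▸ Set.mem_univ i : i ∈ some ⁻¹' S)
      ext o
      cases o with
      | none => simpa [← hfn] using this f
      | some i => simpa using this i

end Operations

theorem isFrame_empty : IsFrame (∅ : Set (Sym2 V)) (fun _ => s((), ())) := by
  have key : ∀ S, bd (∅ : Set (Sym2 V)) (fun _ => s((), ())) S = ∅ := fun S => by simp [bd]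
  refine ⟨fun S => by rw [key]; exact isEven_empty,
    fun Z hZ _ => ⟨∅, by grind⟩,
    fun S _ => ?_⟩
  grind

/-- Adding a vertex inside a face, joined to vertices along a path on the boundary. -/
theorem IsFrame.fan_aux (y a : V) (N : Set V) (l : List V) :
    ∀ (c : V) (ι : Type) (E : Set (Sym2 V)) (d : Sym2 V → Sym2 ι) (f : ι) (A : Set (Sym2 V)),
    IsFrame E d → (c :: l).Nodup → y ∉ c :: l → a ∉ l → pe (c :: l) ⊆ E →
    (∀ e ∈ pe (c :: l), f ∈ d e) → (∀ w ∈ l, s(y, w) ∉ E) → A ⊆ E → (∀ e ∈ A, f ∈ d e) →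
    (∀ e ∈ A, e ∉ pe (c :: l)) →
    (∀ v, dg A v = dg {s(y, c)} v) → s(y, a) ∈ E → (s(y, a) ∈ A ∧ d s(y, a) = s(f, f) ∨
      s(y, a) ∉ A ∧ f ∈ d s(y, a)) → (c ∈ N → f ∈ d s(y, c)) →
    ∃ (ι' : Type) (d' : Sym2 V → Sym2 ι') (f' : ι'), IsFrame (E ∪ {e | ∃ n ∈ N, n ∈ l ∧ e = s(y, n)}) d' ∧
      f' ∈ d' s(y, a) ∧ (∀ z, (c :: l).getLast? = some z → z ∈ N → f' ∈ d' s(y, z)) ∧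
      ∀ e ∈ E, e ∉ A → e ∉ pe (c :: l) → f ∈ d e → f' ∈ d' e := by
  induction l with
  | nil =>
    intro c ι E d f A hF _ _ _ _ _ _ _ _ _ _ _ ha hc
    refine ⟨ι, d, f, by simpa using hF, ?_, ?_, fun e _ _ _ h => h⟩
    · grind
    grind
  | cons b l ih =>
    intro c ι E d f A hF hnd hy hal hE hf hyE hAE hAf hAp hdg hyaE ha hc
    classical
    have hcb : c ≠ b := by rintro rfl; simp at hnd
    have hyc : y ≠ c := by rintro rfl; simp at hy
    have hyb : y ≠ b := by rintro rfl; simp at hy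
    have hcbE : s(c, b) ∈ E := hE (by simp)
    have hcbA : s(c, b) ∉ A := fun h => hAp _ h (by simp)
    have hcbp : s(c, b) ∉ pe (b :: l) := fun h =>
      (List.nodup_cons.1 hnd).1 (mem_of_mem_pe h (by simp))
    have hdg' : ∀ v, dg (insert s(c, b) A) v = dg {s(y, b)} v := fun v => by
      rw [dg_insert hcb hcbA, hdg, dg_singleton hyc, dg_singleton hyb]
      have h2 : (2 : ZMod 2) = 0 := rfl
      linear_combination (if v = c then (1 : ZMod 2) else 0) * h2
    have hsub : pe (b :: l) ⊆ E := (Set.subset_insert _ _).trans hE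
    have hyacb : s(y, a) ≠ s(c, b) := by
      intro h
      have : y ∈ s(c, b) := h ▸ Sym2.mem_mk_left y a
      rw [Sym2.mem_iff] at this
      exact this.elim hyc hyb
    have hAE' : insert s(c, b) A ⊆ E := Set.insert_subset hcbE hAE
    have hAf' : ∀ e ∈ insert s(c, b) A, f ∈ d e := by
      rintro e (rfl | he)
      · exact hf _ (by simp)
      · exact hAf e he
    by_cases hbN : b ∈ N
    · have he₀ : s(y, b) ∉ E := hyE b (by simp)
      obtain ⟨d', hF', hd0, hdA, hdn⟩ := hF.split he₀ hAE' hAf'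
        (fun v => by
          rw [dg_insert hyb (fun h => he₀ (hAE' h)), hdg', dg_singleton hyb]
          exact CharTwo.add_self_eq_zero _)
      have hpA : ∀ e ∈ pe (b :: l), e ∉ insert s(c, b) A ∧ e ≠ s(y, b) := fun e he =>
        ⟨by
          rintro (rfl | h)
          · exact hcbp he
          · exact hAp e h (Set.mem_insert_of_mem _ he),
         by rintro rfl; exact he₀ (hsub he)⟩
      have hmap : ∀ e ∉ insert s(c, b) A, e ≠ s(y, b) → f ∈ d e → some f ∈ d' e :=
        fun e h1 h2 h3 => by
          rw [hdn e h1 h2, Sym2.mem_map]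
          exact ⟨f, h3, rfl⟩
      have hab : a ≠ b := by rintro rfl; simp at hal
      have hyab : s(y, a) ≠ s(y, b) := by
        rw [Ne, Sym2.congr_right]; exact hab
      obtain ⟨ι', d'', f', h1, h2, h3, h4⟩ := ih b (Option ι) (insert s(y, b) E) d' (some f)
        {s(y, b)} hF' hnd.of_cons (fun h => hy (List.mem_cons_of_mem _ h))
        (fun h => hal (List.mem_cons_of_mem _ h)) (hsub.trans (Set.subset_insert _ _))
        (fun e he => hmap e (hpA e he).1 (hpA e he).2 (hf e (Set.mem_insert_of_mem _ he)))
        (fun w hw => by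
          rintro (h | h)
          · rw [Sym2.congr_right] at h
            subst h
            exact (List.nodup_cons.1 hnd.of_cons).1 hw
          · exact hyE w (List.mem_cons_of_mem _ hw) h)
        (by simp) (by rintro e rfl; simp [hd0])
        (by rintro e rfl h; exact (hpA _ h).2 rfl) (fun _ => rfl) (Set.mem_insert_of_mem _ hyaE)
        (Or.inr ⟨hyab, by
          rcases ha with ⟨haA, had⟩ | ⟨haA, had⟩
          · obtain ⟨j, hj, hj'⟩ := hdA _ (Set.mem_insert_of_mem _ haA)
            rw [had, Sym2.congr_right] at hj
            rw [hj', ← hj]; simp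
          · exact hmap _ (by simp [haA, hyacb]) hyab had⟩)
        (fun _ => by simp [hd0])
      refine ⟨ι', d'', f', ?_, h2, ?_, ?_⟩
      · refine (congrArg (fun E => IsFrame E d'') ?_).mp h1
        ext e
        simp only [Set.mem_union, Set.mem_insert_iff, Set.mem_ofPred_eq, List.mem_cons]
        constructor
        · rintro ((rfl | h) | ⟨n, hn, hnl, rfl⟩)
          · exact Or.inr ⟨b, hbN, Or.inl rfl, rfl⟩
          · exact Or.inl h
          · exact Or.inr ⟨n, hn, Or.inr hnl, rfl⟩
        · rintro (h | ⟨n, hn, rfl | hnl, rfl⟩)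
          · exact Or.inl (Or.inr h)
          · exact Or.inl (Or.inl rfl)
          · exact Or.inr ⟨n, hn, hnl, rfl⟩
      · intro z hz
        exact h3 z (by simpa using hz)
      · intro e he heA hep hfe
        have hne : e ≠ s(y, b) := by rintro rfl; exact he₀ he
        have hecb : e ≠ s(c, b) := by rintro rfl; simp at hep
        exact h4 e (Set.mem_insert_of_mem _ he) hne (fun h => hep (Set.mem_insert_of_mem _ h))
          (hmap e (by simp [heA, hecb]) hne hfe)
    · obtain ⟨ι', d', f', h1, h2, h3, h4⟩ := ih b ι E d f (insert s(c, b) A) hF hnd.of_cons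
        (fun h => hy (List.mem_cons_of_mem _ h)) (fun h => hal (List.mem_cons_of_mem _ h)) hsub
        (fun e he => hf e (Set.mem_insert_of_mem _ he))
        (fun w hw => hyE w (List.mem_cons_of_mem _ hw)) hAE' hAf'
        (by
          rintro e (rfl | he) h
          · exact hcbp h
          · exact hAp e he (Set.mem_insert_of_mem _ h))
        hdg' hyaE (by simpa [hyacb] using ha) (fun h => absurd h hbN)
      refine ⟨ι', d', f', ?_, h2, ?_, ?_⟩
      · refine (congrArg (fun E => IsFrame E d') ?_).mp h1
        ext e
        simp only [Set.mem_union, Set.mem_ofPred_eq, List.mem_cons]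
        refine or_congr_right ⟨?_, ?_⟩
        · rintro ⟨n, hn, hnl, rfl⟩
          exact ⟨n, hn, Or.inr hnl, rfl⟩
        · rintro ⟨n, hn, rfl | hnl, rfl⟩
          · exact absurd hn hbN
          · exact ⟨n, hn, hnl, rfl⟩
      · intro z hz
        exact h3 z (by simpa using hz)
      · intro e he heA hep hfe
        have hecb : e ≠ s(c, b) := by rintro rfl; simp at hep
        exact h4 e he (by simp [heA, hecb]) (fun h => hep (Set.mem_insert_of_mem _ h)) hfe

theorem IsFrame.fan {ι : Type} {E : Set (Sym2 V)} {d : Sym2 V → Sym2 ι} (hF : IsFrame E d)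
    {f : ι} {y a : V} {l : List V} {N : Set V} (hnd : (a :: l).Nodup) (hy : y ∉ a :: l)
    (hE : pe (a :: l) ⊆ E) (hf : ∀ e ∈ pe (a :: l), f ∈ d e) (hyE : ∀ w, s(y, w) ∉ E)
    (ha : a ∈ N) (hN : ∀ n ∈ N, n ∈ a :: l) :
    ∃ (ι' : Type) (d' : Sym2 V → Sym2 ι') (f' : ι'),
      IsFrame (E ∪ {e | ∃ n ∈ N, e = s(y, n)}) d' ∧ f' ∈ d' s(y, a) ∧
      (∀ z, (a :: l).getLast? = some z → z ∈ N → f' ∈ d' s(y, z)) ∧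
      ∀ e ∈ E, e ∉ pe (a :: l) → f ∈ d e → f' ∈ d' e := by
  obtain ⟨d₁, hF₁, hd₁, hn₁⟩ := hF.pendant hyE f
  rw [Sym2.eq_swap] at hF₁ hd₁ hn₁
  have hne : ∀ e ∈ E, e ≠ s(y, a) := by grind
  obtain ⟨ι', d', f', h1, h2, h3, h4⟩ := IsFrame.fan_aux y a N l a ι (insert s(y, a) E) d₁ f
    {s(y, a)} hF₁ hnd hy (List.nodup_cons.1 hnd).1 (hE.trans (Set.subset_insert _ _))
    (fun e he => by grind)
    (fun w hw => by grind)
    (by simp) (by grind)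
    (by grind) (fun _ => rfl) (by simp) (Or.inl ⟨rfl, hd₁⟩)
    (fun _ => by simp [hd₁])
  refine ⟨ι', d', f', ?_, h2, h3, fun e he hep hfe =>
    h4 e (Set.mem_insert_of_mem _ he) (hne e he) hep (by grind)⟩
  refine (congrArg (fun E => IsFrame E d') ?_).mp h1
  ext e
  grind

/-- The edge set admits an algebraic planar drawing. -/
def HasFrame (E : Set (Sym2 V)) : Prop := ∃ (ι : Type) (d : Sym2 V → Sym2 ι), IsFrame E d

theorem HasFrame.mono {E E' : Set (Sym2 V)} (h : HasFrame E) (hE : E' ⊆ E) : HasFrame E' := by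
  obtain ⟨ι, d, hF⟩ := h
  exact ⟨_, _, hF.restrict hE⟩

end

section

variable {V : Type*}

/-- The edge set `E` has `H` as a minor with branch sets inside `W`. -/
def HasMinor {T : Type*} (H : SimpleGraph T) (E : Set (Sym2 V)) (W : Set V) : Prop :=
  ∃ f : T → Set V, (∀ t, (f t).Nonempty ∧ f t ⊆ W ∧ CutConn E (f t)) ∧
    (∀ s t, s ≠ t → Disjoint (f s) (f t)) ∧
    ∀ s t, H.Adj s t → ∃ a ∈ f s, ∃ b ∈ f t, s(a, b) ∈ E

/-- Being free of both Kuratowski minors. -/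
def NoMinors (E : Set (Sym2 V)) (W : Set V) : Prop :=
  ¬ HasMinor (SimpleGraph.completeGraph (Fin 5)) E W ∧
  ¬ HasMinor (completeBipartiteGraph (Fin 3) (Fin 3)) E W

theorem CutConn.biUnion {E E' : Set (Sym2 V)} {A : Set V} {g : V → Set V} (hA : CutConn E' A)
    (hg : ∀ v ∈ A, (g v).Nonempty ∧ CutConn E (g v))
    (hE : ∀ u ∈ A, ∀ v ∈ A, s(u, v) ∈ E' → ∃ a ∈ g u, ∃ b ∈ g v, s(a, b) ∈ E) :
    CutConn E (⋃ v ∈ A, g v) := by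
  rcases A.eq_empty_or_nonempty with rfl | ⟨a₀, ha₀⟩
  · intro B hB hn
    simp_all
  obtain ⟨x₀, hx₀⟩ := (hg a₀ ha₀).1
  refine CutConn.of_closed (a := x₀) (Set.mem_biUnion ha₀ hx₀) fun B hB hx hcl => ?_
  have step : ∀ a ∈ A, ∀ x ∈ g a, x ∈ B → g a ⊆ B := by
    intro a ha x hx hxB
    have : B ∩ g a = g a := (hg a ha).2.eq_of_closed Set.inter_subset_right ⟨hxB, hx⟩
      fun u hu w hw he => ⟨hcl u hu.1 w (Set.mem_biUnion ha hw) he, hw⟩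
    grind
  have hC : {a ∈ A | g a ⊆ B} = A := hA.eq_of_closed (Set.sep_subset _ _)
    ⟨ha₀, step a₀ ha₀ x₀ hx₀ hx⟩ fun u hu w hw he => by
      obtain ⟨a, ha, b, hb, hab⟩ := hE u hu.1 w hw he
      exact ⟨hw, step w hw b hb (hcl a (hu.2 ha) b (Set.mem_biUnion hw hb) hab)⟩
  refine hB.antisymm fun x hx => ?_
  obtain ⟨a, ha, hxa⟩ := Set.mem_iUnion₂.1 hx
  rw [← hC] at ha
  exact ha.2 hxa

theorem HasMinor.transfer {T : Type*} {H : SimpleGraph T} {E E' : Set (Sym2 V)} {W W' : Set V}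
    (h : HasMinor H E' W') (g : V → Set V)
    (hg : ∀ v ∈ W', (g v).Nonempty ∧ g v ⊆ W ∧ CutConn E (g v))
    (hd : ∀ u ∈ W', ∀ v ∈ W', u ≠ v → Disjoint (g u) (g v))
    (hE : ∀ u ∈ W', ∀ v ∈ W', u ≠ v → s(u, v) ∈ E' → ∃ a ∈ g u, ∃ b ∈ g v, s(a, b) ∈ E) :
    HasMinor H E W := by
  obtain ⟨f, hf, hfd, hfe⟩ := h
  refine ⟨fun t => ⋃ v ∈ f t, g v, fun t => ⟨?_, ?_, ?_⟩, fun s t hst => ?_, fun s t hst => ?_⟩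
  · obtain ⟨a, ha⟩ := (hf t).1
    obtain ⟨x, hx⟩ := (hg a ((hf t).2.1 ha)).1
    exact ⟨x, Set.mem_biUnion ha hx⟩
  · exact Set.iUnion₂_subset fun v hv => (hg v ((hf t).2.1 hv)).2.1
  · refine CutConn.biUnion (E' := E' \ {e | e.IsDiag}) ?_
      (fun v hv => have := hg v ((hf t).2.1 hv); ⟨this.1, this.2.2⟩)
      fun u hu v hv he => hE u ((hf t).2.1 hu) v ((hf t).2.1 hv) ?_ he.1
    · intro B hB hn hne
      obtain ⟨u, hu, w, hw, he⟩ := (hf t).2.2 B hB hn hne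
      refine ⟨u, hu, w, hw, he, ?_⟩
      rintro (rfl : u = w)
      exact hw.2 hu
    · exact he.2
  · rw [Set.disjoint_left]
    intro x hx hx'
    obtain ⟨a, ha, hxa⟩ := Set.mem_iUnion₂.1 hx
    obtain ⟨b, hb, hxb⟩ := Set.mem_iUnion₂.1 hx'
    have hab : a ≠ b := by
      rintro rfl
      exact Set.disjoint_left.1 (hfd s t hst) ha hb
    grind
  · obtain ⟨a, ha, b, hb, hab⟩ := hfe s t hst
    have hne : a ≠ b := by
      rintro rfl
      exact Set.disjoint_left.1 (hfd s t hst.ne) ha hb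
    obtain ⟨x, hx, y, hy, hxy⟩ := hE a ((hf s).2.1 ha) b ((hf t).2.1 hb) hne hab
    exact ⟨x, Set.mem_biUnion ha hx, y, Set.mem_biUnion hb hy, hxy⟩

theorem NoMinors.transfer {E E' : Set (Sym2 V)} {W W' : Set V}
    (h : NoMinors E W) (g : V → Set V)
    (hg : ∀ v ∈ W', (g v).Nonempty ∧ g v ⊆ W ∧ CutConn E (g v))
    (hd : ∀ u ∈ W', ∀ v ∈ W', u ≠ v → Disjoint (g u) (g v))
    (hE : ∀ u ∈ W', ∀ v ∈ W', u ≠ v → s(u, v) ∈ E' → ∃ a ∈ g u, ∃ b ∈ g v, s(a, b) ∈ E) :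
    NoMinors E' W' :=
  ⟨fun h' => h.1 (h'.transfer g hg hd hE), fun h' => h.2 (h'.transfer g hg hd hE)⟩

theorem NoMinors.mono {E E' : Set (Sym2 V)} {W W' : Set V} (h : NoMinors E W) (hE : E' ⊆ E)
    (hW : W' ⊆ W) : NoMinors E' W' :=
  h.transfer (fun v => {v}) (fun v hv => ⟨by simp, by simpa using hW hv, cutConn_singleton _ _⟩)
    (fun u _ v _ huv => by simpa using huv)
    fun u _ v _ _ he => ⟨u, rfl, v, rfl, hE he⟩

section Glue
variable [Fintype V]

theorem sum_dg {Z : Set (Sym2 V)} (h : ∀ v, s(v, v) ∉ Z) : ∑ v, dg Z v = 0 := by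
  classical
  simp only [dg_def]
  rw [← Finset.sum_product']
  refine Finset.sum_involution (fun p _ => p.swap) ?_ ?_ (by simp) (by simp)
  · grind
  grind

theorem IsFrame.glue {ι₁ ι₂ : Type} {E₁ E₂ : Set (Sym2 V)} {d₁ : Sym2 V → Sym2 ι₁}
    {d₂ : Sym2 V → Sym2 ι₂} (h₁ : IsFrame E₁ d₁) (h₂ : IsFrame E₂ d₂) {u v : V} (huv : u ≠ v)
    (hu₁ : s(u, v) ∈ E₁) (hu₂ : s(u, v) ∈ E₂) (hE : ∀ e ∈ E₁, e ∈ E₂ → e = s(u, v))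
    (hloop : ∀ v, s(v, v) ∉ E₁)
    (hx : ∀ x, x ≠ u → x ≠ v → (∀ w, s(x, w) ∉ E₁) ∨ (∀ w, s(x, w) ∉ E₂)) :
    HasFrame (E₁ ∪ E₂) := by
  classical
  obtain ⟨i₁, j₁, hd₁⟩ : ∃ i j, d₁ s(u, v) = s(i, j) := by
    induction h : d₁ s(u, v) with
    | _ i j => exact ⟨i, j, rfl⟩
  obtain ⟨i₂, j₂, hd₂⟩ : ∃ i j, d₂ s(u, v) = s(i, j) := by
    induction h : d₂ s(u, v) with
    | _ i j => exact ⟨i, j, rfl⟩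
  let r : ι₁ ⊕ ι₂ → ι₁ ⊕ ι₂ → Prop := fun a b => a = .inl j₁ ∧ b = .inr j₂
  let π₁ : ι₁ → Quot r := fun i => Quot.mk r (.inl i)
  let π₂ : ι₂ → Quot r := fun i => Quot.mk r (.inr i)
  have hπ : π₁ j₁ = π₂ j₂ := Quot.sound ⟨rfl, rfl⟩
  let d : Sym2 V → Sym2 (Quot r) := fun e =>
    if e = s(u, v) then s(π₁ i₁, π₂ i₂) else if e ∈ E₁ then (d₁ e).map π₁ else (d₂ e).map π₂
  have key : ∀ S, bd (E₁ ∪ E₂) d S = symmDiff (bd E₁ d₁ (π₁ ⁻¹' S)) (bd E₂ d₂ (π₂ ⁻¹' S)) := by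
    intro S
    ext e
    rw [Set.mem_symmDiff]
    by_cases he : e = s(u, v)
    · subst he
      rw [mem_bd_iff (i := π₁ i₁) (j := π₂ i₂) (by simp [d]), mem_bd_iff hd₁, mem_bd_iff hd₂]
      have : π₁ j₁ ∈ S ↔ π₂ j₂ ∈ S := by rw [hπ]
      simp only [Set.mem_union, hu₁, hu₂, true_and, Set.mem_preimage, or_true]
      tauto
    · by_cases he₁ : e ∈ E₁
      · have he₂ : e ∉ E₂ := fun h => he (hE e he₁ h)
        induction hij : d₁ e with
        | _ i j =>
          rw [mem_bd_iff (i := π₁ i) (j := π₁ j) (by simp [d, he, he₁, hij]), mem_bd_iff hij]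
          have : e ∉ bd E₂ d₂ (π₂ ⁻¹' S) := fun h => he₂ (bd_subset _ _ _ h)
          simp [he₁, this]
      · have : e ∉ bd E₁ d₁ (π₁ ⁻¹' S) := fun h => he₁ (bd_subset _ _ _ h)
        induction hij : d₂ e with
        | _ i j =>
          rw [mem_bd_iff (i := π₂ i) (j := π₂ j) (by simp [d, he, he₁, hij]), mem_bd_iff hij]
          simp [he₁, this]
  refine ⟨Quot r, d, fun S => ?_, fun Z hZ hev => ?_, fun S hS => ?_⟩
  · rw [key]; exact (h₁.even _).symmDiff (h₂.even _)
  · obtain ⟨A, hA₁, hAev, hA₂⟩ : ∃ A ⊆ E₁, IsEven A ∧ symmDiff Z A ⊆ E₂ := by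
      let Z₁ := (Z ∩ E₁) \ {s(u, v)}
      have hout : ∀ x, x ≠ u → x ≠ v → dg Z₁ x = 0 := by
        intro x hxu hxv
        rcases hx x hxu hxv with h | h
        · exact dg_of_notMem fun w hw => h w hw.1.2
        · rw [← hev x]
          refine dg_congr fun w => ⟨fun h => h.1.1, fun hw => ⟨⟨hw, (hZ hw).resolve_right (h w)⟩, ?_⟩⟩
          intro h'
          have : x ∈ s(u, v) := by
            rw [← Set.mem_singleton_iff.1 h']; simp
          rw [Sym2.mem_iff] at this
          tauto
      have hsum : dg Z₁ u + dg Z₁ v = 0 := by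
        rw [← sum_dg (Z := Z₁) fun v hv => hloop v hv.1.2, ← Finset.sum_pair huv]
        refine (Finset.sum_subset (Finset.subset_univ _) fun x _ hx => ?_)
        simp only [Finset.mem_insert, Finset.mem_singleton, not_or] at hx
        exact hout x hx.1 hx.2
      have hsub : Z₁ ⊆ E₁ := fun e he => he.1.2
      have huvZ : s(u, v) ∉ Z₁ := fun h => h.2 rfl
      have hrest : ∀ e ≠ s(u, v), e ∈ Z → e ∉ Z₁ → e ∈ E₂ := fun e h1 h2 h3 =>
        (hZ h2).resolve_left fun h => h3 ⟨⟨h2, h⟩, h1⟩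
      rcases (by decide : ∀ z : ZMod 2, z = 0 ∨ z = 1) (dg Z₁ u) with h0 | h0
      · refine ⟨Z₁, hsub, fun x => ?_, fun e he => ?_⟩
        · by_cases hxu : x = u
          · rw [hxu, h0]
          by_cases hxv : x = v
          · rw [h0, zero_add] at hsum; rw [hxv, hsum]
          exact hout x hxu hxv
        · by_cases heq : e = s(u, v)
          · rwa [heq]
          rcases Set.mem_symmDiff.1 he with h | h
          · exact hrest e heq h.1 h.2
          · exact absurd h.1.1.1 h.2
      · refine ⟨insert s(u, v) Z₁, Set.insert_subset hu₁ hsub, fun x => ?_, fun e he => ?_⟩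
        · rw [dg_insert huv huvZ]
          by_cases hxu : x = u
          · subst hxu
            simp only [h0, if_true, if_neg huv]; decide
          by_cases hxv : x = v
          · subst hxv
            rw [h0] at hsum
            simp only [if_neg hxu, if_true, zero_add]; exact hsum
          simp [hxu, hxv, hout x hxu hxv]
        · by_cases heq : e = s(u, v)
          · rwa [heq]
          rcases Set.mem_symmDiff.1 he with h | h
          · exact hrest e heq h.1 fun h' => h.2 (Or.inr h')
          · exact absurd (h.1.resolve_left heq).1.1 h.2
    obtain ⟨S₁, hS₁⟩ := h₁.gen A hA₁ hAev
    obtain ⟨S₂, hS₂, hc⟩ : ∃ S₂, symmDiff Z A = bd E₂ d₂ S₂ ∧ (j₁ ∈ S₁ ↔ j₂ ∈ S₂) := by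
      obtain ⟨S₂, hS₂⟩ := h₂.gen _ hA₂ (hev.symmDiff hAev)
      by_cases hc : j₁ ∈ S₁ ↔ j₂ ∈ S₂
      · exact ⟨S₂, hS₂, hc⟩
      · exact ⟨S₂ᶜ, by rw [bd_compl, hS₂], by rw [Set.mem_compl_iff]; tauto⟩
    let S : Set (Quot r) := {q | Quot.lift (Sum.elim (· ∈ S₁) (· ∈ S₂)) (by
      rintro _ _ ⟨rfl, rfl⟩; simpa using hc) q}
    refine ⟨S, ?_⟩
    have e1 : π₁ ⁻¹' S = S₁ := rfl
    have e2 : π₂ ⁻¹' S = S₂ := rfl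
    rw [key, e1, e2, ← hS₁, ← hS₂, symmDiff_comm Z, symmDiff_symmDiff_cancel_left]
  · rw [key] at hS
    have heq : bd E₁ d₁ (π₁ ⁻¹' S) = bd E₂ d₂ (π₂ ⁻¹' S) := symmDiff_eq_bot.1 hS
    have hemp : bd E₁ d₁ (π₁ ⁻¹' S) = ∅ :=
      (h₁.even _).eq_empty_of_subset_pe (l := [u, v]) (by simpa using huv) fun e he => by
        have : e = s(u, v) := hE e (bd_subset _ _ _ he) (by rw [heq] at he; exact bd_subset _ _ _ he)
        simp [this]
    have hj : j₁ ∈ π₁ ⁻¹' S ↔ j₂ ∈ π₂ ⁻¹' S := by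
      rw [Set.mem_preimage, Set.mem_preimage, hπ]
    rcases h₁.conn _ hemp with a | a <;> rcases h₂.conn _ (heq ▸ hemp) with b | b
    · left
      ext q
      induction q using Quot.ind with
      | _ q =>
        cases q with
        | inl i => exact iff_of_false (fun h => (a ▸ h : i ∈ (∅ : Set ι₁))) id
        | inr i => exact iff_of_false (fun h => (b ▸ h : i ∈ (∅ : Set ι₂))) id
    · rw [a, b] at hj; simp at hj
    · rw [a, b] at hj; simp at hj
    · right
      ext q
      induction q using Quot.ind with
      | _ q =>
        cases q with
        | inl i => exact iff_of_true (show i ∈ π₁ ⁻¹' S from a ▸ trivial) trivial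
        | inr i => exact iff_of_true (show i ∈ π₂ ⁻¹' S from b ▸ trivial) trivial

end Glue

end

section

variable {V : Type*}

section Base
variable [Fintype V]

theorem hasFrame_triangle {a b c : V} (hab : a ≠ b) (hac : a ≠ c) (hbc : b ≠ c) :
    ∃ (ι : Type) (d : Sym2 V → Sym2 ι) (f : ι), IsFrame {s(a, b), s(c, a), s(c, b)} d ∧
      f ∈ d s(c, a) ∧ f ∈ d s(c, b) := by
  obtain ⟨d₁, h₁, h₁', -⟩ := (isFrame_empty (V := V)).pendant (a := a) (b := b) (by simp) ()
  obtain ⟨ι, d, f, h₂, h₃, h₄, -⟩ := h₁.fan (f := ()) (y := c) (a := a) (l := [b]) (N := {a, b})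
    (by simpa using hab) (by grind) (by simp)
    (by simp_all)
    (by
      grind)
    (by simp) (by simp)
  refine ⟨ι, d, f, (congrArg (fun E => IsFrame E d) ?_).mp h₂, h₃, h₄ b (by simp) (by simp)⟩
  ext e
  simp

theorem hasFrame_of_ncard_le {E : Set (Sym2 V)} {W : Set V} (hW : TwoConn E W)
    (hs : ∀ a b, s(a, b) ∈ E → a ∈ W ∧ b ∈ W ∧ a ≠ b) (h4 : W.ncard ≤ 4) : HasFrame E := by
  obtain ⟨a, ha, b, hb, c, hc, hab, hac, hbc⟩ := hW.three
  obtain ⟨ι, d, f, h₁, h₂, h₃⟩ := hasFrame_triangle hab hac hbc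
  by_cases hw : ∃ w ∈ W, w ≠ a ∧ w ≠ b ∧ w ≠ c
  · obtain ⟨w, hw, hwa, hwb, hwc⟩ := hw
    have hWeq : ∀ x ∈ W, x = a ∨ x = b ∨ x = c ∨ x = w := by
      have hsub : ({a, b, c, w} : Set V) ⊆ W := by grind
      have hcard : ({a, b, c, w} : Set V).ncard = 4 := by
        rw [Set.ncard_insert_of_notMem, Set.ncard_insert_of_notMem, Set.ncard_pair] <;>
          grind
      have := Set.eq_of_subset_of_ncard_le hsub (by omega) (Set.toFinite _)
      grind
    obtain ⟨ι', d', f', h', -⟩ := h₁.fan (f := f) (y := w) (a := a) (l := [c, b]) (N := {a, b, c})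
      (by grind) (by simp [hwa, hwb, hwc])
      (by
        simp only [pe_cons_cons, pe_single]
        grind)
      (by
        simp only [pe_cons_cons, pe_single]
        grind)
      (by simp [hwa, hwb, hwc]) (by simp)
      (by simp)
    refine HasFrame.mono ⟨_, _, h'⟩ fun e he => ?_
    induction e with
    | _ p q =>
      obtain ⟨hp, hq, hpq⟩ := hs p q he
      rcases hWeq p hp with rfl | rfl | rfl | rfl <;> rcases hWeq q hq with rfl | rfl | rfl | rfl <;>
        simp_all
  · push Not at hw
    refine HasFrame.mono ⟨_, _, h₁⟩ fun e he => ?_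
    have hWeq : ∀ x ∈ W, x = a ∨ x = b ∨ x = c := fun x hx => by
      have := hw x hx
      tauto
    induction e with
    | _ p q =>
      obtain ⟨hp, hq, hpq⟩ := hs p q he
      rcases hWeq p hp with rfl | rfl | rfl <;> rcases hWeq q hq with rfl | rfl | rfl <;> simp_all

end Base

section TwoSeparation
variable {E : Set (Sym2 V)} {W B : Set V} {u v : V}

/-- One side of a 2-separation, with the virtual edge added. -/
def piece (E : Set (Sym2 V)) (B : Set V) (u v : V) : Set (Sym2 V) :=
  insert s(u, v) {e ∈ E | ∀ x ∈ e, x ∈ insert u (insert v B)}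

theorem cutConn_piece (hB : B ⊆ W \ {u, v})
    (hc : ∀ x ∈ B, ∀ y ∈ W, s(x, y) ∈ E → y ∈ B ∨ y = u ∨ y = v) {W' : Set V} (hW' : W' ⊆ W)
    (h : CutConn E W') : CutConn (piece E B u v) (insert u (insert v B) ∩ W') := by
  intro C hC hn hne
  have hW1 : ∀ x ∈ insert u (insert v B), x ≠ u → x ≠ v → x ∈ B := by grind
  have hin : ∀ x ∈ B, ∀ y ∈ W', s(x, y) ∈ E →
      y ∈ insert u (insert v B) ∧ s(x, y) ∈ piece E B u v := by
    intro x hx y hy he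
    have hy' : y ∈ insert u (insert v B) := by grind
    refine ⟨hy', Or.inr ⟨he, fun z hz => ?_⟩⟩
    grind
  by_cases h1 : u ∈ C ∧ v ∈ W' ∧ v ∉ C
  · exact ⟨u, h1.1, v, ⟨⟨by simp, h1.2.1⟩, h1.2.2⟩, Or.inl rfl⟩
  by_cases h2 : v ∈ C ∧ u ∈ W' ∧ u ∉ C
  · exact ⟨v, h2.1, u, ⟨⟨by simp, h2.2.1⟩, h2.2.2⟩, Or.inl Sym2.eq_swap⟩
  by_cases h3 : u ∈ C ∨ v ∈ C
  · let R := (insert u (insert v B) ∩ W') \ C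
    have hRB : R ⊆ B := fun x hx => hW1 x hx.1.1
      (by grind)
      (by grind)
    have hRn : R.Nonempty := by
      by_contra hemp
      refine hne (hC.antisymm fun x hx => ?_)
      by_contra hx'
      exact hemp ⟨x, hx, hx'⟩
    obtain ⟨x, hx, y, hy, he⟩ := h R (fun x hx => hx.1.2) hRn (by
      intro hR
      obtain ⟨t, ht⟩ := hn
      have : t ∈ R := hR ▸ (hC ht).2
      exact this.2 ht)
    obtain ⟨hy', he'⟩ := hin x (hRB hx) y hy.1 he
    refine ⟨y, ?_, x, hx, by rwa [Sym2.eq_swap]⟩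
    by_contra hyC
    exact hy.2 ⟨⟨hy', hy.1⟩, hyC⟩
  · push Not at h3
    have hCB : C ⊆ B := fun x hx => hW1 x (hC hx).1 (by rintro rfl; exact h3.1 hx)
      (by rintro rfl; exact h3.2 hx)
    obtain ⟨x, hx, y, hy, he⟩ := h C (fun x hx => (hC hx).2) hn (by
      rintro rfl
      exact hne (hC.antisymm fun x hx => hx.2))
    obtain ⟨hy', he'⟩ := hin x (hCB hx) y hy.1 he
    exact ⟨x, hx, y, ⟨⟨hy', hy.1⟩, hy.2⟩, he'⟩

theorem TwoConn.piece (h : TwoConn E W) (hu : u ∈ W) (hv : v ∈ W) (huv : u ≠ v)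
    (hB : B ⊆ W \ {u, v}) (hn : B.Nonempty)
    (hc : ∀ x ∈ B, ∀ y ∈ W, s(x, y) ∈ E → y ∈ B ∨ y = u ∨ y = v) :
    TwoConn (piece E B u v) (insert u (insert v B)) := by
  have hsub : insert u (insert v B) ⊆ W :=
    Set.insert_subset hu (Set.insert_subset hv (hB.trans Set.sdiff_subset))
  refine ⟨?_, ?_, fun w hw => ?_⟩
  · obtain ⟨b, hb⟩ := hn
    grind
  · have := cutConn_piece hB hc subset_rfl h.conn
    rwa [Set.inter_eq_left.2 hsub] at this
  · have := cutConn_piece hB hc Set.sdiff_subset (h.del w (hsub hw))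
    rwa [show insert u (insert v B) ∩ (W \ {w}) = insert u (insert v B) \ {w} by grind] at this

theorem NoMinors.piece (h : TwoConn E W) (hm : NoMinors E W) (hu : u ∈ W) (hv : v ∈ W)
    (huv : u ≠ v) {B' : Set V}
    (hB : B ⊆ W \ {u, v}) (hB' : B' ⊆ W \ {u, v}) (hn' : B'.Nonempty) (hBB : Disjoint B B')
    (hc' : ∀ x ∈ B', ∀ y ∈ W, s(x, y) ∈ E → y ∈ B' ∨ y = u ∨ y = v) :
    NoMinors (GirthFive.piece E B u v) (insert u (insert v B)) := by
  classical
  have hu' : u ∉ B' := fun h => (hB' h).2 (by simp)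
  have hv' : v ∉ B' := fun h => (hB' h).2 (by simp)
  have hsub : insert u (insert v B) ⊆ W :=
    Set.insert_subset hu (Set.insert_subset hv (hB.trans Set.sdiff_subset))
  have hdis : ∀ x ∈ insert u (insert v B), x ∉ B' := by grind
  refine hm.transfer (fun x => if x = u then insert u B' else {x}) (fun x hx => ?_)
    (fun x hx y hy hxy => ?_) (fun x hx y hy hxy he => ?_)
  · by_cases hxu : x = u
    · subst hxu
      simp only [if_true]
      refine ⟨⟨x, by simp⟩, Set.insert_subset hu (hB'.trans Set.sdiff_subset), ?_⟩
      have := cutConn_piece hB' hc' (Set.sdiff_subset (t := {v})) (h.del v hv)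
      have heq : insert x (insert v B') ∩ (W \ {v}) = insert x B' := by grind
      rw [heq] at this
      refine this.congr fun a ha b hb hab => ?_
      rcases hab with hab | hab
      · exfalso
        have : v ∈ s(a, b) := by rw [hab]; simp
        have hv'' : v ∉ insert x B' := by
          rintro (h | h)
          · exact huv h.symm
          · exact hv' h
        rcases Sym2.mem_iff.1 this with h | h
        · exact hv'' (h ▸ ha)
        · exact hv'' (h ▸ hb)
      · exact hab.1
    · simp only [if_neg hxu]
      exact ⟨by simp, by simpa using hsub hx, cutConn_singleton _ _⟩
  · have h1 := hdis x hx
    have h2 := hdis y hy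
    by_cases hxu : x = u <;> by_cases hyu : y = u <;> simp_all
  · have key : ∃ b ∈ B', s(b, v) ∈ E := by
      obtain ⟨b, hb, t, ht, hbt⟩ := h.del u hu B'
        (fun x hx => ⟨(hB' hx).1, fun hxu => hu' (hxu ▸ hx)⟩) hn' (by rintro rfl; exact hv' ⟨hv, huv.symm⟩)
      rcases hc' b hb t ht.1.1 hbt with h | h | h
      · exact absurd h ht.2
      · exact absurd h ht.1.2
      · exact ⟨b, hb, h ▸ hbt⟩
    rcases he with he | he
    · obtain ⟨b, hb, hbv⟩ := key
      rcases Sym2.eq_iff.1 he with ⟨rfl, rfl⟩ | ⟨rfl, rfl⟩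
      · exact ⟨b, by simp [hb], y, by simp [huv.symm], hbv⟩
      · exact ⟨x, by simp [hxy], b, by simp [hb], by rwa [Sym2.eq_swap]⟩
    · exact ⟨x, by by_cases h : x = u <;> simp [h], y, by by_cases h : y = u <;> simp [h], he.1⟩

end TwoSeparation

theorem exists_contractible [Finite V] {E : Set (Sym2 V)} {W : Set V}
    (hs : ∀ a b, s(a, b) ∈ E → a ∈ W ∧ b ∈ W ∧ a ≠ b) (h5 : 5 ≤ W.ncard) (hW : TwoConn E W)
    (h3 : ∀ u ∈ W, ∀ v ∈ W, u ≠ v → CutConn E (W \ {u, v})) :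
    ∃ x y, s(x, y) ∈ E ∧ TwoConn E (W \ {x, y}) := by
  by_contra! hcon
  have hsep : ∀ x y, s(x, y) ∈ E → ∃ z ∈ W, z ≠ x ∧ z ≠ y ∧ ∃ D ⊆ W, D.Nonempty ∧ x ∉ D ∧ y ∉ D ∧
      z ∉ D ∧ (∀ a ∈ D, ∀ b ∈ W, s(a, b) ∈ E → b ∈ D ∨ b = x ∨ b = y ∨ b = z) ∧
      ∃ r ∈ W, r ∉ D ∧ r ≠ x ∧ r ≠ y ∧ r ≠ z := by
    intro x y hxy
    obtain ⟨hx, hy, hne⟩ := hs x y hxy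
    by_contra! hall
    refine hcon x y hxy ⟨?_, h3 x hx y hy hne, fun z hz D hD hn hne' => ?_⟩
    · have : 2 < (W \ {x, y}).ncard := by
        have := Set.le_ncard_sdiff {x, y} W
        rw [Set.ncard_pair hne] at this
        omega
      obtain ⟨a, b, c, ha, hb, hc, h1, h2, h3⟩ := (Set.two_lt_ncard_iff (Set.toFinite _)).1 this
      grind
    · by_contra! hno
      have hmem : ∀ t, t ∈ (W \ {x, y}) \ {z} ↔ t ∈ W ∧ t ≠ x ∧ t ≠ y ∧ t ≠ z := by
        intro t; simp; tauto
      have hD' := fun t ht => (hmem t).1 (hD ht)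
      obtain ⟨hzW, hzx, hzy⟩ : z ∈ W ∧ z ≠ x ∧ z ≠ y := by
        simpa using hz
      refine hne' (hD.antisymm fun r hr => ?_)
      by_contra hrD
      have hr' := (hmem r).1 hr
      refine hr'.2.2.2 (hall z hzW hzx hzy D (fun t ht => (hD' t ht).1) hn
        (fun h => (hD' x h).2.1 rfl) (fun h => (hD' y h).2.2.1 rfl) (fun h => (hD' z h).2.2.2 rfl)
        (fun a ha b hb he => ?_) r hr'.1 hrD hr'.2.1 hr'.2.2.1)
      by_contra! hb'
      exact hno a ha b ⟨(hmem b).2 ⟨hb, hb'.2.1, hb'.2.2.1, hb'.2.2.2⟩, hb'.1⟩ he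
  have main : ∀ n, ∀ (D : Set V) (x y z : V), D.ncard = n → s(x, y) ∈ E → z ∈ W → D ⊆ W →
      D.Nonempty → x ∉ D → y ∉ D → z ∉ D →
      (∀ a ∈ D, ∀ b ∈ W, s(a, b) ∈ E → b ∈ D ∨ b = x ∨ b = y ∨ b = z) → z ≠ x → z ≠ y → False := by
    intro n
    induction n using Nat.strong_induction_on with
    | _ n ih =>
    intro D x y z hcard hxy hz hD hn hxD hyD hzD hc hzx hzy
    obtain ⟨hx, hy, hne⟩ := hs x y hxy
    obtain ⟨u, huD, z', hz', he⟩ := h3 x hx y hy hne D (fun t ht => ⟨hD ht, by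
      rintro (rfl | rfl)
      · exact hxD ht
      · exact hyD ht⟩) hn (by
        rintro rfl
        exact hzD ⟨hz, by simp [hzx, hzy]⟩)
    have hzz : z' = z := by
      have h1 := hz'.1.2
      simp only [Set.mem_insert_iff, Set.mem_singleton_iff, not_or] at h1
      rcases hc u huD z' hz'.1.1 he with h | h | h | h
      · exact absurd h hz'.2
      · exact absurd h h1.1
      · exact absurd h h1.2
      · exact h
    subst hzz
    obtain ⟨w, hw, hwz, hwu, D₁, hD₁, hn₁, hzD₁, huD₁, hwD₁, hc₁, r, hr, hrD₁, hrz, hru, hrw⟩ :=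
      hsep z' u (by rwa [Sym2.eq_swap])
    obtain ⟨D₂, hD₂, hn₂, hzD₂, huD₂, hwD₂, hc₂, hxD₂, hyD₂⟩ : ∃ D₂ ⊆ W, D₂.Nonempty ∧ z' ∉ D₂ ∧
        u ∉ D₂ ∧ w ∉ D₂ ∧ (∀ a ∈ D₂, ∀ b ∈ W, s(a, b) ∈ E → b ∈ D₂ ∨ b = z' ∨ b = u ∨ b = w) ∧
        x ∉ D₂ ∧ y ∉ D₂ := by
      by_cases hxy' : x ∉ D₁ ∧ y ∉ D₁
      · exact ⟨D₁, hD₁, hn₁, hzD₁, huD₁, hwD₁, hc₁, hxy'⟩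
      · have hux : u ≠ x := by rintro rfl; exact hxD huD
        have huy : u ≠ y := by rintro rfl; exact hyD huD
        refine ⟨{t ∈ W | t ∉ D₁ ∧ t ≠ z' ∧ t ≠ u ∧ t ≠ w}, fun t ht => ht.1,
          ⟨r, hr, hrD₁, hrz, hru, hrw⟩, by simp, by simp, by simp, ?_, ?_, ?_⟩
        · intro a ha b hb hab
          by_contra! hcon
          have hbD : b ∈ D₁ := by
            by_contra hbD
            exact hcon.1 ⟨hb, hbD, hcon.2⟩
          have := hc₁ b hbD a ha.1 (by rwa [Sym2.eq_swap])
          have := ha.2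
          tauto
        · intro h
          have hyD₁ : y ∈ D₁ := by
            by_contra h'
            exact hxy' ⟨h.2.1, h'⟩
          have := hc₁ y hyD₁ x hx (by rwa [Sym2.eq_swap])
          have := h.2
          tauto
        · intro h
          have hxD₁ : x ∈ D₁ := by
            by_contra h'
            exact hxy' ⟨h', h.2.1⟩
          have := hc₁ x hxD₁ y hy hxy
          have := h.2
          tauto
    have huW := hD huD
    obtain ⟨t, ht, u', hu', heu⟩ := h3 z' hz w hw hwz.symm D₂ (fun t ht => ⟨hD₂ ht, by
      rintro (rfl | rfl)
      · exact hzD₂ ht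
      · exact hwD₂ ht⟩) hn₂ (by
        rintro rfl
        exact huD₂ ⟨huW, by
          rintro (rfl | rfl)
          · exact hzD huD
          · exact hwu rfl⟩)
    have huu : u' = u := by
      have h1 := hu'.1.2
      simp only [Set.mem_insert_iff, Set.mem_singleton_iff, not_or] at h1
      rcases hc₂ t ht u' hu'.1.1 heu with h | h | h | h
      · exact absurd h hu'.2
      · exact absurd h h1.1
      · exact h
      · exact absurd h h1.2
    subst huu
    have hcl : ∀ a ∈ D, ∀ b ∈ D₂, s(a, b) ∈ E → b ∈ D := by
      intro a ha b hb hab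
      rcases hc a ha b (hD₂ hb) hab with h | rfl | rfl | rfl
      · exact h
      · exact absurd hb hxD₂
      · exact absurd hb hyD₂
      · exact absurd hb hzD₂
    have htD : t ∈ D := hcl u' huD t ht (by rwa [Sym2.eq_swap])
    refine ih (D₂ ∩ D).ncard ?_ (D₂ ∩ D) z' u' w rfl (by rwa [Sym2.eq_swap]) hw
      (fun t ht => hD₂ ht.1) ⟨t, ht, htD⟩ (fun h => hzD h.2) (fun h => huD₂ h.1)
      (fun h => hwD₂ h.1) (fun a ha b hb hab => ?_) hwz hwu
    · rw [← hcard]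
      exact Set.ncard_lt_ncard (Set.ssubset_iff_subset_ne.2 ⟨Set.inter_subset_right, fun h => by
        rw [← h] at huD; exact huD₂ huD.1⟩) (Set.toFinite _)
    · rcases hc₂ a ha.1 b hb hab with h | h
      · exact Or.inl ⟨h, hcl a ha.2 b h hab⟩
      · exact Or.inr h
  obtain ⟨a, ha, -⟩ := hW.three
  obtain ⟨b, hb, -, hab⟩ := hW.exists_edge ha
  obtain ⟨z, hz, hzx, hzy, D, hD, hn, h1, h2, h3, hc, -⟩ := hsep a b hab
  exact main _ D a b z rfl hab hz hD hn h1 h2 h3 hc hzx hzy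

end

section

variable {V : Type*}

section Lists

theorem ce_of_isRotated {l l' : List V} (h : l ~r l') : ce l = ce l' := by
  obtain ⟨n, hn, rfl⟩ := List.isRotated_iff_mod.1 h
  rw [List.rotate_eq_drop_append_take hn]
  conv_lhs => rw [← List.take_append_drop n l]
  cases l.drop n with
  | nil => simp
  | cons a r => exact ce_rotate _ _ _

theorem exists_first {P : V → Prop} {l : List V} (h : ∃ x ∈ l, P x) :
    ∃ s x r, l = s ++ x :: r ∧ P x ∧ ∀ y ∈ s, ¬ P y := by
  induction l with
  | nil => simp at h
  | cons a l ih =>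
    by_cases ha : P a
    · exact ⟨[], a, l, rfl, ha, by simp⟩
    · obtain ⟨s, x, r, rfl, hx, hs⟩ := ih (by simpa [ha] using h)
      grind

theorem exists_last {P : V → Prop} {l : List V} (h : ∃ x ∈ l, P x) :
    ∃ s x r, l = s ++ x :: r ∧ P x ∧ ∀ y ∈ r, ¬ P y := by
  obtain ⟨s, x, r, hl, hx, hs⟩ := exists_first (l := l.reverse) (P := P) (by simpa using h)
  refine ⟨r.reverse, x, s.reverse, ?_, hx, by simpa using hs⟩
  grind

theorem exists_mem_pe_append (a : V) (l : List V) (b : V) :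
    ∃ u ∈ a :: l, s(u, b) ∈ pe (a :: (l ++ [b])) := by
  induction l generalizing a with
  | nil => simp
  | cons c l ih =>
    obtain ⟨u, hu, he⟩ := ih c
    exact ⟨u, List.mem_cons_of_mem _ hu, Or.inr he⟩

/-- All of `A` lies on a segment of the cyclic list `c` with ends in `A` and no interior point
in `B`. -/
def Separated (A B : Set V) (c : List V) : Prop :=
  ∃ p l q r, c ~r p :: (l ++ q :: r) ∧ p ∈ A ∧ q ∈ A ∧ (∀ v ∈ A, v ∈ p :: (l ++ [q])) ∧
    ∀ v ∈ l, v ∉ B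

theorem rotated_to_head {c : List V} {a : V} (ha : a ∈ c) : ∃ t, c ~r a :: t := by
  obtain ⟨s, t, rfl⟩ := List.append_of_mem ha
  exact ⟨t ++ s, List.isRotated_append⟩

theorem separated_or_alternating {A B : Set V} {c : List V} (hAc : ∀ v ∈ A, v ∈ c)
    {a₁ a₂ : V} (h₁ : a₁ ∈ A) (h₂ : a₂ ∈ A) (h₁₂ : a₁ ≠ a₂) {b : V} (hb : b ∈ c) (hbB : b ∈ B)
    (hbA : b ∉ A) : Separated A B c ∨ ∃ α l₁ β l₂ α' l₃ β' l₄,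
      c ~r α :: (l₁ ++ β :: (l₂ ++ α' :: (l₃ ++ β' :: l₄))) ∧ α ∈ A ∧ α' ∈ A ∧ β ∈ B ∧ β' ∈ B := by
  obtain ⟨t, ht⟩ := rotated_to_head hb
  have hA : ∀ v ∈ A, v ∈ t := fun v hv => by
    have := ht.mem_iff.1 (hAc v hv)
    grind
  obtain ⟨s₁, a', t', rfl, ha', hs₁⟩ := exists_first (P := (· ∈ A)) ⟨a₁, hA a₁ h₁, h₁⟩
  have : ∃ x ∈ t', x ∈ A := by grind
  obtain ⟨s₃, a, s₄, rfl, ha, hs₄⟩ := exists_last this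
  have hrot : b :: (s₁ ++ a' :: (s₃ ++ a :: s₄)) ~r a' :: (s₃ ++ a :: (s₄ ++ b :: s₁)) := by
    have := List.isRotated_append (l := b :: s₁) (l' := a' :: (s₃ ++ a :: s₄))
    simpa using this
  by_cases hβ : ∃ β ∈ s₃, β ∈ B
  · obtain ⟨β, hβ, hβB⟩ := hβ
    obtain ⟨u, w, rfl⟩ := List.append_of_mem hβ
    exact Or.inr ⟨a', u, β, w, a, s₄, b, s₁, by simpa using ht.trans hrot, ha', ha, hβB, hbB⟩
  · push Not at hβ
    refine Or.inl ⟨a', s₃, a, s₄ ++ b :: s₁, ht.trans hrot, ha', ha, fun v hv => ?_, hβ⟩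
    have := hA v hv
    simp only [List.mem_append, List.mem_cons] at this ⊢
    have h1 := hs₁ v
    have h4 := hs₄ v
    tauto

theorem separated_or_minor {A B : Set V} {c : List V} (hAc : ∀ v ∈ A, v ∈ c)
    (hBc : ∀ v ∈ B, v ∈ c) {a₁ a₂ b₁ b₂ : V} (h₁ : a₁ ∈ A) (h₂ : a₂ ∈ A) (h₁₂ : a₁ ≠ a₂)
    (h₃ : b₁ ∈ B) (h₄ : b₂ ∈ B) (h₃₄ : b₁ ≠ b₂) :
    (Separated A B c ∨ Separated B A c) ∨ (∃ α l₁ β l₂ α' l₃ β' l₄,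
      c ~r α :: (l₁ ++ β :: (l₂ ++ α' :: (l₃ ++ β' :: l₄))) ∧ α ∈ A ∧ α' ∈ A ∧ β ∈ B ∧ β' ∈ B) ∨
      ∃ p l₁ q l₂ r l₃, c ~r p :: (l₁ ++ q :: (l₂ ++ r :: l₃)) ∧ (p ∈ A ∧ q ∈ A ∧ r ∈ A) ∧
        p ∈ B ∧ q ∈ B ∧ r ∈ B := by
  by_cases hb : ∃ b ∈ B, b ∉ A
  · obtain ⟨b, hbB, hbA⟩ := hb
    rcases separated_or_alternating hAc h₁ h₂ h₁₂ (hBc b hbB) hbB hbA with h | h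
    · grind
    grind
  by_cases ha : ∃ a ∈ A, a ∉ B
  · obtain ⟨a, haA, haB⟩ := ha
    rcases separated_or_alternating hBc h₃ h₄ h₃₄ (hAc a haA) haA haB with h | h
    · grind
    · obtain ⟨α, l₁, β, l₂, α', l₃, β', l₄, hr, h1, h2, h3, h4⟩ := h
      refine Or.inr (Or.inl ⟨β, l₂, α', l₃, β', l₄, α, l₁, hr.trans ?_, h3, h4, h2, h1⟩)
      have := List.isRotated_append (l := α :: l₁) (l' := β :: (l₂ ++ α' :: (l₃ ++ β' :: l₄)))
      simpa using this
  push Not at ha hb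
  obtain ⟨t, ht⟩ := rotated_to_head (hAc a₁ h₁)
  have hA : ∀ v ∈ A, v = a₁ ∨ v ∈ t := fun v hv => by
    simpa using ht.mem_iff.1 (hAc v hv)
  obtain ⟨s, q, r, rfl, hq, hs⟩ := exists_first (P := (· ∈ A))
    ⟨a₂, (hA a₂ h₂).resolve_left h₁₂.symm, h₂⟩
  by_cases hr : ∃ x ∈ r, x ∈ A
  · obtain ⟨x, hx, hxA⟩ := hr
    obtain ⟨u, w, rfl⟩ := List.append_of_mem hx
    exact Or.inr (Or.inr ⟨a₁, s, q, u, x, w, ht, ⟨h₁, hq, hxA⟩, ha _ h₁, ha _ hq, ha _ hxA⟩)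
  · push Not at hr
    refine Or.inl (Or.inl ⟨a₁, s, q, r, ht, h₁, hq, fun v hv => ?_, fun v hv hvB =>
      hs v hv (hb v hvB)⟩)
    have := hA v hv
    simp only [List.mem_append, List.mem_cons] at this ⊢
    have h1 := hr v
    tauto

end Lists

section Minors
variable {E : Set (Sym2 V)} {W : Set V}

theorem hasMinor_of_lists {T : Type*} {H : SimpleGraph T} (F : T → List V)
    (h : ∀ t, F t ≠ [] ∧ (∀ v ∈ F t, v ∈ W) ∧ pe (F t) ⊆ E)
    (ts : List T) (hts : ∀ t, t ∈ ts) (hd : (ts.flatMap F).Nodup)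
    (hE : ∀ s t, H.Adj s t → ∃ a ∈ F s, ∃ b ∈ F t, s(a, b) ∈ E) : HasMinor H E W := by
  have : Std.Symm (Function.onFun List.Disjoint F) := ⟨fun _ _ h => List.Disjoint.symm h⟩
  exact ⟨fun t => {v | v ∈ F t}, fun t => ⟨List.exists_mem_of_ne_nil _ (h t).1, (h t).2.1,
    cutConn_list _ (h t).2.2⟩, fun s t hst => Set.disjoint_left.2 fun _ hs ht =>
      (List.nodup_flatMap.1 hd).2.forall (hts s) (hts t) hst hs ht, hE⟩

theorem hasMinor_of_alternating {x y α β α' β' : V} {l₁ l₂ l₃ l₄ : List V}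
    (hnd : (x :: y :: α :: (l₁ ++ β :: (l₂ ++ α' :: (l₃ ++ β' :: l₄)))).Nodup)
    (hE : ce (α :: (l₁ ++ β :: (l₂ ++ α' :: (l₃ ++ β' :: l₄)))) ⊆ E)
    (hW : ∀ v ∈ x :: y :: α :: (l₁ ++ β :: (l₂ ++ α' :: (l₃ ++ β' :: l₄))), v ∈ W)
    (hxy : s(x, y) ∈ E) (h₁ : s(x, α) ∈ E) (h₂ : s(x, α') ∈ E) (h₃ : s(y, β) ∈ E)
    (h₄ : s(y, β') ∈ E) : HasMinor (completeBipartiteGraph (Fin 3) (Fin 3)) E W := by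
  have hce : ce (α :: (l₁ ++ β :: (l₂ ++ α' :: (l₃ ++ β' :: l₄)))) =
      pe (α :: (l₁ ++ [β])) ∪ (pe (β :: (l₂ ++ [α'])) ∪ (pe (α' :: (l₃ ++ [β'])) ∪
        pe (β' :: (l₄ ++ [α])))) := by
    have h1 := pe_append (α :: l₁) β (l₂ ++ α' :: (l₃ ++ β' :: (l₄ ++ [α])))
    have h2 := pe_append (β :: l₂) α' (l₃ ++ β' :: (l₄ ++ [α]))
    have h3 := pe_append (α' :: l₃) β' (l₄ ++ [α])
    simp only [List.cons_append] at h1 h2 h3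
    rw [ce_cons]
    grind
  rw [hce] at hE
  simp only [Set.union_subset_iff] at hE
  obtain ⟨e1, e2, e3, e4⟩ := hE
  obtain ⟨u1, hu1, f1⟩ := exists_mem_pe_append α l₁ β
  obtain ⟨u2, hu2, f2⟩ := exists_mem_pe_append β l₂ α'
  obtain ⟨u3, hu3, f3⟩ := exists_mem_pe_append α' l₃ β'
  obtain ⟨u4, hu4, f4⟩ := exists_mem_pe_append β' l₄ α
  replace f1 := e1 f1
  replace f2 := e2 f2
  replace f3 := e3 f3
  replace f4 := e4 f4
  have pre : ∀ a (l : List V) b, pe (a :: (l ++ [b])) ⊆ E → pe (a :: l) ⊆ E := fun a l b h =>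
    (pe_prefix_subset (a :: l) [b]).trans h
  have sw : ∀ {a b : V}, s(a, b) ∈ E → s(b, a) ∈ E := fun h => by rwa [Sym2.eq_swap]
  have key : ∀ i j : Fin 3, ∃ a ∈ (![[x], β :: l₂, β' :: l₄] : Fin 3 → List V) i,
      ∃ b ∈ (![[y], α :: l₁, α' :: l₃] : Fin 3 → List V) j, s(a, b) ∈ E := by
    intro i j
    fin_cases i <;> fin_cases j
    · exact ⟨x, by simp, y, by simp, hxy⟩
    · exact ⟨x, by simp, α, by simp, h₁⟩
    · exact ⟨x, by simp, α', by simp, h₂⟩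
    · exact ⟨β, by simp, y, by simp, sw h₃⟩
    · exact ⟨β, by simp, u1, hu1, sw f1⟩
    · exact ⟨u2, hu2, α', by simp, f2⟩
    · exact ⟨β', by simp, y, by simp, sw h₄⟩
    · exact ⟨u4, hu4, α, by simp, f4⟩
    · exact ⟨β', by simp, u3, hu3, sw f3⟩
  refine hasMinor_of_lists (Sum.elim ![[x], β :: l₂, β' :: l₄] ![[y], α :: l₁, α' :: l₃])
    ?_ [.inl 0, .inr 0, .inr 1, .inl 1, .inr 2, .inl 2]
    (by rintro (t | t) <;> fin_cases t <;> simp) ?_ ?_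
  · rintro (t | t) <;> fin_cases t <;>
      simp only [Sum.elim_inl, Sum.elim_inr, Fin.zero_eta, Fin.mk_one, Fin.reduceFinMk,
        Matrix.cons_val] <;>
      refine ⟨by simp, fun v hv => hW v (by simp at hv ⊢; tauto), ?_⟩
    · simp
    · exact pre _ _ _ e2
    · exact pre _ _ _ e4
    · simp
    · exact pre _ _ _ e1
    · exact pre _ _ _ e3
  · simpa using hnd
  · rintro (i | i) (j | j) hij
    · simp at hij
    · exact key i j
    · obtain ⟨a, ha, b, hb, h⟩ := key j i
      exact ⟨b, hb, a, ha, sw h⟩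
    · simp at hij

theorem hasMinor_of_common {x y p q r : V} {l₁ l₂ l₃ : List V}
    (hnd : (x :: y :: p :: (l₁ ++ q :: (l₂ ++ r :: l₃))).Nodup)
    (hE : ce (p :: (l₁ ++ q :: (l₂ ++ r :: l₃))) ⊆ E)
    (hW : ∀ v ∈ x :: y :: p :: (l₁ ++ q :: (l₂ ++ r :: l₃)), v ∈ W)
    (hxy : s(x, y) ∈ E) (hx : s(x, p) ∈ E ∧ s(x, q) ∈ E ∧ s(x, r) ∈ E)
    (hy : s(y, p) ∈ E ∧ s(y, q) ∈ E ∧ s(y, r) ∈ E) :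
    HasMinor (SimpleGraph.completeGraph (Fin 5)) E W := by
  have hce : ce (p :: (l₁ ++ q :: (l₂ ++ r :: l₃))) =
      pe (p :: (l₁ ++ [q])) ∪ (pe (q :: (l₂ ++ [r])) ∪ pe (r :: (l₃ ++ [p]))) := by
    have h1 := pe_append (p :: l₁) q (l₂ ++ r :: (l₃ ++ [p]))
    have h2 := pe_append (q :: l₂) r (l₃ ++ [p])
    simp only [List.cons_append] at h1 h2
    rw [ce_cons]
    grind
  rw [hce] at hE
  simp only [Set.union_subset_iff] at hE
  obtain ⟨e1, e2, e3⟩ := hE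
  obtain ⟨u1, hu1, f1⟩ := exists_mem_pe_append p l₁ q
  obtain ⟨u2, hu2, f2⟩ := exists_mem_pe_append q l₂ r
  obtain ⟨u3, hu3, f3⟩ := exists_mem_pe_append r l₃ p
  replace f1 := e1 f1
  replace f2 := e2 f2
  replace f3 := e3 f3
  have pre : ∀ a (l : List V) b, pe (a :: (l ++ [b])) ⊆ E → pe (a :: l) ⊆ E := fun a l b h =>
    (pe_prefix_subset (a :: l) [b]).trans h
  have sw : ∀ {a b : V}, s(a, b) ∈ E → s(b, a) ∈ E := fun h => by rwa [Sym2.eq_swap]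
  let F : Fin 5 → List V := ![[x], [y], p :: l₁, q :: l₂, r :: l₃]
  have key : ∀ i j : Fin 5, i < j → ∃ a ∈ F i, ∃ b ∈ F j, s(a, b) ∈ E := by
    intro i j hij
    fin_cases i <;> fin_cases j <;> first | exact absurd hij (by decide) | skip
    · exact ⟨x, by simp [F], y, by simp [F], hxy⟩
    · exact ⟨x, by simp [F], p, by simp [F], hx.1⟩
    · exact ⟨x, by simp [F], q, by simp [F], hx.2.1⟩
    · exact ⟨x, by simp [F], r, by simp [F], hx.2.2⟩
    · exact ⟨y, by simp [F], p, by simp [F], hy.1⟩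
    · exact ⟨y, by simp [F], q, by simp [F], hy.2.1⟩
    · exact ⟨y, by simp [F], r, by simp [F], hy.2.2⟩
    · exact ⟨u1, hu1, q, by simp [F], f1⟩
    · exact ⟨p, by simp [F], u3, hu3, sw f3⟩
    · exact ⟨u2, hu2, r, by simp [F], f2⟩
  refine hasMinor_of_lists F ?_ [0, 1, 2, 3, 4] (by decide) ?_ ?_
  · intro t
    fin_cases t <;>
      simp only [F, Fin.zero_eta, Fin.mk_one, Fin.reduceFinMk, Matrix.cons_val] <;>
      refine ⟨by simp, fun v hv => hW v (by simp at hv ⊢; tauto), ?_⟩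
    · simp
    · simp
    · exact pre _ _ _ e1
    · exact pre _ _ _ e2
    · exact pre _ _ _ e3
  · simpa [F] using hnd
  · intro i j hij
    rcases lt_or_gt_of_ne hij.ne with h | h
    · exact key i j h
    · obtain ⟨a, ha, b, hb, h⟩ := key j i h
      exact ⟨b, hb, a, ha, sw h⟩

end Minors

end

section

variable {V : Type*}

theorem ne_of_mem_pe {l : List V} (hnd : l.Nodup) {a b : V} (h : s(a, b) ∈ pe l) : a ≠ b := by
  induction l with
  | nil => simp at h
  | cons x l ih =>
    cases l with
    | nil => simp at h
    | cons y l =>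
      rw [pe_cons_cons] at h
      grind

theorem eq_nil_of_mem_pe {p q : V} {l : List V} (hnd : (p :: (l ++ [q])).Nodup)
    (h : s(p, q) ∈ pe (p :: (l ++ [q]))) : l = [] := by
  cases l with
  | nil => rfl
  | cons z l =>
    rw [List.cons_append, pe_cons_cons] at h
    simp only [List.cons_append, List.nodup_cons, List.mem_cons, List.mem_append] at hnd
    rcases h with h | h
    · grind
    · have := mem_of_mem_pe h (v := p) (by simp)
      grind

theorem hasFrame_of_separated [Fintype V] {ι : Type} {E₀ : Set (Sym2 V)} {d : Sym2 V → Sym2 ι}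
    (hF : IsFrame E₀ d)
    {f : ι} {c : List V} (hnd : c.Nodup) (h3 : 3 ≤ c.length) (hcE : ce c ⊆ E₀)
    (hf : ∀ e ∈ ce c, f ∈ d e) {x y : V} (hxy : x ≠ y) (hxc : x ∉ c) (hyc : y ∉ c)
    (hxE : ∀ w, s(x, w) ∉ E₀) (hyE : ∀ w, s(y, w) ∉ E₀) {A B : Set V} (hAc : ∀ v ∈ A, v ∈ c)
    (hBc : ∀ v ∈ B, v ∈ c) (hs : Separated A B c) :
    HasFrame (E₀ ∪ {e | ∃ n ∈ A, e = s(x, n)} ∪ {e | ∃ n ∈ insert x B, e = s(y, n)}) := by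
  obtain ⟨p, l, q, r, hr, hp, hq, hA, hB⟩ := hs
  rw [ce_of_isRotated hr] at hcE hf
  rw [hr.perm.nodup_iff] at hnd
  rw [hr.perm.length_eq] at h3
  rw [hr.mem_iff] at hxc hyc
  replace hAc : ∀ v ∈ A, v ∈ p :: (l ++ q :: r) := fun v hv => hr.mem_iff.1 (hAc v hv)
  replace hBc : ∀ v ∈ B, v ∈ p :: (l ++ q :: r) := fun v hv => hr.mem_iff.1 (hBc v hv)
  clear hr
  have hce : ce (p :: (l ++ q :: r)) = pe (p :: (l ++ [q])) ∪ pe (q :: (r ++ [p])) := by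
    have h1 := pe_append (p :: l) q (r ++ [p])
    simp only [List.cons_append] at h1
    rw [ce_cons]
    grind
  rw [hce] at hcE hf
  have hnd₁ : (p :: (l ++ [q])).Nodup := by grind
  have hnd₂ : (q :: (r ++ [p])).Nodup := by grind
  have hdisj : ∀ e ∈ pe (q :: (r ++ [p])), e ∉ pe (p :: (l ++ [q])) := by
    intro e h2 h1
    induction e with
    | _ a b =>
      have hab : a ≠ b := ne_of_mem_pe hnd₁ h1
      have ha1 := mem_of_mem_pe h1 (v := a) (by simp)
      have hb1 := mem_of_mem_pe h1 (v := b) (by simp)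
      have ha2 := mem_of_mem_pe h2 (v := a) (by simp)
      have hb2 := mem_of_mem_pe h2 (v := b) (by simp)
      have key : ∀ z, z ∈ p :: (l ++ [q]) → z ∈ q :: (r ++ [p]) → z = p ∨ z = q := by
        intro z h1 h2
        simp [List.nodup_append] at hnd h1 h2
        grind
      have hs : s(a, b) = s(p, q) := by
        rcases key a ha1 ha2 with rfl | rfl <;> rcases key b hb1 hb2 with rfl | rfl
        · exact absurd rfl hab
        · rfl
        · exact Sym2.eq_swap
        · exact absurd rfl hab
      rw [hs] at h1 h2
      have := eq_nil_of_mem_pe hnd₁ h1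
      have := eq_nil_of_mem_pe hnd₂ (by rwa [Sym2.eq_swap])
      subst_vars
      simp at h3
  obtain ⟨ι₁, d₁, f₁, hF₁, hfp, hlast, hrest⟩ := hF.fan (f := f) (y := x) (a := p)
    (l := l ++ [q]) (N := A) hnd₁ (by simp at hxc ⊢; tauto) (Set.subset_union_left.trans hcE)
    (fun e he => hf e (Or.inl he)) hxE hp hA
  have hfq := hlast q (by
    rw [← List.cons_append, List.getLast?_append]; rfl) hq
  obtain ⟨ι₂, d₂, f₂, hF₂, -⟩ := hF₁.fan (f := f₁) (y := y) (a := x) (l := q :: (r ++ [p]))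
    (N := insert x B) (List.nodup_cons.2 ⟨by simp at hxc ⊢; tauto, hnd₂⟩)
    (by simp at hyc ⊢; tauto)
    (by
      rw [pe_cons_cons]
      exact Set.insert_subset (Or.inr ⟨q, hq, rfl⟩) ((Set.subset_union_right.trans hcE).trans
        Set.subset_union_left))
    (by
      rw [pe_cons_cons]
      rintro e (rfl | he)
      · exact hfq
      · exact hrest e (hcE (Or.inr he)) (hdisj e he) (hf e (Or.inr he)))
    (by
      rintro w (h | ⟨n, hn, h⟩)
      · exact hyE w h
      · have hny : n ≠ y := fun h => hyc (h ▸ hAc n hn)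
        rw [Sym2.eq_iff] at h
        grind)
    (Set.mem_insert _ _)
    (by
      rintro n (rfl | hn)
      · simp
      · have h1 := hBc n hn
        have h2 := fun h => hB n h hn
        simp at h1 ⊢
        tauto)
  exact ⟨_, _, hF₂⟩

section Contract
variable [Fintype V] {E : Set (Sym2 V)} {W : Set V}

theorem Drawn.exists_cycle_around {ι : Type} {d : Sym2 V → Sym2 ι} (h : Drawn E d W) {x : V}
    (hx : x ∈ W) (hU : TwoConn E (W \ {x})) :
    ∃ (ι' : Type) (d' : Sym2 V → Sym2 ι') (f : ι') (c : List V),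
      IsFrame {e ∈ E | x ∉ e} d' ∧ c.Nodup ∧ 3 ≤ c.length ∧ ce c ⊆ {e ∈ E | x ∉ e} ∧
      (∀ e ∈ ce c, f ∈ d' e) ∧ (∀ v ∈ c, v ∈ W \ {x}) ∧ ∀ v, s(x, v) ∈ E → v ∈ c := by
  obtain ⟨w, -, -, hw⟩ := h.two.exists_edge hx
  obtain ⟨f, hf⟩ := exists_face s(x, w) d
  obtain ⟨c, hc⟩ := h.exists_disc (f := f) hU
  have hrot := h.rot (v := x) (S := reg E d f (W \ {x})) fun v hv =>
    (reg_closed hv (v := x) (by simp)).2 rfl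
  replace hrot := hrot.resolve_right fun hn => hn w hw f hf mem_reg
  refine ⟨_, _, Quotient.mk _ f, c, h.frame.restrict (Set.sep_subset _ _), hc.nodup, hc.three,
    fun e he => ⟨hc.ce_subset he, fun hxe => (hc.mem (mem_of_mem_ce he hxe)).2 rfl⟩, ?_,
    fun v hv => hc.mem hv, fun v hv => ?_⟩
  · intro e he
    rw [← hc.bd_eq] at he
    obtain ⟨-, i, hi, j, -, hij⟩ := he
    have : Quotient.mk (mergeSetoid E {e ∈ E | x ∉ e} d) i = Quotient.mk _ f := by
      refine Quotient.sound fun S hS => ?_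
      have hW : ∀ e ∈ bd E d S, ∀ v ∈ e, v ∈ W \ {x} := by
        intro e he v hv
        have h1 := hS he
        induction e with
        | _ a b =>
          have := h.supp _ _ h1.1
          refine ⟨?_, fun hvx => h1.2 (hvx ▸ hv)⟩
          rcases Sym2.mem_iff.1 hv with rfl | rfl
          exacts [this.1, this.2.1]
      constructor
      · intro hiS
        by_contra hfS
        exact hi Sᶜ hfS (by rwa [bd_compl]) hiS
      · exact fun hfS => hi S hfS hW
    simp only [hij, Sym2.map_mk, ← this]
    simp
  · obtain ⟨i, hi⟩ := exists_face s(x, v) d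
    have hs := h.supp _ _ hv
    exact (hc.outer_iff v).1 ⟨⟨hs.2.1, fun h' => hs.2.2 h'.symm⟩, x, by rwa [Sym2.eq_swap], i,
      by rwa [Sym2.eq_swap], hrot v hv i hi⟩

/-- The edges after contracting `y` into `x`. -/
def contract (E : Set (Sym2 V)) (x y : V) : Set (Sym2 V) :=
  {e ∈ E | y ∉ e} ∪ {e | ∃ b, b ≠ x ∧ s(y, b) ∈ E ∧ e = s(x, b)}

omit [Fintype V] in
theorem CutConn.contract {x y : V} {W' : Set V} (h : CutConn E W') (hx : x ∈ W') (hy : y ∈ W')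
    (hxy : x ≠ y) : CutConn (contract E x y) (W' \ {y}) := by
  refine CutConn.of_closed (a := x) ⟨hx, hxy⟩ fun B hB hxB hcl => ?_
  have : insert y B = W' := by
    refine h.eq_of_closed (a := y) (Set.insert_subset hy (hB.trans Set.sdiff_subset))
      (Set.mem_insert _ _) ?_
    rintro u (rfl | hu) w hw he
    · by_cases hwu : w = u
      · exact Or.inl hwu
      by_cases hwx : w = x
      · grind
      · exact Or.inr (hcl x hxB w ⟨hw, hwu⟩ (Or.inr ⟨w, hwx, he, rfl⟩))
    · by_cases hwy : w = y
      · exact Or.inl hwy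
      · refine Or.inr (hcl u hu w ⟨hw, hwy⟩ (Or.inl ⟨he, ?_⟩))
        grind
  grind

theorem hasFrame_of_contract {x y : V}
    (hs : ∀ a b, s(a, b) ∈ E → a ∈ W ∧ b ∈ W ∧ a ≠ b) (hxy : s(x, y) ∈ E)
    (hU : TwoConn E (W \ {x, y})) (hW : TwoConn E W)
    (h3 : ∀ u ∈ W, ∀ v ∈ W, u ≠ v → CutConn E (W \ {u, v})) (hm : NoMinors E W)
    (ih : ∀ E' : Set (Sym2 V), (∀ a b, s(a, b) ∈ E' → a ∈ W \ {y} ∧ b ∈ W \ {y} ∧ a ≠ b) →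
      TwoConn E' (W \ {y}) → NoMinors E' (W \ {y}) → HasFrame E') : HasFrame E := by
  classical
  obtain ⟨hx, hy, hne⟩ := hs x y hxy
  have hWU : (W \ {y}) \ {x} = W \ {x, y} := by ext; simp; tauto
  have hsupp : ∀ a b, s(a, b) ∈ contract E x y → a ∈ W \ {y} ∧ b ∈ W \ {y} ∧ a ≠ b := by
    rintro a b (⟨he, hye⟩ | ⟨b', hb', he, heq⟩)
    · grind
    · obtain ⟨h1, h2, h3⟩ := hs _ _ he
      rcases Sym2.eq_iff.1 heq with ⟨rfl, rfl⟩ | ⟨rfl, rfl⟩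
      · exact ⟨⟨hx, hne⟩, ⟨h2, Ne.symm h3⟩, hb'.symm⟩
      · exact ⟨⟨h2, Ne.symm h3⟩, ⟨hx, hne⟩, hb'⟩
  have hUU : TwoConn (contract E x y) (W \ {x, y}) := hU.congr fun u hu w hw he => Or.inl ⟨he, by
    have h1 := hu.2
    have h2 := hw.2
    simp at h1 h2 ⊢
    tauto⟩
  have htwo : TwoConn (contract E x y) (W \ {y}) := by
    refine ⟨?_, hW.conn.contract hx hy hne, fun v hv => ?_⟩
    · obtain ⟨a, ha, b, hb, c, hc, h⟩ := hU.three
      rw [← hWU] at ha hb hc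
      exact ⟨a, ha.1, b, hb.1, c, hc.1, h⟩
    · by_cases hvx : v = x
      · subst hvx
        rw [hWU]
        exact hUU.conn
      · have := (hW.del v hv.1).contract (x := x) (y := y) ⟨hx, Ne.symm hvx⟩
          ⟨hy, fun h => hv.2 h.symm⟩ hne
        rwa [Set.sdiff_sdiff_comm] at this
  have hmin : NoMinors (contract E x y) (W \ {y}) := by
    refine hm.transfer (fun v => if v = x then {x, y} else {v}) ?_ ?_ ?_
    · intro v hv
      by_cases hvx : v = x
      · simp only [hvx, if_true]
        refine ⟨by simp, by simp [Set.insert_subset_iff, hx, hy], ?_⟩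
        have := (cutConn_singleton E x).union_of_edge (cutConn_singleton E y) (a := x) (b := y)
          rfl rfl (Or.inr hxy)
        simpa [Set.pair_comm] using this
      · simp only [hvx, if_false]
        exact ⟨by simp, by simpa using hv.1, cutConn_singleton _ _⟩
    · intro u hu v hv huv
      have h1 := hu.2
      have h2 := hv.2
      simp only [Set.mem_singleton_iff] at h1 h2
      rw [Set.disjoint_left]
      split_ifs <;> simp <;> grind
    · intro u hu v hv huv he
      have h1 := hu.2
      have h2 := hv.2
      simp only [Set.mem_singleton_iff] at h1 h2
      rcases he with ⟨he, -⟩ | ⟨b, hb, he, heq⟩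
      · exact ⟨u, by split_ifs <;> simp_all, v, by split_ifs <;> simp_all, he⟩
      · rcases Sym2.eq_iff.1 heq with ⟨rfl, rfl⟩ | ⟨rfl, rfl⟩
        · exact ⟨y, by simp, v, by simp [hb], he⟩
        · exact ⟨u, by simp [hb], y, by simp, by rwa [Sym2.eq_swap]⟩
  obtain ⟨ι, d, hF⟩ := ih _ hsupp htwo hmin
  have hD : Drawn (contract E x y) d (W \ {y}) := ⟨hF, htwo, hsupp⟩
  obtain ⟨ι', d', f, c, hF', hnd, hthree, hcE, hf, hcW, hcN⟩ :=
    hD.exists_cycle_around (x := x) ⟨hx, hne⟩ (by rw [hWU]; exact hUU)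
  set E₀ := {e ∈ contract E x y | x ∉ e}
  have hE₀ : E₀ = {e ∈ E | x ∉ e ∧ y ∉ e} := by
    ext e
    constructor
    · rintro ⟨⟨h1, h2⟩ | ⟨b, -, -, rfl⟩, h3⟩
      · exact ⟨h1, h3, h2⟩
      · simp at h3
    · exact fun h => ⟨Or.inl ⟨h.1, h.2.2⟩, h.2.1⟩
  rw [hE₀] at hcE hF'
  have hxc : x ∉ c := fun h => (hcW x h).2 rfl
  have hyc : y ∉ c := fun h => (hcW y h).1.2 rfl
  let A : Set V := {v | v ≠ y ∧ s(x, v) ∈ E}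
  let B : Set V := {v | v ≠ x ∧ s(y, v) ∈ E}
  have hA : ∀ v ∈ A, v ∈ c := fun v hv => hcN v (Or.inl ⟨hv.2, by simp [hne.symm, hv.1.symm]⟩)
  have hB : ∀ v ∈ B, v ∈ c := fun v hv => hcN v (Or.inr ⟨v, hv.1, hv.2, rfl⟩)
  have two : ∀ x y, x ∈ W → y ∈ W → x ≠ y → TwoConn E (W \ {x, y}) →
      ∃ a₁ a₂, (a₁ ≠ y ∧ s(x, a₁) ∈ E) ∧ (a₂ ≠ y ∧ s(x, a₂) ∈ E) ∧ a₁ ≠ a₂ := by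
    intro x y hx hy hne hU
    obtain ⟨a₁, h1, h2, h3', h4⟩ := hW.exists_edge_ne hx hy hne
    obtain ⟨z, hz, z', hz', -, -, hzz, -⟩ := hU.three
    have : ∃ z ∈ W, z ≠ x ∧ z ≠ y ∧ z ≠ a₁ := by
      by_cases hza : z = a₁
      · refine ⟨z', hz'.1, ?_⟩
        have := hz'.2
        simp at this
        grind
      · refine ⟨z, hz.1, ?_⟩
        have := hz.2
        simp at this
        grind
    obtain ⟨z, hz, hzx, hzy, hza⟩ := this
    obtain ⟨a₂, h5, h6, h7⟩ := (h3 y hy a₁ h1 h3'.symm).exists_edge (a := x) (b := z)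
      ⟨hx, by simp [hne, h2.symm]⟩ ⟨hz, by simp [hzy, hza]⟩ hzx.symm
    have h8 := h5.2
    simp at h8
    exact ⟨a₁, a₂, ⟨h3', h4⟩, ⟨h8.1, h7⟩, Ne.symm h8.2⟩
  obtain ⟨a₁, a₂, ha₁, ha₂, ha⟩ := two x y hx hy hne hU
  obtain ⟨b₁, b₂, hb₁, hb₂, hb⟩ := two y x hy hx hne.symm (by rwa [Set.pair_comm])
  have hx₀ : ∀ w, s(x, w) ∉ {e ∈ E | x ∉ e ∧ y ∉ e} := fun w hw => hw.2.1 (by simp)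
  have hy₀ : ∀ w, s(y, w) ∉ {e ∈ E | x ∉ e ∧ y ∉ e} := fun w hw => hw.2.2 (by simp)
  have hcWW : ∀ v ∈ c, v ∈ W := fun v hv => (hcW v hv).1.1
  have hcE' : ce c ⊆ E := fun e he => (hcE he).1
  rcases separated_or_minor hA hB ha₁ ha₂ ha hb₁ hb₂ hb with (h | h) |
    ⟨α, l₁, β, l₂, α', l₃, β', l₄, hr, h1, h2, h4, h5⟩ | ⟨p, l₁, q, l₂, r, l₃, hr, h1, h2⟩
  · refine (hasFrame_of_separated hF' hnd hthree hcE hf hne hxc hyc hx₀ hy₀ hA hB h).mono ?_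
    intro e he
    by_cases hye : y ∈ e
    · obtain ⟨z, rfl⟩ := hye
      by_cases hzx : z = x
      · exact Or.inr ⟨z, Or.inl hzx, rfl⟩
      · exact Or.inr ⟨z, Or.inr ⟨hzx, he⟩, rfl⟩
    by_cases hxe : x ∈ e
    · obtain ⟨z, rfl⟩ := hxe
      simp only [Sym2.mem_iff, not_or] at hye
      exact Or.inl (Or.inr ⟨z, ⟨Ne.symm hye.2, he⟩, rfl⟩)
    · exact Or.inl (Or.inl ⟨he, hxe, hye⟩)
  · refine (hasFrame_of_separated hF' hnd hthree hcE hf hne.symm hyc hxc hy₀ hx₀ hB hA h).mono ?_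
    intro e he
    by_cases hxe : x ∈ e
    · obtain ⟨z, rfl⟩ := hxe
      by_cases hzy : z = y
      · exact Or.inr ⟨z, Or.inl hzy, rfl⟩
      · exact Or.inr ⟨z, Or.inr ⟨hzy, he⟩, rfl⟩
    by_cases hye : y ∈ e
    · obtain ⟨z, rfl⟩ := hye
      simp only [Sym2.mem_iff, not_or] at hxe
      exact Or.inl (Or.inr ⟨z, ⟨Ne.symm hxe.2, he⟩, rfl⟩)
    · exact Or.inl (Or.inl ⟨he, hxe, hye⟩)
  · rw [ce_of_isRotated hr] at hcE'
    rw [hr.perm.nodup_iff] at hnd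
    have hmem : ∀ v, v ∈ c ↔ v ∈ α :: (l₁ ++ β :: (l₂ ++ α' :: (l₃ ++ β' :: l₄))) :=
      fun v => hr.mem_iff
    refine absurd (hasMinor_of_alternating (x := x) (y := y) ?_ hcE' ?_ hxy h1.2 h2.2 h4.2 h5.2) hm.2
    · refine List.nodup_cons.2 ⟨?_, List.nodup_cons.2 ⟨by rwa [← hmem], hnd⟩⟩
      rw [List.mem_cons, ← hmem]
      exact not_or.2 ⟨hne, hxc⟩
    · intro v hv
      rw [List.mem_cons, List.mem_cons, ← hmem] at hv
      rcases hv with rfl | rfl | hv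
      exacts [hx, hy, hcWW v hv]
  · rw [ce_of_isRotated hr] at hcE'
    rw [hr.perm.nodup_iff] at hnd
    have hmem : ∀ v, v ∈ c ↔ v ∈ p :: (l₁ ++ q :: (l₂ ++ r :: l₃)) := fun v => hr.mem_iff
    refine absurd (hasMinor_of_common (x := x) (y := y) ?_ hcE' ?_ hxy
      ⟨h1.1.2, h1.2.1.2, h1.2.2.2⟩ ⟨h2.1.2, h2.2.1.2, h2.2.2.2⟩) hm.1
    · refine List.nodup_cons.2 ⟨?_, List.nodup_cons.2 ⟨by rwa [← hmem], hnd⟩⟩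
      rw [List.mem_cons, ← hmem]
      exact not_or.2 ⟨hne, hxc⟩
    · intro v hv
      rw [List.mem_cons, List.mem_cons, ← hmem] at hv
      rcases hv with rfl | rfl | hv
      exacts [hx, hy, hcWW v hv]

theorem hasFrame_of_noMinors (hs : ∀ a b, s(a, b) ∈ E → a ∈ W ∧ b ∈ W ∧ a ≠ b)
    (hW : TwoConn E W) (hm : NoMinors E W) : HasFrame E := by
  induction hn : W.ncard using Nat.strong_induction_on generalizing E W with
  | _ n ih =>
  by_cases h4 : W.ncard ≤ 4
  · exact hasFrame_of_ncard_le hW hs h4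
  push Not at h4
  by_cases h3 : ∀ u ∈ W, ∀ v ∈ W, u ≠ v → CutConn E (W \ {u, v})
  · obtain ⟨x, y, hxy, hU⟩ := exists_contractible hs h4 hW h3
    exact hasFrame_of_contract hs hxy hU hW h3 hm fun E' hs' hW' hm' =>
      ih _ (by rw [← hn]; exact Set.ncard_sdiff_singleton_lt_of_mem (hs _ _ hxy).2.1) hs' hW' hm' rfl
  · push Not at h3
    obtain ⟨u, hu, v, hv, huv, hcut⟩ := h3
    unfold CutConn at hcut
    push Not at hcut
    obtain ⟨B, hB, hBn, hBne, hno⟩ := hcut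
    let B' := (W \ {u, v}) \ B
    have hB' : B' ⊆ W \ {u, v} := Set.sdiff_subset
    have hBn' : B'.Nonempty := by
      rw [Set.nonempty_iff_ne_empty]
      exact fun h => hBne (hB.antisymm (Set.sdiff_eq_empty.1 h))
    have hBB : Disjoint B B' := Set.disjoint_sdiff_right
    have hc : ∀ x ∈ B, ∀ y ∈ W, s(x, y) ∈ E → y ∈ B ∨ y = u ∨ y = v := by
      intro x hx y hy he
      by_contra! h
      exact hno x hx y ⟨⟨hy, by simp [h.2.1, h.2.2]⟩, h.1⟩ he
    have hc' : ∀ x ∈ B', ∀ y ∈ W, s(x, y) ∈ E → y ∈ B' ∨ y = u ∨ y = v := by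
      intro x hx y hy he
      by_contra! h
      have hyB : y ∈ B := by
        by_contra hyB
        exact h.1 ⟨⟨hy, by simp [h.2.1, h.2.2]⟩, hyB⟩
      exact hno y hyB x hx (by rwa [Sym2.eq_swap])
    have key : ∀ B B' : Set V, B ⊆ W \ {u, v} → B' ⊆ W \ {u, v} → B.Nonempty → B'.Nonempty →
        Disjoint B B' → (∀ x ∈ B, ∀ y ∈ W, s(x, y) ∈ E → y ∈ B ∨ y = u ∨ y = v) →
        (∀ x ∈ B', ∀ y ∈ W, s(x, y) ∈ E → y ∈ B' ∨ y = u ∨ y = v) →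
        HasFrame (piece E B u v) := by
      intro B B' hB hB' hn hn' hBB hc hc'
      refine ih _ ?_ (W := insert u (insert v B)) ?_ (hW.piece hu hv huv hB hn hc)
        (NoMinors.piece hW hm hu hv huv hB hB' hn' hBB hc') rfl
      · rw [← ‹W.ncard = n›]
        refine Set.ncard_lt_ncard ⟨?_, fun h => ?_⟩
        · exact Set.insert_subset hu (Set.insert_subset hv (hB.trans Set.sdiff_subset))
        · obtain ⟨b, hb⟩ := hn'
          have h1 := (hB' hb).2
          rcases h (hB' hb).1 with h | h | h
          · exact h1 (Or.inl h)
          · exact h1 (Or.inr h)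
          · exact Set.disjoint_left.1 hBB h hb
      · rintro a b (h | h)
        · rcases Sym2.eq_iff.1 h with ⟨rfl, rfl⟩ | ⟨rfl, rfl⟩
          · exact ⟨by simp, by simp, huv⟩
          · exact ⟨by simp, by simp, huv.symm⟩
        · exact ⟨h.2 a (by simp), h.2 b (by simp), (hs a b h.1).2.2⟩
    obtain ⟨ι₁, d₁, h₁⟩ := key B B' hB hB' hBn hBn' hBB hc hc'
    obtain ⟨ι₂, d₂, h₂⟩ := key B' B hB' hB hBn' hBn hBB.symm hc' hc
    have hBu : u ∉ B ∧ v ∉ B := ⟨fun h => (hB h).2 (by simp), fun h => (hB h).2 (by simp)⟩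
    refine (h₁.glue h₂ huv (Or.inl rfl) (Or.inl rfl) ?_ ?_ ?_).mono ?_
    · rintro e (h | h) (h' | h')
      · exact h
      · exact h
      · exact h'
      · induction e with
        | _ a b =>
          have hab := (hs a b h.1).2.2
          have key : ∀ z ∈ s(a, b), z = u ∨ z = v := by
            intro z hz
            rcases h.2 z hz with h1 | h1 | h1
            · exact Or.inl h1
            · exact Or.inr h1
            · rcases h'.2 z hz with h2 | h2 | h2
              · exact Or.inl h2
              · exact Or.inr h2
              · exact absurd h2 (Set.disjoint_left.1 hBB h1)
          rcases key a (by simp) with rfl | rfl <;> rcases key b (by simp) with rfl | rfl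
          · exact absurd rfl hab
          · rfl
          · exact Sym2.eq_swap
          · exact absurd rfl hab
    · rintro w (h | h)
      · rcases Sym2.eq_iff.1 h with ⟨rfl, rfl⟩ | ⟨rfl, rfl⟩ <;> exact huv rfl
      · exact (hs w w h.1).2.2 rfl
    · intro x hxu hxv
      have aux : ∀ B : Set V, x ∉ B → ∀ w, s(x, w) ∉ piece E B u v := by
        rintro B hxB w (h | h)
        · rcases Sym2.eq_iff.1 h with ⟨rfl, rfl⟩ | ⟨rfl, rfl⟩
          · exact hxu rfl
          · exact hxv rfl
        · rcases h.2 x (by simp) with h | h | h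
          exacts [hxu h, hxv h, hxB h]
      by_cases hxB : x ∈ B
      · exact Or.inr (aux B' (Set.disjoint_left.1 hBB hxB))
      · exact Or.inl (aux B hxB)
    · intro e he
      induction e with
      | _ a b =>
        obtain ⟨ha, hb, hab⟩ := hs a b he
        have aux : ∀ z ∈ W, z ∈ insert u (insert v B) ∨ z ∈ insert u (insert v B') := by
          intro z hz
          by_cases h1 : z = u
          · exact Or.inl (Or.inl h1)
          by_cases h2 : z = v
          · exact Or.inl (Or.inr (Or.inl h2))
          by_cases h3 : z ∈ B
          · exact Or.inl (Or.inr (Or.inr h3))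
          · exact Or.inr (Or.inr (Or.inr ⟨⟨hz, by simp [h1, h2]⟩, h3⟩))
        by_cases hall : ∀ z ∈ s(a, b), z ∈ insert u (insert v B)
        · exact Or.inl (Or.inr ⟨he, hall⟩)
        · refine Or.inr (Or.inr ⟨he, ?_⟩)
          have hfin : ∀ a b, a ∈ W → b ∈ W → s(a, b) ∈ E → a ∉ insert u (insert v B) →
              ∀ z ∈ s(a, b), z ∈ insert u (insert v B') := by
            intro a b ha hb he ha' z hz
            have ha'' := (aux a ha).resolve_left ha'
            have haB' : a ∈ B' := by
              rcases ha'' with h | h | h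
              · exact absurd (Or.inl h) ha'
              · exact absurd (Or.inr (Or.inl h)) ha'
              · exact h
            rcases Sym2.mem_iff.1 hz with rfl | rfl
            · exact ha''
            · rcases hc' a haB' z hb he with h | h | h
              exacts [Or.inr (Or.inr h), Or.inl h, Or.inr (Or.inl h)]
          push Not at hall
          obtain ⟨z, hz, hz'⟩ := hall
          rcases Sym2.mem_iff.1 hz with rfl | rfl
          · exact hfin _ _ ha hb he hz'
          · rw [Sym2.eq_swap] at he ⊢
            exact hfin _ _ hb ha he hz'

end Contract

end

section

variable {V : Type*} {α : Type*}

/-- No loops, triangles or 4-cycles. -/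
structure Girth5 (E : Set (Sym2 V)) : Prop where
  loop : ∀ a, s(a, a) ∉ E
  tri : ∀ a b c, s(a, b) ∈ E → s(b, c) ∈ E → s(c, a) ∉ E
  quad : ∀ a b c d, s(a, b) ∈ E → s(b, c) ∈ E → s(c, d) ∈ E → s(d, a) ∈ E → a = c ∨ b = d

theorem Girth5.ne {E : Set (Sym2 V)} (h : Girth5 E) {a b : V} (hab : s(a, b) ∈ E) : a ≠ b := by
  rintro rfl
  exact h.loop _ hab

theorem Girth5.three_le {E : Set (Sym2 V)} (h : Girth5 E) {u v : V} {a : List V}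
    (hn : (u :: (a ++ [v])).Nodup) (hE : pe (u :: (a ++ [v])) ⊆ E) (huv : s(u, v) ∈ E)
    (ha : a ≠ []) : 3 ≤ a.length := by
  rcases a with _ | ⟨p, _ | ⟨q, _ | ⟨r, a⟩⟩⟩
  · simp at ha
  · simp [Set.insert_subset_iff] at hE
    exact (h.tri u p v hE.1 hE.2 (mem_swap huv)).elim
  · simp [Set.insert_subset_iff] at hE hn
    rcases h.quad u p q v hE.1 hE.2.1 hE.2.2 (mem_swap huv) with rfl | rfl <;> simp_all
  · simp

theorem Girth5.short_chordless {E : Set (Sym2 V)} (h : Girth5 E) {c : List V} (hn : c.Nodup)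
    (hE : ce c ⊆ E) (hc : c.length ≤ 7) {u v : V} (hu : u ∈ c) (hv : v ∈ c)
    (huv : s(u, v) ∈ E) : s(u, v) ∈ ce c := by
  obtain ⟨t, ht⟩ := rotated_to_head hu
  rw [ce_of_isRotated ht] at hE ⊢
  have hn' : (u :: t).Nodup := ht.nodup_iff.1 hn
  have hl : (u :: t).length = c.length := ht.perm.length_eq.symm
  have hv' : v ∈ u :: t := ht.mem_iff.1 hv
  have hvt : v ∈ t := by
    rcases List.mem_cons.1 hv' with rfl | hv'
    · exact (h.loop _ huv).elim
    · exact hv'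
  obtain ⟨a, b, rfl⟩ := List.append_of_mem hvt
  have hsp := ce_split u v a b
  rw [hsp] at hE ⊢
  rw [Set.union_subset_iff] at hE
  by_cases ha : a = []
  · left; simp [ha]
  by_cases hb : b = []
  · simp_all
  have h1 := h.three_le (a := a) (u := u) (v := v)
    (hn'.sublist (by simp)) hE.1 huv ha
  have h2 := h.three_le (a := b) (u := v) (v := u) (by
    grind) hE.2 (mem_swap huv) hb
  simp at hl
  omega

/-- The map `φ` is a proper colouring on `U`. -/
def Proper (E : Set (Sym2 V)) (U : Set V) (φ : V → α) : Prop :=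
  ∀ u ∈ U, ∀ v ∈ U, s(u, v) ∈ E → φ u ≠ φ v

theorem Proper.mono {E : Set (Sym2 V)} {U U' : Set V} {φ : V → α} (h : Proper E U φ)
    (hU : U' ⊆ U) : Proper E U' φ := fun u hu v hv => h u (hU hu) v (hU hv)

theorem Proper.congr {E : Set (Sym2 V)} {U : Set V} {φ φ' : V → α} (h : Proper E U φ)
    (hU : ∀ v ∈ U, φ' v = φ v) : Proper E U φ' := fun u hu v hv he => by
  rw [hU u hu, hU v hv]; exact h u hu v hv he

theorem Proper.insert {E : Set (Sym2 V)} {U : Set V} {φ : V → α} {x : V} (h : Proper E U φ)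
    (hx : s(x, x) ∉ E) (hU : ∀ v ∈ U, s(x, v) ∈ E → φ x ≠ φ v) : Proper E (insert x U) φ := by
  rintro u (rfl | hu) v (rfl | hv) he
  · exact (hx he).elim
  · exact hU v hv he
  · grind
  · exact h u hu v hv he

theorem Proper.update {E : Set (Sym2 V)} {U : Set V} {φ : V → α} {x : V} {a : α}
    [DecidableEq V] (h : Proper E U φ)
    (hx : s(x, x) ∉ E) (hxU : x ∉ U) (hU : ∀ v ∈ U, s(x, v) ∈ E → a ≠ φ v) :
    Proper E (Insert.insert x U) (Function.update φ x a) := by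
  have hne : ∀ v ∈ U, Function.update φ x a v = φ v := fun v hv => by grind
  refine Proper.insert (h.congr hne) hx fun v hv he => ?_
  grind

/-- The precolouring `ψ` of `P` extends to an `L`-colouring of `U`. -/
def Ext (E : Set (Sym2 V)) (L : V → Finset α) (U P : Set V) (ψ : V → α) : Prop :=
  ∃ φ : V → α, (∀ v ∈ P, φ v = ψ v) ∧ (∀ v ∈ U, v ∉ P → φ v ∈ L v) ∧ Proper E U φ

open Classical in
theorem Proper.glue {E : Set (Sym2 V)} {A B : Set V} {φ χ : V → α} (hA : Proper E A φ)
    (hB : Proper E B χ) (hag : ∀ v ∈ A, v ∈ B → φ v = χ v)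
    (hc : ∀ u ∈ A, u ∉ B → ∀ w ∈ B, w ∉ A → s(u, w) ∉ E) :
    Proper E (A ∪ B) (fun v => if v ∈ A then φ v else χ v) := by
  have key : ∀ u ∈ A, ∀ v ∈ B, v ∉ A → s(u, v) ∈ E → φ u ≠ χ v := fun u hu v hv hvA he => by
    have huB : u ∈ B := by grind
    rw [hag u hu huB]
    exact hB u huB v hv he
  intro u hu v hv he
  by_cases huA : u ∈ A <;> by_cases hvA : v ∈ A <;> simp only [huA, hvA, if_true, if_false]
  · exact hA u huA v hvA he
  · exact key u huA v (hv.resolve_left hvA) hvA he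
  · exact (key v hvA u (hu.resolve_left huA) huA (mem_swap he)).symm
  · exact hB u (hu.resolve_left huA) v (hv.resolve_left hvA) he

theorem Ext.glue {E : Set (Sym2 V)} {L : V → Finset α} {A B U P : Set V} {φ χ ψ : V → α}
    (hU : U ⊆ A ∪ B) (hA : Proper E A φ)
    (hB : Proper E B χ) (hag : ∀ v ∈ A, v ∈ B → φ v = χ v)
    (hc : ∀ u ∈ A, u ∉ B → ∀ w ∈ B, w ∉ A → s(u, w) ∉ E) (hP : P ⊆ A ∪ B)
    (hφ : ∀ v ∈ A, v ∈ P → φ v = ψ v) (hχ : ∀ v ∈ B, v ∉ A → v ∈ P → χ v = ψ v)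
    (hφL : ∀ v ∈ A, v ∉ P → φ v ∈ L v) (hχL : ∀ v ∈ B, v ∉ A → v ∉ P → χ v ∈ L v) :
    Ext E L U P ψ := by
  classical
  refine ⟨fun v => if v ∈ A then φ v else χ v, fun v hv => ?_, fun v hv hvP => ?_,
    (hA.glue hB hag hc).mono hU⟩
  · grind
  grind

theorem CutConn.attach {E : Set (Sym2 V)} {C T : Set V} (hC : CutConn E C)
    (hT : ∀ t ∈ T, ∃ c ∈ C, s(c, t) ∈ E) : CutConn E (C ∪ T) := by
  intro S hS hn hne
  by_cases hSC : (S ∩ C).Nonempty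
  · by_cases hCS : C ⊆ S
    · grind
    · obtain ⟨u, hu, w, hw, he⟩ := hC (S ∩ C) Set.inter_subset_right hSC
        fun h => hCS (Set.inter_eq_right.1 h)
      grind
  · obtain ⟨t, ht⟩ := hn
    have htC : t ∉ C := fun h => hSC ⟨t, ht, h⟩
    obtain ⟨c, hc, he⟩ := hT t ((hS ht).resolve_left htC)
    exact ⟨t, ht, c, ⟨Or.inl hc, fun h => hSC ⟨c, h, hc⟩⟩, mem_swap he⟩

theorem CutConn.inter_side {E : Set (Sym2 V)} {P A B : Set V} (hP : CutConn E P)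
    (hPU : P ⊆ A ∪ B) (hc : ∀ u ∈ A, u ∉ B → ∀ w ∈ B, w ∉ A → s(u, w) ∉ E)
    (hQ : ∀ u ∈ P, u ∈ A → u ∈ B → ∀ v ∈ P, v ∈ A → v ∈ B → u = v ∨ s(u, v) ∈ E) :
    CutConn E (P ∩ A) := by
  intro S hS hn hne
  by_contra! hcl
  have hcl' : ∀ u ∈ S, ∀ w ∈ P, w ∈ A → s(u, w) ∈ E → w ∈ S := fun u hu w hw hwA he => by grind
  by_cases hSB : ∃ z ∈ S, z ∈ B
  · obtain ⟨z, hz, hzB⟩ := hSB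
    have hall : ∀ v ∈ P, v ∈ A → v ∈ B → v ∈ S := fun v hv hvA hvB => by grind
    have : S ∪ (P ∩ B) = P := by
      refine hP.eq_of_closed (a := z)
        (Set.union_subset (fun x hx => (hS hx).1) Set.inter_subset_left) (Or.inl hz) ?_
      grind
    grind
  · obtain ⟨z, hz⟩ := hn
    push Not at hSB
    have : S = P := by
      refine hP.eq_of_closed (a := z) (fun x hx => (hS hx).1) hz ?_
      grind
    grind

variable {ι : Type*}

/-- The induction hypotheses of the extension theorem for a precoloured set `P`. -/
structure Good (E : Set (Sym2 V)) (d : Sym2 V → Sym2 ι) (f : ι) (L : V → Finset α)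
    (U P : Set V) (ψ : V → α) : Prop where
  sub : P ⊆ outer E d f U
  card : P.ncard ≤ 6
  conn : CutConn E P
  proper : Proper E P ψ
  two : ∀ v ∈ U, v ∉ P → 2 ≤ (L v).card
  inner : ∀ v ∈ U, v ∉ outer E d f U → 3 ≤ (L v).card
  indep : ∀ u ∈ U, u ∉ P → ∀ v ∈ U, v ∉ P → (L u).card < 3 → (L v).card < 3 → s(u, v) ∉ E
  far : P.ncard ≤ 1 ∨ ∀ p ∈ P, ∀ v ∈ U, v ∉ P → (L v).card < 3 → s(p, v) ∉ E

/-- Every good precolouring of a proper subset of `U` extends. -/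
def IH (α : Type*) (E : Set (Sym2 V)) (d : Sym2 V → Sym2 ι) (f : ι) (U : Set V) : Prop :=
  ∀ U' ⊂ U, ∀ (L : V → Finset α) (P : Set V) (ψ : V → α),
    Good E d f L U' P ψ → Ext E L U' P ψ

variable {E : Set (Sym2 V)} {d : Sym2 V → Sym2 ι} {f : ι} {L : V → Finset α} {U P A B : Set V}
  {ψ : V → α} [Finite V]

theorem Good.restrict (h : Good E d f L U P ψ) (hA : A ⊆ U) (hc : CutConn E (P ∩ A)) :
    Good E d f L A (P ∩ A) ψ where
  sub := fun _ hv => outer_anti hA (h.sub hv.1) hv.2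
  card := (Set.ncard_le_ncard Set.inter_subset_left).trans h.card
  conn := hc
  proper := h.proper.mono Set.inter_subset_left
  two := fun v hv hvP => h.two v (hA hv) fun h => hvP ⟨h, hv⟩
  inner := fun v hv hvo => h.inner v (hA hv) fun h => hvo (outer_anti hA h hv)
  indep := fun u hu huP v hv hvP => h.indep u (hA hu) (fun h => huP ⟨h, hu⟩) v (hA hv)
    (fun h => hvP ⟨h, hv⟩)
  far := h.far.imp (fun h => (Set.ncard_le_ncard Set.inter_subset_left).trans h)
    fun h p hp v hv hvP => h p hp.1 v (hA hv) fun h => hvP ⟨h, hv⟩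

theorem Good.reduce (h : Good E d f L U P ψ) (hIH : IH α E d f U)
    (hU : A ∪ B = U) (hAU : A ≠ U) (hBU : B ≠ U)
    (hc : ∀ u ∈ A, u ∉ B → ∀ w ∈ B, w ∉ A → s(u, w) ∉ E)
    (hPA : CutConn E (P ∩ A)) (hQo : A ∩ B ⊆ outer E d f B)
    {T : Set V} (hT : ∀ t ∈ B, t ∉ P → t ∉ A → (L t).card < 3 → (∃ q ∈ A ∩ B, s(q, t) ∈ E) → t ∈ T)
    (hTo : ∀ t ∈ T, t ∈ B ∧ t ∉ P ∧ t ∉ A ∧ (L t).card < 3 ∧ ∃ q ∈ A ∩ B, s(q, t) ∈ E)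
    (hcard : ((P ∩ B) ∪ (A ∩ B) ∪ T).ncard ≤ 6) (hconn : CutConn E ((P ∩ B) ∪ (A ∩ B)))
    (huniq : ∀ t ∈ T, ∀ q ∈ A ∩ B, ∀ q' ∈ A ∩ B, s(q, t) ∈ E → s(q', t) ∈ E → q = q')
    (hPQ : ∀ p ∈ P, p ∈ B → p ∉ A → ∀ q ∈ A ∩ B, q ∉ P → s(p, q) ∉ E)
    (hfar : ∀ p ∈ P, p ∈ B → p ∉ A → ∀ v ∈ B, v ∉ P → v ∉ A → (L v).card < 3 → s(p, v) ∉ E) :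
    Ext E L U P ψ := by
  classical
  have hA' : A ⊆ U := hU ▸ Set.subset_union_left
  have hB' : B ⊆ U := hU ▸ Set.subset_union_right
  have hPU : P ⊆ U := fun p hp => (h.sub hp).1
  obtain ⟨φ, hφP, hφL, hφ⟩ := hIH A (hA'.ssubset_of_ne hAU) L _ ψ (h.restrict hA' hPA)
  have hch : ∀ t, ∃ a, t ∈ T → a ∈ L t ∧ ∀ q ∈ A ∩ B, s(q, t) ∈ E → a ≠ φ q := fun t => by
    by_cases ht : t ∈ T
    swap
    · grind
    obtain ⟨htB, htP, htA, -, q, hq, hqt⟩ := hTo t ht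
    have h2 := h.two t (hB' htB) htP
    obtain ⟨a, ha⟩ : ((L t).erase (φ q)).Nonempty := by
      rw [← Finset.card_pos]
      have := Finset.pred_card_le_card_erase (s := L t) (a := φ q)
      omega
    rw [Finset.mem_erase] at ha
    refine ⟨a, fun _ => ⟨ha.2, fun q' hq' hq't => ?_⟩⟩
    rw [← huniq t ht q hq q' hq' hqt hq't]
    exact ha.1
  choose τ hτ' using hch
  have hτL := fun t ht => (hτ' t ht).1
  have hτ := fun t ht => (hτ' t ht).2
  set ψB : V → α := fun v => if v ∈ A then φ v else if v ∈ P then ψ v else τ v with hψB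
  have e1 : ∀ v ∈ A, ψB v = φ v := fun v hv => by simp [hψB, hv]
  have e2 : ∀ v ∈ P, ψB v = ψ v := fun v hv => by
    by_cases hvA : v ∈ A
    · rw [e1 v hvA, hφP v ⟨hv, hvA⟩]
    · simp [hψB, hv, hvA]
  have e3 : ∀ v ∈ T, ψB v = τ v := fun v hv => by
    obtain ⟨-, h2, h3, -⟩ := hTo v hv
    simp [hψB, h2, h3]
  have hTB : ∀ t ∈ T, t ∈ outer E d f B := fun t ht => by
    obtain ⟨htB, htP, htA, ht3, -⟩ := hTo t ht
    by_contra hto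
    have := h.inner t (hB' htB) fun hh => hto (outer_anti hB' hh htB)
    omega
  have hGB : Good E d f L B ((P ∩ B) ∪ (A ∩ B) ∪ T) ψB := by
    refine ⟨?_, hcard, ?_, ?_, ?_, ?_, ?_, Or.inr ?_⟩
    · rintro v ((hv | hv) | hv)
      · exact outer_anti hB' (h.sub hv.1) hv.2
      · exact hQo hv
      · exact hTB v hv
    · exact hconn.attach fun t ht => by
        obtain ⟨-, -, -, -, q, hq, he⟩ := hTo t ht
        exact ⟨q, Or.inr hq, he⟩
    · have hPT : ∀ t ∈ T, ∀ v ∈ (P ∩ B) ∪ (A ∩ B) ∪ T, s(t, v) ∈ E → ψB t ≠ ψB v := by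
        intro t ht v hv he
        obtain ⟨htB, htP, htA, ht3, -⟩ := hTo t ht
        rw [e3 t ht]
        rcases hv with hv | hv
        · by_cases hvA : v ∈ A
          · rw [e1 v hvA]
            exact hτ t ht v ⟨hvA, hv.elim (·.2) (·.2)⟩ (mem_swap he)
          · have hv := hv.resolve_right fun h => hvA h.1
            exact (hfar v hv.1 hv.2 hvA t htB htP htA ht3 (mem_swap he)).elim
        · obtain ⟨hvB, hvP, hvA, hv3, -⟩ := hTo v hv
          exact (h.indep t (hB' htB) htP v (hB' hvB) hvP ht3 hv3 he).elim
      intro u hu v hv he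
      by_cases huT : u ∈ T
      · exact hPT u huT v hv he
      by_cases hvT : v ∈ T
      · exact (hPT v hvT u hu (mem_swap he)).symm
      have hu := hu.resolve_right huT
      have hv := hv.resolve_right hvT
      by_cases huA : u ∈ A <;> by_cases hvA : v ∈ A
      · rw [e1 u huA, e1 v hvA]
        exact hφ u huA v hvA he
      · have hv := hv.resolve_right fun h => hvA h.1
        by_cases huP : u ∈ P
        · rw [e2 u huP, e2 v hv.1]
          exact h.proper u huP v hv.1 he
        · exact (hPQ v hv.1 hv.2 hvA u ⟨huA, hu.elim (·.2) (·.2)⟩ huP (mem_swap he)).elim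
      · have hu := hu.resolve_right fun h => huA h.1
        by_cases hvP : v ∈ P
        · rw [e2 v hvP, e2 u hu.1]
          exact h.proper u hu.1 v hvP he
        · exact (hPQ u hu.1 hu.2 huA v ⟨hvA, hv.elim (·.2) (·.2)⟩ hvP he).elim
      · have hu := hu.resolve_right fun h => huA h.1
        have hv := hv.resolve_right fun h => hvA h.1
        rw [e2 u hu.1, e2 v hv.1]
        exact h.proper u hu.1 v hv.1 he
    · exact fun v hv hvP => h.two v (hB' hv) fun h => hvP (Or.inl (Or.inl ⟨h, hv⟩))
    · exact fun v hv hvo => h.inner v (hB' hv) fun h => hvo (outer_anti hB' h hv)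
    · exact fun u hu huP v hv hvP => h.indep u (hB' hu) (fun h => huP (Or.inl (Or.inl ⟨h, hu⟩)))
        v (hB' hv) fun h => hvP (Or.inl (Or.inl ⟨h, hv⟩))
    · intro p hp v hv hvP hv3 he
      have hvP' : v ∉ P := fun h => hvP (Or.inl (Or.inl ⟨h, hv⟩))
      have hvA : v ∉ A := fun h => hvP (Or.inl (Or.inr ⟨h, hv⟩))
      rcases hp with hp | hp
      · by_cases hpA : p ∈ A
        · exact hvP (Or.inr (hT v hv hvP' hvA hv3 ⟨p, ⟨hpA, hp.elim (·.2) (·.2)⟩, he⟩))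
        · have hp := hp.resolve_right fun h => hpA h.1
          exact hfar p hp.1 hp.2 hpA v hv hvP' hvA hv3 he
      · obtain ⟨hpB, hpP, -, hp3, -⟩ := hTo p hp
        exact h.indep p (hB' hpB) hpP v (hB' hv) hvP' hp3 hv3 he
  obtain ⟨χ, hχP, hχL, hχ⟩ := hIH B (hB'.ssubset_of_ne hBU) L _ ψB hGB
  refine Ext.glue hU.ge hφ hχ (fun v hvA hvB => ?_) hc (hU ▸ hPU) (fun v hv hvP => hφP v ⟨hvP, hv⟩)
    (fun v hv hvA hvP => ?_) (fun v hv hvP => hφL v hv fun h => hvP h.1) (fun v hv hvA hvP => ?_)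
  · rw [hχP v (Or.inl (Or.inr ⟨hvA, hvB⟩)), e1 v hvA]
  · rw [hχP v (Or.inl (Or.inl ⟨hvP, hv⟩)), e2 v hvP]
  · by_cases hvT : v ∈ T
    · rw [hχP v (Or.inr hvT), e3 v hvT]
      exact hτL v hvT
    · exact hχL v hv fun h => h.elim (fun h => h.elim (fun h => hvP h.1) fun h => hvA h.1) hvT

end

section

variable {V : Type*} {α : Type*} {ι : Type*}
variable {E : Set (Sym2 V)} {d : Sym2 V → Sym2 ι} {f : ι} {L : V → Finset α}
  {U P A B Y : Set V} {ψ φ : V → α}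

theorem IH.mono (h : IH α E d f U) (hA : A ⊆ U) : IH α E d f A :=
  fun U' hU' => h U' (hU'.trans_subset hA)

theorem Disc.of_isRotated {c c' : List V} (h : Disc E d f U c) (hc : c ~r c') :
    Disc E d f U c' := by
  obtain ⟨n, hn, rfl⟩ := List.isRotated_iff_mod.1 hc
  rw [List.rotate_eq_drop_append_take hn]
  rw [← List.take_append_drop n c] at h
  exact h.rotate

open Classical in
/-- The colours in `L v` that do not occur on the neighbours of `v` in `Y`. -/
noncomputable def avoid (E : Set (Sym2 V)) (L : V → Finset α) (φ : V → α) (Y : Set V) (v : V) :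
    Finset α :=
  (L v).filter fun a => ∀ y ∈ Y, s(y, v) ∈ E → a ≠ φ y

theorem mem_avoid {v : V} {a : α} :
    a ∈ avoid E L φ Y v ↔ a ∈ L v ∧ ∀ y ∈ Y, s(y, v) ∈ E → a ≠ φ y := by
  classical
  simp [avoid]

theorem avoid_eq {v : V} (h : ∀ y ∈ Y, s(y, v) ∉ E) : avoid E L φ Y v = L v := by
  ext a
  rw [mem_avoid]
  grind

theorem card_le_avoid {v : V}
    (h : ∀ y ∈ Y, ∀ y' ∈ Y, s(y, v) ∈ E → s(y', v) ∈ E → y = y') :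
    (L v).card ≤ (avoid E L φ Y v).card + 1 := by
  classical
  by_cases hy : ∃ y ∈ Y, s(y, v) ∈ E
  · obtain ⟨y, hy, he⟩ := hy
    have : (L v).erase (φ y) ⊆ avoid E L φ Y v := fun a ha => by
      rw [Finset.mem_erase] at ha
      refine mem_avoid.2 ⟨ha.2, fun y' hy' he' => ?_⟩
      grind
    have := Finset.card_le_card this
    have := Finset.pred_card_le_card_erase (s := L v) (a := φ y)
    omega
  · push Not at hy
    rw [avoid_eq hy]
    omega

theorem Ext.of_avoid (h : Ext E (avoid E L φ Y) (U \ Y) P φ)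
    (hφ : Proper E (P ∪ Y) φ) : Ext E L U (P ∪ Y) φ := by
  classical
  obtain ⟨χ, hP, hL, hχ⟩ := h
  have key : ∀ u ∈ Y, ∀ v ∈ U, v ∉ Y → s(u, v) ∈ E → φ u ≠ χ v := fun u hu v hv hvY he => by
    by_cases hvP : v ∈ P
    · rw [hP v hvP]; exact hφ u (Or.inr hu) v (Or.inl hvP) he
    · exact ((mem_avoid.1 (hL v ⟨hv, hvY⟩ hvP)).2 u hu he).symm
  refine ⟨fun v => if v ∈ Y then φ v else χ v, fun v hv => ?_, fun v hv hvP => ?_, ?_⟩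
  · grind
  · simp only [if_neg fun h : v ∈ Y => hvP (Or.inr h)]
    exact (mem_avoid.1 (hL v ⟨hv, fun h => hvP (Or.inr h)⟩ fun h => hvP (Or.inl h))).1
  · intro u hu v hv he
    by_cases huY : u ∈ Y <;> by_cases hvY : v ∈ Y <;> simp only [huY, hvY, if_true, if_false]
    · exact hφ u (Or.inr huY) v (Or.inr hvY) he
    · exact key u huY v hv hvY he
    · exact (key v hvY u hu huY (mem_swap he)).symm
    · exact hχ u ⟨hu, huY⟩ v ⟨hv, hvY⟩ he

theorem nbr_of_mem_ce {w y y' z : V} {l : List V} (hn : (w :: y :: (l ++ [y'])).Nodup)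
    (h : s(w, z) ∈ ce (w :: y :: (l ++ [y']))) : z = y ∨ z = y' := by
  have e : w :: y :: (l ++ [y']) = w :: ((y :: l) ++ [y']) := rfl
  rw [e, ce_eq_insert] at h
  rcases h with h | h
  · grind
  · simp only [List.cons_append, pe_cons_cons, Set.mem_insert_iff] at h
    rcases h with h | h
    · grind
    · have := mem_of_mem_pe h (Sym2.mem_mk_left w z)
      grind

theorem exists_color (L : Finset α) (S : Finset α) (h : S.card < L.card) : ∃ a ∈ L, a ∉ S :=
  Finset.exists_mem_notMem_of_card_lt_card h

theorem split_at_two {c : List V} {y y' : V} (hy : y ∈ c) (hy' : y' ∈ c) (hne : y ≠ y') :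
    ∃ a b, c ~r y :: (a ++ y' :: b) := by
  obtain ⟨t, ht⟩ := rotated_to_head hy
  have : y' ∈ t := (List.mem_cons.1 (ht.mem_iff.1 hy')).resolve_left hne.symm
  obtain ⟨a, b, rfl⟩ := List.append_of_mem this
  exact ⟨a, b, ht⟩

variable [Fintype V] {W : Set V}

theorem Drawn.peel (hD : Drawn E d W) (hIH : IH α E d f U) (hne : Y.Nonempty)
    (hY : Y ⊆ outer E d f U) (hP : P ⊆ outer E d f U) (hPY : ∀ p ∈ P, p ∉ Y)
    (hcard : P.ncard ≤ 6) (hconn : CutConn E P) (hφ : Proper E (P ∪ Y) φ)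
    (htwo : ∀ v ∈ U, v ∉ P → v ∉ Y → 2 ≤ (avoid E L φ Y v).card)
    (hinner : ∀ v ∈ U, v ∉ outer E d f U → 3 ≤ (L v).card)
    (hindep : ∀ u ∈ U, u ∉ P → u ∉ Y → ∀ v ∈ U, v ∉ P → v ∉ Y → (avoid E L φ Y u).card < 3 →
      (avoid E L φ Y v).card < 3 → s(u, v) ∉ E)
    (hfar : ∀ p ∈ P, ∀ v ∈ U, v ∉ P → v ∉ Y → (avoid E L φ Y v).card < 3 → s(p, v) ∉ E) :
    Ext E L U (P ∪ Y) φ := by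
  refine Ext.of_avoid (hIH _ ?_ _ P φ ?_) hφ
  · obtain ⟨y, hy⟩ := hne
    exact ⟨Set.sdiff_subset, fun h => (h (hY hy).1).2 hy⟩
  · refine ⟨fun p hp => outer_anti Set.sdiff_subset (hP hp) ⟨(hP hp).1, hPY p hp⟩, hcard, hconn,
      hφ.mono Set.subset_union_left, fun v hv hvP => htwo v hv.1 hvP hv.2, fun v hv hvo => ?_,
      fun u hu huP v hv hvP => hindep u hu.1 huP hu.2 v hv.1 hvP hv.2,
      Or.inr fun p hp v hv hvP => hfar p hp v hv.1 hvP hv.2⟩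
    rw [avoid_eq fun y hy he => hvo ?_]
    · exact hinner v hv.1 fun h => hvo (outer_anti Set.sdiff_subset h hv)
    · exact outer_anti (Set.sdiff_subset_sdiff_right (Set.singleton_subset_iff.2 hy))
        (hD.outer_delete (hY hy) hv.1 he) hv

set_option maxHeartbeats 2000000 in
theorem Drawn.cyc (hD : Drawn E d W) (hg : Girth5 E) :
    ∀ (n : ℕ) {U : Set V} {c : List V} {ψ : V → α}, U.ncard ≤ n → U ⊆ W → IH α E d f U →
    Disc E d f U c → c.length ≤ 8 → Proper E {v | v ∈ c} ψ →
    (∀ v ∈ U, v ∉ c → 3 ≤ (L v).card) → Ext E L U {v | v ∈ c} ψ := by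
  classical
  intro n
  induction n with
  | zero =>
    intro U c ψ hn _ _ hc
    have h0 : U = ∅ := by
      rw [← Set.ncard_eq_zero]; omega
    have := hc.three
    rcases c with _ | ⟨a, c⟩
    · simp at this
    · have := hc.mem (v := a) (by simp)
      simp [h0] at this
  | succ n ih =>
    intro U c ψ hn hUW hIH hc hlen hψ hL
    by_cases hw : ∃ w ∈ U, w ∉ c ∧ ∃ y ∈ c, ∃ y' ∈ c, y ≠ y' ∧ s(w, y) ∈ E ∧ s(w, y') ∈ E
    · obtain ⟨w, hwU, hwc, y, hy, y', hy', hne, hwy, hwy'⟩ := hw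
      obtain ⟨a, b, hab⟩ := split_at_two hy hy' hne
      have hc' := hc.of_isRotated hab
      have hmem : ∀ v, v ∈ c ↔ v = y ∨ v ∈ a ∨ v = y' ∨ v ∈ b := fun v => by
        rw [hab.mem_iff]; simp
      have hlen' : a.length + b.length + 2 ≤ 8 := by
        have := hab.perm.length_eq; simp at this; omega
      have hnd := hc'.nodup
      have hce := hc'.ce_subset
      rw [ce_split, Set.union_subset_iff] at hce
      have hwa : w ∉ a := fun h => hwc ((hmem w).2 (by simp [h]))
      have hwb : w ∉ b := fun h => hwc ((hmem w).2 (by simp [h]))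
      have hwy0 : w ≠ y := fun h => hwc (h ▸ hy)
      have hwy0' : w ≠ y' := fun h => hwc (h ▸ hy')
      have hyy : s(y, y') ∉ E := fun h => hg.tri w y y' hwy h (mem_swap hwy')
      have hlong : ∀ {y y' : V} {a : List V}, s(w, y) ∈ E → s(w, y') ∈ E → y ≠ y' →
          s(y, y') ∉ E → pe (y :: (a ++ [y'])) ⊆ E → w ∉ a → 2 ≤ a.length := by
        intro y y' a hwy hwy' hne hyy hpe hwa
        rcases a with _ | ⟨p, _ | ⟨q, a⟩⟩
        · simp_all
        · simp [Set.insert_subset_iff] at hpe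
          rcases hg.quad w y p y' hwy hpe.1 hpe.2 (mem_swap hwy') with h | h
          · simp [h] at hwa
          · exact (hne h).elim
        · simp
      have ha2 := hlong hwy hwy' hne hyy hce.1 hwa
      have hb2 := hlong hwy' hwy hne.symm (Sym2.eq_swap ▸ hyy) hce.2 hwb
      obtain ⟨U₁, U₂, hD₁, hD₂, hU, hmeet, hcr⟩ := hD.split hUW hc' (m := [w])
        (by grind) (by
          simp [Set.insert_subset_iff, hwy', mem_swap hwy]) (by simpa using hwU)
        (by simp [hwa, hwb]) (by
          intro p hp q hq he
          have := hg.ne he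
          simp at hp hq
          rcases hp with rfl | rfl | rfl <;> rcases hq with rfl | rfl | rfl <;>
            first
            | exact (this rfl).elim
            | exact (hyy he).elim
            | exact (hyy (mem_swap he)).elim
            | simp [Sym2.eq_swap]) (by simp) (by simp)
      simp only [List.reverse_singleton] at hD₁
      have hyU : ∀ v, v = y ∨ v = w ∨ v = y' → v ∈ U₁ ∧ v ∈ U₂ := fun v hv =>
        ⟨hD₁.mem (by simp; tauto), hD₂.mem (by simp; tauto)⟩
      have hmeet' : ∀ v ∈ U₁, v ∈ U₂ → v = y ∨ v = w ∨ v = y' := fun v h1 h2 => by grind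
      have hnd' := hnd
      simp only [List.nodup_cons, List.nodup_append, List.mem_append, List.mem_cons] at hnd'
      have hs₁ : U₁ ⊂ U := by
        refine ⟨hU ▸ Set.subset_union_left, fun h => ?_⟩
        rcases b with _ | ⟨z, b⟩
        · simp at hb2
        have := hmeet' z (h (hc'.mem (by simp))) (hD₂.mem (by simp))
        grind
      have hs₂ : U₂ ⊂ U := by
        refine ⟨hU ▸ Set.subset_union_right, fun h => ?_⟩
        rcases a with _ | ⟨z, a⟩
        · simp at ha2
        have := hmeet' z (hD₁.mem (by simp)) (h (hc'.mem (by simp)))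
        grind
      have hn₁ := Set.ncard_lt_ncard hs₁
      have hn₂ := Set.ncard_lt_ncard hs₂
      have hnb : ∀ v ∈ c, s(w, v) ∈ E → v = y ∨ v = y' := by
        intro v hv he
        by_contra hv'
        push Not at hv'
        rcases (hmem v).1 hv with h | h | h | h
        · exact hv'.1 h
        · have hr : (y :: (a ++ y' :: [w])) ~r (w :: y :: (a ++ [y'])) := by
            simpa using List.isRotated_append (l := y :: (a ++ [y'])) (l' := [w])
          have := hg.short_chordless hD₁.nodup hD₁.ce_subset (by simp; omega) (u := w) (v := v)
            (by simp) (by simp [h]) he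
          rw [ce_of_isRotated hr] at this
          have := nbr_of_mem_ce (hr.nodup_iff.1 hD₁.nodup) this
          tauto
        · exact hv'.2 h
        · have hr : (y :: ([w] ++ y' :: b)) ~r (w :: y' :: (b ++ [y])) := by
            simpa using List.isRotated_append (l := [y]) (l' := w :: y' :: b)
          have := hg.short_chordless hD₂.nodup hD₂.ce_subset (by simp; omega) (u := w) (v := v)
            (by simp) (by simp [h]) he
          rw [ce_of_isRotated hr] at this
          have := nbr_of_mem_ce (hr.nodup_iff.1 hD₂.nodup) this
          tauto
      obtain ⟨col, hcolL, hcol⟩ := exists_color (L w) {ψ y, ψ y'}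
        (Finset.card_le_two.trans_lt (hL w hwU hwc))
      set ψ' := Function.update ψ w col with hψ'
      have hpr : Proper E (insert w {v | v ∈ c}) ψ' := by
        refine hψ.update (hg.loop w) hwc fun v hv he => ?_
        simp at hcol
        rcases hnb v hv he with rfl | rfl <;> tauto
      have hold : ∀ v, v ∈ c → ψ' v = ψ v := fun v hv => by
        rw [hψ', Function.update_of_ne]; rintro rfl; exact hwc hv
      obtain ⟨χ₁, hP₁, hL₁, hχ₁⟩ := ih (by omega) (hs₁.subset.trans hUW) (hIH.mono hs₁.subset) hD₁
        (by simp; omega) (hpr.mono fun v hv => by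
          have := hmem v; simp at hv ⊢; grind) (fun v hv hvc => hL v (hs₁.subset hv) fun h => by
          have := hmem v
          have h2 : v ∈ b → v ∈ U₂ := fun h => hD₂.mem (by simp [h])
          have := hmeet' v hv
          simp at hvc; grind)
      obtain ⟨χ₂, hP₂, hL₂, hχ₂⟩ := ih (by omega) (hs₂.subset.trans hUW) (hIH.mono hs₂.subset) hD₂
        (by simp; omega) (hpr.mono fun v hv => by
          have := hmem v; simp at hv ⊢; grind) (fun v hv hvc => hL v (hs₂.subset hv) fun h => by
          have := hmem v
          have h2 : v ∈ a → v ∈ U₁ := fun h => hD₁.mem (by simp [h])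
          have := fun h => hmeet' v h hv
          simp at hvc; grind)
      have hUU := Set.ext_iff.1 hU
      simp only [Set.mem_union] at hUU
      have hca : ∀ v ∈ a, v ∈ U₁ := fun v h => hD₁.mem (by simp [h])
      have hcb : ∀ v ∈ b, v ∈ U₂ := fun v h => hD₂.mem (by simp [h])
      have hm₁ : ∀ v ∈ U₁, v ∈ c → v ∈ y :: (a ++ y' :: [w]) := fun v h1 h2 => by
        have := hmem v; have := hmeet' v h1; have := hcb v; simp; grind
      have hm₂ : ∀ v ∈ U₂, v ∈ c → v ∈ y :: ([w] ++ y' :: b) := fun v h1 h2 => by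
        have := hmem v; have := fun h => hmeet' v h h1; have := hca v; simp; grind
      refine Ext.glue hU.ge hχ₁ hχ₂ (fun v h1 h2 => ?_) hcr (fun v hv => hU.ge (hc.mem hv)) ?_ ?_ ?_ ?_
      · have := hmeet' v h1 h2
        rw [hP₁ v (by simp; grind), hP₂ v (by simp; grind)]
      · exact fun v h1 h2 => (hP₁ v (hm₁ v h1 h2)).trans (hold v h2)
      · exact fun v h1 _ h2 => (hP₂ v (hm₂ v h1 h2)).trans (hold v h2)
      · intro v h1 h2
        by_cases hvw : v = w
        · subst hvw
          rw [hP₁ v (by simp), hψ', Function.update_self]; exact hcolL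
        · refine hL₁ v h1 fun h => h2 ?_
          have := hmem v; simp at h ⊢; grind
      · intro v h1 h0 h2
        refine hL₂ v h1 fun h => ?_
        have := hmem v; have := hyU v; simp at h h2; grind
    · push Not at hw
      rcases c with _ | ⟨c0, _ | ⟨c1, t⟩⟩
      · have := hc.three; simp at this
      · have := hc.three; simp at this
      have hset : {v | v ∈ c0 :: c1 :: t} = {v | v ∈ t} ∪ {c0, c1} := by
        ext v; simp
      have h01 : s(c0, c1) ∈ E := hc.ce_subset (by simp [ce])
      have hnd := hc.nodup
      simp only [List.nodup_cons, List.mem_cons] at hnd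
      have huniq : ∀ v ∈ U, v ∉ c0 :: c1 :: t → ∀ y ∈ c0 :: c1 :: t, ∀ y' ∈ c0 :: c1 :: t,
          s(y, v) ∈ E → s(y', v) ∈ E → y = y' := fun v hv hvc y hy y' hy' h h' => by
        by_contra hne
        exact hw v hv hvc y hy y' hy' hne (mem_swap h) (mem_swap h')
      have h3 := hc.three
      rw [hset] at hψ ⊢
      have hav : ∀ v ∈ U, v ∉ c0 :: c1 :: t → (avoid E L ψ {c0, c1} v).card < 3 →
          s(c0, v) ∈ E ∨ s(c1, v) ∈ E := fun v hv hvc h => by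
        by_contra hh
        push Not at hh
        rw [avoid_eq (by simpa using hh)] at h
        have := hL v hv hvc
        omega
      refine hD.peel hIH ⟨c0, by simp⟩ ?_ ?_ ?_ ?_ ?_ hψ ?_ ?_ ?_ ?_
      · rintro v (rfl | rfl) <;> rw [hc.outer_iff] <;> simp
      · intro v hv
        rw [hc.outer_iff]; simp at hv; simp [hv]
      · rintro p hp (rfl | rfl) <;> simp at hp <;> tauto
      · have : {v | v ∈ t} = (t.toFinset : Set V) := by ext; simp
        rw [this, Set.ncard_coe_finset]
        have := t.toFinset_card_le
        simp at hlen; omega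
      · refine cutConn_list t fun e he => hc.ce_subset ?_
        have := pe_suffix_subset [c0, c1] t he
        have := pe_prefix_subset ([c0, c1] ++ t) [c0] this
        exact this
      · intro v hv hvt hvy
        have hvc : v ∉ c0 :: c1 :: t := by
          simp at hvt hvy ⊢; tauto
        have := hL v hv hvc
        have := card_le_avoid (E := E) (L := L) (φ := ψ) (Y := {c0, c1}) (v := v)
          fun y hy y' hy' => huniq v hv hvc y (by simp at hy ⊢; tauto) y' (by simp at hy' ⊢; tauto)
        omega
      · exact fun v hv hvo => hL v hv fun h => hvo ((hc.outer_iff v).2 h)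
      · intro u hu hut huy v hv hvt hvy hu3 hv3 he
        have huc : u ∉ c0 :: c1 :: t := by
          simp at hut huy ⊢; tauto
        have hvc : v ∉ c0 :: c1 :: t := by
          simp at hvt hvy ⊢; tauto
        simp at huc hvc
        rcases hav u hu (by simp; tauto) hu3 with h | h <;>
          rcases hav v hv (by simp; tauto) hv3 with h' | h'
        · exact hg.tri _ _ _ h he (mem_swap h')
        · rcases hg.quad _ _ _ _ h he (mem_swap h') (mem_swap h01) with h | h <;> tauto
        · rcases hg.quad _ _ _ _ h he (mem_swap h') h01 with h | h <;> tauto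
        · exact hg.tri _ _ _ h he (mem_swap h')
      · intro p hp v hv hvt hvy hv3 he
        have hvc : v ∉ c0 :: c1 :: t := by
          simp at hvt hvy ⊢; tauto
        simp at hp
        rcases hav v hv hvc hv3 with h | h
        · have := huniq v hv hvc p (by simp [hp]) c0 (by simp) he h
          subst this; tauto
        · have := huniq v hv hvc p (by simp [hp]) c1 (by simp) he h
          subst this; tauto

/-- A proper colouring extends into a region bounded by a short cycle. -/
theorem Drawn.cyc_extend (hD : Drawn E d W) (hg : Girth5 E) {R K : Set V} {c : List V}
    (hR : R ⊆ W) (hIH : IH α E d f R) (hc : Disc E d f R c) (hlen : c.length ≤ 8)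
    (hK : Proper E K φ) (hcK : ∀ v ∈ c, v ∈ K) (hmeet : ∀ v ∈ R, v ∈ K → v ∈ c)
    (hcr : ∀ u ∈ K, u ∉ R → ∀ w ∈ R, w ∉ K → s(u, w) ∉ E)
    (hL : ∀ v ∈ R, v ∉ K → 3 ≤ (L v).card) :
    ∃ χ : V → α, (∀ v ∈ K, χ v = φ v) ∧ (∀ v ∈ R, v ∉ K → χ v ∈ L v) ∧ Proper E (K ∪ R) χ := by
  classical
  obtain ⟨χ, h1, h2, h3⟩ := hD.cyc hg (L := L) (ψ := φ) _ le_rfl hR hIH hc hlen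
    (hK.mono fun v hv => hcK v hv)
    fun v hv hvc => hL v hv fun h => hvc (hmeet v hv h)
  refine ⟨fun v => if v ∈ K then φ v else χ v, fun v hv => by simp [hv], fun v hv hvK => ?_,
    hK.glue h3 (fun v hvK hvR => (h1 v (hmeet v hvR hvK)).symm) hcr⟩
  grind

end

section

variable {V : Type*} {α : Type*} {ι : Type*} [Fintype V]
variable {E : Set (Sym2 V)} {d : Sym2 V → Sym2 ι} {f : ι} {L : V → Finset α}
  {W U P K Y A B D R : Set V} {φ ψ : V → α} {c ps ys ws vs : List V} {v₁ v₂ v₃ a b : V}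

omit [Fintype V] in
theorem ncard_le_of_list [Finite V] {S : Set V} (K : List V) (h : ∀ v ∈ S, v ∈ K) :
    S.ncard ≤ K.length := by
  classical
  have h1 : S ⊆ (K.toFinset : Set V) := fun v hv => by simpa using h v hv
  calc S.ncard ≤ (K.toFinset : Set V).ncard := Set.ncard_le_ncard h1
    _ = K.toFinset.card := Set.ncard_coe_finset _
    _ ≤ K.length := K.toFinset_card_le

omit [Fintype V] in
theorem head_of_mem_ce {x y t : V} {a b : List V} (hn : (x :: (a ++ y :: b)).Nodup)
    (h : s(x, t) ∈ ce (x :: (a ++ y :: b))) (ht : t ∈ a) : ∃ a', a = t :: a' := by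
  rw [ce_split] at h
  simp only [List.nodup_cons, List.nodup_append, List.mem_append, List.mem_cons] at hn
  rcases h with h | h
  · rcases a with _ | ⟨z, a⟩
    · simp at ht
    · simp only [List.cons_append, pe_cons_cons, Set.mem_insert_iff] at h
      rcases h with h | h
      · grind
      · have := mem_of_mem_pe h (Sym2.mem_mk_left x t)
        grind
  · have := mem_of_mem_pe h (Sym2.mem_mk_right x t)
    grind

omit [Fintype V] in
theorem last_of_mem_ce {x y t : V} {a b : List V} (hn : (x :: (a ++ y :: b)).Nodup)
    (h : s(y, t) ∈ ce (x :: (a ++ y :: b))) (ht : t ∈ a) : ∃ a', a = a' ++ [t] := by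
  have hr : (x :: (a ++ y :: b)).reverse ~r (y :: (a.reverse ++ x :: b.reverse)) := by
    simpa using List.isRotated_append (l := b.reverse) (l' := y :: (a.reverse ++ [x]))
  rw [← ce_reverse, ce_of_isRotated hr] at h
  obtain ⟨a', ha'⟩ := head_of_mem_ce (hr.nodup_iff.1 (List.nodup_reverse.2 hn)) h (by simpa using ht)
  simp_all

/-- Reduction along a path `x, m, y` through the interior of a disc. -/
theorem Drawn.arc (hD : Drawn E d W) (h : Good E d f L U P ψ) (hIH : IH α E d f U) (hUW : U ⊆ W)
    {x y : V} {a₁ a₂ m : List V} (hc : Disc E d f U (x :: (a₁ ++ y :: a₂)))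
    (hm : (x :: (m ++ [y])).Nodup) (hmE : pe (x :: (m ++ [y])) ⊆ E) (hmU : ∀ v ∈ m, v ∈ U)
    (hmc : ∀ v ∈ m, v ∉ a₁ ∧ v ∉ a₂)
    (hch : ∀ a ∈ x :: (m ++ [y]), ∀ b ∈ x :: (m ++ [y]), s(a, b) ∈ E →
      s(a, b) ∈ pe (x :: (m ++ [y])))
    (ha₁ : a₁ ≠ []) (ha₂ : a₂ ≠ []) (hPA : CutConn E (P \ {v | v ∈ a₁}))
    (K : List V) (hK6 : K.length ≤ 6) (hKP : ∀ v ∈ P, v ∈ a₁ → v ∈ K)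
    (hKQ : ∀ v ∈ x :: (m ++ [y]), v ∈ K)
    (hKT : ∀ t ∈ a₁, t ∉ P → (L t).card < 3 → ∀ q ∈ x :: (m ++ [y]), s(q, t) ∈ E → t ∈ K)
    (hconn : CutConn E ({v | v ∈ P ∧ v ∈ a₁} ∪ {v | v ∈ x :: (m ++ [y])}))
    (huniq : ∀ t ∈ a₁, t ∉ P → (L t).card < 3 → ∀ q ∈ x :: (m ++ [y]), ∀ q' ∈ x :: (m ++ [y]),
      s(q, t) ∈ E → s(q', t) ∈ E → q = q')
    (hPQ : ∀ p ∈ P, p ∈ a₁ → ∀ q ∈ x :: (m ++ [y]), q ∉ P → s(p, q) ∉ E)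
    (hfar : ∀ p ∈ P, p ∈ a₁ → ∀ v ∈ a₁, v ∉ P → (L v).card < 3 → s(p, v) ∉ E) :
    Ext E L U P ψ := by
  have hl₁ : 1 ≤ a₁.length := List.length_pos_iff.2 ha₁
  have hl₂ : 1 ≤ a₂.length := List.length_pos_iff.2 ha₂
  obtain ⟨B, A, hB, hA, hU, hmeet, hcr⟩ := hD.split hUW hc hm hmE hmU hmc hch (by omega) (by omega)
  have hnd := hc.nodup
  simp only [List.nodup_cons, List.nodup_append, List.mem_append, List.mem_cons] at hnd
  have hQA : ∀ v ∈ x :: (m ++ [y]), v ∈ A := fun v hv => hA.mem (by simp at hv ⊢; tauto)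
  have hQB : ∀ v ∈ x :: (m ++ [y]), v ∈ B := fun v hv => hB.mem (by simp at hv ⊢; tauto)
  have hQ : ∀ v, v ∈ A ∩ B ↔ v ∈ x :: (m ++ [y]) := fun v =>
    ⟨fun hv => hmeet v hv.2 hv.1, fun hv => ⟨hQA v hv, hQB v hv⟩⟩
  have haB : ∀ v ∈ a₁, v ∈ B ∧ v ∉ A := fun v hv => by
    have h1 : v ∈ B := hB.mem (by simp [hv])
    refine ⟨h1, fun h2 => ?_⟩
    have h3 := hmeet v h1 h2
    have h4 := hmc v
    simp at h3; grind
  have haA : ∀ v ∈ a₂, v ∈ A ∧ v ∉ B := fun v hv => by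
    have h1 : v ∈ A := hA.mem (by simp [hv])
    refine ⟨h1, fun h2 => ?_⟩
    have h3 := hmeet v h2 h1
    have h4 := hmc v
    simp at h3; grind
  have hout : ∀ v ∈ outer E d f U, v ∈ B → v ∉ A → v ∈ a₁ := fun v hv hvB hvA => by
    have h1 := (hc.outer_iff v).1 hv
    have h2 := hQA v
    have h3 := haA v
    simp at h1 h2; grind
  have hshort : ∀ v ∈ U, (L v).card < 3 → v ∈ outer E d f U := fun v hv h3 => by
    by_contra ho
    have := h.inner v hv ho
    omega
  have hPo : ∀ p ∈ P, p ∈ U := fun p hp => (h.sub hp).1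
  have hPB : ∀ v, v ∈ (P ∩ B) ∪ (A ∩ B) ↔ (v ∈ P ∧ v ∈ a₁) ∨ v ∈ x :: (m ++ [y]) := fun v => by
    rw [Set.mem_union, hQ]
    constructor
    · rintro (hv | hv)
      · by_cases hvA : v ∈ A
        · exact Or.inr ((hQ v).1 ⟨hvA, hv.2⟩)
        · exact Or.inl ⟨hv.1, hout v (h.sub hv.1) hv.2 hvA⟩
      · exact Or.inr hv
    · rintro (hv | hv)
      · exact Or.inl ⟨hv.1, (haB v hv.2).1⟩
      · exact Or.inr hv
  have hBU : B ⊆ U := hU ▸ Set.subset_union_left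
  refine h.reduce (A := A) (B := B) (T := {t | t ∈ B ∧ t ∉ P ∧ t ∉ A ∧ (L t).card < 3 ∧
    ∃ q ∈ A ∩ B, s(q, t) ∈ E}) hIH ?_ ?_ ?_ ?_ ?_ ?_ ?_ ?_ ?_ ?_ ?_ ?_ ?_
  · rw [Set.union_comm, hU]
  · obtain ⟨z, t, rfl⟩ := List.exists_cons_of_ne_nil ha₁
    exact fun hh => (haB z (by simp)).2 (hh ▸ hc.mem (by simp))
  · obtain ⟨z, t, rfl⟩ := List.exists_cons_of_ne_nil ha₂
    exact fun hh => (haA z (by simp)).2 (hh ▸ hc.mem (by simp))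
  · exact fun u hu huB w hw hwA he => hcr w hw hwA u hu huB (mem_swap he)
  · convert hPA using 1
    ext v
    simp only [Set.mem_inter_iff, Set.mem_sdiff, Set.mem_ofPred_eq]
    refine and_congr_right fun hv => ⟨fun h1 h2 => (haB v h2).2 h1, fun h1 => ?_⟩
    by_contra hvA
    exact h1 (hout v (h.sub hv) ((hU ▸ hPo v hv : v ∈ B ∪ A).resolve_right hvA) hvA)
  · intro v hv
    rw [hB.outer_iff]
    have := (hQ v).1 hv
    simp at this ⊢; tauto
  · exact fun t ht h1 h2 h3 h4 => ⟨ht, h1, h2, h3, h4⟩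
  · exact fun t ht => ht
  · refine (ncard_le_of_list K ?_).trans hK6
    rintro v (hv | hv)
    · rcases (hPB v).1 hv with hv | hv
      · exact hKP v hv.1 hv.2
      · exact hKQ v hv
    · obtain ⟨h1, h2, h3, h4, q, hq, he⟩ := hv
      exact hKT v (hout v (hshort v (hBU h1) h4) h1 h3) h2 h4 q ((hQ q).1 hq) he
  · convert hconn using 1
    ext v
    exact hPB v
  · rintro t ⟨h1, h2, h3, h4, -⟩ q hq q' hq'
    exact huniq t (hout t (hshort t (hBU h1) h4) h1 h3) h2 h4 q ((hQ q).1 hq) q' ((hQ q').1 hq')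
  · exact fun p hp hpB hpA q hq => hPQ p hp (hout p (h.sub hp) hpB hpA) q ((hQ q).1 hq)
  · exact fun p hp hpB hpA v hv hvP hvA hv3 => hfar p hp (hout p (h.sub hp) hpB hpA) v
      (hout v (hshort v (hBU hv) hv3) hv hvA) hvP hv3

/-- The setting of a minimal counterexample with a chordless outer cycle. -/
structure Base (E : Set (Sym2 V)) (d : Sym2 V → Sym2 ι) (f : ι) (L : V → Finset α)
    (W U P : Set V) (ψ : V → α) : Prop where
  drawn : Drawn E d W
  girth : Girth5 E
  sub : U ⊆ W
  ih : IH α E d f U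
  good : Good E d f L U P ψ
  strict : ∀ p ∈ P, ∀ v ∈ U, v ∉ P → (L v).card < 3 → s(p, v) ∉ E
  notExt : ¬ Ext E L U P ψ
  chordless : ∀ u ∈ outer E d f U, ∀ v ∈ outer E d f U, s(u, v) ∈ E →
    s(u, v) ∈ bd E d (reg E d f U)

theorem Base.chord (h : Base E d f L W U P ψ) (hc : Disc E d f U c) {u v : V} (hu : u ∈ c)
    (hv : v ∈ c) (he : s(u, v) ∈ E) : s(u, v) ∈ ce c := by
  rw [← hc.bd_eq]
  exact h.chordless u ((hc.outer_iff u).2 hu) v ((hc.outer_iff v).2 hv) he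

theorem Base.three (h : Base E d f L W U P ψ) (hc : Disc E d f U c) {v : V} (hv : v ∈ U)
    (hvc : v ∉ c) : 3 ≤ (L v).card :=
  h.good.inner v hv fun h => hvc ((hc.outer_iff v).1 h)

/-- Reduction along an interior path cutting off an arc without precoloured vertices. -/
theorem Base.arc (h : Base E d f L W U P ψ)
    {x y : V} {a₁ a₂ m : List V} (hc : Disc E d f U (x :: (a₁ ++ y :: a₂)))
    (hm : (x :: (m ++ [y])).Nodup) (hmE : pe (x :: (m ++ [y])) ⊆ E) (hmU : ∀ v ∈ m, v ∈ U)
    (hmc : ∀ v ∈ m, v ∉ a₁ ∧ v ∉ a₂)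
    (hch : ∀ a ∈ x :: (m ++ [y]), ∀ b ∈ x :: (m ++ [y]), s(a, b) ∈ E →
      s(a, b) ∈ pe (x :: (m ++ [y])))
    (ha₁ : a₁ ≠ []) (ha₂ : a₂ ≠ []) (haP : ∀ v ∈ a₁, v ∉ P)
    (K : List V) (hK6 : K.length ≤ 6)
    (hKQ : ∀ v ∈ x :: (m ++ [y]), v ∈ K)
    (hKT : ∀ t ∈ a₁, (L t).card < 3 → ∀ q ∈ x :: (m ++ [y]), s(q, t) ∈ E → t ∈ K)
    (huniq : ∀ t ∈ a₁, (L t).card < 3 → ∀ q ∈ x :: (m ++ [y]), ∀ q' ∈ x :: (m ++ [y]),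
      s(q, t) ∈ E → s(q', t) ∈ E → q = q') : False := by
  refine h.notExt (h.drawn.arc h.good h.ih h.sub hc hm hmE hmU hmc hch ha₁ ha₂ ?_ K hK6
    (fun v h1 h2 => (haP v h2 h1).elim) hKQ (fun t ht _ => hKT t ht) ?_
    (fun t ht _ => huniq t ht) (fun p h1 h2 => (haP p h2 h1).elim)
    (fun p h1 h2 => (haP p h2 h1).elim))
  · convert h.good.conn using 1
    grind
  · convert cutConn_list _ hmE using 1
    grind

/-- No interior vertex has two neighbours at the ends of an arc without precoloured vertices. -/
theorem Base.no_two_chord (h : Base E d f L W U P ψ) :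
    ∀ (n : ℕ) {a₁ a₂ : List V} {w y y' : V}, a₁.length ≤ n →
    Disc E d f U (y :: (a₁ ++ y' :: a₂)) → (∀ v ∈ a₁, v ∉ P) → w ∈ U →
    w ∉ y :: (a₁ ++ y' :: a₂) → s(w, y) ∈ E → s(w, y') ∈ E → False := by
  intro n
  induction n with
  | zero =>
    intro a₁ a₂ w y y' hn hc ha hw hwc h1 h2
    have : a₁ = [] := List.length_eq_zero_iff.1 (by omega)
    subst this
    exact h.girth.tri w y y' h1 (hc.ce_subset (by rw [ce_split]; simp)) (mem_swap h2)
  | succ n ih =>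
    intro a₁ a₂ w y y' hn hc ha hw hwc h1 h2
    have hyy : s(y, y') ∉ E := fun he => h.girth.tri w y y' h1 he (mem_swap h2)
    have hce := hc.ce_subset
    rw [ce_split, Set.union_subset_iff] at hce
    have hn1 : a₁ ≠ [] := by
      rintro rfl; simp at hce; exact hyy hce.1
    have hn2 : a₂ ≠ [] := by
      rintro rfl; simp at hce; exact hyy (mem_swap hce.2)
    have hnd := hc.nodup
    have hnd' := hnd
    simp only [List.nodup_cons, List.nodup_append, List.mem_append, List.mem_cons] at hnd'
    simp at hwc
    have hwt : ∀ t ∈ a₁, s(w, t) ∉ E := by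
      intro t ht he
      obtain ⟨s, r, rfl⟩ := List.append_of_mem ht
      have hc' : Disc E d f U (y :: (s ++ t :: (r ++ y' :: a₂))) := by simpa using hc
      refine ih (a₁ := s) (by simp at hn; omega) hc' (fun v hv => ha v (by simp [hv])) hw ?_ h1 he
      simp; simp at hwc; tauto
    have hyt : ∀ t ∈ a₁, s(y, t) ∈ E → ∃ a', a₁ = t :: a' := fun t ht he =>
      head_of_mem_ce hnd (h.chord hc (by simp) (by simp [ht]) he) ht
    have hyt' : ∀ t ∈ a₁, s(y', t) ∈ E → ∃ a', a₁ = a' ++ [t] := fun t ht he =>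
      last_of_mem_ce hnd (h.chord hc (by simp) (by simp [ht]) he) ht
    refine h.arc hc (m := [w]) (by simp; grind) (by
        simp [Set.insert_subset_iff, h2, mem_swap h1]) (by simpa using hw)
        (by simp; grind) ?_ hn1 hn2 ha [y, w, y', a₁.head hn1, a₁.getLast hn1] (by simp)
        (by simp) ?_ ?_
    · intro p hp q hq he
      have := h.girth.ne he
      simp at hp hq
      rcases hp with rfl | rfl | rfl <;> rcases hq with rfl | rfl | rfl <;>
        first
        | exact (this rfl).elim
        | exact (hyy he).elim
        | exact (hyy (mem_swap he)).elim
        | simp [Sym2.eq_swap]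
    · intro t ht _ q hq he
      simp at hq
      rcases hq with rfl | rfl | rfl
      · obtain ⟨a', rfl⟩ := hyt t ht he; simp
      · exact (hwt t ht he).elim
      · obtain ⟨a', rfl⟩ := hyt' t ht he; simp
    · intro t ht _ q hq q' hq' he he'
      have key : s(y, t) ∈ E → s(y', t) ∉ E := fun e1 e2 => by
        rcases h.girth.quad w y t y' h1 e1 (mem_swap e2) (mem_swap h2) with hh | hh
        · subst hh; tauto
        · grind
      simp at hq hq'
      rcases hq with rfl | rfl | rfl <;> rcases hq' with rfl | rfl | rfl <;>
        first
        | rfl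
        | exact (hwt t ht he).elim
        | exact (hwt t ht he').elim
        | exact (key he he').elim
        | exact (key he' he).elim

/-- No interior path of length three cuts off an arc without precoloured vertices if it ends at
a precoloured vertex or at a vertex with a short list. -/
theorem Base.no_three_chord (h : Base E d f L W U P ψ) {a₁ a₂ : List V} {u x y y' : V}
    (hc : Disc E d f U (y :: (a₁ ++ y' :: a₂))) (ha : ∀ v ∈ a₁, v ∉ P) (hu : u ∈ U) (hx : x ∈ U)
    (huc : u ∉ y :: (a₁ ++ y' :: a₂)) (hxc : x ∉ y :: (a₁ ++ y' :: a₂))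
    (hyu : s(y, u) ∈ E) (hux : s(u, x) ∈ E) (hxy : s(x, y') ∈ E)
    (hy' : y' ∈ P ∨ (L y').card < 3) : False := by
  have hnd := hc.nodup
  have hnd' := hnd
  simp only [List.nodup_cons, List.nodup_append, List.mem_append, List.mem_cons] at hnd'
  have hyy0 : y ≠ y' := by grind
  have hxy1 : s(x, y) ∉ E := fun he => h.no_two_chord _ le_rfl hc ha hx hxc he hxy
  have huy1 : s(u, y') ∉ E := fun he => h.no_two_chord _ le_rfl hc ha hu huc
    (mem_swap hyu) he
  simp at huc hxc
  have hyy : s(y, y') ∉ E := fun he => by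
    rcases h.girth.quad y u x y' hyu hux hxy (mem_swap he) with hh | hh
    · exact hxc.1 hh.symm
    · exact huc.2.2.1 hh
  have hce := hc.ce_subset
  rw [ce_split, Set.union_subset_iff] at hce
  have hn1 : a₁ ≠ [] := by
    rintro rfl; simp_all
  have hn2 : a₂ ≠ [] := by
    rintro rfl; simp at hce; grind
  have hut : ∀ t ∈ a₁, s(u, t) ∉ E := by
    intro t ht he
    obtain ⟨s, r, rfl⟩ := List.append_of_mem ht
    have hc' : Disc E d f U (y :: (s ++ t :: (r ++ y' :: a₂))) := by simpa using hc
    refine h.no_two_chord _ le_rfl hc' (fun v hv => ha v (by simp [hv])) hu ?_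
      (mem_swap hyu) he
    simp; simp at huc; tauto
  have hxt : ∀ t ∈ a₁, s(x, t) ∉ E := by
    intro t ht he
    obtain ⟨s, r, rfl⟩ := List.append_of_mem ht
    have hc' : Disc E d f U (t :: (r ++ y' :: (a₂ ++ y :: s))) := by
      refine hc.of_isRotated ?_
      simpa using List.isRotated_append (l := y :: s) (l' := t :: (r ++ y' :: a₂))
    refine h.no_two_chord _ le_rfl hc' (fun v hv => ha v (by simp [hv])) hx ?_ he hxy
    simp; simp at hxc; tauto
  have hyt : ∀ t ∈ a₁, s(y, t) ∈ E → ∃ a', a₁ = t :: a' := fun t ht he =>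
    head_of_mem_ce hnd (h.chord hc (by simp) (by simp [ht]) he) ht
  have hyt' : ∀ t ∈ a₁, (L t).card < 3 → s(y', t) ∉ E := fun t ht h3 he => by
    have htU : t ∈ U := hc.mem (by simp [ht])
    by_cases hyP : y' ∈ P
    · exact h.strict y' hyP t htU (ha t ht) h3 he
    · exact h.good.indep y' (hc.mem (by simp)) hyP t htU (ha t ht) (hy'.resolve_left hyP) h3 he
  have hux0 := h.girth.ne hux
  refine h.arc hc (m := [u, x]) (by simp; grind) (by
      simp [Set.insert_subset_iff, hyu, hux, hxy]) (by simp [hu, hx])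
      (by simp; grind) ?_ hn1 hn2 ha [y, u, x, y', a₁.head hn1] (by simp)
      (by simp) ?_ ?_
  · intro p hp q hq he
    have := h.girth.ne he
    simp at hp hq
    rcases hp with rfl | rfl | rfl | rfl <;> rcases hq with rfl | rfl | rfl | rfl <;>
      first
      | exact (this rfl).elim
      | exact (hyy he).elim
      | exact (hyy (mem_swap he)).elim
      | exact (hxy1 he).elim
      | exact (hxy1 (mem_swap he)).elim
      | exact (huy1 he).elim
      | exact (huy1 (mem_swap he)).elim
      | simp [Sym2.eq_swap]
  · intro t ht h3 q hq he
    simp at hq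
    rcases hq with rfl | rfl | rfl | rfl
    · obtain ⟨a', rfl⟩ := hyt t ht he; simp
    · exact (hut t ht he).elim
    · exact (hxt t ht he).elim
    · exact (hyt' t ht h3 he).elim
  · intro t ht h3 q hq q' hq' he he'
    simp at hq hq'
    rcases hq with rfl | rfl | rfl | rfl <;> rcases hq' with rfl | rfl | rfl | rfl <;>
      first
      | rfl
      | exact (hut t ht he).elim
      | exact (hut t ht he').elim
      | exact (hxt t ht he).elim
      | exact (hxt t ht he').elim
      | exact (hyt' t ht h3 he).elim
      | exact (hyt' t ht h3 he').elim

theorem Drawn.mem_outer_of_inter (hD : Drawn E d W) {p v : V} (hA : CutConn E A)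
    (hBU : B ⊆ U) (hpA : p ∈ A) (hp : p ∈ outer E d f U) (hv : v ∈ A) (hvB : v ∈ B)
    (hAB : ∀ z ∈ A, z ∈ B → z = v) : v ∈ outer E d f B := by
  have hreg := reg_anti (E := E) (d := d) (f := f) hBU
  set Z : Set V := {z | z ∈ A ∧ ∃ w, s(z, w) ∈ E ∧ ∃ i ∈ d s(z, w), i ∈ reg E d f B} with hZ
  by_cases hvZ : v ∈ Z
  · exact ⟨hvB, hvZ.2⟩
  exfalso
  have hpZ : p ∈ Z := by
    obtain ⟨-, w, hw, i, hi, hiU⟩ := hp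
    grind
  have : Z = A := by
    refine hA.eq_of_closed (fun z hz => hz.1) hpZ fun z hz w hw he => ⟨hw, ?_⟩
    have hzB : z ∉ B := fun hzB => hvZ (hAB z hz.1 hzB ▸ hz)
    obtain ⟨-, u, hu, i, hi, hiB⟩ := hz
    rcases hD.rot (v := z) (S := reg E d f B)
      (fun w hw => hzB (reg_closed hw (Sym2.mem_mk_left z w))) with hall | hall
    · obtain ⟨j, hj⟩ := exists_face s(z, w) d
      grind
    grind
  grind

omit [Fintype V] in
theorem Good.glue_of_subset [Finite V] (h : Good E d f L U P ψ) (hIH : IH α E d f U)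
    (hU : A ∪ B = U) (hAU : A ≠ U) (hBU : B ≠ U) (hAB : A ∩ B ⊆ P)
    (hc : ∀ u ∈ A, u ∉ B → ∀ w ∈ B, w ∉ A → s(u, w) ∉ E)
    (hPA : CutConn E (P ∩ A)) (hPB : CutConn E (P ∩ B)) : Ext E L U P ψ := by
  have hA' : A ⊆ U := hU ▸ Set.subset_union_left
  have hB' : B ⊆ U := hU ▸ Set.subset_union_right
  obtain ⟨φ, hφP, hφL, hφ⟩ := hIH A (hA'.ssubset_of_ne hAU) L _ ψ (h.restrict hA' hPA)
  obtain ⟨χ, hχP, hχL, hχ⟩ := hIH B (hB'.ssubset_of_ne hBU) L _ ψ (h.restrict hB' hPB)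
  refine Ext.glue hU.ge hφ hχ (fun v hvA hvB => ?_) hc (fun p hp => hU.ge (h.sub hp).1)
    (fun v hv hvP => hφP v ⟨hvP, hv⟩) (fun v hv _ hvP => hχP v ⟨hvP, hv⟩)
    (fun v hv hvP => hφL v hv fun h => hvP h.1) (fun v hv _ hvP => hχL v hv fun h => hvP h.1)
  grind

theorem Drawn.glue_cut (hD : Drawn E d W) (h : Good E d f L U P ψ) (hIH : IH α E d f U)
    (hU : A ∪ B = U) (hAU : A ≠ U) (hBU : B ≠ U) {v : V} (hAB : A ∩ B = {v}) (hvP : v ∉ P)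
    (hP : P ⊆ A) (hPne : P.Nonempty) (hA : CutConn E A)
    (hc : ∀ u ∈ A, u ∉ B → ∀ w ∈ B, w ∉ A → s(u, w) ∉ E) : Ext E L U P ψ := by
  have hA' : A ⊆ U := hU ▸ Set.subset_union_left
  have hB' : B ⊆ U := hU ▸ Set.subset_union_right
  have hPA : P ∩ A = P := Set.inter_eq_left.2 hP
  have hv : v ∈ A ∩ B := hAB ▸ rfl
  have hAB' : ∀ z ∈ A, z ∈ B → z = v := fun z h1 h2 => by
    have : z ∈ A ∩ B := ⟨h1, h2⟩
    rwa [hAB] at this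
  have hPB : ∀ z ∈ B, z ∉ P := fun z hz hzP => hvP (hAB' z (hP hzP) hz ▸ hzP)
  obtain ⟨φ, hφP, hφL, hφ⟩ := hIH A (hA'.ssubset_of_ne hAU) L _ ψ
    (h.restrict hA' (hPA.symm ▸ h.conn))
  obtain ⟨p, hp⟩ := hPne
  have hG : Good E d f L B {v} φ := by
    refine ⟨?_, by simp, cutConn_singleton E v, ?_, fun z hz _ => h.two z (hB' hz) (hPB z hz),
      fun z hz hzo => h.inner z (hB' hz) fun h => hzo (outer_anti hB' h hz),
      fun u hu _ w hw _ => h.indep u (hB' hu) (hPB u hu) w (hB' hw) (hPB w hw),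
      Or.inl (by simp)⟩
    · rintro _ rfl
      exact hD.mem_outer_of_inter hA hB' (hP hp) (h.sub hp) hv.1 hv.2 hAB'
    · rintro _ rfl _ rfl he
      exact ((hD.supp _ _ he).2.2 rfl).elim
  obtain ⟨χ, hχP, hχL, hχ⟩ := hIH B (hB'.ssubset_of_ne hBU) L _ φ hG
  refine Ext.glue hU.ge hφ hχ (fun z hzA hzB => ?_) hc (fun p hp => hU.ge (h.sub hp).1)
    (fun z hz hzP => hφP z ⟨hzP, hz⟩) (fun z hz _ hzP => (hPB z hz hzP).elim)
    (fun z hz hzP => hφL z hz fun h => hzP h.1) (fun z hz hzA hzP => hχL z hz ?_)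
  · obtain rfl := hAB' z hzA hzB
    exact (hχP z rfl).symm
  · rintro rfl
    exact hzA hv.1

omit [Fintype V] in
theorem Good.ext_of_low [Finite V] (h : Good E d f L U P ψ) (hIH : IH α E d f U) {v p : V}
    (hv : v ∈ U) (hvP : v ∉ P) (hloop : s(v, v) ∉ E)
    (hp : ∀ w ∈ U, s(v, w) ∈ E → w = p) : Ext E L U P ψ := by
  classical
  have hsub : U \ {v} ⊆ U := Set.sdiff_subset
  have hPs : P ∩ (U \ {v}) = P := Set.inter_eq_left.2 fun q hq =>
    ⟨(h.sub hq).1, fun hqv => hvP (hqv ▸ hq)⟩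
  obtain ⟨φ, h1, h2, h3⟩ := hIH (U \ {v}) ⟨hsub, fun hh => (hh hv).2 rfl⟩ L _ ψ
    (h.restrict hsub (hPs.symm ▸ h.conn))
  rw [hPs] at h1 h2
  obtain ⟨a, haL, ha⟩ := exists_color (L v) {φ p} (by
    have := h.two v hv hvP
    simp; omega)
  have hne : ∀ u, u ≠ v → Function.update φ v a u = φ u := fun u hu =>
    Function.update_of_ne hu _ _
  refine ⟨Function.update φ v a, fun u hu => ?_, fun u hu huP => ?_, ?_⟩
  · grind
  · grind
  · refine (h3.update hloop (a := a) (by simp) fun w hw he => ?_).mono fun u hu => ?_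
    · grind
    grind

omit [Fintype V] in
theorem not_cutConn {S : Set V} (h : ¬ CutConn E S) :
    ∃ B ⊆ S, B.Nonempty ∧ B ≠ S ∧ ∀ u ∈ B, ∀ w ∈ S, w ∉ B → s(u, w) ∉ E := by
  unfold CutConn at h
  grind

theorem Drawn.twoConn_of_bad (hD : Drawn E d W) (h : Good E d f L U P ψ) (hIH : IH α E d f U)
    (hP : P.Nonempty) (hbad : ¬ Ext E L U P ψ) : TwoConn E U := by
  have hPU : P ⊆ U := fun p hp => (h.sub hp).1
  have hconn : CutConn E U := by
    by_contra hnc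
    obtain ⟨S, hS, hSn, hSU, hcl⟩ := not_cutConn hnc
    have hU : S ∪ (U \ S) = U := Set.union_sdiff_cancel hS
    have hcr : ∀ u ∈ S, u ∉ U \ S → ∀ w ∈ U \ S, w ∉ S → s(u, w) ∉ E :=
      fun u hu _ w hw hwS => hcl u hu w hw.1 hwS
    refine hbad (h.glue_of_subset (A := S) (B := U \ S) hIH hU hSU ?_ ?_ hcr ?_ ?_)
    · intro hh
      obtain ⟨s, hs⟩ := hSn
      grind
    · simp
    · exact h.conn.inter_side (hPU.trans hU.ge) hcr fun u _ h1 h2 => (h2.2 h1).elim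
    · exact h.conn.inter_side (B := S) (by grind)
        (fun u hu hu' w hw hw' he => hcr w hw hw' u hu hu' (mem_swap he))
        fun u _ h1 h2 => (h1.2 h2).elim
  refine ⟨?_, hconn, fun v hv => ?_⟩
  · by_contra hthree
    push Not at hthree
    obtain ⟨p, hp⟩ := hP
    by_cases hUP : U ⊆ P
    · exact hbad ⟨ψ, fun _ _ => rfl, fun v hv hvP => (hvP (hUP hv)).elim, h.proper.mono hUP⟩
    · obtain ⟨v, hv, hvP⟩ := Set.not_subset.1 hUP
      have hloop : ∀ v, s(v, v) ∉ E := fun v he => (hD.supp _ _ he).2.2 rfl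
      refine hbad (h.ext_of_low hIH hv hvP (hloop v) (p := p) fun w hw he => ?_)
      by_contra hwp
      exact hwp (hthree v hv p (hPU hp) w hw (fun h => hvP (h ▸ hp)) (by
        grind)).symm
  · by_contra hnc
    obtain ⟨S, hS, hSn, hSU, hcl⟩ := not_cutConn hnc
    have hvS : v ∉ S := fun h => (hS h).2 rfl
    have hSU' : S ⊆ U := fun z hz => (hS hz).1
    have hU : insert v S ∪ (U \ S) = U := by grind
    have hmeet : insert v S ∩ (U \ S) = {v} := by grind
    have hcr : ∀ u ∈ insert v S, u ∉ U \ S → ∀ w ∈ U \ S, w ∉ insert v S → s(u, w) ∉ E := by grind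
    have hcr' : ∀ u ∈ U \ S, u ∉ insert v S → ∀ w ∈ insert v S, w ∉ U \ S → s(u, w) ∉ E :=
      fun u hu hu' w hw hw' he => hcr w hw hw' u hu hu' (mem_swap he)
    have hAU : insert v S ≠ U := fun hh => hSU (Set.Subset.antisymm hS fun z hz =>
      (hh ▸ hz.1 : z ∈ insert v S).resolve_left hz.2)
    have hBU : U \ S ≠ U := by
      intro hh
      obtain ⟨s, hs⟩ := hSn
      grind
    have heq : ∀ u ∈ insert v S, u ∈ U \ S → u = v := fun u h1 h2 => by
      have : u ∈ insert v S ∩ (U \ S) := ⟨h1, h2⟩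
      rwa [hmeet] at this
    have key : ∀ (Q : Set V), Q ⊆ U → CutConn E Q →
        CutConn E (Q ∩ insert v S) ∧ CutConn E (Q ∩ (U \ S)) := fun Q hQ hQc =>
      ⟨hQc.inter_side (hQ.trans hU.ge) hcr fun u _ h1 h2 w _ h3 h4 =>
          Or.inl ((heq u h1 h2).trans (heq w h3 h4).symm),
        hQc.inter_side (B := insert v S) (by rw [Set.union_comm, hU]; exact hQ) hcr'
          fun u _ h1 h2 w _ h3 h4 => Or.inl ((heq u h2 h1).trans (heq w h4 h3).symm)⟩
    have hAs : insert v S ⊆ U := hU ▸ Set.subset_union_left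
    obtain ⟨hA, hB⟩ := key U subset_rfl hconn
    rw [Set.inter_eq_right.2 hAs] at hA
    rw [Set.inter_eq_right.2 Set.sdiff_subset] at hB
    by_cases hvP : v ∈ P
    · exact hbad (h.glue_of_subset hIH hU hAU hBU (by rw [hmeet]; simpa using hvP) hcr
        (key P hPU h.conn).1 (key P hPU h.conn).2)
    · by_cases hPS : (P ∩ S).Nonempty
      · obtain ⟨q, hq⟩ := hPS
        have : P ∩ S = P := by
          refine h.conn.eq_of_closed Set.inter_subset_left hq fun u hu w hw he => ⟨hw, ?_⟩
          by_contra hwS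
          exact hcl u hu.2 w ⟨hPU hw, fun h => hvP (h ▸ hw)⟩ hwS he
        exact hbad (hD.glue_cut h hIH hU hAU hBU hmeet hvP
          (fun z hz => Or.inr (this.ge hz).2) hP hA hcr)
      · exact hbad (hD.glue_cut h hIH (by rw [Set.union_comm, hU]) hBU hAU
          (by rw [Set.inter_comm, hmeet]) hvP (fun z hz => ⟨hPU hz, fun h => hPS ⟨z, hz, h⟩⟩) hP hB
          hcr')

open Classical in
omit [Fintype V] in
theorem countP_le_ncard [Finite V] {l : List V} (hl : l.Nodup) :
    l.countP (fun v => decide (v ∈ P)) ≤ P.ncard := by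
  rw [List.countP_eq_length_filter, ← List.toFinset_card_of_nodup (hl.filter _),
    ← Set.ncard_coe_finset]
  exact Set.ncard_le_ncard fun v hv => by simp at hv; exact hv.2

set_option maxHeartbeats 1600000 in
open Classical in
theorem Drawn.ext_of_chord (hD : Drawn E d W) (hg : Girth5 E) (h : Good E d f L U P ψ)
    (hIH : IH α E d f U) (hUW : U ⊆ W) : ∀ (n : ℕ) {x y : V} {a₁ a₂ : List V}, a₁.length ≤ n →
    Disc E d f U (x :: (a₁ ++ y :: a₂)) →
    a₁.countP (fun v => decide (v ∈ P)) ≤ a₂.countP (fun v => decide (v ∈ P)) →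
    a₁ ≠ [] → a₂ ≠ [] → s(x, y) ∈ E → Ext E L U P ψ := by
  intro n
  induction n with
  | zero =>
    grind
  | succ n ih =>
    intro x y a₁ a₂ hn hc hcount ha₁ ha₂ hxy
    by_contra hbad
    have hnd := hc.nodup
    have hnd' := hnd
    simp only [List.nodup_cons, List.nodup_append, List.mem_append, List.mem_cons] at hnd'
    have hce := hc.ce_subset
    rw [ce_split, Set.union_subset_iff] at hce
    have hmin : ∀ {s m r : List V} {w u : V}, x :: (a₁ ++ [y]) = s ++ w :: (m ++ u :: r) →
        m ≠ [] → (s ≠ [] ∨ r ≠ []) → s(w, u) ∉ E := by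
      intro s m r w u heq hm hsr he
      have hc' : Disc E d f U (w :: (m ++ u :: (r ++ a₂ ++ s))) := by
        have h1 : x :: (a₁ ++ y :: a₂) = s ++ (w :: (m ++ u :: (r ++ a₂))) := by grind
        rw [h1] at hc
        simpa using hc.rotate
      have hsub : m.Sublist a₁ ∧ m.length < a₁.length := by
        have hl := congrArg List.length heq
        simp at hl
        refine ⟨?_, ?_⟩
        · have h1 : (w :: (m ++ [u])).Sublist (x :: (a₁ ++ [y])) := by simp_all
          have h2 : (m ++ [u]).Sublist (a₁ ++ [y]) := h1.tail
          have h3 := h2.reverse.tail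
          grind
        · rcases hsr with h1 | h1
          · have := List.length_pos_iff.2 h1; omega
          · have := List.length_pos_iff.2 h1; omega
      grind
    have hxt : ∀ t ∈ a₁, s(x, t) ∈ E → ∃ a', a₁ = t :: a' := by
      intro t ht he
      obtain ⟨s, r, rfl⟩ := List.append_of_mem ht
      rcases s with _ | ⟨z, s⟩
      · exact ⟨r, rfl⟩
      · exact (hmin (s := []) (m := z :: s) (r := r ++ [y]) (by simp) (by simp) (by simp) he).elim
    have hyt : ∀ t ∈ a₁, s(y, t) ∈ E → ∃ a', a₁ = a' ++ [t] := by
      intro t ht he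
      obtain ⟨s, r, rfl⟩ := List.append_of_mem ht
      rcases r with _ | ⟨z, r⟩
      · exact ⟨s, rfl⟩
      grind
    obtain ⟨B, A, hB, hA, hU, hmeet, hcr⟩ := hD.split hUW hc (m := []) (by simp; grind)
      (by simp [hxy]) (by simp) (by simp) (by
        intro p hp q hq he
        have := hg.ne he
        simp at hp hq
        rcases hp with rfl | rfl <;> rcases hq with rfl | rfl <;>
        first
        | exact (this rfl).elim
        | simp [Sym2.eq_swap]) (by grind)
          (by have := List.length_pos_iff.2 ha₂; omega)
    have hcr' : ∀ u ∈ a₁, ∀ w ∈ a₂, s(u, w) ∉ E := by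
      intro u hu w hw
      have hu1 : u ∈ B := hB.mem (by simp [hu])
      have hw1 : w ∈ A := hA.mem (by simp [hw])
      refine hcr u hu1 (fun h1 => ?_) w hw1 (fun h1 => ?_)
      · grind
      grind
    have hPc : ∀ p ∈ P, p = x ∨ p ∈ a₁ ∨ p = y ∨ p ∈ a₂ := fun p hp => by
      simpa using (hc.outer_iff p).1 (h.sub hp)
    set A' : Set V := {v | v = x ∨ v = y ∨ v ∈ a₂} with hA'
    set B' : Set V := {v | v = x ∨ v = y ∨ v ∈ a₁} with hB'
    have hinter : ∀ u ∈ A', u ∈ B' → u = x ∨ u = y := by grind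
    have hpair : ∀ u, (u = x ∨ u = y) → ∀ v, (v = x ∨ v = y) → u = v ∨ s(u, v) ∈ E := by grind
    have hPA : CutConn E (P ∩ A') := by
      refine h.conn.inter_side (B := B') (fun p hp => ?_) (fun u hu hu' w hw hw' he => ?_)
        fun u _ h1 h2 v _ h3 h4 => hpair u (hinter u h1 h2) v (hinter v h3 h4)
      · grind
      grind
    have hPB : CutConn E (P ∩ B') := by
      refine h.conn.inter_side (B := A') (fun p hp => ?_) (fun u hu hu' w hw hw' he => ?_)
        fun u _ h1 h2 v _ h3 h4 => hpair u (hinter u h2 h1) v (hinter v h4 h3)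
      · grind
      grind
    have hmany : ∀ p ∈ P, p ∈ a₁ → (∃ q ∈ P, q ∈ a₂) ∧ (x ∈ P ∨ y ∈ P) := by
      intro p hp hpa
      have h1 : 0 < a₁.countP (fun v => decide (v ∈ P)) :=
        List.countP_pos_iff.2 ⟨p, hpa, by simpa using hp⟩
      obtain ⟨q, hqa, hq⟩ := List.countP_pos_iff.1 (h1.trans_le hcount)
      have hq : q ∈ P := by simpa using hq
      refine ⟨⟨q, hq, hqa⟩, ?_⟩
      by_contra hno
      have : {v | v ∈ P ∧ v ∈ a₁} = P := by
        refine h.conn.eq_of_closed (fun v hv => hv.1) ⟨hp, hpa⟩ fun u hu w hw he => ⟨hw, ?_⟩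
        rcases hPc w hw with h2 | h2 | h2 | h2
        · subst h2; tauto
        · exact h2
        · subst h2; tauto
        · exact (hcr' u hu.2 w h2 he).elim
      have h2 := (this.ge hq).2
      grind
    have hstrict : ∀ p ∈ P, p ∈ a₁ → ∀ r ∈ P, ∀ v ∈ U, v ∉ P → (L v).card < 3 →
        s(r, v) ∉ E := by
      intro p hp hpa
      refine h.far.resolve_left fun h1 => ?_
      obtain ⟨q, hq, hqa⟩ := (hmany p hp hpa).1
      have := (Set.ncard_le_one (Set.toFinite P)).1 h1 p hp q hq
      grind
    have hk2 : (a₁.filter (fun v => decide (v ∈ P))).length ≤ 2 := by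
      rw [← List.countP_eq_length_filter]
      by_contra hk
      have h1 : 0 < a₁.countP (fun v => decide (v ∈ P)) := by omega
      obtain ⟨p, hpa, hp⟩ := List.countP_pos_iff.1 h1
      have h2 := (hmany p (by simpa using hp) hpa).2
      have h3 := (countP_le_ncard (P := P) hnd).trans h.card
      simp only [List.countP_cons, List.countP_append] at h3
      rcases h2 with h2 | h2 <;> simp [h2] at h3 <;> omega
    have hall : ∀ {S : Set V}, S ⊆ P ∩ B' → S.Nonempty → (x ∉ S ∧ x ∈ P ∨ y ∉ S ∧ y ∈ P) →
        (∀ u ∈ S, ∀ w ∈ P ∩ B', s(u, w) ∈ E → w ∈ S) → False := by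
      rintro S hS ⟨s, hs⟩ hxy hcl
      have := hPB.eq_of_closed hS hs hcl
      rcases hxy with hh | hh
      · exact hh.1 (this.ge ⟨hh.2, by simp [hB']⟩)
      · exact hh.1 (this.ge ⟨hh.2, by simp [hB']⟩)
    have hlen : (∀ v ∈ a₁, v ∈ P) → False := by
      intro hall
      rw [List.filter_eq_self.2 (by simpa using hall)] at hk2
      rcases a₁ with _ | ⟨u, _ | ⟨v, _ | ⟨w, a₁⟩⟩⟩
      · exact ha₁ rfl
      · simp [Set.insert_subset_iff] at hce
        exact hg.tri x u y hce.1.1 hce.1.2 (mem_swap hxy)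
      · simp [Set.insert_subset_iff] at hce
        rcases hg.quad x u v y hce.1.1 hce.1.2.1 hce.1.2.2 (mem_swap hxy) with hh | hh
        · subst hh; simp at hnd'
        · subst hh; simp at hnd'
      · simp at hk2
    refine hbad (hD.arc h hIH hUW hc (m := []) (by simp; grind) (by simp [hxy]) (by simp) (by simp)
      ?_ ha₁ ha₂ ?_ (x :: y :: a₁.head ha₁ :: a₁.getLast ha₁ ::
        a₁.filter (fun v => decide (v ∈ P))) ?_ ?_ ?_ ?_ ?_ ?_ ?_ ?_)
    · intro p hp q hq he
      have := hg.ne he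
      simp at hp hq
      rcases hp with rfl | rfl <;> rcases hq with rfl | rfl <;>
      first
      | exact (this rfl).elim
      | simp [Sym2.eq_swap]
    · convert hPA using 1
      ext v
      simp only [Set.mem_sdiff, Set.mem_inter_iff, hA', Set.mem_ofPred_eq]
      refine and_congr_right fun hv => ?_
      have := hPc v hv
      grind
    · simp only [List.length_cons]; omega
    · intro v h1 h2; simp [h1, h2]
    · simp
    · intro t ht _ _ q hq he
      simp at hq
      rcases hq with rfl | rfl
      · obtain ⟨a', rfl⟩ := hxt t ht he; simp
      · obtain ⟨a', rfl⟩ := hyt t ht he; simp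
    · have hQ : CutConn E {v | v ∈ x :: ([] ++ [y])} := cutConn_list _ (by simp [hxy])
      by_cases hPa : ∃ p ∈ P, p ∈ a₁
      · obtain ⟨p, hp, hpa⟩ := hPa
        have hz : ∃ z, z ∈ P ∩ B' ∧ z ∈ x :: ([] ++ [y]) := by
          rcases (hmany p hp hpa).2 with hh | hh
          · exact ⟨x, ⟨hh, by simp [hB']⟩, by simp⟩
          · exact ⟨y, ⟨hh, by simp [hB']⟩, by simp⟩
        obtain ⟨z, hz1, hz2⟩ := hz
        convert hPB.union_of_edge hQ hz1 hz2 (Or.inl rfl) using 1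
        ext v
        simp only [Set.mem_union, Set.mem_ofPred_eq, Set.mem_inter_iff, hB']
        simp; tauto
      · convert hQ using 1
        ext v
        constructor
        · rintro (hv | hv)
          · exact (hPa ⟨v, hv⟩).elim
          · exact hv
        · exact Or.inr
    · intro t ht _ _ q hq q' hq' he he'
      simp at hq hq'
      rcases hq with rfl | rfl <;> rcases hq' with rfl | rfl <;> first
        | rfl
        | exact (hg.tri _ _ _ hxy he' (mem_swap he)).elim
        | exact (hg.tri _ _ _ hxy he (mem_swap he')).elim
    · intro p hp hpa q hq hqP he
      simp at hq
      have hm := (hmany p hp hpa).2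
      refine hlen fun z hz => ?_
      by_contra hzP
      obtain ⟨s, r, rfl⟩ := List.append_of_mem hz
      rcases hq with rfl | rfl
      · obtain ⟨a', ha'⟩ := hxt p hpa (mem_swap he)
        have hps : p ∈ s := by
          rcases s with _ | ⟨t, s⟩
          · simp at ha'; exact (hzP (ha'.1 ▸ hp)).elim
          · simp at ha'; simp [ha'.1]
        refine hall (S := {v | v ∈ P ∧ v ∈ s}) (fun v hv => ⟨hv.1, by simp [hB', hv.2]⟩)
          ⟨p, hp, hps⟩ (Or.inr ⟨fun hh => ?_, hm.resolve_left hqP⟩) fun u hu w hw he => ⟨hw.1, ?_⟩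
        · have := hh.2; simp at hnd'; grind
        · obtain ⟨s1, s2, hs⟩ := List.append_of_mem hu.2
          subst hs
          rcases hw with ⟨hwP, rfl | rfl | hw⟩
          · exact (hqP hwP).elim
          · exact (hmin (s := q :: s1) (w := u) (m := s2 ++ z :: r) (u := w) (r := []) (by simp)
              (by simp) (by simp) he).elim
          · by_contra hws
            simp at hw hws
            have hwz : w ≠ z := fun h => hzP (h ▸ hwP)
            have hwr : w ∈ r := by tauto
            obtain ⟨r1, r2, rfl⟩ := List.append_of_mem hwr
            exact hmin (s := q :: s1) (w := u) (m := s2 ++ z :: r1) (u := w) (r := r2 ++ [y])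
              (by simp) (by simp) (by simp) he
      · obtain ⟨a', ha'⟩ := hyt p hpa (mem_swap he)
        have hpr : p ∈ r := by
          rcases List.eq_nil_or_concat r with rfl | ⟨r', t, rfl⟩
          · have := congrArg List.reverse ha'
            simp at this; exact (hzP (this.1 ▸ hp)).elim
          · have := congrArg List.reverse ha'
            simp at this; simp [this.1]
        refine hall (S := {v | v ∈ P ∧ v ∈ r}) (fun v hv => ⟨hv.1, by simp [hB', hv.2]⟩)
          ⟨p, hp, hpr⟩ (Or.inl ⟨fun hh => ?_, hm.resolve_right hqP⟩) fun u hu w hw he => ⟨hw.1, ?_⟩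
        · have := hh.2; simp at hnd'; grind
        · obtain ⟨r1, r2, hs⟩ := List.append_of_mem hu.2
          subst hs
          rcases hw with ⟨hwP, rfl | rfl | hw⟩
          · exact (hmin (s := []) (w := w) (m := s ++ z :: r1) (u := u) (r := r2 ++ [q]) (by simp)
              (by simp) (by simp) (mem_swap he)).elim
          · exact (hqP hwP).elim
          · by_contra hws
            simp at hw hws
            have hwz : w ≠ z := fun h => hzP (h ▸ hwP)
            have hwr : w ∈ s := by tauto
            obtain ⟨s1, s2, rfl⟩ := List.append_of_mem hwr
            exact hmin (s := x :: s1) (w := w) (m := s2 ++ z :: r1) (u := u) (r := r2 ++ [q])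
              (by simp) (by simp) (by simp) (mem_swap he)
    · exact fun p hp hpa v hva => hstrict p hp hpa p hp v (hc.mem (by simp [hva]))

theorem Drawn.chordless (hD : Drawn E d W) (hg : Girth5 E) (h : Good E d f L U P ψ)
    (hIH : IH α E d f U) (hUW : U ⊆ W) (hbad : ¬ Ext E L U P ψ) (hc : Disc E d f U c) {u v : V}
    (hu : u ∈ c) (hv : v ∈ c) (he : s(u, v) ∈ E) : s(u, v) ∈ ce c := by
  classical
  obtain ⟨a, b, hr⟩ := split_at_two hu hv (hg.ne he)
  have hc' := hc.of_isRotated hr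
  rw [ce_of_isRotated hr, ce_split]
  by_contra hno
  have ha : a ≠ [] := by rintro rfl; simp at hno
  have hb : b ≠ [] := by rintro rfl; simp_all
  rcases le_total (a.countP fun v => decide (v ∈ P)) (b.countP fun v => decide (v ∈ P)) with hh | hh
  · exact hbad (hD.ext_of_chord hg h hIH hUW _ le_rfl hc' hh ha hb he)
  · refine hbad (hD.ext_of_chord hg h hIH hUW _ le_rfl (x := v) (y := u) (a₁ := b) (a₂ := a) ?_ hh
      hb ha (mem_swap he))
    simpa using hc'.rotate (l := u :: a)

omit [Fintype V] in
theorem mem_ce_append (l : List V) (a b : V) (r : List V) : s(a, b) ∈ ce (l ++ a :: b :: r) := by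
  rw [ce_rotate]
  simp [ce_cons]

omit [Fintype V] in
theorem mem_ce_ends (a : V) (l : List V) (b : V) : s(b, a) ∈ ce (a :: (l ++ [b])) := by
  have := ce_rotate (a :: l) b []
  rw [List.cons_append] at this
  rw [this]
  simp [ce_cons]

omit [Fintype V] in
theorem exists_nbrs (hn : c.Nodup) (h3 : 3 ≤ c.length) {v : V} (hv : v ∈ c) :
    ∃ a b, ∀ w, s(v, w) ∈ ce c → w = a ∨ w = b := by
  obtain ⟨t, ht⟩ := rotated_to_head hv
  have hl := ht.perm.length_eq
  rcases t with _ | ⟨y, t⟩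
  · simp at hl; omega
  rcases List.eq_nil_or_concat t with rfl | ⟨l, y', rfl⟩
  · simp at hl; omega
  rw [List.concat_eq_append] at ht
  exact ⟨y, y', fun w hw => nbr_of_mem_ce (ht.nodup_iff.1 hn) (ce_of_isRotated ht ▸ hw)⟩

omit [Fintype V] in
/-- One step of greedy colouring. -/
theorem Proper.step (h : Proper E K φ) {v : V} (hv : v ∉ K) (hloop : s(v, v) ∉ E) (N : List V)
    (hN : N.length < (L v).card) (hnb : ∀ w ∈ K, s(v, w) ∈ E → w ∈ N) :
    ∃ φ' : V → α, (∀ w, w ≠ v → φ' w = φ w) ∧ φ' v ∈ L v ∧ Proper E (Insert.insert v K) φ' := by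
  classical
  obtain ⟨a, ha, hac⟩ := exists_color (L v) (N.map φ).toFinset
    ((List.toFinset_card_le _).trans_lt (by simpa using hN))
  refine ⟨Function.update φ v a, fun w hw => Function.update_of_ne hw _ _, by simpa using ha,
    h.update hloop hv fun w hw he => ?_⟩
  rintro rfl
  exact hac (by simpa using ⟨w, hnb w hw he, rfl⟩)

omit [Fintype V] in
theorem Proper.greedy (hloop : ∀ v, s(v, v) ∉ E) (l : List V) : l.Nodup → Proper E K φ →
    (∀ v ∈ l, v ∉ K) →
    (∀ s v r, l = s ++ v :: r → ∃ N : List V, N.length < (L v).card ∧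
      ∀ w, w ∈ K ∨ w ∈ s → s(v, w) ∈ E → w ∈ N) →
    ∃ φ' : V → α, (∀ w ∈ K, φ' w = φ w) ∧ (∀ v ∈ l, φ' v ∈ L v) ∧
      Proper E (K ∪ {v | v ∈ l}) φ' := by
  induction l generalizing K φ with
  | nil => exact fun _ h _ _ => ⟨φ, by simp, by simp, by simpa using h⟩
  | cons v l ih =>
    intro hnd hφ hK hN
    obtain ⟨N, hN1, hN2⟩ := hN [] v l rfl
    obtain ⟨φ₁, h1, h2, h3⟩ := hφ.step (L := L) (hK v (by simp)) (hloop v) N hN1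
      fun w hw => hN2 w (Or.inl hw)
    simp at hnd
    obtain ⟨φ₂, h4, h5, h6⟩ := ih hnd.2 h3
      (fun w hw => by
        have := hK w (by simp [hw])
        simp only [Set.mem_insert_iff]
        rintro (rfl | h)
        · exact hnd.1 hw
        · exact this h)
      (fun s w r hs => by
        obtain ⟨M, hM1, hM2⟩ := hN (v :: s) w r (by rw [hs]; rfl)
        exact ⟨M, hM1, fun z hz => hM2 z (by simp at hz ⊢; tauto)⟩)
    refine ⟨φ₂, fun w hw => ?_, fun w hw => ?_, h6.mono fun w hw => ?_⟩
    · rw [h4 w (Or.inr hw), h1 w fun h => hK v (by simp) (h ▸ hw)]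
    · rcases List.mem_cons.1 hw with rfl | hw
      · rw [h4 w (Or.inl rfl)]; exact h2
      · exact h5 w hw
    · simp at hw ⊢; tauto

theorem Base.exists_of_not_ext (hD : Drawn E d W) (hg : Girth5 E) (h : Good E d f L U P ψ)
    (hIH : IH α E d f U) (hUW : U ⊆ W) (hP : P.Nonempty) (hbad : ¬ Ext E L U P ψ) :
    ∃ (P' : Set V) (ψ' : V → α) (c : List V), Base E d f L W U P' ψ' ∧ Disc E d f U c ∧
      P'.Nonempty := by
  classical
  obtain ⟨c, hc⟩ := hD.exists_disc (f := f) (hD.twoConn_of_bad h hIH hP hbad)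
  have hcl : ∀ u ∈ outer E d f U, ∀ v ∈ outer E d f U, s(u, v) ∈ E →
      s(u, v) ∈ bd E d (reg E d f U) := fun u hu v hv he => by
    rw [hc.bd_eq]
    exact hD.chordless hg h hIH hUW hbad hc ((hc.outer_iff u).1 hu) ((hc.outer_iff v).1 hv) he
  rcases h.far with hfar | hfar
  swap
  · exact ⟨P, ψ, c, ⟨hD, hg, hUW, hIH, h, hfar, hbad, hcl⟩, hc, hP⟩
  obtain ⟨p, hp⟩ := hP
  obtain rfl : P = {p} := by
    ext q
    exact ⟨fun hq => (Set.ncard_le_one (Set.toFinite P)).1 hfar q hq p hp, fun hq => hq ▸ hp⟩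
  have hpc : p ∈ c := (hc.outer_iff p).1 (h.sub rfl)
  set T : Set V := {v | v ∈ U ∧ v ≠ p ∧ (L v).card < 3 ∧ s(p, v) ∈ E} with hT
  have hTo : ∀ v ∈ T, v ∈ outer E d f U := fun v hv => by
    by_contra hvo
    have := h.inner v hv.1 hvo
    grind
  obtain ⟨a, b, hab⟩ := exists_nbrs hc.nodup hc.three hpc
  have hTab : ∀ v ∈ T, v = a ∨ v = b := fun v hv =>
    hab v (hc.bd_eq ▸ hcl p (h.sub rfl) v (hTo v hv) hv.2.2.2)
  have hcol : ∀ v ∈ T, ∃ x ∈ L v, x ≠ ψ p := fun v hv => by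
    obtain ⟨x, hx, hx'⟩ := exists_color (L v) {ψ p}
      (by have := h.two v hv.1 hv.2.1; rw [Finset.card_singleton]; omega)
    exact ⟨x, hx, by simpa using hx'⟩
  have : Nonempty α := ⟨ψ p⟩
  choose! χ hχL hχ using hcol
  set ψ' : V → α := fun v => if v ∈ T then χ v else ψ v with hψ'
  have hpT : p ∉ T := fun h => h.2.1 rfl
  have hψp : ψ' p = ψ p := by simp only [hψ', if_neg hpT]
  have hψT : ∀ v ∈ T, ψ' v = χ v := fun v hv => by simp only [hψ', if_pos hv]
  have hTT : ∀ u ∈ T, ∀ v ∈ T, s(u, v) ∉ E := fun u hu v hv =>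
    h.indep u hu.1 hu.2.1 v hv.1 hv.2.1 hu.2.2.1 hv.2.2.1
  have hstr : ∀ q ∈ ({p} ∪ T : Set V), ∀ v ∈ U, v ∉ ({p} ∪ T : Set V) → (L v).card < 3 →
      s(q, v) ∉ E := by
    rintro q (rfl | hq) v hv hvP hv3 he
    · exact hvP (Or.inr ⟨hv, fun h => hvP (Or.inl h), hv3, he⟩)
    · exact h.indep q hq.1 hq.2.1 v hv (fun h => hvP (Or.inl h)) hq.2.2.1 hv3 he
  refine ⟨{p} ∪ T, ψ', c, ⟨hD, hg, hUW, hIH, ⟨?_, ?_, ?_, ?_, ?_, h.inner, ?_, Or.inr hstr⟩, hstr,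
    ?_, hcl⟩, hc, ⟨p, Or.inl rfl⟩⟩
  · rintro q (rfl | hq)
    · exact h.sub rfl
    · exact hTo q hq
  · refine (ncard_le_of_list [p, a, b] fun v hv => ?_).trans (by simp)
    rcases hv with rfl | hv
    · simp
    · have := hTab v hv; simp; tauto
  · exact (cutConn_singleton E p).attach fun t ht => ⟨p, rfl, ht.2.2.2⟩
  · rintro u (rfl | hu) v (rfl | hv) he
    · exact (hg.loop _ he).elim
    · rw [hψp, hψT v hv]; exact (hχ v hv).symm
    · rw [hψp, hψT u hu]; exact hχ u hu
    · exact (hTT u hu v hv he).elim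
  · exact fun v hv hvP => h.two v hv fun h => hvP (Or.inl h)
  · exact fun u hu huP v hv hvP => h.indep u hu (fun h => huP (Or.inl h)) v hv
      fun h => hvP (Or.inl h)
  · rintro ⟨φ, h1, h2, h3⟩
    refine hbad ⟨φ, ?_, fun v hv hvp => ?_, h3⟩
    · rintro _ rfl
      rw [h1 _ (Or.inl rfl), hψp]
    · by_cases hvT : v ∈ T
      · rw [h1 v (Or.inr hvT), hψT v hvT]; exact hχL v hvT
      · exact h2 v hv fun h => h.elim hvp hvT

/-- A minimal counterexample, with its outer cycle split into the precoloured path `ps` and the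
remaining path `vs`. -/
structure Ctx (E : Set (Sym2 V)) (d : Sym2 V → Sym2 ι) (f : ι) (L : V → Finset α)
    (W U P : Set V) (ψ : V → α) (ps vs : List V) : Prop extends Base E d f L W U P ψ where
  disc : Disc E d f U (ps ++ vs)
  mem : ∀ v, v ∈ P ↔ v ∈ ps
  ps_ne : ps ≠ []
  long : 9 ≤ ps.length + vs.length

theorem Base.contiguous (h : Base E d f L W U P ψ) (hc : Disc E d f U c) (hP : P.Nonempty) :
    ∃ ps vs : List V, Disc E d f U (ps ++ vs) ∧ (∀ v, v ∈ P ↔ v ∈ ps) := by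
  have hPc : ∀ v ∈ P, v ∈ c := fun v hv => (hc.outer_iff v).1 (h.good.sub hv)
  by_cases hall : ∀ v ∈ c, v ∈ P
  · exact ⟨c, [], by simpa using hc, fun v => ⟨hPc v, hall v⟩⟩
  push Not at hall
  obtain ⟨v, hv, hvP⟩ := hall
  obtain ⟨t, ht⟩ := rotated_to_head hv
  have hct := hc.of_isRotated ht
  have hPt : ∀ p ∈ P, p ∈ t := fun p hp =>
    (List.mem_cons.1 (ht.mem_iff.1 (hPc p hp))).resolve_left fun h => hvP (h ▸ hp)
  obtain ⟨p, hp⟩ := hP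
  obtain ⟨s, x, r, rfl, hx, hs⟩ := exists_first (P := fun v => v ∈ P) ⟨p, hPt p hp, hp⟩
  by_cases hr : ∀ w ∈ r, w ∈ P
  · refine ⟨x :: r, v :: s, ?_, fun w => ⟨fun hw => ?_, fun hw => ?_⟩⟩
    · exact Disc.rotate (l := v :: s) (r := x :: r) hct
    · grind
    grind
  push Not at hr
  obtain ⟨r₁, z, r₂, rfl, hz, hr₁⟩ := exists_first (P := fun v => v ∉ P) hr
  push Not at hr₁
  have hnd := hct.nodup
  have e : v :: (s ++ x :: (r₁ ++ z :: r₂)) = v :: ((s ++ x :: r₁) ++ z :: r₂) := by simp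
  have hcl : {w | w ∈ x :: r₁} = P := by
    refine h.good.conn.eq_of_closed (a := x) ?_ (by simp) fun u hu w hw he => ?_
    · grind
    · have hu' : u ∈ x :: r₁ := hu
      have he' := h.chord hct (u := u) (v := w) (by simp at hu' ⊢; tauto)
        (List.mem_cons_of_mem _ (hPt w hw)) he
      rw [e, ce_split] at he'
      have hwt := hPt w hw
      have hwz : w ≠ z := fun h => hz (h ▸ hw)
      have hwv : w ≠ v := fun h => hvP (h ▸ hw)
      have hws : w ∉ s := fun h => hs w h hw
      rcases he' with he' | he'
      · have := mem_of_mem_pe he' (Sym2.mem_mk_right u w)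
        simp at this ⊢; tauto
      · have := mem_of_mem_pe he' (Sym2.mem_mk_left u w)
        simp only [List.nodup_cons, List.nodup_append, List.mem_append, List.mem_cons] at hnd hu'
        simp at this
        grind
  refine ⟨x :: r₁, z :: (r₂ ++ v :: s), ?_, fun w => ?_⟩
  · have := Disc.rotate (l := v :: s) (r := x :: (r₁ ++ z :: r₂)) hct
    simpa using this
  · rw [← hcl]; rfl

theorem Base.exists_ctx (h : Base E d f L W U P ψ) (hc : Disc E d f U c) (hP : P.Nonempty) :
    ∃ ps vs : List V, Ctx E d f L W U P ψ ps vs := by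
  obtain ⟨ps, vs, hd, hm⟩ := h.contiguous hc hP
  refine ⟨ps, vs, h, hd, hm, ?_, ?_⟩
  · rintro rfl
    obtain ⟨p, hp⟩ := hP
    grind
  · by_contra hlen
    have hnd := hd.nodup
    have hnd' := hnd
    rw [List.nodup_append] at hnd'
    have hset : {v | v ∈ ps ++ vs} = P ∪ {v | v ∈ vs} := by
      ext v; simp [hm]
    have key : ∃ φ : V → α, (∀ w ∈ P, φ w = ψ w) ∧ (∀ v ∈ vs, φ v ∈ L v) ∧
        Proper E {v | v ∈ ps ++ vs} φ := by
      rw [hset]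
      rcases vs with _ | ⟨v, t⟩
      · exact ⟨ψ, by simp, by simp, by simpa using h.good.proper⟩
      have hperm : (t ++ [v]).Perm (v :: t) := List.perm_append_comm (l₁ := t) (l₂ := [v])
      obtain ⟨φ, h1, h2, h3⟩ := Proper.greedy (E := E) (L := L) h.girth.loop (t ++ [v])
        (hperm.nodup_iff.2 hnd'.2.1) h.good.proper
        (fun w hw hwP => by grind)
        (fun s w r hs => by
          have hwv : w ∈ v :: t := hperm.mem_iff.1 (hs ▸ by simp)
          have hwc : w ∈ ps ++ v :: t := List.mem_append_right _ hwv
          have hwU : w ∈ U := hd.mem hwc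
          have hwP : w ∉ P := fun hh => hnd'.2.2 w ((hm w).1 hh) w hwv rfl
          obtain ⟨a, b, hab⟩ := exists_nbrs hnd hd.three hwc
          have hsv : ∀ z, z ∈ P ∨ z ∈ s → z ∈ ps ++ v :: t := by
            rintro z (hz | hz)
            · exact List.mem_append_left _ ((hm z).1 hz)
            · exact List.mem_append_right _ (hperm.mem_iff.1 (hs ▸ by simp [hz]))
          have hab' : ∀ z, z ∈ P ∨ z ∈ s → s(w, z) ∈ E → z = a ∨ z = b := fun z hz he =>
            hab z (h.chord hd hwc (hsv z hz) he)
          by_cases hw3 : 3 ≤ (L w).card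
          · exact ⟨[a, b], hw3, fun z hz he => by simpa using hab' z hz he⟩
          push Not at hw3
          have hw2 := h.good.two w hwU hwP
          have hnP : ∀ p ∈ P, s(p, w) ∉ E := fun p hp => h.strict p hp w hwU hwP hw3
          obtain ⟨z, hzP, hzs, hzc⟩ : ∃ z, z ∉ P ∧ z ∉ s ∧ s(w, z) ∈ ce (ps ++ v :: t) := by
            have hne : ps ≠ [] := by
              rintro rfl
              obtain ⟨p, hp⟩ := hP
              simpa using (hm p).1 hp
            rcases List.eq_nil_or_concat r with rfl | ⟨r', x, rfl⟩
            · obtain ⟨rfl, hh⟩ := List.append_inj' hs rfl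
              obtain rfl : v = w := by simpa using hh
              obtain ⟨l, q, rfl⟩ := (List.eq_nil_or_concat ps).resolve_left hne
              rw [List.concat_eq_append] at hm hd
              refine (hnP q ((hm q).2 (by simp)) (hd.ce_subset ?_)).elim
              simpa using mem_ce_append l q v t
            · rw [List.concat_eq_append] at hs
              obtain ⟨rfl, hh⟩ := List.append_inj' (t₂ := [x]) (s₂ := s ++ w :: r')
                (hs.trans (by simp)) rfl
              obtain rfl : v = x := by simpa using hh
              rcases r' with _ | ⟨z, r'⟩
              · obtain ⟨p, l, rfl⟩ := List.exists_cons_of_ne_nil hne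
                refine (hnP p ((hm p).2 (by simp)) (hd.ce_subset ?_)).elim
                rw [Sym2.eq_swap]
                simpa using mem_ce_ends p (l ++ v :: s) w
              · refine ⟨z, fun hz => hnd'.2.2 z ((hm z).1 hz) z (by simp) rfl, fun hz => ?_, ?_⟩
                · have := hnd'.2.1
                  simp [List.nodup_append] at this
                  grind
                · simpa using mem_ce_append (ps ++ v :: s) w z r'
          have hzu : ∀ u, u ∈ P ∨ u ∈ s → u ≠ z := by
            rintro u hu rfl
            tauto
          rcases hab z hzc with rfl | rfl
          · exact ⟨[b], hw2, fun u hu he => by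
              simpa using (hab' u hu he).resolve_left (hzu u hu)⟩
          · exact ⟨[a], hw2, fun u hu he => by
              simpa using (hab' u hu he).resolve_right (hzu u hu)⟩)
      refine ⟨φ, h1, fun w hw => h2 w (hperm.mem_iff.2 hw), h3.mono fun w hw => ?_⟩
      rcases hw with hw | hw
      · exact Or.inl hw
      · exact Or.inr (hperm.mem_iff.2 hw)
    obtain ⟨φ, h1, h2, h3⟩ := key
    obtain ⟨χ, h4, h5, h6⟩ := h.drawn.cyc h.girth (L := L) _ le_rfl h.sub h.ih hd
      (by simp; omega) h3 fun v hv hvc => h.three hd hv hvc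
    refine h.notExt ⟨χ, fun v hv => ?_, fun v hv hvP => ?_, h6⟩
    · rw [h4 v (hset.ge (Or.inl hv)), h1 v hv]
    · by_cases hvv : v ∈ vs
      · rw [h4 v (hset.ge (Or.inr hvv))]; exact h2 v hvv
      · exact h5 v hv fun hh => (hset.le hh).elim hvP hvv

theorem Base.eq_nil_or (h : Base E d f L W U P ψ) {x y : V} {a b : List V}
    (hc : Disc E d f U (x :: (a ++ y :: b))) (he : s(x, y) ∈ E) : a = [] ∨ b = [] := by
  have h1 := h.chord hc (by simp) (by simp) he
  have hn := hc.nodup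
  rw [ce_split] at h1
  rcases h1 with h1 | h1
  · left
    refine eq_nil_of_mem_pe ?_ h1
    grind
  · right
    refine eq_nil_of_mem_pe ?_ (mem_swap h1)
    grind

theorem Ctx.reverse (h : Ctx E d f L W U P ψ ps vs) :
    Ctx E d f L W U P ψ ps.reverse vs.reverse where
  toBase := h.toBase
  disc := by
    have := h.disc.reverse
    rw [List.reverse_append] at this
    exact this.rotate
  mem v := by rw [h.mem]; simp
  ps_ne := by simpa using h.ps_ne
  long := by simpa using h.long

theorem Ctx.ps_length (h : Ctx E d f L W U P ψ ps vs) : ps.length ≤ 6 := by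
  classical
  have h1 := (List.nodup_append.1 h.disc.nodup).1
  rw [← List.toFinset_card_of_nodup h1, ← Set.ncard_coe_finset]
  refine le_trans (Set.ncard_le_ncard fun v hv => ?_) h.good.card
  rw [h.mem]; simpa using hv

theorem Ctx.disjoint (h : Ctx E d f L W U P ψ ps vs) {v : V} (hv : v ∈ vs) : v ∉ P := fun hP =>
  (List.nodup_append.1 h.disc.nodup).2.2 v ((h.mem v).1 hP) v hv rfl

theorem Ctx.cross {p₁ p₂ w₁ w₂ : List V} {p v : V}
    (h : Ctx E d f L W U P ψ (p₁ ++ p :: p₂) (w₁ ++ v :: w₂)) (he : s(p, v) ∈ E) :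
    (w₁ = [] ∧ p₂ = []) ∨ (w₂ = [] ∧ p₁ = []) := by
  have hc : Disc E d f U (p :: ((p₂ ++ w₁) ++ v :: (w₂ ++ p₁))) := by
    have := h.disc
    simp only [List.append_assoc, List.cons_append] at this
    simpa using this.rotate
  have := h.eq_nil_or hc he
  simp at this
  tauto

theorem Ctx.no_two_vs {w₁ m w₂ : List V} {v v' x : V}
    (h : Ctx E d f L W U P ψ ps (w₁ ++ v :: (m ++ v' :: w₂))) (hx : x ∈ U)
    (hxc : x ∉ ps ++ (w₁ ++ v :: (m ++ v' :: w₂))) (h1 : s(x, v) ∈ E) (h2 : s(x, v') ∈ E) :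
    False := by
  have hc : Disc E d f U (v :: (m ++ v' :: (w₂ ++ ps ++ w₁))) := by
    have := h.disc
    rw [← List.append_assoc] at this
    simpa using this.rotate
  refine h.no_two_chord _ le_rfl hc (fun u hu => h.disjoint (by simp [hu])) hx ?_ h1 h2
  grind

theorem Ctx.no_two_last {p₁ m w₂ : List V} {v p x : V}
    (h : Ctx E d f L W U P ψ (p₁ ++ [p]) (m ++ v :: w₂)) (hx : x ∈ U)
    (hxc : x ∉ (p₁ ++ [p]) ++ (m ++ v :: w₂)) (h1 : s(x, p) ∈ E) (h2 : s(x, v) ∈ E) :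
    False := by
  have hc : Disc E d f U (p :: (m ++ v :: (w₂ ++ p₁))) := by
    have := h.disc
    rw [List.append_assoc] at this
    simpa using this.rotate
  refine h.no_two_chord _ le_rfl hc (fun u hu => h.disjoint (by simp [hu])) hx ?_ h1 h2
  grind

theorem Ctx.no_two_first {p₂ w₁ m : List V} {v p x : V}
    (h : Ctx E d f L W U P ψ (p :: p₂) (w₁ ++ v :: m)) (hx : x ∈ U)
    (hxc : x ∉ (p :: p₂) ++ (w₁ ++ v :: m)) (h1 : s(x, p) ∈ E) (h2 : s(x, v) ∈ E) :
    False := by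
  have h' := h.reverse
  simp only [List.reverse_cons, List.reverse_append, List.append_assoc, List.cons_append,
    List.nil_append] at h'
  refine h'.no_two_last hx ?_ h1 h2
  grind

set_option maxHeartbeats 1600000 in
theorem Ctx.no_link_short {p₁ p₂ w₁ w₂ : List V} {p v x : V}
    (h : Ctx E d f L W U P ψ (p₁ ++ p :: p₂) (w₁ ++ v :: w₂)) (hx : x ∈ U)
    (hxc : x ∉ (p₁ ++ p :: p₂) ++ (w₁ ++ v :: w₂)) (hw₁ : w₁ ≠ []) (hp₂ : p₂.length ≤ 2)
    (h1 : s(x, p) ∈ E) (h2 : s(x, v) ∈ E) (hq : ∀ q ∈ p₂, s(x, q) ∉ E) : False := by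
  have hc : Disc E d f U (p :: ((p₂ ++ w₁) ++ v :: (w₂ ++ p₁))) := by
    have := h.disc
    simp only [List.append_assoc, List.cons_append] at this
    simpa using this.rotate
  have hnd := hc.nodup
  simp only [List.nodup_cons, List.nodup_append, List.mem_append, List.mem_cons] at hnd
  have hpv : s(p, v) ∉ E := fun he => h.girth.tri x p v h1 he (mem_swap h2)
  have hce := hc.ce_subset
  have ha₂ : w₂ ++ p₁ ≠ [] := fun hh => by
    rw [hh] at hce
    have := hce (mem_ce_ends p (p₂ ++ w₁) v)
    grind
  simp at hxc
  have hpP : p ∈ P := (h.mem p).2 (by simp)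
  have hpp : pe (p₁ ++ p :: p₂) ⊆ E := by
    refine (pe_prefix_subset _ (w₁ ++ v :: w₂)).trans ?_
    refine Set.Subset.trans ?_ h.disc.ce_subset
    obtain ⟨z, l, hl⟩ : ∃ z l, (p₁ ++ p :: p₂) ++ (w₁ ++ v :: w₂) = z :: l := by
      cases p₁ <;> simp
    rw [hl, ce_cons]
    exact pe_prefix_subset _ _
  have hxt : ∀ t ∈ w₁, s(x, t) ∉ E := by
    intro t ht he
    obtain ⟨s, r, rfl⟩ := List.append_of_mem ht
    rw [List.append_assoc, List.cons_append] at h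
    refine h.no_two_vs hx ?_ he h2
    grind
  have hvt : ∀ t ∈ w₁, s(v, t) ∈ E → ∃ a', w₁ = a' ++ [t] := fun t ht he => by
    obtain ⟨a', ha'⟩ := last_of_mem_ce hc.nodup (h.chord hc (by simp) (by simp [ht]) he)
      (by simp [ht])
    rcases List.eq_nil_or_concat w₁ with rfl | ⟨l, z, rfl⟩
    · grind
    · rw [List.concat_eq_append, ← List.append_assoc] at ha'
      obtain ⟨-, hh⟩ := List.append_inj' ha' rfl
      grind
  have hPa : ∀ v ∈ P, v ∈ p₂ ++ w₁ → v ∈ p₂ := fun v hv hv' =>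
    (List.mem_append.1 hv').resolve_right fun hh => h.disjoint (by simp [hh]) hv
  have hshort : ∀ t ∈ p₂ ++ w₁, t ∉ P → t ∈ w₁ := fun t ht htP =>
    (List.mem_append.1 ht).resolve_left fun hh => htP ((h.mem t).2 (by simp [hh]))
  refine h.notExt (h.drawn.arc h.good h.ih h.sub hc (m := [x]) (by simp; grind)
    (by simp [Set.insert_subset_iff, mem_swap h1, h2]) (by simpa using hx)
    (by simp; grind) ?_ (by simp [hw₁]) ha₂ ?_ ([p, x, v, w₁.getLast hw₁] ++ p₂) ?_ ?_ ?_ ?_ ?_ ?_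
    ?_ ?_)
  · intro a ha b hb he
    have := h.girth.ne he
    simp at ha hb
    rcases ha with rfl | rfl | rfl <;> rcases hb with rfl | rfl | rfl <;>
      first
      | exact (this rfl).elim
      | exact (hpv he).elim
      | exact (hpv (mem_swap he)).elim
      | simp [Sym2.eq_swap]
  · have := cutConn_list (E := E) (p₁ ++ [p]) (by
      refine Set.Subset.trans ?_ hpp
      have : p₁ ++ p :: p₂ = (p₁ ++ [p]) ++ p₂ := by simp
      rw [this]
      exact pe_prefix_subset _ _)
    convert this using 1
    ext z
    simp only [Set.mem_sdiff, Set.mem_ofPred_eq, h.mem, List.mem_append, List.mem_cons]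
    have := hnd
    grind
  · simp; omega
  · grind
  · simp
  · intro t ht htP h3 q hq' he
    have htw := hshort t ht htP
    simp at hq'
    rcases hq' with rfl | rfl | rfl
    · exact (h.strict _ hpP t (hc.mem (by simp [htw])) htP h3 he).elim
    · grind
    grind
  · have h3 : CutConn E {z | z ∈ p :: p₂} := cutConn_list _
      ((pe_suffix_subset p₁ (p :: p₂)).trans hpp)
    have h4 : CutConn E {z | z ∈ p :: ([x] ++ [v])} := cutConn_list _
      (by simp [Set.insert_subset_iff, mem_swap h1, h2])
    convert h3.union_of_edge h4 (a := p) (b := p) (by simp) (by simp) (Or.inl rfl) using 1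
    ext z
    simp only [Set.mem_union, Set.mem_ofPred_eq]
    have := hPa z
    have h5 := h.mem z
    simp only [List.mem_append, List.mem_cons, List.not_mem_nil, or_false] at this h5 ⊢
    grind
  · intro t ht htP h3 q hq' q' hq'' he he'
    have htw := hshort t ht htP
    have hp := h.strict p hpP t (hc.mem (by simp [htw])) htP h3
    simp at hq' hq''
    rcases hq' with rfl | rfl | rfl <;> rcases hq'' with rfl | rfl | rfl <;>
      first
      | rfl
      | exact (hp he).elim
      | exact (hp he').elim
      | exact (hxt t htw he).elim
      | exact (hxt t htw he').elim
  · intro z hz hz' q hq' hqP he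
    have hz2 := hPa z hz hz'
    simp at hq'
    rcases hq' with rfl | rfl | rfl
    · exact hqP hpP
    · exact hq z hz2 (mem_swap he)
    · obtain ⟨s, r, rfl⟩ := List.append_of_mem hz2
      have e : p₁ ++ p :: (s ++ z :: r) = (p₁ ++ p :: s) ++ z :: r := by simp
      rw [e] at h
      rcases h.cross he with hh | hh
      · exact hw₁ hh.1
      · simp at hh
  · exact fun z hz _ t ht htP h3 => h.strict z hz t (hc.mem (by simp at ht ⊢; tauto)) htP h3

/-- Extending a colouring of a cycle and of a path across it, both sides being short. -/
theorem Drawn.cyc_two (hD : Drawn E d W) (hg : Girth5 E) (hUW : U ⊆ W) (hIH : IH α E d f U)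
    {x y : V} {a₁ a₂ m : List V} (hc : Disc E d f U (x :: (a₁ ++ y :: a₂)))
    (hm : (x :: (m ++ [y])).Nodup) (hmE : pe (x :: (m ++ [y])) ⊆ E) (hmU : ∀ v ∈ m, v ∈ U)
    (hmc : ∀ v ∈ m, v ∉ a₁ ∧ v ∉ a₂)
    (hch : ∀ a ∈ x :: (m ++ [y]), ∀ b ∈ x :: (m ++ [y]), s(a, b) ∈ E →
      s(a, b) ∈ pe (x :: (m ++ [y])))
    (h₁ : 1 ≤ a₁.length + m.length) (h₂ : 1 ≤ m.length + a₂.length)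
    (l₁ : a₁.length + m.length ≤ 6) (l₂ : m.length + a₂.length ≤ 6)
    (hφ : Proper E {v | v ∈ x :: (a₁ ++ y :: a₂) ∨ v ∈ m} φ)
    (hL : ∀ v ∈ U, v ∉ x :: (a₁ ++ y :: a₂) → v ∉ m → 3 ≤ (L v).card) :
    ∃ χ : V → α, (∀ v, v ∈ x :: (a₁ ++ y :: a₂) ∨ v ∈ m → χ v = φ v) ∧
      (∀ v ∈ U, v ∉ x :: (a₁ ++ y :: a₂) → v ∉ m → χ v ∈ L v) ∧ Proper E U χ := by
  obtain ⟨B, A, hB, hA, hU, hmeet, hcr⟩ := hD.split hUW hc hm hmE hmU hmc hch h₁ h₂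
  have hBU : B ⊆ U := hU ▸ Set.subset_union_left
  have hAU : A ⊆ U := hU ▸ Set.subset_union_right
  have hnd := hc.nodup
  simp only [List.nodup_cons, List.nodup_append, List.mem_append, List.mem_cons] at hnd
  have memB : ∀ v, v ∈ x :: (a₁ ++ y :: m.reverse) → v ∈ B := fun v => hB.mem
  have memA : ∀ v, v ∈ x :: (m ++ y :: a₂) → v ∈ A := fun v => hA.mem
  simp only [List.mem_append, List.mem_cons, List.mem_reverse, List.not_mem_nil, or_false]
    at memA memB hmeet
  obtain ⟨φ₁, e₁, L₁, p₁⟩ := hD.cyc_extend hg (L := L) (K := {v | v ∈ x :: (a₁ ++ y :: a₂) ∨ v ∈ m})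
    (hBU.trans hUW) (hIH.mono hBU) hB (by simp; omega) hφ (fun v hv => by simp at hv ⊢; tauto)
    (fun v hv hvK => by simp at hvK ⊢; grind)
    (fun u hu huB w hw hwK he => by
      have := memA u; have := memB u; have := memA w
      refine hcr w hw (fun h => hwK ?_) u ?_ huB (mem_swap he)
      · have := hmeet w hw h
        simp; tauto
      · simp at hu; tauto)
    (fun v hv hvK => by simp at hvK; exact hL v (hBU hv) (by simp; tauto) (by tauto))
  obtain ⟨φ₂, e₂, L₂, p₂⟩ := hD.cyc_extend hg (L := L)
    (K := {v | v ∈ x :: (a₁ ++ y :: a₂) ∨ v ∈ m} ∪ B)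
    (hAU.trans hUW) (hIH.mono hAU) hA (by simp; omega) p₁
    (fun v hv => Or.inl (by simp at hv ⊢; tauto))
    (fun v hv hvK => by simp at hvK ⊢; grind)
    (fun u hu huA w hw hwK => by
      refine hcr u ?_ huA w hw fun h => hwK (Or.inr h)
      have := memA u; have := memB u
      simp at hu; tauto)
    (fun v hv hvK => by simp at hvK; exact hL v (hAU hv) (by simp; tauto) (by tauto))
  refine ⟨φ₂, fun v hv => ?_, fun v hv hvc hvm => ?_, p₂.mono fun v hv => ?_⟩
  · rw [e₂ v (Or.inl hv), e₁ v hv]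
  · have hK : v ∉ {v | v ∈ x :: (a₁ ++ y :: a₂) ∨ v ∈ m} := fun h => h.elim hvc hvm
    by_cases hvB : v ∈ B
    · rw [e₂ v (Or.inr hvB)]; exact L₁ v hvB hK
    · exact L₂ v ((hU.ge hv).resolve_left hvB) fun h => h.elim hK hvB
  · exact (hU.ge hv).elim (fun h => Or.inl (Or.inr h)) Or.inr

set_option maxHeartbeats 1600000 in
/-- An interior neighbour of the last vertex of a path `v₁ v₂ v` of free vertices has no
precoloured neighbour. -/
theorem Ctx.no_link_three {p₀ p₁ p p₃ p₄ p₅ v₁ v₂ v x : V}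
    (h : Ctx E d f L W U P ψ [p₀, p₁, p, p₃, p₄, p₅] [v₁, v₂, v]) (hx : x ∈ U)
    (hxc : x ∉ [p₀, p₁, p, p₃, p₄, p₅] ++ [v₁, v₂, v]) (h1 : s(x, p) ∈ E) (h2 : s(x, v) ∈ E)
    (hq : ∀ q ∈ [p₀, p₁, p₃, p₄, p₅], s(x, q) ∉ E) : False := by
  have hce := h.disc.ce_subset
  have hnd := h.disc.nodup
  have hsub : ∀ u ∈ [p₀, p₁, p, p₃, p₄, p₅, v₁, v₂, v], u ∈ U := fun u hu => h.disc.mem hu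
  simp [ce_cons, Set.insert_subset_iff] at hce
  obtain ⟨e01, e12, e23, e34, e45, e5v, ev1, ev2, ev0⟩ := hce
  simp at hnd hxc
  have hP : ∀ w, w ∈ P ↔ w = p₀ ∨ w = p₁ ∨ w = p ∨ w = p₃ ∨ w = p₄ ∨ w = p₅ := by
    simpa using h.mem
  have hvP : ∀ w ∈ P, s(v, w) ∈ E → w = p₀ := fun w hw he => by
    obtain ⟨s, r, hs⟩ := List.append_of_mem ((h.mem w).1 hw)
    have h' := hs ▸ h
    rcases h'.cross (w₁ := [v₁, v₂]) (w₂ := []) (mem_swap he) with hh | hh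
    · simp at hh
    grind
  have hv₁P : ∀ w ∈ P, s(v₁, w) ∈ E → w = p₅ := fun w hw he => by
    obtain ⟨s, r, hs⟩ := List.append_of_mem ((h.mem w).1 hw)
    have h' := hs ▸ h
    rcases h'.cross (w₁ := []) (w₂ := [v₂, v]) (mem_swap he) with hh | hh
    · have := hh.2; subst this
      have := congrArg List.getLast? hs
      grind
    · simp at hh
  have hv₂P : ∀ w ∈ P, s(v₂, w) ∉ E := fun w hw he => by
    obtain ⟨s, r, hs⟩ := List.append_of_mem ((h.mem w).1 hw)
    have h' := hs ▸ h
    rcases h'.cross (w₁ := [v₁]) (w₂ := [v]) (mem_swap he) with hh | hh <;> simp at hh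
  have hd : ∀ w ∈ [v₁, v₂, v], w ∉ P := fun w hw => h.disjoint hw
  have hxP : x ∉ P := by rw [hP]; tauto
  have hv1v : s(v₁, v) ∉ E := fun he => h.girth.tri v₁ v₂ v ev1 ev2 (mem_swap he)
  have hxv₂ : s(x, v₂) ∉ E := fun he => h.girth.tri x v₂ v he ev2 (mem_swap h2)
  have hxv₁ : s(x, v₁) ∉ E := fun he => by
    rcases h.girth.quad x v₁ v₂ v he ev1 ev2 (mem_swap h2) with hh | hh <;> simp [hh] at *
  have two := h.good.two
  simp at hd
  have l₁ : 3 ≤ (L v₁).card := by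
    by_contra hh
    exact h.strict p₅ ((hP _).2 (by simp)) v₁ (hsub v₁ (by simp)) hd.1 (by omega) e5v
  have lx : 3 ≤ (L x).card := h.three h.disc hx (by simp; tauto)
  have l₂ := two v₂ (hsub v₂ (by simp)) hd.2.1
  have lv := two v (hsub v (by simp)) hd.2.2
  obtain ⟨φ, f1, f2, f3⟩ := h.good.proper.greedy (L := L) h.girth.loop [v, v₂, v₁, x]
    (by simp; grind) (by simp; tauto) (by
      rintro s w r hs
      rcases s with _ | ⟨a, _ | ⟨b, _ | ⟨c', _ | ⟨d', s⟩⟩⟩⟩ <;> simp at hs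
      · obtain ⟨rfl, -⟩ := hs
        exact ⟨[p₀], by simp; omega, fun w hw he => by grind⟩
      · obtain ⟨rfl, rfl, -⟩ := hs
        exact ⟨[v], by simp; omega, fun w hw he => by grind⟩
      · obtain ⟨rfl, rfl, rfl, -⟩ := hs
        exact ⟨[p₅, v₂], by simp; omega, fun w hw he => by grind⟩
      · obtain ⟨rfl, rfl, rfl, rfl, -⟩ := hs
        exact ⟨[p, v], by simp; omega, fun w hw he => by
          simp at hw
          rcases hw with hw | rfl | rfl | rfl
          · rw [hP] at hw
            by_cases hwp : w = p
            · simp [hwp]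
            · exact (hq w (by simp; grind) he).elim
          · simp
          · exact (hxv₂ he).elim
          · exact (hxv₁ he).elim⟩)
  have hc : Disc E d f U (p :: ([p₃, p₄, p₅, v₁, v₂] ++ v :: [p₀, p₁])) :=
    h.disc.rotate (l := [p₀, p₁]) (r := [p, p₃, p₄, p₅, v₁, v₂, v])
  have hpv : s(p, v) ∉ E := fun he => h.girth.tri x p v h1 he (mem_swap h2)
  obtain ⟨χ, g1, g2, g3⟩ := h.drawn.cyc_two h.girth (L := L) h.sub h.ih hc (m := [x])
    (by simp; grind) (by simp [Set.insert_subset_iff, mem_swap h1, h2]) (by simpa using hx)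
    (by simp; grind)
    (fun a ha b hb he => by
      have := h.girth.ne he
      simp at ha hb
      rcases ha with rfl | rfl | rfl <;> rcases hb with rfl | rfl | rfl <;>
        first
        | exact (this rfl).elim
        | exact (hpv he).elim
        | exact (hpv (mem_swap he)).elim
        | simp [Sym2.eq_swap])
    (by simp) (by simp) (by simp) (by simp)
    (f3.mono fun u hu => by
      have := hP u
      simp at hu ⊢; grind)
    (fun u hu huc _ => h.three hc hu huc)
  refine h.notExt ⟨χ, fun u hu => ?_, fun u hu huP => ?_, g3⟩
  · rw [g1 u (Or.inl ?_), f1 u hu]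
    have := (hP u).1 hu
    simp; grind
  · rw [hP] at huP
    by_cases hu1 : u ∈ [v, v₂, v₁, x]
    · rw [g1 u ?_]
      · exact f2 u hu1
      · simp at hu1 ⊢; grind
    · refine g2 u hu ?_ ?_ <;> simp at hu1 ⊢ <;> grind

theorem Ctx.no_link {w₁ w₂ : List V} {p v x : V} (h : Ctx E d f L W U P ψ ps (w₁ ++ v :: w₂))
    (hw₁ : w₁ ≠ []) (hw₂ : w₂ ≠ [] ∨ w₁.length = 2) (hx : x ∈ U)
    (hxc : x ∉ ps ++ (w₁ ++ v :: w₂)) (h2 : s(x, v) ∈ E) (hp : p ∈ P) : s(x, p) ∉ E := by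
  intro he
  have hex : ∃ q ∈ ps, s(x, q) ∈ E := ⟨p, (h.mem p).1 hp, he⟩
  have hl := h.ps_length
  obtain ⟨p₁, q, p₂, rfl, h1, hlast⟩ := exists_last hex
  by_cases h2l : p₂.length ≤ 2
  · exact h.no_link_short hx hxc hw₁ h2l h1 h2 hlast
  simp at hl
  rcases eq_or_ne w₂ [] with rfl | hne
  · have hlong := h.long
    have hw := hw₂.resolve_left (by simp)
    simp at hlong
    have hvl : s(v, (p₁ ++ q :: p₂).head (by simp)) ∈ E := by
      have := h.disc.ce_subset
      rcases p₁ with _ | ⟨p₀, p₁⟩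
      · exact this (by simpa using mem_ce_ends q (p₂ ++ w₁) v)
      · exact this (by simpa using mem_ce_ends p₀ (p₁ ++ q :: p₂ ++ w₁) v)
    rcases p₁ with _ | ⟨p₀, _ | ⟨p₁, _ | ⟨p', p₁⟩⟩⟩
    · exact h.no_two_first hx hxc h1 h2
    · have := h.disc.ce_subset (mem_ce_append [] p₀ q (p₂ ++ (w₁ ++ [v])))
      have hn := h.disc.nodup
      simp at hvl hn hxc
      rcases h.girth.quad p₀ q x v this (mem_swap h1) h2 hvl with hh | hh
      · simp [hh] at hxc
      · simp [hh] at hn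
    · obtain ⟨a, b, rfl⟩ := List.length_eq_two.1 hw
      obtain ⟨p₃, p₄, p₅, rfl⟩ := List.length_eq_three.1 (by simp at hl hlong; omega : p₂.length = 3)
      have e01 := h.disc.ce_subset (mem_ce_append [] p₀ p₁ ([q, p₃, p₄, p₅] ++ [a, b, v]))
      have e12 := h.disc.ce_subset (mem_ce_append [p₀] p₁ q ([p₃, p₄, p₅] ++ [a, b, v]))
      simp at hvl
      refine h.no_link_three hx hxc h1 h2 fun z hz hxz => ?_
      simp at hz
      rcases hz with rfl | rfl | hz
      · exact h.girth.tri x z v hxz (mem_swap hvl) (mem_swap h2)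
      · exact h.girth.tri x z q hxz e12 (mem_swap h1)
      · exact hlast z (by simpa using hz) hxz
    · simp at hl; omega
  · obtain ⟨q₁, q', q₂, hqq, h1', hfirst⟩ := exists_first hex
    have hq₁ : q₁.length ≤ 2 := by
      by_contra hlt
      have hmem : q ∈ q₁ := by
        have h3 : (p₁ ++ q :: p₂)[p₁.length]? = some q := by simp
        rw [hqq, List.getElem?_append_left (by omega)] at h3
        exact List.mem_of_getElem? h3
      exact hfirst q hmem h1
    rw [hqq] at h hxc
    have h' := h.reverse
    simp only [List.reverse_append, List.reverse_cons, List.append_assoc, List.cons_append,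
      List.nil_append] at h'
    refine h'.no_link_short hx ?_ (by simpa using hne) (by simpa using hq₁) h1' h2
      (fun z hz => hfirst z (by simpa using hz))
    simp at hxc ⊢
    tauto

theorem Ctx.cross_last {p v : V} {w₂ : List V} (h : Ctx E d f L W U P ψ ps (v :: w₂))
    (hw : w₂ ≠ []) (hp : p ∈ P) (he : s(v, p) ∈ E) : ∃ p₁, ps = p₁ ++ [p] := by
  obtain ⟨s, r, rfl⟩ := List.append_of_mem ((h.mem p).1 hp)
  rcases h.cross (w₁ := []) (mem_swap he) with hh | hh
  · grind
  grind

theorem Ctx.cross_first {p v : V} {w₁ : List V} (h : Ctx E d f L W U P ψ ps (w₁ ++ [v]))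
    (hw : w₁ ≠ []) (hp : p ∈ P) (he : s(v, p) ∈ E) : ∃ p₂, ps = p :: p₂ := by
  obtain ⟨s, r, rfl⟩ := List.append_of_mem ((h.mem p).1 hp)
  rcases h.cross (w₂ := []) (mem_swap he) with hh | hh
  · exact (hw hh.1).elim
  grind

theorem Ctx.not_cross {p v : V} {w₁ w₂ : List V} (h : Ctx E d f L W U P ψ ps (w₁ ++ v :: w₂))
    (hw₁ : w₁ ≠ []) (hw₂ : w₂ ≠ []) (hp : p ∈ P) : s(v, p) ∉ E := fun he => by
  obtain ⟨s, r, rfl⟩ := List.append_of_mem ((h.mem p).1 hp)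
  rcases h.cross (mem_swap he) with hh | hh
  · exact hw₁ hh.1
  · exact hw₂ hh.1

set_option maxHeartbeats 1600000 in
theorem Ctx.no_three_link {p₀ p₁ v₁ v₂ v₃ b x : V} {qs w : List V}
    (h : Ctx E d f L W U P ψ (p₀ :: p₁ :: qs) (v₁ :: v₂ :: v₃ :: w)) (hw : w ≠ [])
    (hb : b ∈ U) (hx : x ∈ U) (hbc : b ∉ (p₀ :: p₁ :: qs) ++ (v₁ :: v₂ :: v₃ :: w))
    (hxc : x ∉ (p₀ :: p₁ :: qs) ++ (v₁ :: v₂ :: v₃ :: w)) (h1 : s(v₃, b) ∈ E)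
    (h2 : s(b, x) ∈ E) (h3 : s(x, p₁) ∈ E) : False := by
  have hc : Disc E d f U (v₃ :: ((w ++ [p₀]) ++ p₁ :: (qs ++ [v₁, v₂]))) := by
    have := Disc.rotate (l := (p₀ :: p₁ :: qs) ++ [v₁, v₂]) (r := v₃ :: w) (by simpa using h.disc)
    simpa using this
  have hnd := hc.nodup
  simp at hnd
  have e01 : s(p₀, p₁) ∈ E :=
    h.disc.ce_subset (mem_ce_append [] p₀ p₁ (qs ++ (v₁ :: v₂ :: v₃ :: w)))
  have hp₀ : p₀ ∈ P := (h.mem _).2 (by simp)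
  have hp₁ : p₁ ∈ P := (h.mem _).2 (by simp)
  have hbp₀ : s(b, p₀) ∉ E := Ctx.no_link (w₁ := [v₁, v₂]) h (by simp) (Or.inl hw) hb hbc
    (mem_swap h1) hp₀
  have hvp₀ : s(v₃, p₀) ∉ E := Ctx.not_cross (w₁ := [v₁, v₂]) h (by simp) hw hp₀
  have hbt : ∀ t ∈ w, s(b, t) ∉ E := by
    intro t ht he
    obtain ⟨s, r, rfl⟩ := List.append_of_mem ht
    exact Ctx.no_two_vs (w₁ := [v₁, v₂]) h hb hbc (mem_swap h1) he
  have hxt : ∀ t ∈ w, (L t).card < 3 → s(x, t) ∉ E := by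
    intro t ht ht3 he
    obtain ⟨s, r, rfl⟩ := List.append_of_mem ht
    have hc' : Disc E d f U (v₃ :: (s ++ t :: (r ++ p₀ :: p₁ :: (qs ++ [v₁, v₂])))) := by
      simpa using hc
    refine h.no_three_chord hc' (fun v hv => h.disjoint (by simp [hv])) hb hx ?_ ?_ h1 h2 he
      (Or.inr ht3)
    · simp at hbc ⊢; grind
    simp_all
  have hvt : ∀ t ∈ w, s(v₃, t) ∈ E → ∃ r, w = t :: r := fun t ht he => by
    obtain ⟨a', ha'⟩ := head_of_mem_ce hc.nodup (h.chord hc (by simp) (by simp [ht]) he)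
      (by simp [ht])
    rcases w with _ | ⟨z, l⟩
    · exact (hw rfl).elim
    grind
  have hvx : s(v₃, x) ∉ E := fun he => h.girth.tri v₃ b x h1 h2 (mem_swap he)
  have hbp₁ : s(b, p₁) ∉ E := fun he => h.girth.tri b x p₁ h2 h3 (mem_swap he)
  have hxp₀ : s(x, p₀) ∉ E := fun he => h.girth.tri x p₀ p₁ he e01 (mem_swap h3)
  simp at hbc hxc
  have hvp₁ : s(v₃, p₁) ∉ E := fun he => by
    rcases h.girth.quad v₃ b x p₁ h1 h2 h3 (mem_swap he) with hh | hh <;> grind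
  have hbx := h.girth.ne h2
  have hqs : pe (p₀ :: p₁ :: qs) ⊆ E := by
    refine (pe_prefix_subset _ ((v₁ :: v₂ :: v₃ :: w) ++ [p₀])).trans ?_
    have := h.disc.ce_subset
    rw [List.cons_append, ce_cons] at this
    simpa using this
  have hPa : ∀ v ∈ P, v ∈ w ++ [p₀] → v = p₀ := fun v hv hv' =>
    (List.mem_append.1 hv').elim (fun hh => (h.disjoint (by simp [hh]) hv).elim) (by simp)
  have hshort : ∀ t ∈ w ++ [p₀], t ∉ P → t ∈ w := fun t ht htP =>
    (List.mem_append.1 ht).resolve_right fun hh => htP (by simp at hh; rwa [hh])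
  refine h.notExt (h.drawn.arc h.good h.ih h.sub hc (m := [b, x]) (by simp; grind)
    (by simp [Set.insert_subset_iff, h1, h2, h3]) (by simp [hb, hx])
    (by simp; grind) ?_ (by simp) (by simp) ?_ [p₀, p₁, x, b, v₃, w.head hw] (by simp) ?_ ?_ ?_ ?_
    ?_ ?_ ?_)
  · intro a ha b hb he
    have := h.girth.ne he
    simp at ha hb
    rcases ha with rfl | rfl | rfl | rfl <;> rcases hb with rfl | rfl | rfl | rfl <;>
      first
      | exact (this rfl).elim
      | exact (hvx he).elim
      | exact (hvx (mem_swap he)).elim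
      | exact (hbp₁ he).elim
      | exact (hbp₁ (mem_swap he)).elim
      | exact (hvp₁ he).elim
      | exact (hvp₁ (mem_swap he)).elim
      | simp [Sym2.eq_swap]
  · have := cutConn_list (E := E) (p₁ :: qs) ((pe_suffix_subset [p₀] (p₁ :: qs)).trans hqs)
    convert this using 1
    ext z
    have := h.mem z
    grind
  · grind
  · simp
  · intro t ht htP h3' q hq' he
    have htw := hshort t ht htP
    simp at hq'
    rcases hq' with rfl | rfl | rfl | rfl
    · obtain ⟨r, rfl⟩ := hvt t htw he; simp
    · grind
    · grind
    · exact (h.strict _ hp₁ t (hc.mem (by simp [htw])) htP h3' he).elim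
  · have := cutConn_list (E := E) [p₀, p₁, x, b, v₃]
      (by simp [Set.insert_subset_iff, e01, mem_swap h1, mem_swap h2,
        mem_swap h3])
    convert this using 1
    ext z
    have := hPa z
    simp at this ⊢
    grind
  · intro t ht htP h3' q hq' q' hq'' he he'
    have htw := hshort t ht htP
    have hp := h.strict p₁ hp₁ t (hc.mem (by simp [htw])) htP h3'
    have hb := hbt t htw
    have hx := hxt t htw h3'
    simp at hq' hq''
    rcases hq' with rfl | rfl | rfl | rfl <;> rcases hq'' with rfl | rfl | rfl | rfl <;>
      first
      | rfl
      | contradiction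
  · intro z hz hz' q hq' hqP he
    obtain rfl := hPa z hz hz'
    rw [Sym2.eq_swap] at he
    simp at hq'
    rcases hq' with rfl | rfl | rfl | rfl <;> contradiction
  · exact fun z hz _ t ht htP h3 => h.strict z hz t (hc.mem (by simp at ht ⊢; grind)) htP h3

set_option maxHeartbeats 3200000 in
theorem Ctx.no_three_link_end {p₀ p₁ p₂ p₃ p₄ p₅ v₁ v₂ v₃ b x : V}
    (h : Ctx E d f L W U P ψ [p₀, p₁, p₂, p₃, p₄, p₅] [v₁, v₂, v₃])
    (hb : b ∈ U) (hx : x ∈ U) (hbc : b ∉ [p₀, p₁, p₂, p₃, p₄, p₅] ++ [v₁, v₂, v₃])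
    (hxc : x ∉ [p₀, p₁, p₂, p₃, p₄, p₅] ++ [v₁, v₂, v₃]) (h1 : s(v₃, b) ∈ E)
    (h2 : s(b, x) ∈ E) (h3 : s(x, p₁) ∈ E) : False := by
  classical
  have hc : Disc E d f U (p₁ :: ([p₂, p₃, p₄, p₅, v₁, v₂] ++ v₃ :: [p₀])) :=
    h.disc.rotate (l := [p₀]) (r := [p₁, p₂, p₃, p₄, p₅, v₁, v₂, v₃])
  have hce := h.disc.ce_subset
  have hnd := h.disc.nodup
  have hsub : ∀ u ∈ [p₀, p₁, p₂, p₃, p₄, p₅, v₁, v₂, v₃], u ∈ U := fun u hu => h.disc.mem hu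
  have hP := h.mem
  have hd : ∀ w ∈ [v₁, v₂, v₃], w ∉ P := fun w hw => h.disjoint hw
  simp [ce_cons, Set.insert_subset_iff] at hce
  obtain ⟨e01, e12, e23, e34, e45, e5v, ev1, ev2, ev0⟩ := hce
  have hp₀ : p₀ ∈ P := (h.mem _).2 (by simp)
  have hp₅ : p₅ ∈ P := (h.mem _).2 (by simp)
  have l₁ : 3 ≤ (L v₁).card := by
    by_contra hh
    exact h.strict p₅ hp₅ v₁ (hsub v₁ (by simp)) (hd _ (by simp)) (by omega) e5v
  have l₃ : 3 ≤ (L v₃).card := by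
    by_contra hh
    exact h.strict p₀ hp₀ v₃ (hsub v₃ (by simp)) (hd _ (by simp)) (by omega) (mem_swap ev0)
  have l₂ := h.good.two v₂ (hsub v₂ (by simp)) (hd _ (by simp))
  have hv1v : s(v₁, v₃) ∉ E := fun he => h.girth.tri v₁ v₂ v₃ ev1 ev2 (mem_swap he)
  have hbP : ∀ p ∈ P, s(b, p) ∉ E := fun p hp => Ctx.no_link (w₁ := [v₁, v₂]) h (by simp)
    (Or.inr rfl) hb hbc (mem_swap h1) hp
  have hb₀ := hbP _ hp₀
  have hb₁ := hbP p₁ ((h.mem _).2 (by simp))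
  have hvx : s(v₃, x) ∉ E := fun he => h.girth.tri v₃ b x h1 h2 (mem_swap he)
  have hxp₀ : s(x, p₀) ∉ E := fun he => h.girth.tri x p₀ p₁ he e01 (mem_swap h3)
  have hvp₁ : s(v₃, p₁) ∉ E := fun he =>
    h.girth.tri p₁ p₀ v₃ (mem_swap e01) (mem_swap ev0) he
  have hbx := h.girth.ne h2
  have hin : ∀ v ∈ U, v ∉ [p₀, p₁, p₂, p₃, p₄, p₅, v₁, v₂, v₃] → 3 ≤ (L v).card :=
    fun v hv hvc => h.three h.disc hv hvc
  simp at hnd hbc hxc hP hd hin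
  obtain ⟨φ, f1, f2, f3⟩ := h.good.proper.greedy (L := L) h.girth.loop [v₂, v₃, v₁]
    (by simp; grind) (by simp; tauto) (by
      rintro s w r hs
      rcases s with _ | ⟨a, _ | ⟨b, _ | ⟨c', s⟩⟩⟩ <;> simp at hs
      · obtain ⟨rfl, -⟩ := hs
        exact ⟨[], by grind, fun w hw he => by
          simp at hw
          exact (Ctx.not_cross (w₁ := [v₁]) (w₂ := [v₃]) h (by simp) (by simp) hw he).elim⟩
      · obtain ⟨rfl, rfl, -⟩ := hs
        exact ⟨[p₀, v₂], by simp; omega, fun w hw he => by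
          simp at hw
          rcases hw with hw | rfl
          · obtain ⟨l, hl⟩ := Ctx.cross_first (w₁ := [v₁, v₂]) h (by simp) hw he
            grind
          · simp⟩
      · obtain ⟨rfl, rfl, rfl, -⟩ := hs
        exact ⟨[p₅, v₂], by simp; omega, fun w hw he => by
          simp at hw
          rcases hw with hw | rfl | rfl
          · obtain ⟨l, hl⟩ := Ctx.cross_last h (by simp) hw he
            have := congrArg List.getLast? hl
            simp at this; simp [this]
          · simp
          grind⟩)
  obtain ⟨A, B, hA, hB, hU, hmeet, hcr⟩ := h.drawn.split h.sub hc (m := [x, b]) (by simp; grind)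
    (by simp [Set.insert_subset_iff, mem_swap h1, mem_swap h2, mem_swap h3])
    (by simp [hb, hx]) (by simp; grind) (by
      intro a ha b hb he
      have := h.girth.ne he
      simp at ha hb
      rcases ha with rfl | rfl | rfl | rfl <;> rcases hb with rfl | rfl | rfl | rfl <;>
      first
      | exact (this rfl).elim
      | contradiction
      | exact (hvx (mem_swap he)).elim
      | exact (hb₁ (mem_swap he)).elim
      | exact (hvp₁ (mem_swap he)).elim
      | simp [Sym2.eq_swap]) (by simp) (by simp)
  have hAU : A ⊆ U := hU ▸ Set.subset_union_left
  have hBU : B ⊆ U := hU ▸ Set.subset_union_right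
  have memA : ∀ v ∈ [p₁, p₂, p₃, p₄, p₅, v₁, v₂, v₃, b, x], v ∈ outer E d f A := fun v hv =>
    (hA.outer_iff v).2 (by simpa using hv)
  have memB : ∀ v ∈ [p₁, x, b, v₃, p₀], v ∈ B := fun v hv => hB.mem (by simpa using hv)
  simp at hmeet
  have hp₀A : p₀ ∉ A := fun hh => by
    have := hmeet p₀ hh (memB _ (by simp))
    grind
  have hlist : ∀ v ∈ A, v ∉ [p₁, p₂, p₃, p₄, p₅, v₁, v₂, v₃] → 3 ≤ (L v).card :=
    fun v hv hvc => by
      simp at hvc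
      grind
  have huq : ∀ v : V, ∀ y ∈ ({v₂, v₃} : Set V), ∀ y' ∈ ({v₂, v₃} : Set V), s(y, v) ∈ E →
      s(y', v) ∈ E → y = y' := by
    rintro v y (rfl | rfl) y' (rfl | rfl) he he'
    · rfl
    · exact (h.girth.tri _ _ _ he (mem_swap he') (mem_swap ev2)).elim
    · exact (h.girth.tri _ _ _ he (mem_swap he') ev2).elim
    · rfl
  have hPA : ∀ v, v ∈ [p₁, p₂, p₃, p₄, p₅, v₁] ↔ v = p₁ ∨ v = p₂ ∨ v = p₃ ∨ v = p₄ ∨ v = p₅ ∨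
    v = v₁ := by simp
  have hshort : ∀ v ∈ A, v ∉ {v | v ∈ [p₁, p₂, p₃, p₄, p₅, v₁]} → v ∉ ({v₂, v₃} : Set V) →
      (avoid E L φ {v₂, v₃} v).card < 3 → ∃ y ∈ ({v₂, v₃} : Set V), s(y, v) ∈ E := by
    intro v hv hvP hvY hlt
    by_contra! hno
    rw [avoid_eq hno] at hlt
    have := hlist v hv (by simp at hvP hvY ⊢; grind)
    omega
  have hext : Ext E L A ({v | v ∈ [p₁, p₂, p₃, p₄, p₅, v₁]} ∪ {v₂, v₃}) φ := by
    refine h.drawn.peel (h.ih.mono hAU) (by simp) (fun v hv => memA v ?_) (fun v hv => memA v ?_)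
      ?_ (ncard_le_of_list [p₁, p₂, p₃, p₄, p₅, v₁] fun v hv => hv)
      (cutConn_list _ (by simp [Set.insert_subset_iff, e12, e23, e34, e45, e5v]))
      (f3.mono fun v hv => ?_) (fun v hv hvP hvY => ?_) (fun v hv hvo => hlist v hv ?_)
      (fun u hu huP huY v hv hvP hvY h3u h3v he => ?_) fun p hp v hv hvP hvY h3v he => ?_
    · simp at hv ⊢; grind
    · simp at hv ⊢; grind
    · simp; grind
    · simp at hv ⊢; grind
    · have := card_le_avoid (L := L) (φ := φ) (huq v)
      have := hlist v hv (by simp at hvP hvY ⊢; grind)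
      omega
    · intro hh
      exact hvo (memA v (by simp at hh ⊢; grind))
    · obtain ⟨y, hy, hyu⟩ := hshort u hu huP huY h3u
      obtain ⟨z, hz, hzv⟩ := hshort v hv hvP hvY h3v
      rcases hy with rfl | rfl <;> rcases hz with rfl | rfl
      · exact h.girth.tri _ _ _ hyu he (mem_swap hzv)
      · rcases h.girth.quad _ _ _ _ hyu he (mem_swap hzv) (mem_swap ev2) with hh | hh
        · exact hvY (by simp [hh])
        · exact huY (by simp [hh])
      · rcases h.girth.quad _ _ _ _ hyu he (mem_swap hzv) ev2 with hh | hh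
        · exact hvY (by simp [hh])
        · exact huY (by simp [hh])
      · exact h.girth.tri _ _ _ hyu he (mem_swap hzv)
    · obtain ⟨y, hy, hyv⟩ := hshort v hv hvP hvY h3v
      rw [Sym2.eq_swap] at he hyv
      have hvc : v ∉ [p₀, p₁, p₂, p₃, p₄, p₅] ++ [v₁, v₂, v₃] := by
        have : v ≠ p₀ := fun hh => hp₀A (hh ▸ hv)
        simp at hvP hvY ⊢; grind
      by_cases hpv : p = v₁
      · subst hpv
        rcases hy with rfl | rfl
        · exact h.girth.tri _ _ _ he ev1 (mem_swap hyv)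
        · rcases h.girth.quad _ _ _ _ he ev1 ev2 (mem_swap hyv) with hh | hh
          · simp [hh] at hvc
          · grind
      have hpP : p ∈ P := by rw [hP]; simp at hp; grind
      rcases hy with rfl | rfl
      · exact Ctx.no_link (w₁ := [v₁]) (w₂ := [v₃]) h (by simp) (by simp) (hAU hv) hvc hyv hpP he
      · exact Ctx.no_link (w₁ := [v₁, v₂]) (w₂ := []) h (by simp) (by simp) (hAU hv) hvc hyv hpP he
  obtain ⟨χ, c1, c2, c3⟩ := hext
  have hglue := f3.glue c3 (fun v hv hvA => (c1 v ?_).symm) fun u hu huA w hw hwK he => ?_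
  rotate_left
  · have : v ≠ p₀ := fun hh => hp₀A (hh ▸ hvA)
    simp [hP] at hv ⊢; grind
  · have hu0 : u = p₀ := by
      by_contra hne
      have := memA u
      refine huA (this ?_).1
      simp [hP] at hu ⊢; grind
    subst hu0
    have hwB : w ∈ B := by
      by_contra hwB
      exact hcr w hw hwB _ (memB _ (by simp)) huA (mem_swap he)
    rw [Sym2.eq_swap] at he
    have := hmeet w hw hwB
    simp [hP] at hwK
    rcases this with rfl | rfl | rfl | rfl
    · simp at hwK
    · exact hxp₀ he
    · exact hb₀ he
    · simp at hwK
  have hcK : ∀ v ∈ p₁ :: ([x, b] ++ v₃ :: [p₀]), v ∈ P ∪ {v | v ∈ [v₂, v₃, v₁]} ∪ A := by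
    intro v hv
    have := memA v
    simp at hv
    rcases hv with rfl | rfl | rfl | rfl | rfl
    · exact Or.inl (Or.inl (by simp [hP]))
    · exact Or.inr (this (by simp)).1
    · exact Or.inr (this (by simp)).1
    · exact Or.inl (Or.inr (by simp))
    · exact Or.inl (Or.inl hp₀)
  have hinK : ∀ v ∈ B, v ∈ P ∪ {v | v ∈ [v₂, v₃, v₁]} ∪ A →
      v ∈ p₁ :: ([x, b] ++ v₃ :: [p₀]) := by
    intro v hv hvK
    by_cases hvA : v ∈ A
    · have := hmeet v hvA hv
      simp; grind
    · have := memA v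
      have : v = p₀ := by
        by_contra hne
        refine hvA (this ?_).1
        simp [hP] at hvK ⊢; grind
      simp [this]
  have hcrK : ∀ u ∈ P ∪ {v | v ∈ [v₂, v₃, v₁]} ∪ A, u ∉ B → ∀ w ∈ B,
      w ∉ P ∪ {v | v ∈ [v₂, v₃, v₁]} ∪ A → s(u, w) ∉ E := by
    intro u hu huB w hw hwK he
    have huA : u ∈ A := by
      by_contra huA
      have : u = p₀ := by
        by_contra hne
        refine huA (memA u ?_).1
        simp [hP] at hu ⊢; grind
      exact huB (this ▸ memB p₀ (by simp))
    exact hcr u huA huB w hw (fun hh => hwK (Or.inr hh)) he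
  have hLK : ∀ v ∈ B, v ∉ P ∪ {v | v ∈ [v₂, v₃, v₁]} ∪ A → 3 ≤ (L v).card := by
    intro v hv hvK
    refine hin v (hBU hv) ?_ ?_ ?_ ?_ ?_ ?_ ?_ ?_ ?_ <;>
    · rintro rfl; simp [hP] at hvK
  obtain ⟨χ₂, g1, g2, g3⟩ := h.drawn.cyc_extend h.girth (L := L) (hBU.trans h.sub) (h.ih.mono hBU)
    hB (by simp) hglue hcK hinK hcrK hLK
  refine h.notExt ⟨χ₂, fun u hu => ?_, fun u hu huP => ?_, g3.mono fun u hu => ?_⟩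
  · rw [g1 u (Or.inl (Or.inl hu))]
    rw [if_pos (Set.mem_union_left _ hu), f1 u hu]
  · by_cases hu1 : u ∈ [v₂, v₃, v₁]
    · rw [g1 u (Or.inl (Or.inr hu1))]
      rw [if_pos (show u ∈ P ∪ {v | v ∈ [v₂, v₃, v₁]} from Or.inr hu1)]
      exact f2 u hu1
    by_cases huA : u ∈ A
    · rw [g1 u (Or.inr huA)]
      rw [if_neg (show u ∉ P ∪ {v | v ∈ [v₂, v₃, v₁]} from fun hh => hh.elim huP hu1)]
      refine c2 u huA ?_
      simp [hP] at huP hu1 ⊢; grind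
    · refine g2 u ((hU.ge hu).resolve_left huA) fun hh => ?_
      rcases hh with (hh | hh) | hh
      · exact huP hh
      · exact hu1 hh
      · exact huA hh
  · exact (hU.ge hu).elim (fun hh => Or.inl (Or.inr hh)) Or.inr

omit [Fintype V] in
theorem Disc.pe_subset {l a r : List V} (h : Disc E d f U (l ++ (a ++ r))) : pe a ⊆ E := by
  have := h.rotate
  rw [List.append_assoc] at this
  rcases a with _ | ⟨x, a⟩
  · simp
  have hce := this.ce_subset
  rw [List.cons_append, ce_cons] at hce
  refine Set.Subset.trans ?_ hce
  rw [← List.cons_append, List.append_assoc]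
  exact pe_prefix_subset _ _

/-- Data for colouring a disc whose boundary is `ps ++ (ys ++ ws)`, the vertices of `ps` and `ys`
being coloured, by deleting `ys`: after the deletion, a short vertex adjacent to `ps` may occur only
as the middle vertex of a path from `ps` to `ys` cutting off a short cycle. -/
structure Peel (E : Set (Sym2 V)) (d : Sym2 V → Sym2 ι) (f : ι) (L : V → Finset α)
    (W U : Set V) (ps ys ws : List V) (φ : V → α) : Prop where
  drawn : Drawn E d W
  girth : Girth5 E
  sub : U ⊆ W
  ih : IH α E d f U
  disc : Disc E d f U (ps ++ (ys ++ ws))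
  ne : ys ≠ []
  card : ps.length ≤ 6
  proper : Proper E {v | v ∈ ps ∨ v ∈ ys} φ
  two : ∀ v ∈ U, v ∉ ps → v ∉ ys → 2 ≤ (avoid E L φ {v | v ∈ ys} v).card
  inner : ∀ v ∈ U, v ∉ ps → v ∉ ys → v ∉ ws → 3 ≤ (L v).card
  indep : ∀ u ∈ U, u ∉ ps → u ∉ ys → ∀ v ∈ U, v ∉ ps → v ∉ ys →
    (avoid E L φ {v | v ∈ ys} u).card < 3 → (avoid E L φ {v | v ∈ ys} v).card < 3 → s(u, v) ∉ E
  uniq : ∀ v ∈ U, v ∉ ps → v ∉ ys → ∀ y ∈ ys, ∀ y' ∈ ys, s(v, y) ∈ E → s(v, y') ∈ E → y = y'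
  link : ∀ v ∈ U, v ∉ ps → v ∉ ys → (avoid E L φ {v | v ∈ ys} v).card < 3 → ∀ p ∈ ps,
    s(v, p) ∈ E → v ∉ ws ∧ ∃ y ∈ ys, s(v, y) ∈ E
  short : ∀ v ∈ U, v ∉ ps → v ∉ ys → v ∉ ws → ∀ p₁ p p₂ y₁ y y₂, ps = p₁ ++ p :: p₂ →
    ys = y₁ ++ y :: y₂ → s(v, p) ∈ E → s(v, y) ∈ E → p₂ ≠ [] ∧ p₂.length + y₁.length ≤ 5 ∧
    (p₂.length + y₁.length = 5 → ∀ q ∈ p₂, s(v, q) ∉ E)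

set_option maxHeartbeats 3200000 in
theorem Peel.ext (h : Peel E d f L W U ps ys ws φ) :
    Ext E L U ({v | v ∈ ps} ∪ {v | v ∈ ys}) φ := by
  classical
  have hout : ∀ v, v ∈ outer E d f U ↔ v ∈ ps ∨ v ∈ ys ∨ v ∈ ws := fun v => by
    rw [h.disc.outer_iff]; simp
  have hpsE : pe ps ⊆ E := Disc.pe_subset (l := []) h.disc
  have hnd := h.disc.nodup
  set Y : Set V := {v | v ∈ ys} with hY
  have hprop : Proper E ({v | v ∈ ps} ∪ Y) φ := h.proper.mono fun v hv => hv
  let T : V → List V → List V → Prop := fun x p₁ y₂ => ∃ p p₂ y₁ y, x ∈ U ∧ x ∉ ps ∧ x ∉ ys ∧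
    (avoid E L φ Y x).card < 3 ∧ ps = p₁ ++ p :: p₂ ∧ ys = y₁ ++ y :: y₂ ∧ s(x, p) ∈ E ∧
    s(x, y) ∈ E
  by_cases hT : ∃ n x p₁ y₂, p₁.length = n ∧ T x p₁ y₂
  swap
  · refine h.drawn.peel h.ih ⟨ys.head h.ne, List.head_mem h.ne⟩ (fun v hv => (hout v).2 (Or.inr (Or.inl hv)))
      (fun v hv => (hout v).2 (Or.inl hv)) (fun p hp hpY => ?_) ((ncard_le_of_list ps fun v hv => hv).trans h.card)
      (cutConn_list _ hpsE) hprop h.two (fun v hv hvo => ?_) h.indep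
      (fun p hp v hv hvP hvY h3 he => ?_)
    · grind
    · have := (hout v).not.1 hvo
      exact h.inner v hv (by tauto) (by tauto) (by tauto)
    · obtain ⟨-, y, hy, he'⟩ := h.link v hv hvP hvY h3 p hp (mem_swap he)
      obtain ⟨p₁, p₂, hp⟩ := List.append_of_mem hp
      obtain ⟨y₁, y₂, hy⟩ := List.append_of_mem hy
      grind
  obtain ⟨n, hn, hmin⟩ : ∃ n, (∃ x p₁ y₂, p₁.length = n ∧ T x p₁ y₂) ∧
      ∀ m < n, ¬ ∃ x p₁ y₂, p₁.length = m ∧ T x p₁ y₂ :=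
    ⟨Nat.find hT, Nat.find_spec hT, fun m hm => Nat.find_min hT hm⟩
  have hT' : ∃ k x p₁ y₂, p₁.length = n ∧ y₂.length = k ∧ T x p₁ y₂ := by grind
  obtain ⟨k, ⟨x, p₁, y₂, hp₁, hy₂, p, p₂, y₁, y, hx, hxps, hxys, hx3, hps, hys, hxp, hxy⟩, hmin'⟩ :
      ∃ k, (∃ x p₁ y₂, p₁.length = n ∧ y₂.length = k ∧ T x p₁ y₂) ∧
      ∀ m < k, ¬ ∃ x p₁ y₂, p₁.length = n ∧ y₂.length = m ∧ T x p₁ y₂ :=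
    ⟨Nat.find hT', Nat.find_spec hT', fun m hm => Nat.find_min hT' hm⟩
  have hxw := (h.link x hx hxps hxys hx3 p (by simp [hps]) hxp).1
  obtain ⟨hp₂, hlen, hq8⟩ := h.short x hx hxps hxys hxw p₁ p p₂ y₁ y y₂ hps hys hxp hxy
  have hc : Disc E d f U (p :: ((p₂ ++ y₁) ++ y :: (y₂ ++ ws ++ p₁))) := by
    have := h.disc
    rw [hps, List.append_assoc] at this
    have := this.rotate
    simpa [hys] using this
  have hn' := hc.nodup
  have hpy : s(p, y) ∉ E := fun he => h.girth.tri x p y hxp he (mem_swap hxy)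
  have hpsm : ∀ v, v ∈ ps ↔ v ∈ p₁ ∨ v = p ∨ v ∈ p₂ := fun v => by simp [hps]
  have hysm : ∀ v, v ∈ ys ↔ v ∈ y₁ ∨ v = y ∨ v ∈ y₂ := fun v => by simp [hys]
  simp only [List.nodup_cons, List.nodup_append, List.mem_append, List.mem_cons] at hn'
  obtain ⟨A, B, hA, hB, hU, hmeet, hcr⟩ := h.drawn.split h.sub hc (m := [x])
    (by simp; grind)
    (by simp [Set.insert_subset_iff, mem_swap hxp, hxy]) (by simpa using hx)
    (by simp; grind) (fun a ha b hb he => by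
      have := h.girth.ne he
      simp at ha hb
      rcases ha with rfl | rfl | rfl <;> rcases hb with rfl | rfl | rfl <;>
        first
        | exact (this rfl).elim
        | exact (hpy he).elim
        | exact (hpy (mem_swap he)).elim
        | simp [Sym2.eq_swap]) (by simp) (by simp)
  have hAU : A ⊆ U := hU ▸ Set.subset_union_left
  have hBU : B ⊆ U := hU ▸ Set.subset_union_right
  have memA : ∀ v, v ∈ p :: ((p₂ ++ y₁) ++ y :: [x].reverse) → v ∈ A := fun v => hA.mem
  have memB : ∀ v, v ∈ outer E d f B ↔ v ∈ p :: ([x] ++ y :: (y₂ ++ ws ++ p₁)) := hB.outer_iff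
  simp at hmeet memA memB
  -- neighbours of the new vertex
  have hnox : ∀ q ∈ p₂, s(x, q) ∉ E := by
    intro q hq he
    rcases hlen.lt_or_eq with hlt | heq
    swap
    · exact hq8 heq q hq he
    have hch := h.girth.short_chordless hA.nodup hA.ce_subset (by simp; omega) (u := x) (v := q)
      (by simp) (by simp [hq]) he
    have e : p :: ((p₂ ++ y₁) ++ y :: [x].reverse) = (p :: ((p₂ ++ y₁) ++ [y])) ++ x :: [] := by simp
    have hnA := hA.nodup
    rw [e, List.nodup_append_comm] at hnA
    rw [e, ce_rotate] at hch
    rcases nbr_of_mem_ce hnA hch with rfl | rfl <;> grind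
  have hxK : x ∉ ({v | v ∈ ps} ∪ Y : Set V) := by grind
  obtain ⟨φ', hφ', hφx, hprop'⟩ := hprop.step (L := L) hxK (h.girth.loop x) [p, y]
    (by have := h.inner x hx hxps hxys hxw; simp; omega) (fun w hw he => by
      rcases hw with hw | hw
      · rcases (hpsm w).1 hw with hw | rfl | hw
        · obtain ⟨a, b, rfl⟩ := List.append_of_mem hw
          exact (hmin a.length (by rw [← hp₁]; simp) ⟨x, a, y₂, rfl, w, b ++ p :: p₂, y₁, y, hx, hxps,
            hxys, hx3, by simp [hps], hys, he, hxy⟩).elim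
        · simp
        grind
      · rw [h.uniq x hx hxps hxys w hw y ((hysm y).2 (Or.inr (Or.inl rfl))) he hxy]
        simp)
  -- colour the side away from the short cycle
  have hBA : ∀ v ∈ B, v ∉ p₁ ++ [p, x] → v ∉ y :: y₂ → v ∉ A ∧ v ∉ ps ∧ v ∉ ys := by
    intro v hv h1 h2
    have hvA : v ∉ A := fun hvA => by
      rcases hmeet v hvA hv with rfl | rfl | rfl
      · exact h1 (by simp)
      · exact h1 (by simp)
      · exact h2 (by simp)
    grind
  have hy₁B : ∀ v ∈ y₁, v ∈ A ∧ v ∉ B := fun v hv => by grind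
  have hav : ∀ v ∈ B, v ∉ p₁ ++ [p, x] → v ∉ y :: y₂ →
      avoid E L φ' {v | v ∈ y :: y₂} v = avoid E L φ Y v := by
    intro v hv h1 h2
    have h3 := hBA v hv h1 h2
    ext a
    rw [mem_avoid, mem_avoid]
    refine and_congr_right fun _ => ⟨fun hh z hz he => ?_, fun hh z hz he => ?_⟩
    · have hz' := (hysm z).1 hz
      rw [← hφ' z fun e => hxys (e ▸ hz)]
      grind
    · have hz' : z ∈ ys := by grind
      rw [hφ' z fun e => hxys (e ▸ hz')]
      exact hh z hz' he
  have hps' : ∀ v ∈ p₁ ++ [p, x], v ∈ ps ∨ v = x := fun v hv => by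
    rw [hpsm]
    simp at hv
    tauto
  have hys' : ∀ v ∈ y :: y₂, v ∈ ys := fun v hv => by grind
  have hextB : Ext E L B ({v | v ∈ p₁ ++ [p, x]} ∪ {v | v ∈ y :: y₂}) φ' := by
    refine h.drawn.peel (h.ih.mono hBU) ⟨y, by simp⟩ (fun v hv => (memB v).2 ?_)
      (fun v hv => (memB v).2 ?_) (fun q hq hqY => ?_)
      ((ncard_le_of_list (p₁ ++ [p, x]) fun v hv => hv).trans ?_) (cutConn_list _ ?_)
      (hprop'.mono ?_) (fun v hv h1 h2 => ?_) (fun v hv hvo => ?_)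
      (fun u hu hu1 hu2 v hv h1 h2 hu3 hv3 => ?_) (fun q hq v hv h1 h2 h3 he => ?_)
    · grind
    · simp at hv ⊢
      tauto
    · have := hys' q hqY
      rcases hps' q hq with hq | rfl
      · exact (List.nodup_append.1 hnd).2.2 q hq q (by simp; exact Or.inl this) rfl
      · exact hxys this
    · have h1 := h.card
      have h2 := List.length_pos_iff.2 hp₂
      rw [hps] at h1
      simp at h1 ⊢
      omega
    · rw [pe_append]
      refine Set.union_subset (Set.Subset.trans ?_ hpsE) (by
        simp [mem_swap hxp])
      have := pe_prefix_subset (p₁ ++ [p]) p₂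
      rwa [hps, show p₁ ++ p :: p₂ = (p₁ ++ [p]) ++ p₂ by simp]
    · rintro v (hv | hv)
      · rcases hps' v hv with hv | rfl
        · exact Or.inr (Or.inl hv)
        · exact Or.inl rfl
      · exact Or.inr (Or.inr (hys' v hv))
    · have h3 := hBA v hv h1 h2
      rw [hav v hv h1 h2]
      exact h.two v (hBU hv) h3.2.1 h3.2.2
    · have hvo' := (memB v).not.1 hvo
      have h1 : v ∉ p₁ ++ [p, x] := fun hh => hvo' (by simp at hh ⊢; tauto)
      have h2 : v ∉ y :: y₂ := fun hh => hvo' (by simp at hh ⊢; tauto)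
      have h3 := hBA v hv h1 h2
      exact h.inner v (hBU hv) h3.2.1 h3.2.2 fun hh => hvo' (by simp [hh])
    · have h3 := hBA v hv h1 h2
      have h4 := hBA u hu hu1 hu2
      rw [hav v hv h1 h2] at hv3
      rw [hav u hu hu1 hu2] at hu3
      exact h.indep u (hBU hu) h4.2.1 h4.2.2 v (hBU hv) h3.2.1 h3.2.2 hu3 hv3
    · have h4 := hBA v hv h1 h2
      rw [hav v hv h1 h2] at h3
      have he' := mem_swap he
      rcases hps' q hq with hqp | rfl
      swap
      · exact h.indep q hx hxps hxys v (hBU hv) h4.2.1 h4.2.2 hx3 h3 he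
      obtain ⟨-, z, hz, hvz⟩ := h.link v (hBU hv) h4.2.1 h4.2.2 h3 q hqp he'
      simp only [List.mem_append, List.mem_cons, List.not_mem_nil, or_false] at hq
      rcases hq with hq | rfl | rfl
      · obtain ⟨a, b, rfl⟩ := List.append_of_mem hq
        obtain ⟨y₁', y₂', hz'⟩ := List.append_of_mem hz
        exact hmin a.length (by rw [← hp₁]; simp) ⟨v, a, y₂', rfl, q, b ++ p :: p₂, y₁', z, hBU hv,
          h4.2.1, h4.2.2, h3, by simp [hps], hz', he', hvz⟩
      · rcases (hysm z).1 hz with hz | rfl | hz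
        · exact hcr z (hy₁B z hz).1 (hy₁B z hz).2 v hv h4.1 (mem_swap hvz)
        · rcases h.girth.quad x z v q hxy (mem_swap hvz) he' (mem_swap hxp) with rfl | rfl
          · exact h1 (by simp)
          · exact hn'.1 (Or.inr (Or.inl rfl))
        · obtain ⟨a, b, rfl⟩ := List.append_of_mem hz
          exact hmin' b.length (by rw [← hy₂]; simp; omega) ⟨v, p₁, b, hp₁, rfl, q, p₂,
            y₁ ++ y :: a, z, hBU hv, h4.2.1, h4.2.2, h3, hps, by simp [hys], he', hvz⟩
      · exact hxps hqp
  obtain ⟨χ, hχ1, hχ2, hχ3⟩ := hextB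
  -- glue
  have hKB : ∀ v, v ∈ (Insert.insert x ({v | v ∈ ps} ∪ Y) : Set V) → v ∈ B →
      v ∈ p₁ ++ [p, x] ∨ v ∈ y :: y₂ := by
    intro v hv hvB
    by_contra hcon
    push Not at hcon
    have := hBA v hvB hcon.1 hcon.2
    rcases hv with rfl | hv | hv
    · exact hcon.1 (by simp)
    · exact this.2.1 hv
    · exact this.2.2 hv
  have hBK : ∀ v, v ∈ p₁ ++ [p, x] ∨ v ∈ y :: y₂ →
      v ∈ (Insert.insert x ({v | v ∈ ps} ∪ Y) : Set V) := by
    rintro v (hv | hv)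
    · rcases hps' v hv with hv | rfl
      · exact Or.inr (Or.inl hv)
      · exact Or.inl rfl
    · exact Or.inr (Or.inr (hys' v hv))
  have hglue := hprop'.glue hχ3 (fun v hv hvB => (hχ1 v (hKB v hv hvB)).symm)
    (fun u hu huB w hw hwK => by
      have hwA := (hBA w hw (fun hh => hwK (hBK w (Or.inl hh))) (fun hh => hwK (hBK w (Or.inr hh)))).1
      have huA : u ∈ A := by
        have : u ∈ U := by
          rcases hu with rfl | hu | hu
          · exact hx
          · exact h.disc.mem (by simp [show u ∈ ps from hu])
          · exact h.disc.mem (by simp [show u ∈ ys from hu])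
        rw [← hU] at this
        exact this.resolve_right huB
      exact hcr u huA huB w hw hwA)
  refine Exists.elim (h.drawn.cyc_extend h.girth (L := L) (hAU.trans h.sub) (h.ih.mono hAU) hA
    (by simp; omega) hglue (fun v hv => ?_) (fun v hvA hvK => ?_) (fun u hu huA w hw hwK => ?_)
    (fun v hv hvK => ?_)) ?_
  · have : v ∈ ps ∨ v = x ∨ v ∈ ys := by
      rw [hpsm, hysm]
      simp at hv
      tauto
    rcases this with hv | rfl | hv
    · exact Or.inl (Or.inr (Or.inl hv))
    · exact Or.inl (Or.inl rfl)
    · exact Or.inl (Or.inr (Or.inr hv))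
  · have hB' : v ∈ B → v ∈ p :: ((p₂ ++ y₁) ++ y :: [x].reverse) := fun hvB => by
      rcases hmeet v hvA hvB with rfl | rfl | rfl <;> simp
    have hoB : v = p ∨ v = x ∨ v = y ∨ v ∈ y₂ ∨ v ∈ ws ∨ v ∈ p₁ → v ∈ B := fun hh =>
      ((memB v).2 hh).1
    rcases hvK with (rfl | hv | hv) | hv
    · simp
    · rcases (hpsm v).1 hv with hv | rfl | hv
      · exact hB' (hoB (by tauto))
      · simp
      · simp [hv]
    · rcases (hysm v).1 hv with hv | rfl | hv
      · simp [hv]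
      · simp
      · exact hB' (hoB (by tauto))
    · exact hB' hv
  · have huB : u ∈ B := by
      have : u ∈ U := by
        rcases hu with (rfl | hu | hu) | hu
        · exact hx
        · exact h.disc.mem (by simp [show u ∈ ps from hu])
        · exact h.disc.mem (by simp [show u ∈ ys from hu])
        · exact hBU hu
      rw [← hU] at this
      exact this.resolve_left huA
    rw [Sym2.eq_swap]
    exact hcr w hw (fun hh => hwK (Or.inr hh)) u huB huA
  · refine h.inner v (hAU hv) (fun hh => hvK (Or.inl (Or.inr (Or.inl hh))))
      (fun hh => hvK (Or.inl (Or.inr (Or.inr hh)))) fun hh => hvK (Or.inr ?_)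
    exact ((memB v).2 (by tauto)).1
  · rintro χ' ⟨h1, h2, h3⟩
    refine ⟨χ', fun v hv => ?_, fun v hv hvP => ?_, h3.mono fun v hv => ?_⟩
    · rw [h1 v (Or.inl (Or.inr hv)), if_pos (show v ∈ _ from Or.inr hv)]
      exact hφ' v fun e => hxK (e ▸ hv)
    · by_cases hvx : v = x
      · subst hvx
        rw [h1 v (Or.inl (Or.inl rfl)), if_pos (show v ∈ _ from Or.inl rfl)]
        exact hφx
      have hvI : v ∉ (Insert.insert x ({v | v ∈ ps} ∪ Y) : Set V) := by
        rintro (hh | hh)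
        · exact hvx hh
        · exact hvP hh
      by_cases hvB : v ∈ B
      · rw [h1 v (Or.inr hvB), if_neg hvI]
        exact hχ2 v hvB fun hh => hvI (hBK v hh)
      · refine h2 v ?_ fun hh => hh.elim hvI hvB
        rw [← hU] at hv
        exact hv.resolve_right hvB
    · rw [← hU] at hv
      rcases hv with hv | hv
      · exact Or.inr hv
      · exact Or.inl (Or.inr hv)

omit [Fintype V] in
theorem avoid_eq_of_notMem {v : V} (h : ∀ y ∈ Y, s(y, v) ∈ E → φ y ∉ L v) :
    avoid E L φ Y v = L v := by
  ext a
  rw [mem_avoid]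
  grind

theorem Ctx.uniq_vs (h : Ctx E d f L W U P ψ ps vs) {x y y' : V} (hx : x ∈ U) (hxc : x ∉ ps ++ vs)
    (hy : y ∈ vs) (hy' : y' ∈ vs) (h1 : s(x, y) ∈ E) (h2 : s(x, y') ∈ E) : y = y' := by
  by_contra hne
  obtain ⟨s, r, rfl⟩ := List.append_of_mem hy
  rcases List.mem_append.1 hy' with hh | hh
  · obtain ⟨s, t, rfl⟩ := List.append_of_mem hh
    rw [List.append_assoc, List.cons_append] at h hxc
    exact h.no_two_vs hx hxc h2 h1
  · have hh := (List.mem_cons.1 hh).resolve_left (Ne.symm hne)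
    obtain ⟨s, t, rfl⟩ := List.append_of_mem hh
    exact h.no_two_vs hx hxc h1 h2

theorem Ctx.consecutive {w₁ m w₂ : List V} {u v : V}
    (h : Ctx E d f L W U P ψ ps (w₁ ++ u :: (m ++ v :: w₂))) (he : s(u, v) ∈ E) : m = [] := by
  have hc : Disc E d f U (u :: (m ++ v :: (w₂ ++ ps ++ w₁))) := by
    have := h.disc
    rw [← List.append_assoc] at this
    simpa using this.rotate
  refine (h.eq_nil_or hc he).resolve_right fun hh => h.ps_ne ?_
  simp_all

theorem Ctx.join (h : Ctx E d f L W U P ψ ps (ys ++ ws)) {y w : V} (hy : y ∈ ys) (hw : w ∈ ws)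
    (he : s(y, w) ∈ E) : (∃ y₁, ys = y₁ ++ [y]) ∧ ∃ w₂, ws = w :: w₂ := by
  obtain ⟨y₁, y₂, rfl⟩ := List.append_of_mem hy
  obtain ⟨w₁, w₂, rfl⟩ := List.append_of_mem hw
  have := Ctx.consecutive (w₁ := y₁) (m := y₂ ++ w₁) (by simpa using h) he
  simp_all

theorem Ctx.notExt_of_colour (h : Ctx E d f L W U P ψ ps vs) (hφP : ∀ v ∈ P, φ v = ψ v)
    (hφL : ∀ y ∈ ys, φ y ∈ L y) : ¬ Ext E L U ({v | v ∈ ps} ∪ {v | v ∈ ys}) φ := by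
  rintro ⟨χ, h1, h2, h3⟩
  refine h.notExt ⟨χ, fun v hv => (h1 v (Or.inl ((h.mem v).1 hv))).trans (hφP v hv),
    fun v hv hvP => ?_, h3⟩
  by_cases hvy : v ∈ ys
  · grind
  · exact h2 v hv fun hh => hh.elim (fun hh => hvP ((h.mem v).2 hh)) hvy

set_option maxHeartbeats 1600000 in
/-- Deleting an initial segment of the uncoloured boundary is impossible, unless an interior edge
joins neighbours of that segment. -/
theorem Ctx.exists_rung (h : Ctx E d f L W U P ψ ps (ys ++ ws)) (hys : ys ≠ [])
    (hw : ws ≠ [] ∨ ys.length = 3) (hφP : ∀ v ∈ P, φ v = ψ v) (hφL : ∀ y ∈ ys, φ y ∈ L y)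
    (hφ : Proper E (P ∪ {v | v ∈ ys}) φ)
    (hhead : ∀ w ws', ws = w :: ws' → (∀ y ∈ ys, s(y, w) ∈ E → φ y ∉ L w) ∨
      (3 ≤ (L w).card ∧ ∃ u r, ws' = u :: r ∧ 3 ≤ (L u).card)) :
    ∃ u ∈ U, ∃ v ∈ U, u ∉ ps ++ (ys ++ ws) ∧ v ∉ ps ++ (ys ++ ws) ∧ s(u, v) ∈ E ∧
      (∃ y ∈ ys, s(u, y) ∈ E) ∧ ∃ y ∈ ys, s(v, y) ∈ E := by
  classical
  by_contra hnorm
  have hnd := h.disc.nodup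
  have hmem : ∀ v, v ∈ ps ++ (ys ++ ws) ↔ v ∈ ps ∨ v ∈ ys ∨ v ∈ ws := fun v => by simp
  -- neighbours in the deleted segment
  have huniq : ∀ v ∈ U, v ∉ ps → v ∉ ys → ∀ y ∈ ys, ∀ y' ∈ ys, s(v, y) ∈ E → s(v, y') ∈ E →
      y = y' := by
    intro v hv h1 h2 y hy y' hy' he he'
    by_cases hvw : v ∈ ws
    · obtain ⟨⟨a, ha⟩, -⟩ := h.join hy hvw (mem_swap he)
      obtain ⟨⟨b, hb⟩, -⟩ := h.join hy' hvw (mem_swap he')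
      have := ha.symm.trans hb
      simpa using congrArg List.getLast? this
    · exact h.uniq_vs hv (by rw [hmem]; tauto) (List.mem_append_left _ hy)
        (List.mem_append_left _ hy') he he'
  have hcard : ∀ v ∈ U, v ∉ ps → v ∉ ys → (L v).card ≤ (avoid E L φ {v | v ∈ ys} v).card + 1 :=
    fun v hv h1 h2 => card_le_avoid fun y hy y' hy' he he' =>
      huniq v hv h1 h2 y hy y' hy' (mem_swap he) (mem_swap he')
  have hthree : ∀ v ∈ U, v ∉ ps → v ∉ ys → v ∉ ws → 3 ≤ (L v).card := fun v hv h1 h2 h3 =>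
    h.three h.disc hv (by rw [hmem]; tauto)
  have hoff : ∀ v ∈ U, v ∉ ps → v ∉ ys → v ∉ ws → (avoid E L φ {v | v ∈ ys} v).card < 3 →
      ∃ y ∈ ys, s(v, y) ∈ E := by
    intro v hv h1 h2 h3 h4
    by_contra hcon
    push Not at hcon
    rw [avoid_eq (Y := {v | v ∈ ys}) fun y hy he => hcon y hy (mem_swap he)] at h4
    grind
  have hon : ∀ w ∈ ws, avoid E L φ {v | v ∈ ys} w = L w ∨
      (3 ≤ (L w).card ∧ ∃ u r, ws = w :: u :: r ∧ 3 ≤ (L u).card) := by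
    intro w hw
    by_cases hall : ∀ y ∈ ys, s(y, w) ∈ E → φ y ∉ L w
    · exact Or.inl (avoid_eq_of_notMem hall)
    · push Not at hall
      obtain ⟨y, hy, he, hyL⟩ := hall
      obtain ⟨-, w₂, rfl⟩ := h.join hy hw he
      grind
  have hnP : ∀ v, v ∉ ps → v ∉ P := fun v hv hh => hv ((h.mem v).1 hh)
  have hwsP : ∀ v ∈ ws, v ∉ ys := fun v hv hh => by grind
  have hww : ∀ u ∈ ws, ∀ v ∈ ws, (avoid E L φ {v | v ∈ ys} u).card < 3 →
      (avoid E L φ {v | v ∈ ys} v).card < 3 → avoid E L φ {v | v ∈ ys} u = L u →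
      s(u, v) ∉ E := by
    intro u hu v hv h3 h3' heq he
    have huP := h.disjoint (List.mem_append_right ys hu)
    have hvP := h.disjoint (List.mem_append_right ys hv)
    have huU := h.disc.mem ((hmem u).2 (Or.inr (Or.inr hu)))
    have hvU := h.disc.mem ((hmem v).2 (Or.inr (Or.inr hv)))
    rw [heq] at h3
    rcases hon v hv with heq' | ⟨h4, t, r, rfl, h5⟩
    · rw [heq'] at h3'
      exact h.good.indep u huU huP v hvU hvP h3 h3' he
    · have hut : u ∈ t :: r := (List.mem_cons.1 hu).resolve_left fun e => by
        subst e
        omega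
      obtain ⟨a, b, hab⟩ := List.append_of_mem hut
      have := Ctx.consecutive (w₁ := ys) (m := a) (u := v) (v := u) (w₂ := b)
        (by rw [← hab]; exact h) (mem_swap he)
      grind
  have hwo : ∀ u ∈ U, u ∉ ps → u ∉ ys → u ∉ ws → ∀ v ∈ ws,
      (avoid E L φ {v | v ∈ ys} u).card < 3 → s(u, v) ∉ E := by
    intro u hu h1 h2 h3 v hv h4 he
    obtain ⟨y, hy, he'⟩ := hoff u hu h1 h2 h3 h4
    have := h.uniq_vs hu (by rw [hmem]; tauto) (List.mem_append_left _ hy)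
      (List.mem_append_right _ hv) he' he
    grind
  refine h.notExt_of_colour hφP hφL (Peel.ext (ws := ws) (W := W) (d := d) (f := f) ?_)
  refine ⟨h.drawn, h.girth, h.sub, h.ih, h.disc, hys, h.ps_length, hφ.mono fun v hv =>
    hv.imp (h.mem v).2 id, fun v hv h1 h2 => ?_, hthree, fun u hu hu1 hu2 v hv h1 h2 h3 h3' he => ?_,
    huniq, fun v hv h1 h2 h3 p hp he => ?_, ?_⟩
  · by_cases hvw : v ∈ ws
    · rcases hon v hvw with heq | ⟨h3, -⟩
      · rw [heq]
        exact h.good.two v hv (hnP v h1)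
      · have := hcard v hv h1 h2
        omega
    · have := hcard v hv h1 h2
      have := hthree v hv h1 h2 hvw
      omega
  · by_cases huw : u ∈ ws <;> by_cases hvw : v ∈ ws
    · rcases hon u huw with heq | ⟨h4, t, r, hws, h5⟩
      · exact hww u huw v hvw h3 h3' heq he
      rcases hon v hvw with heq | ⟨h4', t', r', hws', h5'⟩
      · exact hww v hvw u huw h3' h3 heq (mem_swap he)
      · rw [hws] at hws'
        simp at hws'
        exact h.girth.ne he hws'.1
    · exact hwo v hv h1 h2 hvw u huw h3' (mem_swap he)
    · exact hwo u hu hu1 hu2 huw v hvw h3 he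
    · exact hnorm ⟨u, hu, v, hv, by rw [hmem]; tauto, by rw [hmem]; tauto, he,
        hoff u hu hu1 hu2 huw h3, hoff v hv h1 h2 hvw h3'⟩
  · have hvw : v ∉ ws := by
      intro hvw
      rcases hon v hvw with heq | ⟨-, u, r, rfl, -⟩
      · rw [heq] at h3
        exact h.strict p ((h.mem p).2 hp) v hv (hnP v h1) h3 (mem_swap he)
      · exact h.not_cross hys (by simp) ((h.mem p).2 hp) he
    exact ⟨hvw, hoff v hv h1 h2 hvw h3⟩
  · rintro v hv h1 h2 h3 p₁ p p₂ y₁ y y₂ rfl rfl he he'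
    have hvc : v ∉ (p₁ ++ p :: p₂) ++ (y₁ ++ y :: y₂ ++ ws) := by
      rw [hmem]
      tauto
    have hy₁ : y₁ = [] := by
      by_contra hy₁
      have h' := h
      rw [List.append_assoc, List.cons_append] at h'
      refine h'.no_link hy₁ ?_ hv (by simpa using hvc) he' ((h.mem p).2 (by simp)) he
      rcases hw with hw | hw
      · exact Or.inl (by simp [hw])
      · by_cases hy₂ : y₂ = []
        · subst hy₂
          simp at hw
          exact Or.inr hw
        · exact Or.inl (by simp [hy₂])
    subst hy₁
    have hps := h.ps_length
    simp at hps
    refine ⟨?_, by simp; omega, fun hh => ?_⟩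
    · rintro rfl
      exact Ctx.no_two_last (m := []) h hv hvc he he'
    · have : p₁ = [] := by
        rw [← List.length_eq_zero_iff]
        simp at hh
        omega
      subst this
      exact (Ctx.no_two_first (w₁ := []) h hv hvc he he').elim

omit [Fintype V] in
theorem Girth5.no_rung (hg : Girth5 E) {u v y y' : V} (he : s(u, v) ∈ E) (h1 : s(u, y) ∈ E)
    (h2 : s(v, y') ∈ E) (huy' : u ≠ y') (hvy : v ≠ y) (h : y = y' ∨ s(y, y') ∈ E) : False := by
  rcases h with rfl | h
  · exact hg.tri u v y he h2 (mem_swap h1)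
  · rcases hg.quad u v y' y he h2 (mem_swap h) (mem_swap h1) with h | h
    · exact huy' h
    · exact hvy h

theorem Ctx.edge (h : Ctx E d f L W U P ψ ps vs) {w₁ w₂ : List V} {a b : V}
    (hvs : vs = w₁ ++ a :: b :: w₂) : s(a, b) ∈ E := by
  subst hvs
  refine h.disc.ce_subset ?_
  rw [← List.append_assoc]
  exact mem_ce_append _ _ _ _

theorem Ctx.three_first {v₁ : V} (h : Ctx E d f L W U P ψ ps (v₁ :: ws)) : 3 ≤ (L v₁).card := by
  by_contra hlt
  obtain ⟨p₁, p, rfl⟩ : ∃ p₁ p, ps = p₁ ++ [p] :=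
    ⟨_, _, (List.dropLast_append_getLast h.ps_ne).symm⟩
  refine h.strict p ((h.mem p).2 (by simp)) v₁ (h.disc.mem (by simp)) (h.disjoint (by simp))
    (by omega) (h.disc.ce_subset ?_)
  rw [List.append_assoc]
  exact mem_ce_append _ _ _ _

theorem Ctx.three_last {v : V} (h : Ctx E d f L W U P ψ ps (ws ++ [v])) : 3 ≤ (L v).card := by
  have h' := h.reverse
  rw [List.reverse_append] at h'
  exact h'.three_first

theorem Ctx.last_nbr (h : Ctx E d f L W U P ψ ps (ys ++ ws)) {v₁ : V} (hws : ys ++ ws = v₁ :: vs)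
    (hvs : vs ≠ []) : ∃ q, ∀ p ∈ P, s(v₁, p) ∈ E → p = q := by
  rw [hws] at h
  obtain ⟨p₁, q, hp⟩ : ∃ p₁ p, ps = p₁ ++ [p] :=
    ⟨_, _, (List.dropLast_append_getLast h.ps_ne).symm⟩
  refine ⟨q, fun p hpP he => ?_⟩
  obtain ⟨p₁', hp'⟩ := h.cross_last hvs hpP he
  simp_all

/-- Colouring the first three boundary vertices, with a restricted list at the third one. -/
theorem Ctx.colour_three {v₁ v₂ v₃ : V} (h : Ctx E d f L W U P ψ ps (v₁ :: v₂ :: v₃ :: ws))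
    {S : Finset α} (hS : S ⊆ L v₃) (hS' : S.Nonempty) (hS2 : ws = [] → 2 ≤ S.card) :
    ∃ φ : V → α, (∀ v ∈ P, φ v = ψ v) ∧ (∀ y ∈ [v₁, v₂, v₃], φ y ∈ L y) ∧ φ v₃ ∈ S ∧
      Proper E (P ∪ {v | v ∈ [v₁, v₂, v₃]}) φ := by
  classical
  have hnd := (List.nodup_append.1 h.disc.nodup).2.1
  have hP : ∀ v ∈ v₁ :: v₂ :: v₃ :: ws, v ∉ P := fun v hv => h.disjoint hv
  have hl : ∀ v, s(v, v) ∉ E := h.girth.loop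
  simp at hnd
  have h3P : ∃ N : List V, N.length < S.card ∧ ∀ p ∈ P, s(v₃, p) ∈ E → p ∈ N := by
    by_cases hw : ws = []
    · subst hw
      obtain ⟨q, hq⟩ := Ctx.last_nbr (ys := []) (vs := [v₂, v₁]) (v₁ := v₃) h.reverse (by simp)
        (by simp)
      exact ⟨[q], by grind, fun p hp he => by simp [hq p hp he]⟩
    · exact ⟨[], by simpa using hS', fun p hp he =>
        (Ctx.not_cross (w₁ := [v₁, v₂]) h (by simp) hw hp he).elim⟩
  obtain ⟨N, hN, hN'⟩ := h3P
  obtain ⟨χ, h1, h2, h3⟩ := h.good.proper.step (L := fun _ => S) (hP v₃ (by simp)) (hl v₃) N hN hN'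
  have hP2 : ∀ p ∈ P, s(v₂, p) ∉ E := fun p hp =>
    Ctx.not_cross (w₁ := [v₁]) h (by simp) (by simp) hp
  have h2L := h.good.two v₂ (h.disc.mem (by simp)) (hP v₂ (by simp))
  obtain ⟨χ', h4, h5, h6⟩ := h3.step (L := L) (v := v₂)
    (by grind)
    (hl v₂) [v₃] (by simp; omega) (by
      grind)
  obtain ⟨q, hq⟩ := Ctx.last_nbr (ys := []) h rfl (by simp)
  have h1L := h.three_first
  have he12 := h.edge (w₁ := []) rfl
  have he23 := h.edge (w₁ := [v₁]) rfl
  obtain ⟨χ₃, h7, h8, h9⟩ := h6.step (L := L) (v := v₁)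
    (by rintro (hh | hh | hh); exacts [hnd.1.1 hh, hnd.1.2.1 hh, hP v₁ (by simp) hh])
    (hl v₁) [v₂, q] (by simp; omega) (by
      rintro w (rfl | rfl | hw) he
      · simp
      · exact (h.girth.tri v₁ v₂ w he12 he23 (mem_swap he)).elim
      · simp [hq w hw he])
  have hv3 : χ₃ v₃ = χ v₃ := (h7 v₃ (by grind)).trans (h4 v₃ (by grind))
  refine ⟨χ₃, fun v hv => ?_, ?_, hv3 ▸ h2, h9.mono ?_⟩
  · have a1 : v ≠ v₁ := fun e => hP v₁ (by simp) (e ▸ hv)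
    have a2 : v ≠ v₂ := fun e => hP v₂ (by simp) (e ▸ hv)
    have a3 : v ≠ v₃ := fun e => hP v₃ (by simp) (e ▸ hv)
    rw [h7 v a1, h4 v a2, h1 v a3]
  · intro y hy
    simp at hy
    rcases hy with rfl | rfl | rfl
    · exact h8
    · rw [h7 y (by grind)]
      exact h5
    · rw [hv3]
      exact hS h2
  · rintro v (hv | hv)
    · exact Or.inr (Or.inr (Or.inr hv))
    · simp at hv
      rcases hv with rfl | rfl | rfl
      · exact Or.inl rfl
      · exact Or.inr (Or.inl rfl)
      · exact Or.inr (Or.inr (Or.inl rfl))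

/-- Colouring the first two boundary vertices, with a restricted list at the second one. -/
theorem Ctx.colour_two {v₁ v₂ : V} (h : Ctx E d f L W U P ψ ps (v₁ :: v₂ :: ws)) (hws : ws ≠ [])
    {S : Finset α} (hS : S ⊆ L v₂) (hS' : S.Nonempty) :
    ∃ φ : V → α, (∀ v ∈ P, φ v = ψ v) ∧ (∀ y ∈ [v₁, v₂], φ y ∈ L y) ∧ φ v₂ ∈ S ∧
      Proper E (P ∪ {v | v ∈ [v₁, v₂]}) φ := by
  classical
  have hnd := (List.nodup_append.1 h.disc.nodup).2.1
  have hP : ∀ v ∈ v₁ :: v₂ :: ws, v ∉ P := fun v hv => h.disjoint hv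
  have hl : ∀ v, s(v, v) ∉ E := h.girth.loop
  simp at hnd
  obtain ⟨χ, h1, h2, h3⟩ := h.good.proper.step (L := fun _ => S) (hP v₂ (by simp)) (hl v₂) []
    (by simpa using hS') fun p hp he =>
        (Ctx.not_cross (w₁ := [v₁]) h (by simp) hws hp he).elim
  obtain ⟨q, hq⟩ := Ctx.last_nbr (ys := []) h rfl (by simp)
  have h1L := h.three_first
  obtain ⟨χ₃, h7, h8, h9⟩ := h3.step (L := L) (v := v₁)
    (by grind)
    (hl v₁) [v₂, q] (by simp; omega) (by
      grind)
  have hv3 : χ₃ v₂ = χ v₂ := h7 v₂ (by grind)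
  refine ⟨χ₃, fun v hv => ?_, ?_, hv3 ▸ h2, h9.mono ?_⟩
  · grind
  · grind
  grind

theorem Ctx.exists_cons (h : Ctx E d f L W U P ψ ps vs) : ∃ v₁ v₂ v₃ ws, vs = v₁ :: v₂ :: v₃ :: ws := by
  have h1 := h.ps_length
  have h2 := h.long
  match vs, h2 with
  | [], h2 => simp at h2; omega
  | [_], h2 => simp at h2; omega
  | [_, _], h2 => simp at h2; omega
  | v₁ :: v₂ :: v₃ :: ws, _ => simp

/-- The only remaining configuration. -/
structure Special (E : Set (Sym2 V)) (d : Sym2 V → Sym2 ι) (f : ι) (L : V → Finset α)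
    (W U P : Set V) (ψ : V → α) (ps : List V) (v₁ v₂ v₃ : V) (ws : List V) (a b : V) : Prop
    extends Ctx E d f L W U P ψ ps (v₁ :: v₂ :: v₃ :: ws) where
  three₃ : 3 ≤ (L v₃).card
  next : ∀ w ws', ws = w :: ws' → (L w).card < 3
  memU : a ∈ U ∧ b ∈ U
  off : a ∉ ps ++ (v₁ :: v₂ :: v₃ :: ws) ∧ b ∉ ps ++ (v₁ :: v₂ :: v₃ :: ws)
  e₁ : s(v₁, a) ∈ E
  e₂ : s(a, b) ∈ E
  e₃ : s(b, v₃) ∈ E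

set_option maxHeartbeats 1600000 in
theorem Ctx.exists_special (h : Ctx E d f L W U P ψ ps vs) :
    ∃ v₁ v₂ v₃ ws a b, Special E d f L W U P ψ ps v₁ v₂ v₃ ws a b := by
  classical
  obtain ⟨v₁, v₂, v₃, ws, rfl⟩ := h.exists_cons
  have hg := h.girth
  have he12 := h.edge (w₁ := []) rfl
  have he23 := h.edge (w₁ := [v₁]) rfl
  have hP : ∀ v ∈ v₁ :: v₂ :: v₃ :: ws, v ∉ P := fun v hv => h.disjoint hv
  have hU : ∀ v ∈ v₁ :: v₂ :: v₃ :: ws, v ∈ U := fun v hv => h.disc.mem (List.mem_append_right _ hv)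
  have two : ¬ ∃ φ : V → α, (∀ v ∈ P, φ v = ψ v) ∧ (∀ y ∈ [v₁, v₂], φ y ∈ L y) ∧
      Proper E (P ∪ {v | v ∈ [v₁, v₂]}) φ ∧ (φ v₂ ∉ L v₃ ∨
      (3 ≤ (L v₃).card ∧ ∃ u r, ws = u :: r ∧ 3 ≤ (L u).card)) := by
    rintro ⟨φ, h1, h2, h3, h4⟩
    obtain ⟨u, hu, v, hv, huc, hvc, he, ⟨y, hy, hy'⟩, z, hz, hz'⟩ :=
      Ctx.exists_rung (ys := [v₁, v₂]) (ws := v₃ :: ws) h (by simp) (by simp) h1 h2 h3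
        (by
          rintro w ws' hw
          obtain ⟨rfl, rfl⟩ := List.cons.inj hw
          refine h4.imp (fun h4 y hy he => ?_) id
          simp at hy
          rcases hy with rfl | rfl
          · exact (hg.tri y v₂ v₃ he12 he23 (mem_swap he)).elim
          · exact h4)
    refine hg.no_rung he hy' hz' ?_ ?_ ?_
    · grind
    · grind
    grind
  have h2L : 2 ≤ (L v₂).card := h.good.two v₂ (hU _ (by simp)) (hP _ (by simp))
  have hne2 : (L v₂).Nonempty := Finset.card_pos.1 (by omega)
  by_cases h2 : 3 ≤ (L v₂).card
  · exfalso
    by_cases h3 : 3 ≤ (L v₃).card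
    · obtain ⟨q, hq⟩ := Ctx.last_nbr (ys := []) h rfl (by simp)
      have h1L := h.three_first
      obtain ⟨χ, h7, h8, h9⟩ := h.good.proper.step (L := L) (hP v₁ (by simp)) (hg.loop v₁) [q]
        (by simp; omega) fun w hw he => by simp [hq w hw he]
      obtain ⟨u, hu, v, hv, huc, hvc, he, ⟨y, hy, hy'⟩, z, hz, hz'⟩ :=
        Ctx.exists_rung (ys := [v₁]) (ws := v₂ :: v₃ :: ws) (φ := χ) h (by simp) (by simp)
          (fun v hv => h7 v fun e => hP v₁ (by simp) (e ▸ hv)) (by simpa using h8)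
          (h9.mono (by
            simp))
          (by
            grind)
      simp at hy hz
      subst hy hz
      exact hg.tri u v _ he hz' (mem_swap hy')
    · have hS : (L v₂ \ L v₃).Nonempty := by
        obtain ⟨a, ha, hb⟩ := exists_color (L v₂) (L v₃) (by omega)
        grind
      have hws : ws ≠ [] := by
        rintro rfl
        exact h3 (Ctx.three_last (ws := [v₁, v₂]) h)
      obtain ⟨φ, h4, h5, h6, h7⟩ := h.colour_two (by simp) Finset.sdiff_subset hS
      grind
  · have h3 : 3 ≤ (L v₃).card := by
      by_contra h3
      exact h.good.indep v₂ (hU _ (by simp)) (hP _ (by simp)) v₃ (hU _ (by simp)) (hP _ (by simp))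
        (by omega) (by omega) he23
    by_cases hnext : ∀ w ws', ws = w :: ws' → (L w).card < 3
    · obtain ⟨S, hS, hS1, hS2, hS3⟩ : ∃ S ⊆ L v₃, S.Nonempty ∧ (ws = [] → 2 ≤ S.card) ∧
          ∀ w ws', ws = w :: ws' → ∀ x ∈ S, x ∉ L w := by
        rcases ws with _ | ⟨w, ws⟩
        · exact ⟨L v₃, subset_rfl, Finset.card_pos.1 (by omega), fun _ => by omega, by simp⟩
        · have := hnext w ws rfl
          obtain ⟨x, hx, hx'⟩ := exists_color (L v₃) (L w) (by omega)
          exact ⟨L v₃ \ L w, Finset.sdiff_subset, ⟨x, by simp [hx, hx']⟩, by simp, by simp⟩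
      obtain ⟨φ, h4, h5, h6, h7⟩ := h.colour_three hS hS1 hS2
      have hnd := (List.nodup_append.1 h.disc.nodup).2.1
      simp at hnd
      obtain ⟨u, hu, v, hv, huc, hvc, he, ⟨y, hy, hy'⟩, z, hz, hz'⟩ :=
        Ctx.exists_rung (ys := [v₁, v₂, v₃]) (ws := ws) h (by simp) (Or.inr rfl) h4 h5 h7
          (by
            rintro w ws' rfl
            refine Or.inl fun y hy he => ?_
            obtain ⟨⟨y₁, hy₁⟩, -⟩ := Ctx.join (ys := [v₁, v₂, v₃]) h hy (List.mem_cons_self) he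
            have : v₃ = y := by simpa using congrArg List.getLast? hy₁
            grind)
      have key : ∀ y z, y ∈ [v₁, v₂, v₃] → z ∈ [v₁, v₂, v₃] → s(u, y) ∈ E → s(v, z) ∈ E →
          ¬ (y = z ∨ s(y, z) ∈ E) := fun y z hy hz hy' hz' => hg.no_rung he hy' hz' (by
          grind) (by
          grind)
      have hk := key y z hy hz hy' hz'
      have mk : ∀ a b, a ∈ U → b ∈ U → a ∉ ps ++ ([v₁, v₂, v₃] ++ ws) →
          b ∉ ps ++ ([v₁, v₂, v₃] ++ ws) → s(a, b) ∈ E → s(a, v₁) ∈ E → s(b, v₃) ∈ E →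
          ∃ v₁ v₂ v₃ ws a b, Special E d f L W U P ψ ps v₁ v₂ v₃ ws a b := fun a b ha hb ha' hb' h1 h2 h3' =>
        ⟨v₁, v₂, v₃, ws, a, b, ⟨h, h3, hnext, ⟨ha, hb⟩, ⟨ha', hb'⟩, mem_swap h2, h1,
          h3'⟩⟩
      simp only [List.mem_cons, List.not_mem_nil, or_false] at hy hz
      rcases hy with rfl | rfl | rfl <;> rcases hz with rfl | rfl | rfl
      · simp at hk
      · grind
      · exact mk u v hu hv huc hvc he hy' hz'
      · exact (hk (Or.inr (mem_swap he12))).elim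
      · simp at hk
      · grind
      · exact mk v u hv hu hvc huc (mem_swap he) hz' hy'
      · exact (hk (Or.inr (mem_swap he23))).elim
      · simp at hk
    · exfalso
      push Not at hnext
      obtain ⟨u, r, rfl, hu⟩ := hnext
      obtain ⟨φ, h4, h5, h6, h7⟩ := h.colour_two (by simp) subset_rfl hne2
      grind

/-- The remaining configuration together with the two discs into which the path `v₁ a b v₃` splits
the disc. -/
structure Special.Split (E : Set (Sym2 V)) (d : Sym2 V → Sym2 ι) (f : ι) (L : V → Finset α)
    (W U P : Set V) (ψ : V → α) (ps : List V) (v₁ v₂ v₃ : V) (ws : List V) (a b : V) (D R : Set V) :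
    Prop extends Special E d f L W U P ψ ps v₁ v₂ v₃ ws a b where
  discD : Disc E d f D (ps ++ ([v₁, a, b, v₃] ++ ws))
  discR : Disc E d f R [v₁, v₂, v₃, b, a]
  union : R ∪ D = U
  inter : ∀ v ∈ R, v ∈ D → v ∈ [v₁, a, b, v₃]
  cross' : ∀ u ∈ R, u ∉ D → ∀ w ∈ D, w ∉ R → s(u, w) ∉ E

theorem Special.girth_facts (h : Special E d f L W U P ψ ps v₁ v₂ v₃ ws a b) :
    (s(v₁, v₂) ∈ E ∧ s(v₂, v₃) ∈ E) ∧ s(v₁, v₃) ∉ E ∧ s(v₁, b) ∉ E ∧ s(a, v₃) ∉ E ∧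
      s(v₂, a) ∉ E ∧ s(v₂, b) ∉ E ∧ a ≠ b := by
  have hg := h.girth
  have he12 := h.edge (w₁ := []) rfl
  have he23 := h.edge (w₁ := [v₁]) rfl
  have hnd := h.disc.nodup
  have ho := h.off
  have h1 := h.e₁
  have h2 := h.e₂
  have h3 := h.e₃
  simp [List.nodup_append] at hnd ho
  refine ⟨⟨he12, he23⟩, fun he => hg.tri _ _ _ he12 he23 (mem_swap he), fun he =>
    hg.tri _ _ _ h1 h2 (mem_swap he), fun he => hg.tri _ _ _ h2 h3 (mem_swap he), fun he =>
    hg.tri _ _ _ he12 he (mem_swap h1), fun he =>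
    hg.tri _ _ _ he h3 (mem_swap he23), hg.ne h2⟩

theorem Special.exists_split (h : Special E d f L W U P ψ ps v₁ v₂ v₃ ws a b) :
    ∃ D R, Special.Split E d f L W U P ψ ps v₁ v₂ v₃ ws a b D R := by
  have hc : Disc E d f U (v₁ :: ([v₂] ++ v₃ :: (ws ++ ps))) := by simpa using h.disc.rotate
  obtain ⟨⟨he12, he23⟩, h13, h1b, ha3, -, -, hab⟩ := h.girth_facts
  have hnd := h.disc.nodup
  have ho := h.off
  have h1 := h.e₁
  have h2 := h.e₂
  have h3 := h.e₃
  simp only [List.nodup_append, List.nodup_cons, List.mem_append, List.mem_cons] at hnd ho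
  obtain ⟨R, D, hR, hD, hU, hi, hcr⟩ := h.drawn.split h.sub hc (m := [a, b])
    (by simp; grind) (by simp [Set.insert_subset_iff, h1, h2, h3]) (by simp [h.memU])
    (by simp; grind) (fun x hx y hy he => by
      have := h.girth.ne he
      simp only [List.mem_append, List.mem_cons, List.not_mem_nil, or_false] at hx hy
      rcases hx with rfl | (rfl | rfl) | rfl <;> rcases hy with rfl | (rfl | rfl) | rfl <;>
        first
        | exact (this rfl).elim
        | exact (h13 he).elim
        | exact (h13 (mem_swap he)).elim
        | exact (h1b he).elim
        | exact (h1b (mem_swap he)).elim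
        | exact (ha3 he).elim
        | exact (ha3 (mem_swap he)).elim
        | simp [Sym2.eq_swap]) (by simp) (by simp; omega)
  refine ⟨D, R, h, ?_, by simpa using hR, hU, fun v hv hv' => by simpa using hi v hv hv', hcr⟩
  have := Disc.rotate (l := v₁ :: a :: b :: v₃ :: ws) (r := ps) (by simpa using hD)
  simpa using this

theorem Special.Split.subset (h : Special.Split E d f L W U P ψ ps v₁ v₂ v₃ ws a b D R) :
    D ⊆ U ∧ R ⊆ U :=
  ⟨h.union ▸ Set.subset_union_right, h.union ▸ Set.subset_union_left⟩

theorem Special.Split.v₂_notMem (h : Special.Split E d f L W U P ψ ps v₁ v₂ v₃ ws a b D R) :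
    v₂ ∉ D ∧ v₂ ∈ R := by
  have hR : v₂ ∈ R := h.discR.mem (by simp)
  have hnd := h.discR.nodup
  refine ⟨fun hD => ?_, hR⟩
  have := h.inter v₂ hR hD
  grind

/-- A colouring of the large disc and of `v₂` extends to the small disc. -/
theorem Special.Split.not_proper (h : Special.Split E d f L W U P ψ ps v₁ v₂ v₃ ws a b D R)
    (hφP : ∀ v ∈ P, φ v = ψ v) (hφL : ∀ v ∈ D, v ∉ P → φ v ∈ L v) (hφ₂ : φ v₂ ∈ L v₂) :
    ¬ Proper E (Insert.insert v₂ D) φ := by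
  intro hφ
  have hRU := h.subset.2
  have hDU := h.subset.1
  have hPD : ∀ v ∈ P, v ∈ D := fun v hv =>
    h.discD.mem (List.mem_append_left _ ((h.mem v).1 hv))
  have hoR : ∀ v ∈ [v₁, v₂, v₃, b, a], v ∈ (Insert.insert v₂ D : Set V) := by
    intro v hv
    simp at hv
    rcases hv with rfl | rfl | rfl | rfl | rfl
    · exact Or.inr (h.discD.mem (by simp))
    · exact Or.inl rfl
    · exact Or.inr (h.discD.mem (by simp))
    · exact Or.inr (h.discD.mem (by simp))
    · exact Or.inr (h.discD.mem (by simp))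
  have hkey : ∃ χ : V → α, (∀ v ∈ (Insert.insert v₂ D : Set V), χ v = φ v) ∧
      (∀ v ∈ R, v ∉ (Insert.insert v₂ D : Set V) → χ v ∈ L v) ∧
      Proper E (Insert.insert v₂ D ∪ R) χ := by
    refine h.drawn.cyc_extend h.girth (hRU.trans h.sub) (h.ih.mono hRU) h.discR (by simp) hφ hoR
      (fun v hv hvK => ?_) (fun u hu huR w hw hwK => ?_) (fun v hv hvK => ?_)
    · rcases hvK with rfl | hvD
      · simp
      · have := h.inter v hv hvD
        grind
    · have huD : u ∈ D := by
        rcases hu with rfl | hu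
        · exact (huR h.v₂_notMem.2).elim
        · exact hu
      rw [Sym2.eq_swap]
      exact h.cross' w hw (fun hh => hwK (Or.inr hh)) u huD huR
    · refine h.three h.disc (hRU hv) fun hvc => hvK ?_
      by_cases hv2 : v = v₂
      · exact Or.inl hv2
      · refine Or.inr (h.discD.mem ?_)
        grind
  obtain ⟨χ, h1, h2, h3⟩ := hkey
  refine h.notExt ⟨χ, fun v hv => (h1 v (Or.inr (hPD v hv))).trans (hφP v hv), fun v hv hvP => ?_,
    h3.mono ?_⟩
  · by_cases hvK : v ∈ (Insert.insert v₂ D : Set V)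
    · grind
    · refine h2 v ?_ hvK
      rw [← h.union] at hv
      grind
  · rw [← h.union]
    grind

set_option maxHeartbeats 1600000 in
/-- There is no short cycle cut off from the large disc by a path `x m y`, unless the vertices of
the boundary arc between `x` and `y` cannot be coloured greedily. -/
theorem Special.Split.no_detour (h : Special.Split E d f L W U P ψ ps v₁ v₂ v₃ ws a b D R)
    {x y : V} {l m r : List V} (hc : Disc E d f D (x :: (l ++ y :: r))) (hl : l ≠ []) (hm₀ : m ≠ [])
    (hlP : ∀ v ∈ l, v ∉ P) (hlen : l.length + m.length ≤ 6)
    (hm : (x :: (m ++ [y])).Nodup) (hmE : pe (x :: (m ++ [y])) ⊆ E) (hmD : ∀ v ∈ m, v ∈ D)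
    (hmc : ∀ v ∈ m, v ∉ l ∧ v ∉ r)
    (hch : ∀ a ∈ x :: (m ++ [y]), ∀ b ∈ x :: (m ++ [y]), s(a, b) ∈ E →
      s(a, b) ∈ pe (x :: (m ++ [y])))
    (hN : ∀ s v t, l = s ++ v :: t → ∃ N : List V, N.length < (L v).card ∧
      ∀ w, w ∈ x :: (m ++ [y]) ∨ w = v₂ ∨ w ∈ s → s(v, w) ∈ E → w ∈ N) : False := by
  have hDU := h.subset.1
  obtain ⟨A, B, hA, hB, hAB, hi, hcr⟩ := h.drawn.split (hDU.trans h.sub) hc hm hmE hmD hmc hch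
    (by have := List.length_pos_iff.2 hl; omega) (by have := List.length_pos_iff.2 hm₀; omega)
  have hAD : A ⊆ D := hAB ▸ Set.subset_union_left
  have hBD : B ⊆ D := hAB ▸ Set.subset_union_right
  have hnd := hc.nodup
  simp only [List.nodup_cons, List.nodup_append, List.mem_append, List.mem_cons] at hnd
  have hlA : ∀ v ∈ l, v ∈ A ∧ v ∉ B := by
    intro v hv
    have hvA : v ∈ A := hA.mem (by simp [hv])
    grind
  have hPB : ∀ p ∈ P, p ∈ B := by
    intro p hp
    have hpc : p ∈ x :: (l ++ y :: r) := by
      rw [← hc.outer_iff, h.discD.outer_iff]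
      exact List.mem_append_left _ ((h.mem p).1 hp)
    refine hB.mem ?_
    grind
  have h2D := h.v₂_notMem.1
  have h2U : v₂ ∈ U := h.disc.mem (by simp)
  have hBU : (Insert.insert v₂ B : Set V) ⊆ U := by grind
  obtain ⟨v, hv⟩ := List.exists_mem_of_ne_nil l hl
  have hss : (Insert.insert v₂ B : Set V) ⊂ U := by grind
  have hcA : ∀ v ∈ x :: (l ++ y :: r), v ∈ (Insert.insert v₂ B : Set V) ∪ {v | v ∈ l} := by
    intro v hv
    by_cases hvl : v ∈ l
    · exact Or.inr hvl
    · refine Or.inl (Or.inr (hB.mem ?_))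
      grind
  have hin : ∀ v ∈ (Insert.insert v₂ B : Set V), v ∉ l := by grind
  have hPB' : P ∩ Insert.insert v₂ B = P := Set.inter_eq_left.2 fun p hp => Or.inr (hPB p hp)
  have hgood := h.good.restrict hBU (hPB'.symm ▸ h.good.conn)
  rw [hPB'] at hgood
  obtain ⟨χ, hχ1, hχ2, hχ3⟩ := h.ih _ hss _ _ _ hgood
  obtain ⟨χ', h1, h2, h3⟩ := hχ3.greedy (L := L) h.girth.loop l hnd.2.1
    (fun v hv hv' => hin v hv' hv) fun s v t hlst => by
      obtain ⟨N, hN1, hN2⟩ := hN s v t hlst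
      refine ⟨N, hN1, fun w hw he => hN2 w ?_ he⟩
      have hvl : v ∈ l := by simp [hlst]
      grind
  have hkey : ∃ η : V → α, (∀ v ∈ (Insert.insert v₂ B : Set V) ∪ {v | v ∈ l}, η v = χ' v) ∧
      (∀ v ∈ A, v ∉ (Insert.insert v₂ B : Set V) ∪ {v | v ∈ l} → η v ∈ L v) ∧
      Proper E (((Insert.insert v₂ B : Set V) ∪ {v | v ∈ l}) ∪ A) η := by
    refine h.drawn.cyc_extend h.girth (hAD.trans (hDU.trans h.sub)) (h.ih.mono (hAD.trans hDU)) hA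
      (by simp; omega) h3 (fun v hv => ?_) (fun v hv hvK => ?_) (fun u hu huA w hw hwK => ?_)
      (fun v hv hvK => ?_)
    · simp at hv
      rcases hv with rfl | hv | rfl | hv
      · exact hcA _ (by simp)
      · exact Or.inr hv
      · exact hcA _ (by simp)
      · exact Or.inl (Or.inr (hB.mem (by simp [hv])))
    · grind
    · rcases hu with (rfl | hu) | hu
      · have hwR : w ∉ R := fun hwR => hwK (hcA w (by
          rw [← hc.outer_iff, h.discD.outer_iff]
          have := h.inter w hwR (hAD hw)
          simp at this ⊢
          tauto))
        exact h.cross' _ h.v₂_notMem.2 h2D w (hAD hw) hwR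
      · rw [Sym2.eq_swap]
        exact hcr w hw (fun hh => hwK (Or.inl (Or.inr hh))) u hu huA
      · exact (huA (hlA u hu).1).elim
    · refine h.three h.disc (hDU (hAD hv)) fun hvc => hvK (hcA v ?_)
      rw [← hc.outer_iff, h.discD.outer_iff]
      have : v ≠ v₂ := fun e => h2D (hAD (e ▸ hv))
      simp at hvc ⊢
      tauto
  obtain ⟨η, g1, g2, g3⟩ := hkey
  have hηB : ∀ v ∈ (Insert.insert v₂ B : Set V), η v = χ v := fun v hv =>
    (g1 v (Or.inl hv)).trans (h1 v hv)
  have h2P : v₂ ∉ P := h.disjoint (by simp)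
  refine h.not_proper (φ := η) (fun v hv => (hηB v (Or.inr (hPB v hv))).trans (hχ1 v hv))
    (fun v hv hvP => ?_) ?_ (g3.mono ?_)
  · by_cases hvK : v ∈ (Insert.insert v₂ B : Set V)
    · rw [hηB v hvK]
      exact hχ2 v hvK hvP
    · by_cases hvl : v ∈ l
      · rw [g1 v (Or.inr hvl)]
        exact h2 v hvl
      · rw [← hAB] at hv
        refine g2 v (hv.resolve_right fun hh => hvK (Or.inr hh)) ?_
        rintro (hh | hh)
        exacts [hvK hh, hvl hh]
  · rw [hηB _ (Or.inl rfl)]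
    exact hχ2 _ (Or.inl rfl) h2P
  · rw [← hAB]
    rintro v (rfl | hv | hv)
    · exact Or.inl (Or.inl (Or.inl rfl))
    · exact Or.inr hv
    · exact Or.inl (Or.inl (Or.inr hv))

omit [Fintype V] in
theorem eq_of_singleton_eq_append {x v : V} {s t : List V} (h : [x] = s ++ v :: t) :
    s = [] ∧ v = x ∧ t = [] := by
  rcases s with _ | ⟨s, ss⟩ <;> simp_all

omit [Fintype V] in
theorem eq_of_pair_eq_append {x y v : V} {s t : List V} (h : [x, y] = s ++ v :: t) :
    (s = [] ∧ v = x ∧ t = [y]) ∨ (s = [x] ∧ v = y ∧ t = []) := by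
  rcases s with _ | ⟨s, _ | ⟨s', ss⟩⟩ <;> simp_all

omit [Fintype V] in
theorem Girth5.path_three (hg : Girth5 E) {x z y : V} (h1 : s(x, z) ∈ E) (h2 : s(z, y) ∈ E) :
    ∀ a ∈ x :: ([z] ++ [y]), ∀ b ∈ x :: ([z] ++ [y]), s(a, b) ∈ E →
      s(a, b) ∈ pe (x :: ([z] ++ [y])) := by
  intro a ha b hb he
  have hne := hg.ne he
  have hxy : s(x, y) ∉ E := fun he => hg.tri _ _ _ h1 h2 (mem_swap he)
  simp only [List.cons_append, List.nil_append, List.mem_cons, List.not_mem_nil, or_false] at ha hb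
  rcases ha with rfl | rfl | rfl <;> rcases hb with rfl | rfl | rfl <;>
    first
    | exact (hne rfl).elim
    | exact (hxy he).elim
    | exact (hxy (mem_swap he)).elim
    | simp [Sym2.eq_swap]

omit [Fintype V] in
theorem Girth5.path_four (hg : Girth5 E) {x z w y : V} (h1 : s(x, z) ∈ E) (h2 : s(z, w) ∈ E)
    (h3 : s(w, y) ∈ E) (hxy : s(x, y) ∉ E) :
    ∀ a ∈ x :: ([z, w] ++ [y]), ∀ b ∈ x :: ([z, w] ++ [y]), s(a, b) ∈ E →
      s(a, b) ∈ pe (x :: ([z, w] ++ [y])) := by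
  intro a ha b hb he
  have hne := hg.ne he
  have hxw : s(x, w) ∉ E := fun he => hg.tri _ _ _ h1 h2 (mem_swap he)
  have hzy : s(z, y) ∉ E := fun he => hg.tri _ _ _ h2 h3 (mem_swap he)
  simp only [List.cons_append, List.nil_append, List.mem_cons, List.not_mem_nil, or_false] at ha hb
  rcases ha with rfl | rfl | rfl | rfl <;> rcases hb with rfl | rfl | rfl | rfl <;>
    first
    | exact (hne rfl).elim
    | exact (hxy he).elim
    | exact (hxy (mem_swap he)).elim
    | exact (hxw he).elim
    | exact (hxw (mem_swap he)).elim
    | exact (hzy he).elim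
    | exact (hzy (mem_swap he)).elim
    | simp [Sym2.eq_swap]

theorem Special.three_ab (h : Special E d f L W U P ψ ps v₁ v₂ v₃ ws a b) :
    (3 ≤ (L a).card ∧ 3 ≤ (L b).card) ∧ a ∉ P ∧ b ∉ P :=
  ⟨⟨h.three h.disc h.memU.1 h.off.1, h.three h.disc h.memU.2 h.off.2⟩,
    fun hh => h.off.1 (List.mem_append_left _ ((h.mem _).1 hh)),
    fun hh => h.off.2 (List.mem_append_left _ ((h.mem _).1 hh))⟩

set_option maxHeartbeats 1600000 in
/-- Adjacent interior vertices of the large disc do not both have neighbours on `v₁ a b v₃`. -/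
theorem Special.Split.no_rung (h : Special.Split E d f L W U P ψ ps v₁ v₂ v₃ ws a b D R)
    {z z' y y' : V} (hz : z ∈ D) (hz' : z' ∈ D) (hzc : z ∉ ps ++ ([v₁, a, b, v₃] ++ ws))
    (hzc' : z' ∉ ps ++ ([v₁, a, b, v₃] ++ ws)) (he : s(z, z') ∈ E) (hy : y ∈ [v₁, a, b, v₃])
    (hy' : y' ∈ [v₁, a, b, v₃]) (h1 : s(z, y) ∈ E) (h2 : s(z', y') ∈ E) : False := by
  have hg := h.girth
  obtain ⟨⟨he12, he23⟩, h13, h1b, ha3, h2a, h2b, hab⟩ := h.girth_facts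
  obtain ⟨⟨ha, hb⟩, haP, hbP⟩ := h.three_ab
  have e1 := h.e₁
  have e2 := h.e₂
  have e3 := h.e₃
  have hnd := h.discD.nodup
  have hne := hg.ne he
  have rung : ∀ {z z' y y' : V}, z ∉ ps ++ ([v₁, a, b, v₃] ++ ws) →
      z' ∉ ps ++ ([v₁, a, b, v₃] ++ ws) → s(z, z') ∈ E → y ∈ [v₁, a, b, v₃] →
      y' ∈ [v₁, a, b, v₃] → s(z, y) ∈ E → s(z', y') ∈ E → ¬ (y = y' ∨ s(y, y') ∈ E) := by
    intro z z' y y' hzc hzc' he hy hy' h1 h2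
    exact hg.no_rung he h1 h2 (fun e => hzc (e ▸ by grind))
      (fun e => hzc' (e ▸ by simp at hy ⊢; tauto))
  have main : ∀ {z z' : V}, z ∈ D → z' ∈ D → z ∉ ps ++ ([v₁, a, b, v₃] ++ ws) →
      z' ∉ ps ++ ([v₁, a, b, v₃] ++ ws) → s(z, z') ∈ E →
      ¬ (s(z, v₁) ∈ E ∧ s(z', b) ∈ E) ∧ ¬ (s(z, a) ∈ E ∧ s(z', v₃) ∈ E) ∧
      ¬ (s(z, v₁) ∈ E ∧ s(z', v₃) ∈ E) := by
    intro z z' hz hz' hzc hzc' he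
    have hne := hg.ne he
    have he' : s(z', z) ∈ E := mem_swap he
    simp only [List.nodup_append, List.nodup_cons, List.mem_append, List.mem_cons,
      List.not_mem_nil, or_false] at hnd hzc hzc'
    refine ⟨fun ⟨h1, h2⟩ => ?_, fun ⟨h1, h2⟩ => ?_, fun ⟨h1, h2⟩ => ?_⟩
    · have hc : Disc E d f D (v₁ :: ([a] ++ b :: (v₃ :: ws ++ ps))) := by
        simpa using h.discD.rotate
      refine h.no_detour (m := [z, z']) hc (by simp) (by simp) (by simpa using haP) (by simp)
        (by simp; grind) (by simp [Set.insert_subset_iff, mem_swap h1, he, h2])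
        (by simp [hz, hz']) (by simp; grind) (hg.path_four (mem_swap h1) he h2 h1b) ?_
      intro s v t hst
      obtain ⟨rfl, rfl, rfl⟩ := eq_of_singleton_eq_append hst
      refine ⟨[v₁, b], by simp; omega, fun w hw hvw => ?_⟩
      simp only [List.cons_append, List.nil_append, List.mem_cons, List.not_mem_nil, or_false] at hw ⊢
      rcases hw with (rfl | rfl | rfl | rfl) | rfl
      · exact Or.inl rfl
      · exact (hg.tri _ _ _ e1 hvw h1).elim
      · exact (hg.tri _ _ _ e2 (mem_swap h2) (mem_swap hvw)).elim
      · exact Or.inr rfl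
      · exact (h2a (mem_swap hvw)).elim
    · have hc : Disc E d f D (a :: ([b] ++ v₃ :: (ws ++ ps ++ [v₁]))) := by
        have hh : Disc E d f D ((ps ++ [v₁]) ++ ([a, b, v₃] ++ ws)) := by simpa using h.discD
        simpa using hh.rotate
      refine h.no_detour (m := [z, z']) hc (by simp) (by simp) (by simpa using hbP) (by simp)
        (by simp; grind) (by simp [Set.insert_subset_iff, mem_swap h1, he, h2])
        (by simp [hz, hz']) (by simp; grind) (hg.path_four (mem_swap h1) he h2 ha3) ?_
      intro s v t hst
      obtain ⟨rfl, rfl, rfl⟩ := eq_of_singleton_eq_append hst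
      refine ⟨[a, v₃], by simp; omega, fun w hw hvw => ?_⟩
      simp only [List.cons_append, List.nil_append, List.mem_cons, List.not_mem_nil, or_false] at hw ⊢
      rcases hw with (rfl | rfl | rfl | rfl) | rfl
      · exact Or.inl rfl
      · exact (hg.tri _ _ _ e2 hvw h1).elim
      · exact (hg.tri _ _ _ e3 (mem_swap h2) (mem_swap hvw)).elim
      · exact Or.inr rfl
      · exact (h2b (mem_swap hvw)).elim
    · have hc : Disc E d f D (v₁ :: ([a, b] ++ v₃ :: (ws ++ ps))) := by
        simpa using h.discD.rotate
      refine h.no_detour (m := [z, z']) hc (by simp) (by simp) (by simp [haP, hbP]) (by simp)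
        (by simp; grind) (by simp [Set.insert_subset_iff, mem_swap h1, he, h2])
        (by simp [hz, hz']) (by simp; grind) (hg.path_four (mem_swap h1) he h2 h13) ?_
      intro s v t hst
      obtain ⟨rfl, rfl, rfl⟩ | ⟨rfl, rfl, rfl⟩ := eq_of_pair_eq_append hst
      · refine ⟨[v₁, b], by simp; omega, fun w hw hvw => ?_⟩
        simp only [List.cons_append, List.nil_append, List.mem_cons, List.not_mem_nil, or_false] at hw ⊢
        rcases hw with (rfl | rfl | rfl | rfl) | rfl
        · exact Or.inl rfl
        · exact (hg.tri _ _ _ e1 hvw h1).elim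
        · rcases hg.quad _ _ _ _ e1 hvw he' h1 with rfl | rfl <;> simp at hzc hzc'
        · exact (ha3 hvw).elim
        · exact (h2a (mem_swap hvw)).elim
      · refine ⟨[a, v₃], by simp; omega, fun w hw hvw => ?_⟩
        simp only [List.cons_append, List.nil_append, List.mem_cons, List.not_mem_nil, or_false] at hw ⊢
        rcases hw with (rfl | rfl | rfl | rfl) | rfl | rfl
        · exact (h1b (mem_swap hvw)).elim
        · rcases hg.quad _ _ _ _ hvw he h2 (mem_swap e3) with rfl | rfl <;> simp at hzc hzc'
        · exact (hg.tri _ _ _ e3 (mem_swap h2) (mem_swap hvw)).elim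
        · exact Or.inr rfl
        · exact (h2b (mem_swap hvw)).elim
        · exact Or.inl rfl
  have hr := rung hzc hzc' he hy hy' h1 h2
  obtain ⟨m1, m2, m3⟩ := main hz hz' hzc hzc' he
  obtain ⟨n1, n2, n3⟩ := main hz' hz hzc' hzc (mem_swap he)
  simp only [List.mem_cons, List.not_mem_nil, or_false] at hy hy'
  have e1' : s(a, v₁) ∈ E := mem_swap e1
  have e2' : s(b, a) ∈ E := mem_swap e2
  have e3' : s(v₃, b) ∈ E := mem_swap e3
  clear rung main
  rcases hy with rfl | rfl | rfl | rfl <;> rcases hy' with rfl | rfl | rfl | rfl <;>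
    first
    | exact hr (Or.inl rfl)
    | exact hr (Or.inr ‹_›)
    | exact m1 ⟨h1, h2⟩
    | exact m2 ⟨h1, h2⟩
    | exact m3 ⟨h1, h2⟩
    | exact n1 ⟨h2, h1⟩
    | exact n2 ⟨h2, h1⟩
    | exact n3 ⟨h2, h1⟩

/-- No interior vertex of the large disc is adjacent to `b` and to the last precoloured vertex. -/
theorem Special.Split.no_last {p₁ : List V} {p x : V}
    (h : Special.Split E d f L W U P ψ (p₁ ++ [p]) v₁ v₂ v₃ ws a b D R) (hx : x ∈ D)
    (hxc : x ∉ (p₁ ++ [p]) ++ ([v₁, a, b, v₃] ++ ws)) (h1 : s(x, p) ∈ E) (h2 : s(x, b) ∈ E) :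
    False := by
  have hg := h.girth
  obtain ⟨⟨he12, he23⟩, h13, h1b, ha3, h2a, h2b, hab⟩ := h.girth_facts
  obtain ⟨⟨ha, hb⟩, haP, hbP⟩ := h.three_ab
  have e1 := h.e₁
  have e2 := h.e₂
  have e3 := h.e₃
  have hnd := h.discD.nodup
  have hc : Disc E d f D (p :: ([v₁, a] ++ b :: (v₃ :: ws ++ p₁))) := by
    have hh : Disc E d f D (p₁ ++ (p :: [v₁, a, b, v₃] ++ ws)) := by simpa using h.discD
    simpa using hh.rotate
  have hp1 : s(p, v₁) ∈ E := hc.ce_subset (by simpa using mem_ce_append [] _ _ _)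
  have hap : s(a, p) ∉ E := fun he => Ctx.no_two_last (m := []) h.toCtx h.memU.1 h.off.1 he
    (mem_swap e1)
  have h1L := h.three_first
  simp only [List.nodup_append, List.nodup_cons, List.mem_append, List.mem_cons,
      List.not_mem_nil, or_false] at hnd hxc
  refine h.no_detour (m := [x]) hc (by simp) (by simp) (by simp [haP, h.disjoint]) (by simp)
    (by simp; grind) (by simp [Set.insert_subset_iff, mem_swap h1, h2])
    (by simp [hx]) (by simp; grind) (hg.path_three (mem_swap h1) h2) ?_
  intro s v t hst
  obtain ⟨rfl, rfl, rfl⟩ | ⟨rfl, rfl, rfl⟩ := eq_of_pair_eq_append hst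
  · refine ⟨[p, v₂], by simp; omega, fun w hw hvw => ?_⟩
    simp only [List.cons_append, List.nil_append, List.mem_cons, List.not_mem_nil, or_false] at hw ⊢
    rcases hw with (rfl | rfl | rfl) | rfl
    · exact Or.inl rfl
    · exact (hg.tri _ _ _ hp1 hvw h1).elim
    · exact (h1b hvw).elim
    · exact Or.inr rfl
  · refine ⟨[v₁, b], by simp; omega, fun w hw hvw => ?_⟩
    simp only [List.cons_append, List.nil_append, List.mem_cons, List.not_mem_nil, or_false] at hw ⊢
    rcases hw with (rfl | rfl | rfl) | rfl | rfl
    · exact (hap hvw).elim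
    · exact (hg.tri _ _ _ hvw h2 (mem_swap e2)).elim
    · exact Or.inr rfl
    · exact (h2a (mem_swap hvw)).elim
    · exact Or.inl rfl

set_option maxHeartbeats 1600000 in
theorem Special.spread_colour {p₀ p₁ p₂ p₃ p₄ p₅ x : V}
    (h : Special E d f L W U P ψ [p₀, p₁, p₂, p₃, p₄, p₅] v₁ v₂ v₃ ws a b) (hx : x ∈ U)
    (hxc : x ∉ [p₀, p₁, p₂, p₃, p₄, p₅] ++ (v₁ :: v₂ :: v₃ :: ws)) (hxa : s(x, a) ∈ E)
    (hx1 : s(x, p₁) ∈ E) (hx4 : s(x, p₄) ∈ E) :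
    s(p₁, v₁) ∉ E ∧ ∃ χ : V → α, (∀ v ∈ P, χ v = ψ v) ∧ (∀ v ∈ [v₂, v₁, x, a], χ v ∈ L v) ∧
      Proper E (P ∪ {v | v ∈ [v₂, v₁, x, a]}) χ := by
  classical
  have hg := h.girth
  obtain ⟨⟨he12, he23⟩, h13, h1b, ha3, h2a, h2b, hab⟩ := h.girth_facts
  obtain ⟨⟨ha, hb⟩, haP, hbP⟩ := h.three_ab
  have e1 := h.e₁
  have hac := h.off.1
  have haU := h.memU.1
  have hx3 := h.three h.disc hx hxc
  have h1L := h.three_first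
  have hce : ∀ {u v}, s(u, v) ∈ ce ([p₀, p₁, p₂, p₃, p₄, p₅] ++ (v₁ :: v₂ :: v₃ :: ws)) →
      s(u, v) ∈ E := fun hh => h.disc.ce_subset hh
  have f0 : s(p₀, p₁) ∈ E := hce (by simpa using mem_ce_append [] _ _ _)
  have f1 : s(p₁, p₂) ∈ E := hce (by simpa using mem_ce_append [p₀] _ _ _)
  have f3 : s(p₃, p₄) ∈ E := hce (by simpa using mem_ce_append [p₀, p₁, p₂] _ _ _)
  have f4 : s(p₄, p₅) ∈ E := hce (by simpa using mem_ce_append [p₀, p₁, p₂, p₃] _ _ _)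
  have hP : ∀ v, v ∈ P ↔ v ∈ [p₀, p₁, p₂, p₃, p₄, p₅] := h.mem
  have hvP : ∀ v ∈ v₁ :: v₂ :: v₃ :: ws, v ∉ P := fun v hv => h.disjoint hv
  have hxP : x ∉ P := fun hh => hxc (List.mem_append_left _ ((hP x).1 hh))
  have hnd := h.disc.nodup
  have n1 : ∀ p ∈ P, s(v₁, p) ∈ E → p = p₅ := fun p hp he => by
    obtain ⟨q, hq⟩ := Ctx.cross_last h.toCtx (by simp) hp he
    have := congrArg List.getLast? hq
    simpa using this.symm
  have n2 : ∀ p ∈ P, s(v₂, p) ∉ E := fun p hp =>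
    Ctx.not_cross (w₁ := [v₁]) h.toCtx (by simp) (by simp) hp
  have nx : ∀ p ∈ P, s(x, p) ∈ E → p = p₁ ∨ p = p₄ := by
    intro p hp he
    rw [hP] at hp
    simp only [List.mem_cons, List.not_mem_nil, or_false] at hp
    rcases hp with rfl | rfl | rfl | rfl | rfl | rfl
    · exact (hg.tri _ _ _ f0 (mem_swap hx1) he).elim
    · exact Or.inl rfl
    · exact (hg.tri _ _ _ hx1 f1 (mem_swap he)).elim
    · exact (hg.tri _ _ _ f3 (mem_swap hx4) he).elim
    · exact Or.inr rfl
    · exact (hg.tri _ _ _ hx4 f4 (mem_swap he)).elim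
  have na : ∀ p ∈ P, s(a, p) ∉ E := by
    intro p hp he
    rw [hP] at hp
    simp only [List.mem_cons, List.not_mem_nil, or_false] at hp
    rcases hp with rfl | rfl | rfl | rfl | rfl | rfl
    · exact Ctx.no_two_first (w₁ := []) h.toCtx haU hac he (mem_swap e1)
    · exact hg.tri _ _ _ hxa he (mem_swap hx1)
    · rcases hg.quad _ _ _ _ he (mem_swap f1) (mem_swap hx1) hxa with rfl | rfl
      · simp at hac
      · simp at hxc
    · rcases hg.quad _ _ _ _ he f3 (mem_swap hx4) hxa with rfl | rfl
      · simp at hac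
      · simp at hxc
    · exact hg.tri _ _ _ hxa he (mem_swap hx4)
    · exact Ctx.no_two_last (p₁ := [p₀, p₁, p₂, p₃, p₄]) (m := []) h.toCtx haU hac he
        (mem_swap e1)
  have nx1 : s(x, v₁) ∉ E := fun he => hg.tri _ _ _ hxa (mem_swap e1) (mem_swap he)
  have nx2 : s(x, v₂) ∉ E := fun he => by
    rcases hg.quad _ _ _ _ he (mem_swap he12) e1 (mem_swap hxa) with rfl | rfl
    · simp at hxc
    · simp at hac
  have hp1 : p₁ ∈ P := (hP _).2 (by simp)
  have np11 : s(p₁, v₁) ∉ E := fun he => by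
    have := n1 p₁ hp1 (mem_swap he)
    simp at hnd
    grind
  have hxa' := hg.ne hxa
  have h1U : v₁ ∈ U := h.disc.mem (by simp)
  have h2U : v₂ ∈ U := h.disc.mem (by simp)
  simp only [List.cons_append, List.nil_append, List.nodup_cons, List.mem_cons] at hnd hac hxc
  refine ⟨np11, h.good.proper.greedy (L := L) hg.loop [v₂, v₁, x, a]
    (by simp; grind) (by simp [hvP, hxP, haP]) (by
      intro s v t hst
      rcases s with _ | ⟨s₁, _ | ⟨s₂, _ | ⟨s₃, _ | ⟨s₄, ss⟩⟩⟩⟩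
      · obtain ⟨rfl, -⟩ : v₂ = v ∧ _ := by simpa using hst
        refine ⟨[], by have := h.good.two _ h2U (hvP _ (by simp)); change 0 < _; omega, fun w hw he => ?_⟩
        simp at hw
        exact (n2 w hw he).elim
      · obtain ⟨rfl, rfl, -⟩ : v₂ = s₁ ∧ v₁ = v ∧ _ := by simpa using hst
        refine ⟨[p₅, v₂], by simp; omega, fun w hw he => ?_⟩
        simp at hw ⊢
        exact hw.imp (fun hw => n1 w hw he) id
      · obtain ⟨rfl, rfl, rfl, -⟩ : v₂ = s₁ ∧ v₁ = s₂ ∧ x = v ∧ _ := by simpa using hst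
        refine ⟨[p₁, p₄], by simp; omega, fun w hw he => ?_⟩
        simp at hw ⊢
        rcases hw with hw | rfl | rfl
        · exact nx w hw he
        · exact (nx2 he).elim
        · exact (nx1 he).elim
      · obtain ⟨rfl, rfl, rfl, rfl, -⟩ : v₂ = s₁ ∧ v₁ = s₂ ∧ x = s₃ ∧ a = v ∧ _ := by
          simpa using hst
        refine ⟨[v₁, x], by simp; omega, fun w hw he => ?_⟩
        simp at hw ⊢
        rcases hw with hw | rfl | rfl | rfl
        · exact (na w hw he).elim
        · exact (h2a (mem_swap he)).elim
        · exact Or.inl rfl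
        · exact Or.inr rfl
      · simp at hst)⟩

set_option maxHeartbeats 1600000 in
/-- With six precoloured vertices, no neighbour of `a` is adjacent to both the second and the fifth
of them. -/
theorem Special.no_spread {p₀ p₁ p₂ p₃ p₄ p₅ x : V}
    (h : Special E d f L W U P ψ [p₀, p₁, p₂, p₃, p₄, p₅] v₁ v₂ v₃ ws a b) (hx : x ∈ U)
    (hxc : x ∉ [p₀, p₁, p₂, p₃, p₄, p₅] ++ (v₁ :: v₂ :: v₃ :: ws)) (hxa : s(x, a) ∈ E)
    (hx1 : s(x, p₁) ∈ E) (hx4 : s(x, p₄) ∈ E) : False := by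
  have hg := h.girth
  obtain ⟨np11, χ, c1, c2, c3⟩ := h.spread_colour hx hxc hxa hx1 hx4
  have he12 := h.girth_facts.1.1
  have e1 := h.e₁
  have hac := h.off.1
  have haU := h.memU.1
  have f0 : s(p₀, p₁) ∈ E := h.disc.ce_subset (by simpa using mem_ce_append [] _ _ _)
  have hP : ∀ v, v ∈ P ↔ v ∈ [p₀, p₁, p₂, p₃, p₄, p₅] := h.mem
  have hvP : ∀ v ∈ v₁ :: v₂ :: v₃ :: ws, v ∉ P := fun v hv => h.disjoint hv
  have hnd := h.disc.nodup
  have hp1 : p₁ ∈ P := (hP _).2 (by simp)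
  have hxa' := hg.ne hxa
  have hc : Disc E d f U (p₁ :: ([p₂, p₃, p₄, p₅] ++ v₁ :: (v₂ :: v₃ :: ws ++ [p₀]))) := by
    simpa using Disc.rotate (l := [p₀]) h.disc
  obtain ⟨A, B, hA, hB, hAB, hi, hcr⟩ := h.drawn.split h.sub hc (m := [x, a])
    (by grind)
    (by simp [Set.insert_subset_iff, mem_swap hx1, hxa, mem_swap e1])
    (by simp [hx, haU]) (by simp_all)
    (hg.path_four (mem_swap hx1) hxa (mem_swap e1) np11) (by simp) (by simp; omega)
  have hAU : A ⊆ U := hAB ▸ Set.subset_union_left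
  have hBU : B ⊆ U := hAB ▸ Set.subset_union_right
  have hPB : ∀ v ∈ P, v ∈ B → v = p₀ ∨ v = p₁ := by
    intro v hv hvB
    by_contra hcon
    rw [hP] at hv
    have hvA : v ∈ A := hA.mem (by grind)
    have := hi v hvA hvB
    simp at hv this hnd hac hxc hcon
    grind only
  have hp0B : p₀ ∈ B := hB.mem (by simp)
  have hp1B : p₁ ∈ B := hB.mem (by simp)
  have hmB : ∀ v ∈ [p₀, p₁, x, a, v₁, v₂], v ∈ outer E d f B := by
    intro v hv
    rw [hB.outer_iff]
    simp at hv ⊢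
    grind only
  have hp2 : p₂ ∈ U ∧ p₂ ∉ B := ⟨h.disc.mem (by simp), fun hh => by
    have := hPB p₂ ((hP _).2 (by simp)) hh
    simp at hnd
    grind only⟩
  have hQP : ∀ v ∈ B, v ∉ {v | v ∈ [p₀, p₁, x, a, v₁, v₂]} → v ∉ P := by grind
  have hgood : Good E d f L B {v | v ∈ [p₀, p₁, x, a, v₁, v₂]} χ := by
    refine ⟨hmB, ncard_le_of_list [p₀, p₁, x, a, v₁, v₂] fun v hv => hv, cutConn_list _ ?_,
      c3.mono ?_, fun v hv hvQ => h.good.two v (hBU hv) (hQP v hv hvQ),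
      fun v hv hvo => h.good.inner v (hBU hv) fun hh => hvo (outer_anti hBU hh hv),
      fun u hu huQ v hv hvQ => h.good.indep u (hBU hu) (hQP u hu huQ) v (hBU hv) (hQP v hv hvQ),
      Or.inr fun p hp v hv hvQ hv3 he => ?_⟩
    · simp [Set.insert_subset_iff, f0, mem_swap hx1, hxa, mem_swap e1, he12]
    · intro v hv
      simp [hP] at hv ⊢
      grind only
    · have hvP' := hQP v hv hvQ
      have hvw : v ∈ ws := by
        by_contra hvw
        refine absurd (h.three h.disc (hBU hv) fun hvc => ?_) (by omega)
        rw [hP] at hvP'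
        have h3 := h.three₃
        have hv33 : v ≠ v₃ := fun e => by grind
        simp at hvc hvQ hvP'
        grind only
      obtain ⟨w₁, w₂, rfl⟩ := List.append_of_mem hvw
      simp only [Set.mem_ofPred_eq, List.mem_cons, List.not_mem_nil, or_false] at hp
      rcases hp with rfl | rfl | rfl | rfl | rfl | rfl
      · exact h.strict _ ((hP _).2 (by simp)) v (hBU hv) hvP' hv3 he
      · exact h.strict _ hp1 v (hBU hv) hvP' hv3 he
      · have hc' : Disc E d f U (v₁ :: ((v₂ :: v₃ :: w₁) ++ v :: (w₂ ++ [p₀, p₁, p₂, p₃, p₄, p₅]))) := by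
          simpa using h.disc.rotate
        exact h.no_three_chord hc' (fun u hu => hvP u (by simp at hu ⊢; grind only)) haU hx
          (by simp at hac ⊢; grind only) (by simp at hxc ⊢; grind only) e1 (mem_swap hxa) he (Or.inr hv3)
      · exact Ctx.no_two_vs (w₁ := []) (m := v₂ :: v₃ :: w₁) h.toCtx haU h.off.1 (mem_swap e1) he
      · exact absurd (Ctx.consecutive (w₁ := []) (m := v₂ :: v₃ :: w₁) h.toCtx he) (by simp)
      · exact absurd (Ctx.consecutive (w₁ := [v₁]) (m := v₃ :: w₁) h.toCtx he) (by simp)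
  obtain ⟨η, g1, g2, g3⟩ := h.ih B ⟨hBU, fun hh => hp2.2 (hh hp2.1)⟩ _ _ _ hgood
  have hK₀ := c3.glue g3 (fun v hv hvB => (g1 v (by
      rcases hv with hv | hv
      · have := hPB v hv hvB
        simp
        grind only
      · simp at hv ⊢
        grind only)).symm) (fun u hu huB w hw hwK => by
      by_cases hwA : w ∈ A
      · have := hi w hwA hw
        refine (hwK ?_).elim
        simp at this
        rcases this with rfl | rfl | rfl | rfl
        · exact Or.inl hp1
        · exact Or.inr (by simp)
        · exact Or.inr (by simp)
        · exact Or.inr (by simp)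
      · refine hcr u ?_ huB w hw hwA
        have hu0 : u ≠ p₀ := fun e => huB (e ▸ hp0B)
        rcases hu with hu | hu
        · rw [hP] at hu
          refine hA.mem ?_
          simp at hu ⊢
          grind only
        · exact (huB ((hB.outer_iff u).2 (by simp at hu ⊢; grind only)).1).elim)
  obtain ⟨κ, k1, k2, hK⟩ : ∃ κ : V → α, (∀ v ∈ P ∪ {v | v ∈ [v₂, v₁, x, a]}, κ v = χ v) ∧
      (∀ v ∉ P ∪ {v | v ∈ [v₂, v₁, x, a]}, κ v = η v) ∧
      Proper E ((P ∪ {v | v ∈ [v₂, v₁, x, a]}) ∪ B) κ :=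
    ⟨_, fun v hv => if_pos hv, fun v hv => if_neg hv, hK₀⟩
  have hKA : ∀ v ∈ A, v ∈ (P ∪ {v | v ∈ [v₂, v₁, x, a]}) ∪ B →
      v ∈ p₁ :: ([p₂, p₃, p₄, p₅] ++ v₁ :: [x, a].reverse) := by
    intro v hv hvK
    by_cases hvB : v ∈ B
    · have := hi v hv hvB
      simp at this ⊢
      grind only
    · have hv0 : v ≠ p₀ := fun e => hvB (e ▸ hp0B)
      have hv2 : v ≠ v₂ := fun e => hvB (e ▸ hB.mem (by simp))
      simp [hP, hvB] at hvK ⊢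
      grind only
  have hUK : ∀ v ∈ U, v ∉ (P ∪ {v | v ∈ [v₂, v₁, x, a]}) ∪ B → 3 ≤ (L v).card := by
    intro v hv hvK
    refine h.three h.disc hv fun hvc => hvK ?_
    by_cases hvp : v ∈ P
    · exact Or.inl (Or.inl hvp)
    · refine Or.inr (hB.mem ?_)
      rw [hP] at hvp
      simp at hvc hvp ⊢
      grind only
  have hkey : ∃ θ : V → α, (∀ v ∈ (P ∪ {v | v ∈ [v₂, v₁, x, a]}) ∪ B,
      θ v = κ v) ∧
      (∀ v ∈ A, v ∉ (P ∪ {v | v ∈ [v₂, v₁, x, a]}) ∪ B → θ v ∈ L v) ∧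
      Proper E (((P ∪ {v | v ∈ [v₂, v₁, x, a]}) ∪ B) ∪ A) θ := by
    refine h.drawn.cyc_extend hg (hAU.trans h.sub) (h.ih.mono hAU) hA (by simp) hK
      (fun v hv => ?_) hKA (fun u hu huA w hw hwK => ?_) (fun v hv hvK => hUK v (hAU hv) hvK)
    · by_cases hvp : v ∈ P
      · exact Or.inl (Or.inl hvp)
      · refine Or.inr (hB.mem ?_)
        rw [hP] at hvp
        simp at hv hvp ⊢
        grind only
    · have huB : u ∈ B := by
        by_contra huB
        have hu0 : u ≠ p₀ := fun e => huB (e ▸ hp0B)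
        have hu2 : u ≠ v₂ := fun e => huB (e ▸ hB.mem (by simp))
        refine huA (hA.mem ?_)
        simp [hP, huB] at hu ⊢
        grind only
      rw [Sym2.eq_swap]
      exact hcr w hw (fun hh => hwK (Or.inr hh)) u huB huA
  obtain ⟨θ, t1, t2, t3⟩ := hkey
  refine h.notExt ⟨θ, fun v hv => ?_, fun v hv hvp => ?_, t3.mono ?_⟩
  · rw [t1 v (Or.inl (Or.inl hv)), k1 v (Or.inl hv), c1 v hv]
  · by_cases hvK : v ∈ (P ∪ {v | v ∈ [v₂, v₁, x, a]}) ∪ B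
    · rw [t1 v hvK]
      by_cases hvA : v ∈ P ∪ {v | v ∈ [v₂, v₁, x, a]}
      · rw [k1 v hvA]
        exact c2 v (hvA.resolve_left hvp)
      · rw [k2 v hvA]
        refine g2 v (hvK.resolve_left hvA) fun hvQ => ?_
        simp [hP] at hvQ hvA
        grind only
    · rw [← hAB] at hv
      exact t2 v (hv.resolve_right fun hh => hvK (Or.inr hh)) hvK
  · rw [← hAB]
    rintro v (hv | hv)
    · exact Or.inr hv
    · exact Or.inl (Or.inr hv)

omit [Fintype V] in
theorem Girth5.uniq_of_short (hg : Girth5 E) {m : List V} (hm : m.length ≤ 3) (hmE : pe m ⊆ E)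
    (ha : a ∉ m) : ∃ q, ∀ p ∈ m, s(a, p) ∈ E → p = q := by
  have htri : ∀ x y, s(x, y) ∈ E → s(a, x) ∈ E → s(a, y) ∈ E → False := fun x y h h1 h2 =>
    hg.tri _ _ _ h1 h (mem_swap h2)
  match m, hm with
  | [], _ => exact ⟨a, by simp⟩
  | [x], _ => exact ⟨x, by simp⟩
  | [x, y], _ =>
    simp at hmE
    by_cases hx : s(a, x) ∈ E
    · exact ⟨x, by grind⟩
    · exact ⟨y, by simp [hx]⟩
  | [x, y, z], _ =>
    simp [Set.insert_subset_iff] at hmE ha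
    by_cases hx : s(a, x) ∈ E
    · refine ⟨x, ?_⟩
      simp
      refine ⟨fun hy => (htri x y hmE.1 hx hy).elim, fun hz => ?_⟩
      rcases hg.quad _ _ _ _ hx hmE.1 hmE.2 (mem_swap hz) with h | h
      · exact (ha.2.1 h).elim
      · exact h.symm
    · by_cases hy : s(a, y) ∈ E
      · refine ⟨y, ?_⟩
        simp [hx]
        exact fun hz => (htri y z hmE.2 hy hz).elim
      · exact ⟨z, by simp [hx, hy]⟩

theorem Special.uniq_a (h : Special E d f L W U P ψ ps v₁ v₂ v₃ ws a b) :
    ∃ q, ∀ p ∈ P, s(a, p) ∈ E → p = q := by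
  have hg := h.girth
  have e1 : s(a, v₁) ∈ E := mem_swap h.e₁
  have hac := h.off.1
  have haU := h.memU.1
  have hlen := h.ps_length
  have hpE : pe ps ⊆ E := Disc.pe_subset (l := []) h.disc
  obtain ⟨p₀, t, rfl⟩ := List.exists_cons_of_ne_nil h.ps_ne
  have hp0 : s(a, p₀) ∉ E := fun he => Ctx.no_two_first (w₁ := []) h.toCtx haU hac he e1
  rcases List.eq_nil_or_concat' t with rfl | ⟨m, z, rfl⟩
  · exact ⟨p₀, fun p hp _ => by simpa [h.mem] using hp⟩
  have hz : s(a, z) ∉ E := fun he =>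
    Ctx.no_two_last (p₁ := p₀ :: m) (m := []) h.toCtx haU hac he e1
  rcases List.eq_nil_or_concat' m with rfl | ⟨m, y, rfl⟩
  · refine ⟨p₀, fun p hp he => ?_⟩
    simp [h.mem] at hp
    grind
  have hyz : s(y, z) ∈ E := hpE (by
    have := pe_suffix_subset (p₀ :: m) [y, z]
    simp_all)
  have hz1 : s(z, v₁) ∈ E := h.disc.ce_subset (by
    simpa using mem_ce_append (p₀ :: (m ++ [y])) z v₁ (v₂ :: v₃ :: ws))
  have hnd := h.disc.nodup
  have hy : s(a, y) ∉ E := fun he => by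
    rcases hg.quad _ _ _ _ he hyz hz1 (mem_swap e1) with rfl | rfl
    · simp at hac
    grind
  simp at hlen hac
  obtain ⟨q, hq⟩ := hg.uniq_of_short (a := a) (m := m) (by omega)
    ((by have := pe_suffix_subset [p₀] (m ++ [y, z]); exact (pe_prefix_subset m [y, z]).trans
          (by simpa using this) : pe m ⊆ pe (p₀ :: (m ++ [y] ++ [z]))).trans (by simpa using hpE))
    (by tauto)
  refine ⟨q, fun p hp he => ?_⟩
  simp [h.mem] at hp
  rcases hp with rfl | hp | rfl | rfl
  · exact (hp0 he).elim
  · exact hq p hp he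
  · exact (hy he).elim
  · exact (hz he).elim

/-- A colouring of the precoloured vertices and of the five vertices of the configuration. -/
theorem Special.exists_colour (h : Special E d f L W U P ψ ps v₁ v₂ v₃ ws a b) :
    ∃ φ : V → α, (∀ v ∈ P, φ v = ψ v) ∧ (∀ y ∈ [v₁, v₂, v₃, a, b], φ y ∈ L y) ∧
      (∀ w ws', ws = w :: ws' → φ v₃ ∉ L w) ∧ Proper E (P ∪ {v | v ∈ [v₁, v₂, v₃, a, b]}) φ := by
  classical
  have hg := h.girth
  obtain ⟨⟨he12, he23⟩, h13, h1b, ha3, h2a, h2b, hab⟩ := h.girth_facts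
  obtain ⟨⟨ha, hb⟩, haP, hbP⟩ := h.three_ab
  have h3 := h.three₃
  obtain ⟨S, hS, hS1, hS2, hS3⟩ : ∃ S ⊆ L v₃, S.Nonempty ∧ (ws = [] → 2 ≤ S.card) ∧
      ∀ w ws', ws = w :: ws' → ∀ x ∈ S, x ∉ L w := by
    rcases hws : ws with _ | ⟨w, ws'⟩
    · exact ⟨L v₃, subset_rfl, Finset.card_pos.1 (by omega), fun _ => by omega, by simp⟩
    · have := h.next w ws' hws
      obtain ⟨x, hx, hx'⟩ := exists_color (L v₃) (L w) (by omega)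
      exact ⟨L v₃ \ L w, Finset.sdiff_subset, ⟨x, by simp [hx, hx']⟩, by simp, by simp⟩
  obtain ⟨φ, c1, c2, c3, c4⟩ := h.colour_three hS hS1 hS2
  obtain ⟨q, hq⟩ := h.uniq_a
  have hbn : ∀ p ∈ P, s(b, p) ∉ E := fun p hp => Ctx.no_link (w₁ := [v₁, v₂]) h.toCtx (by simp)
    (Or.inr rfl) h.memU.2 h.off.2 h.e₃ hp
  have hac := h.off.1
  have hbc := h.off.2
  simp only [List.mem_append, List.mem_cons] at hac hbc
  have hK : ∀ v ∈ [a, b], v ∉ P ∪ {v | v ∈ [v₁, v₂, v₃]} := by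
    intro v hv
    simp only [List.mem_cons, List.not_mem_nil, or_false] at hv
    rcases hv with rfl | rfl
    · simp [haP]
      tauto
    · simp [hbP]
      tauto
  obtain ⟨χ, g1, g2, g3⟩ := c4.greedy (L := L) hg.loop [a, b] (by simpa using hab) hK (by
    intro s v t hst
    obtain ⟨rfl, rfl, rfl⟩ | ⟨rfl, rfl, rfl⟩ := eq_of_pair_eq_append hst
    · refine ⟨[q, v₁], by simp; omega, fun w hw he => ?_⟩
      simp at hw ⊢
      rcases hw with hw | rfl | rfl | rfl
      · exact Or.inl (hq w hw he)
      · exact Or.inr rfl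
      · exact (h2a (mem_swap he)).elim
      · exact (ha3 he).elim
    · refine ⟨[v₃, a], by simp; omega, fun w hw he => ?_⟩
      simp at hw ⊢
      rcases hw with (hw | rfl | rfl | rfl) | rfl
      · exact (hbn w hw he).elim
      · exact (h1b (mem_swap he)).elim
      · exact (h2b (mem_swap he)).elim
      · exact Or.inl rfl
      · exact Or.inr rfl)
  have g4 : ∀ v ∈ [v₁, v₂, v₃], χ v = φ v := fun v hv => g1 v (Or.inr hv)
  refine ⟨χ, fun v hv => (g1 v (Or.inl hv)).trans (c1 v hv), fun v hv => ?_, fun w ws' hws => ?_,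
    g3.mono fun v hv => ?_⟩
  · by_cases hv' : v ∈ [v₁, v₂, v₃]
    · rw [g4 v hv']
      exact c2 v hv'
    · exact g2 v (by simp at hv hv' ⊢; tauto)
  · rw [g4 v₃ (by simp)]
    exact hS3 w ws' hws _ c3
  · simp at hv ⊢
    tauto

theorem Special.no_chord_a {p : V} {p₂ : List V} {x : V}
    (h : Special E d f L W U P ψ (p :: p₂) v₁ v₂ v₃ ws a b) (hx : x ∈ U)
    (hxc : x ∉ (p :: p₂) ++ (v₁ :: v₂ :: v₃ :: ws)) (h1 : s(x, p) ∈ E) (h2 : s(x, a) ∈ E) :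
    False := by
  have hac := h.off.1
  refine h.no_three_chord (y := v₁) (a₁ := v₂ :: v₃ :: ws) (a₂ := p₂) (u := a) (x := x) (y' := p)
    (by simpa using h.disc.rotate) (fun v hv => h.disjoint (by simp at hv ⊢; tauto)) h.memU.1 hx
    ?_ ?_ h.e₁ (mem_swap h2) h1 (Or.inl ((h.mem p).2 (by simp)))
  · grind
  grind

theorem Special.no_chord_b {p : V} {p₂ : List V} {x : V}
    (h : Special E d f L W U P ψ (p :: p₂) v₁ v₂ v₃ ws a b) (hx : x ∈ U)
    (hxc : x ∉ (p :: p₂) ++ (v₁ :: v₂ :: v₃ :: ws)) (h1 : s(x, p) ∈ E) (h2 : s(x, b) ∈ E) :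
    False := by
  have hbc := h.off.2
  refine h.no_three_chord (y := v₃) (a₁ := ws) (a₂ := p₂ ++ [v₁, v₂]) (u := b) (x := x) (y' := p)
    ?_ (fun v hv => h.disjoint (by simp at hv ⊢; tauto)) h.memU.2 hx
    ?_ ?_ (mem_swap h.e₃) (mem_swap h2) h1 (Or.inl ((h.mem p).2 (by simp)))
  · have := h.disc
    rw [show (p :: p₂) ++ (v₁ :: v₂ :: v₃ :: ws) = (p :: p₂ ++ [v₁, v₂]) ++ (v₃ :: ws) by simp]
      at this
    simpa using this.rotate
  · grind
  grind

theorem Special.no_link_b {p₀ p x : V} {p₂ : List V}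
    (h : Special E d f L W U P ψ (p₀ :: p :: p₂) v₁ v₂ v₃ ws a b) (hlen : p₂.length = 4)
    (hx : x ∈ U) (hxc : x ∉ (p₀ :: p :: p₂) ++ (v₁ :: v₂ :: v₃ :: ws)) (h1 : s(x, p) ∈ E)
    (h2 : s(x, b) ∈ E) : False := by
  by_cases hw : ws = []
  · subst hw
    match p₂, hlen with
    | [p₂, p₃, p₄, p₅], _ =>
      exact h.toCtx.no_three_link_end h.memU.2 hx h.off.2 hxc (mem_swap h.e₃)
        (mem_swap h2) h1
  · exact h.toCtx.no_three_link hw h.memU.2 hx h.off.2 hxc (mem_swap h.e₃)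
      (mem_swap h2) h1

theorem Special.Split.short (h : Special.Split E d f L W U P ψ ps v₁ v₂ v₃ ws a b D R) {v p y : V}
    {p₁ p₂ y₁ y₂ : List V} (hv : v ∈ D) (hvc : v ∉ ps ++ ([v₁, a, b, v₃] ++ ws))
    (hps : ps = p₁ ++ p :: p₂) (hys : [v₁, a, b, v₃] = y₁ ++ y :: y₂) (hp : s(v, p) ∈ E)
    (hy : s(v, y) ∈ E) : p₂ ≠ [] ∧ p₂.length + y₁.length ≤ 5 ∧
      (p₂.length + y₁.length = 5 → ∀ q ∈ p₂, s(v, q) ∉ E) := by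
  have hg := h.girth
  have hvU := h.subset.1 hv
  have hv2 : v ≠ v₂ := fun e => h.v₂_notMem.1 (e ▸ hv)
  have hvc' : v ∉ ps ++ (v₁ :: v₂ :: v₃ :: ws) := by grind
  have hpE : pe ps ⊆ E := Disc.pe_subset (l := []) h.disc
  have hlen := h.ps_length
  subst hps
  simp at hlen
  have hpP : p ∈ P := (h.mem p).2 (by simp)
  have hp₁ : p₁ ≠ [] → 1 ≤ p₁.length := fun h => List.length_pos_iff.2 h
  have hpp : pe (p :: p₂) ⊆ E := (pe_suffix_subset p₁ (p :: p₂)).trans hpE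
  have hlast : ∀ (m : List V) (z : V), p₁ ++ p :: p₂ = m ++ [z] → s(v, z) ∈ E → s(v, a) ∈ E →
      False := by
    intro m z hm hz hva
    have hzE : s(z, v₁) ∈ E := h.disc.ce_subset (by
      rw [hm]
      obtain _ | ⟨m₀, m⟩ := m
      · simpa using mem_ce_append [] z v₁ (v₂ :: v₃ :: ws)
      · simpa using mem_ce_append (m₀ :: m) z v₁ (v₂ :: v₃ :: ws))
    have hac := h.off.1
    rw [hm] at hac hvc'
    rcases hg.quad _ _ _ _ hz hzE h.e₁ (mem_swap hva) with e | e
    · simp [e] at hvc'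
    · simp [e] at hac
  have hq₁ : ∀ q r, p₂ = q :: r → s(v, q) ∉ E := fun q r e he => by
    subst e
    exact hg.tri _ _ _ hp (hpp (by simp)) (mem_swap he)
  have hq₂ : ∀ q q' r, p₂ = q :: q' :: r → s(v, q') ∉ E := fun q q' r e he => by
    subst e
    simp [Set.insert_subset_iff] at hpp
    rcases hg.quad _ _ _ _ hp hpp.1 hpp.2.1 (mem_swap he) with e | e
    · simp [e] at hvc
    · have := h.disc.nodup
      simp [List.nodup_append, e] at this
  obtain rfl | ⟨y₀, rfl⟩ | ⟨y₀, y₁', rfl⟩ | ⟨y₀, y₁', y₂', y₁, rfl⟩ : y₁ = [] ∨ (∃ y₀, y₁ = [y₀]) ∨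
      (∃ y₀ y₁', y₁ = [y₀, y₁']) ∨ ∃ y₀ y₁' y₂' y₃, y₁ = y₀ :: y₁' :: y₂' :: y₃ := by
    match y₁ with
    | [] => simp
    | [_] => simp
    | [_, _] => simp
    | _ :: _ :: _ :: _ => simp
  · simp at hys
    obtain ⟨rfl, -⟩ := hys
    refine ⟨?_, by simp; omega, fun h5 => ?_⟩
    · rintro rfl
      exact h.toCtx.no_two_last (m := []) hvU hvc' hp hy
    · obtain rfl : p₁ = [] := by
        by_contra hne
        have := hp₁ hne
        simp at h5
        omega
      exact (h.toCtx.no_two_first (p₂ := p₂) (w₁ := []) hvU hvc' hp hy).elim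
  · simp at hys
    obtain ⟨rfl, rfl, -⟩ := hys
    have hne : p₁ ≠ [] := by
      rintro rfl
      exact h.toSpecial.no_chord_a hvU hvc' hp hy
    have := hp₁ hne
    refine ⟨?_, by simp; omega, fun h5 => ?_⟩
    · rintro rfl
      exact hlast p₁ p rfl hp hy
    · simp at h5
      obtain ⟨p₀, rfl⟩ := List.length_eq_one_iff.1 (show p₁.length = 1 by omega)
      match p₂, h5 with
      | [q₁, q₂, q₃, q₄], _ =>
        intro q hq
        simp at hq
        rcases hq with rfl | rfl | rfl | rfl
        · exact hq₁ _ _ rfl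
        · exact hq₂ _ _ _ rfl
        · exact fun he => h.toSpecial.no_spread hvU hvc' hy hp he
        · exact fun he => hlast [p₀, p, q₁, q₂, q₃] q rfl he hy
  · simp at hys
    obtain ⟨rfl, rfl, rfl, -⟩ := hys
    have hne : p₁ ≠ [] := by
      rintro rfl
      exact h.toSpecial.no_chord_b hvU hvc' hp hy
    have := hp₁ hne
    have h4 : p₂.length ≠ 4 := by
      intro h4
      obtain ⟨p₀, rfl⟩ := List.length_eq_one_iff.1 (show p₁.length = 1 by omega)
      exact h.toSpecial.no_link_b h4 hvU hvc' hp hy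
    refine ⟨?_, by simp; omega, fun h5 => ?_⟩
    · rintro rfl
      exact h.no_last hv hvc hp hy
    · simp at h5
      match p₂, h5 with
      | [q₁, q₂, q₃], _ =>
        intro q hq
        simp at hq
        rcases hq with rfl | rfl | rfl
        · exact hq₁ _ _ rfl
        · exact hq₂ _ _ _ rfl
        · intro he
          have h' := h
          rw [show p₁ ++ [p, q₁, q₂, q] = (p₁ ++ [p, q₁, q₂]) ++ [q] by simp] at h' hvc
          exact h'.no_last hv hvc he hy
  · simp at hys
    obtain ⟨rfl, rfl, rfl, hys⟩ := hys
    obtain rfl : y = v₃ := by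
      obtain _ | ⟨_, _⟩ := y₁ <;> simp at hys
      exact hys.1.symm
    exact (Ctx.no_link (w₁ := [v₁, v₂]) h.toCtx (by simp) (Or.inr rfl) hvU hvc' hy hpP hp).elim

theorem Special.Split.eq_v₃ (h : Special.Split E d f L W U P ψ ps v₁ v₂ v₃ ws a b D R) {w y : V}
    (hw : w ∈ ws) (hy : y ∈ [v₁, a, b, v₃]) (he : s(y, w) ∈ E) : y = v₃ ∧ ∃ ws', ws = w :: ws' := by
  have hnd := h.disc.nodup
  have hvs := (List.nodup_append.1 hnd).2.1
  simp at hy hvs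
  have hj : ∀ y ∈ [v₁, v₂, v₃], s(y, w) ∈ E → y = v₃ ∧ ∃ ws', ws = w :: ws' := fun y hy he => by
    obtain ⟨⟨m, hm⟩, hw'⟩ := Ctx.join (ys := [v₁, v₂, v₃]) h.toCtx hy hw he
    have := congrArg List.getLast? hm
    grind
  rcases hy with rfl | rfl | rfl | rfl
  · grind
  · have := h.uniq_vs h.memU.1 h.off.1 (y := v₁) (y' := w) (by simp) (by simp [hw])
      (mem_swap h.e₁) he
    grind
  · have := h.uniq_vs h.memU.2 h.off.2 (y := v₃) (y' := w) (by simp) (by simp [hw]) h.e₃ he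
    grind
  grind

theorem Special.Split.uniq_off (h : Special.Split E d f L W U P ψ ps v₁ v₂ v₃ ws a b D R) {v y y' : V}
    (hv : v ∈ D) (hvc : v ∉ ps ++ ([v₁, a, b, v₃] ++ ws)) (hy : y ∈ [v₁, a, b, v₃])
    (hy' : y' ∈ [v₁, a, b, v₃]) (h1 : s(v, y) ∈ E) (h2 : s(v, y') ∈ E) : y = y' := by
  have hg := h.girth
  have hvU := h.subset.1 hv
  have hv2 : v ≠ v₂ := fun e => h.v₂_notMem.1 (e ▸ hv)
  have hvc' : v ∉ ps ++ (v₁ :: v₂ :: v₃ :: ws) := by grind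
  have htri : ∀ x y, s(x, y) ∈ E → s(v, x) ∈ E → s(v, y) ∈ E → False := fun x y h h1 h2 =>
    hg.tri _ _ _ h1 h (mem_swap h2)
  have e₁ := h.e₁
  have e₂ := h.e₂
  have e₃ := h.e₃
  have hvs := (List.nodup_append.1 h.disc.nodup).2.1
  have hac := h.off.1
  have hbc := h.off.2
  have h13 : s(v, v₁) ∈ E → s(v, v₃) ∈ E → False := fun h1 h2 => by
    have := h.uniq_vs hvU hvc' (by simp) (by simp) h1 h2
    simp [this] at hvs
  have h1b : s(v, v₁) ∈ E → s(v, b) ∈ E → False := fun h1 h2 => by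
    rcases hg.quad _ _ _ _ h1 e₁ e₂ (mem_swap h2) with e | e
    · simp [e] at hvc
    · simp [e] at hbc
  have ha3 : s(v, a) ∈ E → s(v, v₃) ∈ E → False := fun h1 h2 => by
    rcases hg.quad _ _ _ _ h1 e₂ e₃ (mem_swap h2) with e | e
    · simp [e] at hvc
    · simp [e] at hac
  simp only [List.mem_cons, List.not_mem_nil, or_false] at hy hy'
  grind

theorem Special.Split.no_low (h : Special.Split E d f L W U P ψ ps v₁ v₂ v₃ ws a b D R) {u v y : V}
    (hu : u ∈ D) (huc : u ∉ ps ++ ([v₁, a, b, v₃] ++ ws)) (hv : v ∈ ws) (hvL : (L v).card < 3)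
    (hy : y ∈ [v₁, a, b, v₃]) (h1 : s(u, y) ∈ E) (h2 : s(u, v) ∈ E) : False := by
  have huU := h.subset.1 hu
  have hu2 : u ≠ v₂ := fun e => h.v₂_notMem.1 (e ▸ hu)
  have huc' : u ∉ ps ++ (v₁ :: v₂ :: v₃ :: ws) := by grind
  have hvs := (List.nodup_append.1 h.disc.nodup).2.1
  have hj : ∀ y ∈ [v₁, v₂, v₃], s(u, y) ∈ E → False := fun y hy h1 => by
    have := h.uniq_vs huU huc' (y := y) (y' := v) (by simp at hy ⊢; tauto) (by simp [hv]) h1 h2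
    grind
  have hvsP : ∀ z ∈ v₁ :: v₂ :: v₃ :: ws, z ∉ P := fun z hz => h.disjoint hz
  simp only [List.mem_cons, List.not_mem_nil, or_false] at hy
  have hac := h.off.1
  have hbc := h.off.2
  obtain ⟨w₁, w₂, hw⟩ := List.append_of_mem hv
  rcases hy with rfl | rfl | rfl | rfl
  · exact hj _ (by simp) h1
  · refine h.no_three_chord (y := v₁) (a₁ := v₂ :: v₃ :: w₁) (a₂ := w₂ ++ ps) (u := y) (x := u)
      (y' := v) ?_ (fun z hz => hvsP z (by rw [hw]; simp at hz ⊢; tauto)) h.memU.1 huU ?_ ?_ h.e₁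
      (mem_swap h1) h2 (Or.inr hvL)
    · have := h.disc
      rw [hw] at this
      simpa using this.rotate
    · rw [hw] at hac
      simp at hac ⊢
      tauto
    · rw [hw] at huc'
      simp at huc' ⊢
      tauto
  · refine h.no_three_chord (y := v₃) (a₁ := w₁) (a₂ := w₂ ++ (ps ++ [v₁, v₂])) (u := y) (x := u)
      (y' := v) ?_ (fun z hz => hvsP z (by rw [hw]; simp at hz ⊢; tauto)) h.memU.2 huU ?_ ?_
      (mem_swap h.e₃) (mem_swap h1) h2 (Or.inr hvL)
    · have := h.disc
      rw [show ps ++ (v₁ :: v₂ :: v₃ :: ws) = (ps ++ [v₁, v₂]) ++ (v₃ :: ws) by simp, hw] at this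
      simpa using this.rotate
    · rw [hw] at hbc
      simp at hbc ⊢
      tauto
    · rw [hw] at huc'
      simp at huc' ⊢
      tauto
  · exact hj _ (by simp) h1

set_option maxHeartbeats 1600000 in
theorem Special.Split.false (h : Special.Split E d f L W U P ψ ps v₁ v₂ v₃ ws a b D R) : False := by
  classical
  obtain ⟨φ, hφP, hφL, hnext, hφ⟩ := h.toSpecial.exists_colour
  have hmem : ∀ v, v ∈ ps ++ ([v₁, a, b, v₃] ++ ws) ↔
      v ∈ ps ∨ v ∈ [v₁, a, b, v₃] ∨ v ∈ ws := fun v => by grind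
  have hsub : ∀ y ∈ [v₁, a, b, v₃], y ∈ [v₁, v₂, v₃, a, b] := fun y hy => by simp at hy ⊢; tauto
  have hnd := h.discD.nodup
  have hDU := h.subset.1
  have hon : ∀ w ∈ ws, avoid E L φ {v | v ∈ [v₁, a, b, v₃]} w = L w := fun w hw =>
    avoid_eq_of_notMem fun y hy he => by
      obtain ⟨rfl, ws', e⟩ := h.eq_v₃ hw hy he
      exact hnext w ws' e
  have hnP : ∀ v, v ∉ ps → v ∉ P := fun v hv hh => hv ((h.mem v).1 hh)
  have huniq : ∀ v ∈ D, v ∉ ps → v ∉ [v₁, a, b, v₃] → ∀ y ∈ [v₁, a, b, v₃],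
      ∀ y' ∈ [v₁, a, b, v₃], s(v, y) ∈ E → s(v, y') ∈ E → y = y' := by
    intro v hv h1 h2 y hy y' hy' he he'
    by_cases hvw : v ∈ ws
    · rw [(h.eq_v₃ hvw hy (mem_swap he)).1, (h.eq_v₃ hvw hy' (mem_swap he')).1]
    · exact h.uniq_off hv (by rw [hmem]; tauto) hy hy' he he'
  have hcard : ∀ v ∈ D, v ∉ ps → v ∉ [v₁, a, b, v₃] →
      (L v).card ≤ (avoid E L φ {v | v ∈ [v₁, a, b, v₃]} v).card + 1 :=
    fun v hv h1 h2 => card_le_avoid fun y hy y' hy' he he' =>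
      huniq v hv h1 h2 y hy y' hy' (mem_swap he) (mem_swap he')
  have hthree : ∀ v ∈ D, v ∉ ps → v ∉ [v₁, a, b, v₃] → v ∉ ws → 3 ≤ (L v).card :=
    fun v hv h1 h2 h3 => h.three h.disc (hDU hv) fun hvc => by
      have hv2 : v ≠ v₂ := fun e => h.v₂_notMem.1 (e ▸ hv)
      grind
  have hoff : ∀ v ∈ D, v ∉ ps → v ∉ [v₁, a, b, v₃] → v ∉ ws →
      (avoid E L φ {v | v ∈ [v₁, a, b, v₃]} v).card < 3 → ∃ y ∈ [v₁, a, b, v₃], s(v, y) ∈ E := by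
    intro v hv h1 h2 h3 h4
    by_contra hcon
    push Not at hcon
    rw [avoid_eq (Y := {v | v ∈ [v₁, a, b, v₃]}) fun y hy he =>
      hcon y hy (mem_swap he)] at h4
    grind
  have hwo : ∀ u ∈ D, u ∉ ps → u ∉ [v₁, a, b, v₃] → u ∉ ws → ∀ v ∈ ws, (L v).card < 3 →
      (avoid E L φ {v | v ∈ [v₁, a, b, v₃]} u).card < 3 → s(u, v) ∉ E := by
    intro u hu h1 h2 h3 v hv hvL h4 he
    obtain ⟨y, hy, he'⟩ := hoff u hu h1 h2 h3 h4
    exact h.no_low hu (by rw [hmem]; tauto) hv hvL hy he' he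
  have hpeel : Peel E d f L W D ps [v₁, a, b, v₃] ws φ := by
    refine ⟨h.drawn, h.girth, hDU.trans h.sub, h.ih.mono hDU, h.discD, by simp, h.ps_length,
      hφ.mono fun v hv => hv.imp (h.mem v).2 (hsub v), fun v hv h1 h2 => ?_, hthree,
      fun u hu hu1 hu2 v hv h1 h2 h3 h3' he => ?_, huniq, fun v hv h1 h2 h3 p hp he => ?_,
      fun v hv h1 h2 h3 p₁ p p₂ y₁ y y₂ hps hys hp hy =>
        h.short hv (by rw [hmem]; tauto) hps hys hp hy⟩
    · by_cases hvw : v ∈ ws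
      · rw [hon v hvw]
        exact h.good.two v (hDU hv) (hnP v h1)
      grind
    · by_cases huw : u ∈ ws <;> by_cases hvw : v ∈ ws
      · rw [hon u huw] at h3
        rw [hon v hvw] at h3'
        exact h.good.indep u (hDU hu) (hnP u hu1) v (hDU hv) (hnP v h1) h3 h3' he
      · rw [hon u huw] at h3
        exact hwo v hv h1 h2 hvw u huw h3 h3' (mem_swap he)
      · grind
      · obtain ⟨y, hy, hy'⟩ := hoff u hu hu1 hu2 huw h3
        obtain ⟨z, hz, hz'⟩ := hoff v hv h1 h2 hvw h3'
        exact h.no_rung hu hv (by rw [hmem]; tauto) (by rw [hmem]; tauto) he hy hz hy' hz'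
    · have hvw : v ∉ ws := by
        intro hvw
        rw [hon v hvw] at h3
        exact h.strict p ((h.mem p).2 hp) v (hDU hv) (hnP v h1) h3 (mem_swap he)
      exact ⟨hvw, hoff v hv h1 h2 hvw h3⟩
  obtain ⟨χ, c1, c2, c3⟩ := hpeel.ext
  have hv2D := h.v₂_notMem
  have hχ : ∀ y ∈ [v₁, a, b, v₃], χ y = φ y := fun y hy => c1 y (Or.inr hy)
  have hpr : Proper E (insert v₂ D) (Function.update χ v₂ (φ v₂)) := by
    refine c3.update (h.girth.loop _) hv2D.1 fun v hv he => ?_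
    have hvR : v ∈ R := by
      by_contra hvR
      exact h.cross' v₂ hv2D.2 hv2D.1 v hv hvR he
    have hv4 := h.inter v hvR hv
    rw [hχ v hv4]
    exact hφ v₂ (Or.inr (by simp)) v (Or.inr (hsub v hv4)) he
  have hup : ∀ v ∈ D, Function.update χ v₂ (φ v₂) v = χ v := fun v hv =>
    (Function.update_of_ne (fun e => hv2D.1 (e ▸ hv) : v ≠ v₂) _ _ : Function.update χ v₂ (φ v₂) v = χ v)
  refine h.not_proper (fun v hv => ?_) (fun v hv hvP => ?_) ?_ hpr
  · have hvps := (h.mem v).1 hv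
    rw [hup v (h.discD.mem (by simp [hvps])), c1 v (Or.inl hvps), hφP v hv]
  · rw [hup v hv]
    by_cases hv4 : v ∈ [v₁, a, b, v₃]
    · rw [hχ v hv4]
      exact hφL v (hsub v hv4)
    · exact c2 v hv fun hh => hh.elim (fun hh => hvP ((h.mem v).2 hh)) hv4
  · simpa using hφL v₂ (by simp)

/-- Every good precolouring extends. -/
theorem Drawn.ext_of_good (hD : Drawn E d W) (hg : Girth5 E) (hUW : U ⊆ W)
    (h : Good E d f L U P ψ) : Ext E L U P ψ := by
  classical
  induction hn : U.ncard using Nat.strong_induction_on generalizing U L P ψ with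
  | _ n ih =>
  have hIH : IH α E d f U := fun U' hU' L' P' ψ' h' =>
    ih _ (hn ▸ Set.ncard_lt_ncard hU') (hU'.subset.trans hUW) h' rfl
  have hne : ∀ {P : Set V} {ψ : V → α}, Good E d f L U P ψ → P.Nonempty → Ext E L U P ψ := by
    intro P ψ h hP
    by_contra hbad
    obtain ⟨P', ψ', c, hB, hc, hP'⟩ := Base.exists_of_not_ext hD hg h hIH hUW hP hbad
    obtain ⟨ps, vs, hC⟩ := hB.exists_ctx hc hP'
    obtain ⟨v₁, v₂, v₃, ws, a, b, hS⟩ := hC.exists_special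
    obtain ⟨D, R, hR⟩ := hS.exists_split
    exact hR.false
  rcases P.eq_empty_or_nonempty with rfl | hP
  swap
  · exact hne h hP
  rcases U.eq_empty_or_nonempty with rfl | hU
  · exact ⟨ψ, fun v _ => rfl, by simp, by intro u hu; simp at hu⟩
  obtain ⟨p, hp⟩ := hD.outer_nonempty hUW hU (f := f)
  have hpL := h.two p (outer_subset hp) (by simp)
  obtain ⟨γ, hγ⟩ := Finset.card_pos.1 (show 0 < (L p).card by omega)
  obtain ⟨φ, h1, h2, h3⟩ := hne (P := {p}) (ψ := fun _ => γ) ⟨by simpa using hp, by simp,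
    cutConn_singleton _ _, fun u hu v hv he => by
      simp only [Set.mem_singleton_iff] at hu hv
      subst hu hv
      exact (hg.loop _ he).elim, fun v hv _ => h.two v hv (by simp), h.inner,
      fun u hu _ v hv _ => h.indep u hu (by simp) v hv (by simp), by simp⟩ ⟨p, rfl⟩
  refine ⟨φ, by simp, fun v hv _ => ?_, h3⟩
  grind

end

end GirthFive

namespace GirthFive

variable {V : Type*} {α : Type*}
variable {E : Set (Sym2 V)} {L : V → Finset α}

theorem NoMinors.exists_colour_of_twoConn [Fintype V] {W : Set V} (hg : Girth5 E)
    (hm : NoMinors E W) (hL : ∀ v, 3 ≤ (L v).card) (hW : TwoConn E W) {v : V} (hv : v ∈ W)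
    {γ : α} (hγ : γ ∈ L v) : ∃ φ : V → α, φ v = γ ∧ (∀ u ∈ W, φ u ∈ L u) ∧ Proper E W φ := by
  let E' : Set (Sym2 V) := {e | e ∈ E ∧ ∀ u ∈ e, u ∈ W}
  have hE : E' ⊆ E := fun e he => he.1
  have hmem : ∀ u ∈ W, ∀ w ∈ W, s(u, w) ∈ E → s(u, w) ∈ E' := fun u hu w hw he =>
    ⟨he, by simp [hu, hw]⟩
  have hW' : TwoConn E' W := ⟨hW.three, hW.conn.congr hmem, fun x hx =>
    (hW.del x hx).congr fun u hu w hw => hmem u hu.1 w hw.1⟩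
  have hg' : Girth5 E' := ⟨fun a h => hg.loop a (hE h), fun a b c h1 h2 h3 =>
    hg.tri a b c (hE h1) (hE h2) (hE h3), fun a b c d h1 h2 h3 h4 =>
    hg.quad a b c d (hE h1) (hE h2) (hE h3) (hE h4)⟩
  have hs : ∀ a b, s(a, b) ∈ E' → a ∈ W ∧ b ∈ W ∧ a ≠ b := fun a b h =>
    ⟨h.2 a (by simp), h.2 b (by simp), hg'.ne h⟩
  obtain ⟨ι, d, hd⟩ := hasFrame_of_noMinors hs hW' (hm.mono hE subset_rfl)
  obtain ⟨a, ha, b, hb, c, hc, h1, h2, h3⟩ := hW.three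
  obtain ⟨u, hu, w, hw, he⟩ := hW'.conn {v} (by simpa using hv) (by simp) fun h => by grind
  obtain rfl : u = v := hu
  obtain ⟨f, hf⟩ := exists_face s(u, w) d
  have hD : Drawn E' d W := ⟨hd, hW', hs⟩
  obtain ⟨φ, c1, c2, c3⟩ := hD.ext_of_good (f := f) (L := L) (P := {u}) (ψ := fun _ => γ) hg'
    subset_rfl ⟨by simpa using ⟨hv, w, he, f, hf, mem_reg⟩, by simp, cutConn_singleton _ _,
      fun x hx y hy he => by grind,
      fun x _ _ => by have := hL x; omega, fun x _ _ => hL x, fun x _ _ _ _ _ h => by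
        have := hL x; omega, by simp⟩
  refine ⟨φ, c1 u rfl, fun x hx => ?_, fun x hx y hy he => c3 x hx y hy (hmem x hx y hy he)⟩
  by_cases hxu : x = u
  · subst hxu
    rw [c1 x rfl]
    exact hγ
  · exact c2 x hx hxu

theorem NoMinors.exists_colour [Fintype V] (hg : Girth5 E) (hm : NoMinors E Set.univ)
    (hL : ∀ v, 3 ≤ (L v).card) (W : Set V) {v : V} (hv : v ∈ W) {γ : α} (hγ : γ ∈ L v) :
    ∃ φ : V → α, φ v = γ ∧ (∀ u ∈ W, φ u ∈ L u) ∧ Proper E W φ := by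
  classical
  induction hn : W.ncard using Nat.strong_induction_on generalizing W v γ with
  | _ n ih =>
  have hglue : ∀ A C : Set V, A ⊂ W → C ⊂ W → A ∪ C = W →
      (∀ x ∈ A, x ∉ C → ∀ y ∈ C, y ∉ A → s(x, y) ∉ E) → (∀ x ∈ A ∩ C, ∀ y ∈ A ∩ C, x = y) →
      v ∈ A → ∃ φ : V → α, φ v = γ ∧ (∀ u ∈ W, φ u ∈ L u) ∧ Proper E W φ := by
    intro A C hA hC hAC hcr hsub hvA
    obtain ⟨φ, c1, c2, c3⟩ := ih _ (hn ▸ Set.ncard_lt_ncard hA) A hvA hγ rfl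
    obtain ⟨u, hu, δ, hδ, hag⟩ : ∃ u ∈ C, ∃ δ ∈ L u, ∀ x ∈ A, x ∈ C → x = u ∧ φ x = δ := by
      rcases (A ∩ C).eq_empty_or_nonempty with h0 | ⟨u, huA, huC⟩
      · have hCne : C.Nonempty := by
          by_contra h
          rw [Set.not_nonempty_iff_eq_empty] at h
          subst h
          exact hA.ne (by simpa using hAC)
        obtain ⟨u, hu⟩ := hCne
        obtain ⟨δ, hδ⟩ := Finset.card_pos.1 (show 0 < (L u).card by have := hL u; omega)
        exact ⟨u, hu, δ, hδ, fun x hx hx' => (h0.le ⟨hx, hx'⟩).elim⟩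
      · exact ⟨u, huC, φ u, c2 u huA, fun x hx hx' => by
          rw [hsub x ⟨hx, hx'⟩ u ⟨huA, huC⟩]; simp⟩
    obtain ⟨χ, d1, d2, d3⟩ := ih _ (hn ▸ Set.ncard_lt_ncard hC) C hu hδ rfl
    refine ⟨_, ?_, ?_, hAC ▸ c3.glue d3 (fun x hx hx' => ?_) hcr⟩
    · simp [hvA, c1]
    · intro x hx
      by_cases hxA : x ∈ A
      · simpa [hxA] using c2 x hxA
      · simpa [hxA] using d2 x ((hAC.ge hx).resolve_left hxA)
    · obtain ⟨rfl, h⟩ := hag x hx hx'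
      rw [h, d1]
  have hcut : ∀ A C : Set V, A ⊂ W → C ⊂ W → A ∪ C = W →
      (∀ x ∈ A, x ∉ C → ∀ y ∈ C, y ∉ A → s(x, y) ∉ E) → (∀ x ∈ A ∩ C, ∀ y ∈ A ∩ C, x = y) →
      ∃ φ : V → α, φ v = γ ∧ (∀ u ∈ W, φ u ∈ L u) ∧ Proper E W φ := by
    intro A C hA hC hAC hcr hsub
    rcases hAC.ge hv with hvA | hvC
    · exact hglue A C hA hC hAC hcr hsub hvA
    · exact hglue C A hC hA (Set.union_comm A C ▸ hAC) (fun x hx hx' y hy hy' he =>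
        hcr y hy hy' x hx hx' (mem_swap he)) (Set.inter_comm A C ▸ hsub) hvC
  by_cases hconn : CutConn E W
  swap
  · obtain ⟨B, hB, hBn, hBW, hno⟩ := not_cutConn hconn
    refine hcut B (W \ B) (hB.ssubset_of_ne hBW) (Set.sdiff_subset.ssubset_of_ne fun h => ?_)
      (Set.union_sdiff_cancel hB) (fun x hx _ y hy _ => hno x hx y hy.1 hy.2)
      (fun x hx => (hx.2.2 hx.1).elim)
    obtain ⟨x, hx⟩ := hBn
    exact (h.ge (hB hx)).2 hx
  by_cases hdel : ∀ u ∈ W, CutConn E (W \ {u})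
  swap
  · push Not at hdel
    obtain ⟨u, hu, hd⟩ := hdel
    obtain ⟨B, hB, hBn, hBW, hno⟩ := not_cutConn hd
    obtain ⟨x, hx⟩ := hBn
    have huB : u ∉ B := fun h => (hB h).2 rfl
    refine hcut (insert u B) (W \ B) ?_ ?_ ?_ ?_ ?_
    · refine (Set.insert_subset hu fun y hy => (hB hy).1).ssubset_of_ne fun h => hBW ?_
      rw [← h]
      simp [huB]
    · exact Set.sdiff_subset.ssubset_of_ne fun h => (h.ge (hB hx).1).2 hx
    · ext y
      have : y ∈ B → y ∈ W := fun h => (hB h).1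
      have : y = u → y ∈ W := fun h => h ▸ hu
      simp
      tauto
    · intro y hy hy' z hz hz' he
      have hyB : y ∈ B := by
        by_contra h
        exact hy' ⟨(hy.resolve_right h) ▸ hu, h⟩
      exact hno y hyB z ⟨hz.1, fun h => hz' (Or.inl h)⟩ hz.2 he
    · intro y hy z hz
      rw [hy.1.resolve_right hy.2.2, hz.1.resolve_right hz.2.2]
  by_cases hthree : ∃ a ∈ W, ∃ b ∈ W, ∃ c ∈ W, a ≠ b ∧ a ≠ c ∧ b ≠ c
  · exact NoMinors.exists_colour_of_twoConn hg (hm.mono subset_rfl (Set.subset_univ W)) hL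
      ⟨hthree, hconn, hdel⟩ hv hγ
  have hex : ∀ u, ∃ δ ∈ L u, δ ≠ γ := fun u => by
    obtain ⟨δ, hδ, hne⟩ := exists_color (L u) {γ} (by have := hL u; simp; omega)
    exact ⟨δ, hδ, by simpa using hne⟩
  choose κ hκ hκγ using hex
  refine ⟨fun u => if u = v then γ else κ u, by simp, fun u _ => ?_, fun x hx y hy he => ?_⟩
  · by_cases h : u = v
    · simpa [h] using hγ
    · simpa [h] using hκ u
  · have hxy := hg.ne he
    by_cases h1 : x = v
    · have h2 : y ≠ v := fun h => hxy (h1.trans h.symm)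
      simpa [h1, h2] using (hκγ y).symm
    · by_cases h2 : y = v
      · simpa [h1, h2] using hκγ x
      · exact (hthree ⟨v, hv, x, hx, y, hy, Ne.symm h1, Ne.symm h2, hxy⟩).elim

theorem connected_induce_of_cutConn {G : SimpleGraph V} {A : Set V} (hne : A.Nonempty)
    (h : CutConn G.edgeSet A) : (G.induce A).Connected := by
  obtain ⟨x, hx⟩ := hne
  have : Nonempty A := ⟨⟨x, hx⟩⟩
  rw [SimpleGraph.connected_iff_exists_forall_reachable]
  refine ⟨⟨x, hx⟩, ?_⟩
  by_contra hcon
  push Not at hcon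
  obtain ⟨⟨y, hy⟩, hxy⟩ := hcon
  obtain ⟨u, ⟨hu, hxu⟩, w, ⟨hw, hwB⟩, he⟩ := h {u | ∃ hu : u ∈ A, (G.induce A).Reachable ⟨x, hx⟩ ⟨u, hu⟩}
    (fun u hu => hu.1) ⟨x, hx, SimpleGraph.Reachable.refl _⟩ fun h => hxy (h.ge hy).2
  exact hwB ⟨hw, hxu.trans (SimpleGraph.Adj.reachable (by simpa using he))⟩

theorem HasMinor.isMinorOf {T : Type*} {H : SimpleGraph T} {G : SimpleGraph V} {W : Set V}
    (h : HasMinor H G.edgeSet W) : H.IsMinorOf G := by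
  obtain ⟨f, h1, h2, h3⟩ := h
  refine ⟨f, fun t => connected_induce_of_cutConn (h1 t).1 (h1 t).2.2, fun s t hst => h2 s t hst,
    fun s t hst => ?_⟩
  simp_all

theorem girth5_edgeSet {G : SimpleGraph V}
    (h : ∀ (v : V) (c : G.Walk v v), c.IsCycle → c.length ≠ 3 ∧ c.length ≠ 4) :
    Girth5 G.edgeSet where
  loop a ha := G.loopless.irrefl a ha
  tri a b c h1 h2 h3 := by
    simp only [SimpleGraph.mem_edgeSet] at h1 h2 h3
    refine (h a (.cons h1 (.cons h2 (.cons h3 .nil))) ?_).1 (by simp)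
    have := h1.ne
    have := h2.ne
    have := h3.ne
    rw [SimpleGraph.Walk.isCycle_def]
    simp [SimpleGraph.Walk.isTrail_def]
    grind
  quad a b c d h1 h2 h3 h4 := by
    simp only [SimpleGraph.mem_edgeSet] at h1 h2 h3 h4
    by_contra! hne
    refine (h a (.cons h1 (.cons h2 (.cons h3 (.cons h4 .nil)))) ?_).2 (by simp)
    have := h1.ne
    have := h2.ne
    have := h3.ne
    have := h4.ne
    rw [SimpleGraph.Walk.isCycle_def]
    simp [SimpleGraph.Walk.isTrail_def]
    grind

end GirthFive

theorem planar_girth_five_three_choosable {V : Type*} [Fintype V] {α : Type*} [DecidableEq α]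
    (G : SimpleGraph V) (hG : G.IsPlanar)
    (hgirth : ∀ (v : V) (c : G.Walk v v), c.IsCycle → c.length ≠ 3 ∧ c.length ≠ 4)
    (L : V → Finset α) (hL : ∀ v, 3 ≤ (L v).card) :
    ∃ φ : V → α, (∀ v, φ v ∈ L v) ∧ ∀ ⦃u v⦄, G.Adj u v → φ u ≠ φ v := by
  rcases isEmpty_or_nonempty V with hV | ⟨⟨v⟩⟩
  · simp
  obtain ⟨γ, hγ⟩ := Finset.card_pos.1 (show 0 < (L v).card by have := hL v; omega)
  obtain ⟨φ, -, h1, h2⟩ := GirthFive.NoMinors.exists_colour (GirthFive.girth5_edgeSet hgirth)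
    ⟨fun h => hG.1 h.isMinorOf, fun h => hG.2 h.isMinorOf⟩ hL Set.univ (Set.mem_univ v) hγ
  exact ⟨φ, fun v => h1 v trivial, fun u v he => h2 u trivial v trivial he⟩
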